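/- There exist constants c > 0, c_1 > 0 and c_2 > 0 such that the following holds for all T ≥ 3 and all P ≥ T^{1/log log T}. Among all primitive Dirichlet characters χ mod q with modulus q ≤ T and greatest prime factor P⁺(q) ≤ P, there is at most one for which the Dirichlet L-function L(s,χ) has a zero in the region R = {s ∈ ℂ : Re(s) > 1 - c/log P and |Im(s)| ≤ exp(log P / √(log T))}. Moreover, if such a character χ mod q exists, then χ is real (i.e., χ takes only real values), L(s,χ) has exactly one zero in R, this zero is real and simple, and P⁺(q) ≥ c_1 log q and log q ≥ c_2 log log T. -/

import Mathlib

open Complex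

/-- The greatest prime factor of a natural number (`0` if `n ≤ 1`). -/
def maxPrimeFac (n : ℕ) : ℕ := n.primeFactors.sup id

namespace WeilS
open Polynomial

section
variable {K : Type*} [Field K]

/-- Hasse derivatives of powers -/
lemma hasse_pow (f : K[X]) (μ : ℕ) (hμ : f.natDegree ≤ μ) (h1 : 1 ≤ μ) (E : ℕ) : ∀ l : ℕ,
    ∃ A : K[X], hasseDeriv l (f ^ E) * f ^ l = f ^ E * A ∧ A.natDegree ≤ l * (μ - 1) := by
  induction E with
  | zero =>
    intro l
    rcases Nat.eq_zero_or_pos l with h | h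
    · exact ⟨1, by simp [h], by simp⟩
    · exact ⟨0, by simp [hasseDeriv_apply_one _ h], by simp⟩
  | succ E ih =>
    have hf : ∀ l : ℕ, ∃ B : K[X], hasseDeriv l f * f ^ l = f * B ∧ B.natDegree ≤ l * (μ - 1) := by
      intro l
      rcases Nat.eq_zero_or_pos l with h | h
      · exact ⟨1, by simp [h], by simp⟩
      · obtain ⟨m, rfl⟩ : ∃ m, l = m + 1 := ⟨l - 1, by omega⟩
        by_cases hm : f.natDegree < m + 1
        · exact ⟨0, by simp [hasseDeriv_eq_zero_of_lt_natDegree _ _ hm], by simp⟩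
        · refine ⟨hasseDeriv (m+1) f * f ^ m, by ring, ?_⟩
          refine natDegree_mul_le.trans ?_
          have h2 := natDegree_hasseDeriv_le f (m+1)
          have h3 : (f ^ m).natDegree ≤ m * μ := natDegree_pow_le.trans (Nat.mul_le_mul_left _ hμ)
          obtain ⟨ν, rfl⟩ : ∃ ν, μ = ν + 1 := ⟨μ - 1, by omega⟩
          simp only [Nat.add_sub_cancel]
          have : (m+1) * ν = m * ν + ν := by ring
          have : m * (ν + 1) = m * ν + m := by ring
          omega
    choose B hB hBd using hf
    choose A hA hAd using ih
    intro l
    refine ⟨∑ ij ∈ Finset.HasAntidiagonal.antidiagonal l, A ij.1 * B ij.2, ?_, ?_⟩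
    · rw [pow_succ, hasseDeriv_mul, Finset.sum_mul, Finset.mul_sum]
      refine Finset.sum_congr rfl fun ij hij => ?_
      rw [Finset.HasAntidiagonal.mem_antidiagonal] at hij
      rw [← hij, pow_add]
      linear_combination (hasseDeriv ij.2 f * f ^ ij.2) * hA ij.1 + (f ^ E * A ij.1) * hB ij.2
    · refine natDegree_sum_le_of_forall_le _ _ fun ij hij => ?_
      rw [Finset.HasAntidiagonal.mem_antidiagonal] at hij
      refine natDegree_mul_le.trans ?_
      rw [← hij, add_mul]
      exact add_le_add (hAd _) (hBd _)

/-- Hasse derivatives of X^{qj}, over a field with q elements in char p -/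
lemma hasse_Xq (p n j l : ℕ) [Fact p.Prime] [CharP K p] (hl : 0 < l) (hlq : l < p ^ n) :
    hasseDeriv l ((X : K[X]) ^ (p ^ n * j)) = 0 := by
  have key : ∀ x : K, (hasseDeriv l ((X : K[X]) ^ (p ^ n * j))).eval x = 0 := by
    intro x
    rw [← taylor_coeff, taylor_X_pow, pow_mul]
    have : (X + C x : K[X]) ^ (p ^ n) = expand K (p ^ n) (X + C (x ^ p ^ n)) := by
      rw [add_pow_char_pow]; simp
    rw [this, ← map_pow, coeff_expand (pow_pos (Fact.out : p.Prime).pos _)]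
    rw [if_neg]
    intro h; exact absurd (Nat.le_of_dvd hl h) (by omega)
  ext m
  rw [hasseDeriv_coeff, coeff_X_pow]
  split_ifs with h
  · have := key 1
    rw [← monomial_one_right_eq_X_pow, hasseDeriv_monomial] at this
    simp only [eval_monomial] at this
    simp at this
    rw [h]; simpa using this
  · simp

lemma hasse_mul_Xq (p n j l : ℕ) [Fact p.Prime] [CharP K p] (hlq : l < p ^ n) (g : K[X]) :
    hasseDeriv l (g * (X : K[X]) ^ (p ^ n * j)) = hasseDeriv l g * X ^ (p ^ n * j) := by
  rw [hasseDeriv_mul]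
  rw [Finset.sum_eq_single (l, 0)]
  · simp
  · rintro ⟨a, b⟩ hab hne
    rw [Finset.HasAntidiagonal.mem_antidiagonal] at hab
    simp only at hab ⊢
    rw [hasse_Xq p n j b, mul_zero]
    · rcases Nat.eq_zero_or_pos b with h | h
      · subst h; simp at hab; exact absurd (by rw [hab]) hne
      · exact h
    · omega
  · intro h; exact absurd (Finset.HasAntidiagonal.mem_antidiagonal.2 (by simp)) h

lemma dvd_of_hasse (R : K[X]) (L : ℕ) (x : K) (h : ∀ l < L, (hasseDeriv l R).eval x = 0) :
    (X - C x) ^ L ∣ R := by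
  rw [X_sub_C_pow_dvd_iff, X_pow_dvd_iff]
  intro l hl
  rw [← taylor_apply, taylor_coeff]; exact h l hl

lemma card_mul_le (R : K[X]) (hR : R ≠ 0) (L : ℕ) (S : Finset K)
    (h : ∀ x ∈ S, ∀ l < L, (hasseDeriv l R).eval x = 0) : S.card * L ≤ R.natDegree := by
  classical
  have hd : ∏ x ∈ S, (X - C x) ^ L ∣ R := by
    apply Finset.prod_dvd_of_coprime
    · intro x _ y _ hxy
      exact (pairwise_coprime_X_sub_C (s := fun x : K => x) (fun a b h => h) hxy).pow
    · intro x hx; exact dvd_of_hasse R L x (h x hx)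
  have := natDegree_le_of_dvd hd hR
  rw [natDegree_prod_of_monic _ _ (fun x _ => (monic_X_sub_C x).pow L)] at this
  simpa using this

end

lemma degree_arith (q d e μ κ L i i' j j' u v : ℕ) (hde : d * e + 1 = q)
    (hκ : d * (κ + μ) ≤ q) (hi : i < d) (hi' : i' < d) (hμ1 : 1 ≤ μ) (hd : 1 ≤ d)
    (hco : Nat.Coprime μ d) (b1 : u < κ) (b2 : v < κ)
    (heq : (L + i * e) * μ + u + q * j = (L + i' * e) * μ + v + q * j') : i = i' ∧ j = j' := by
  have e1 : (q : ℤ) * ((i * μ + j * d) - (i' * μ + j' * d)) = d * v - d * u + i * μ - i' * μ := by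
    have hz : ((d : ℤ) * e + 1) = q := by exact_mod_cast hde
    have hh : ((L:ℤ) + i * e) * μ + u + q * j = (L + i' * e) * μ + v + q * j' := by exact_mod_cast heq
    have hdd : (d:ℤ) * e = q - 1 := by linarith
    have : (d:ℤ) * (((L:ℤ) + i * e) * μ + u + q * j) = d * ((L + i' * e) * μ + v + q * j') := by
      rw [hh]
    have e2 : (d:ℤ) * (((L:ℤ) + i * e) * μ + u + q * j) = d * L * μ + i * μ * (d * e) + d * u + q * (j * d) := by ring
    have e3 : (d:ℤ) * (((L:ℤ) + i' * e) * μ + v + q * j') = d * L * μ + i' * μ * (d * e) + d * v + q * (j' * d) := by ring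
    rw [e2, e3, hdd] at this
    linear_combination this
  have hqpos : (0:ℤ) < q := by have : 0 < q := by omega
                               exact_mod_cast this
  have b3 : (d:ℤ) * (κ + μ) ≤ q := by exact_mod_cast hκ
  have b4 : (u:ℤ) + 1 ≤ κ := by exact_mod_cast b1
  have b5 : (v:ℤ) + 1 ≤ κ := by exact_mod_cast b2
  have b6 : (i:ℤ) + 1 ≤ d := by exact_mod_cast hi
  have b7 : (i':ℤ) + 1 ≤ d := by exact_mod_cast hi'
  have b8 : (0:ℤ) ≤ u := by positivity
  have b9 : (0:ℤ) ≤ v := by positivity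
  have b10 : (0:ℤ) ≤ i := by positivity
  have b11 : (0:ℤ) ≤ i' := by positivity
  have b12 : (1:ℤ) ≤ μ := by exact_mod_cast hμ1
  have b13 : (1:ℤ) ≤ d := by exact_mod_cast hd
  have hΔ : ((i:ℤ) * μ + j * d) - (i' * μ + j' * d) = 0 := by
    by_contra hΔ
    have c1 : (d:ℤ) * v ≤ d * (κ - 1) := mul_le_mul_of_nonneg_left (by linarith) (by linarith)
    have c2 : (d:ℤ) * u ≤ d * (κ - 1) := mul_le_mul_of_nonneg_left (by linarith) (by linarith)
    have c3 : (i:ℤ) * μ ≤ d * μ := mul_le_mul_of_nonneg_right (by linarith) (by linarith)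
    have c4 : (i':ℤ) * μ ≤ d * μ := mul_le_mul_of_nonneg_right (by linarith) (by linarith)
    have c5 : (0:ℤ) ≤ d * v := by positivity
    have c6 : (0:ℤ) ≤ d * u := by positivity
    have c7 : (0:ℤ) ≤ i * μ := by positivity
    have c8 : (0:ℤ) ≤ i' * μ := by positivity
    rcases lt_or_gt_of_ne hΔ with h | h
    · have : (q:ℤ) * ((i * μ + j * d) - (i' * μ + j' * d)) ≤ q * (-1) := mul_le_mul_of_nonneg_left (by linarith [Int.add_one_le_of_lt h]) hqpos.le
      linarith
    · have : (q:ℤ) * 1 ≤ q * ((i * μ + j * d) - (i' * μ + j' * d)) := mul_le_mul_of_nonneg_left (by linarith [Int.add_one_le_of_lt h]) hqpos.le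
      linarith
  have hdvd : (d:ℤ) ∣ ((i:ℤ) - i') * μ := ⟨(j':ℤ) - j, by linear_combination hΔ⟩
  have hcoz : IsCoprime (d:ℤ) (μ:ℤ) := (Nat.isCoprime_iff_coprime.2 hco).symm
  have hdvd2 : (d:ℤ) ∣ ((i:ℤ) - i') := hcoz.dvd_of_dvd_mul_right hdvd
  have hii : (i:ℤ) - i' = 0 := by
    by_contra hcon
    have := Int.le_of_dvd (abs_pos.2 hcon) ((dvd_abs _ _).2 hdvd2)
    have h3 : |(i:ℤ) - i'| < d := by rw [abs_lt]; constructor <;> linarith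
    linarith
  have hii' : i = i' := by omega
  refine ⟨hii', ?_⟩
  subst hii'
  have : (j:ℤ) * d = j' * d := by linarith
  have : (j:ℤ) = j' := mul_right_cancel₀ (by linarith) this
  exact_mod_cast this

/-- Stepanov's upper bound, raw form -/
lemma stepanov_raw {K : Type*} [Field K] [Fintype K] (p n : ℕ) [Fact p.Prime] [CharP K p]
    (hq : Fintype.card K = p ^ n) (f : K[X]) (hf : f ≠ 0) (d e μ κ J L : ℕ) (hμ : f.natDegree = μ)
    (hμ1 : 1 ≤ μ) (hde : d * e + 1 = p ^ n) (hd : 1 ≤ d) (hco : Nat.Coprime μ d)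
    (hκ : d * (κ + μ) ≤ p ^ n) (hL : L ≤ p ^ n)
    (hcount : L * (κ + L * μ + J) < d * J * κ) (a : K) (ha : a ≠ 0) (he : 1 ≤ e) (S : Finset K)
    (hS : ∀ x ∈ S, (f.eval x) ^ e = a) :
    S.card * L ≤ L * μ + p ^ n * (μ + 1 + J) := by
  classical
  set q := p ^ n with hqdef
  have hA : ∀ i l : ℕ, ∃ A : K[X], hasseDeriv l (f ^ (L + i * e)) * f ^ l = f ^ (L + i*e) * A ∧
    A.natDegree ≤ l * (μ - 1) := fun i l => hasse_pow f μ hμ.le hμ1 _ l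
  choose A hA hAd using hA
  -- the condition polynomials
  let B : ℕ → ℕ → K[X] →ₗ[K] K[X] := fun i l =>
    ∑ ij ∈ Finset.HasAntidiagonal.antidiagonal l,
      (LinearMap.mulLeft K (f ^ (l - ij.1) * A i ij.1)).comp (hasseDeriv ij.2)
  have hB : ∀ i l k, hasseDeriv l (f ^ (L + i*e) * k) * f ^ l = f ^ (L + i*e) * B i l k := by
    intro i l k
    simp only [B, LinearMap.sum_apply, LinearMap.comp_apply, LinearMap.mulLeft_apply]
    rw [hasseDeriv_mul, Finset.sum_mul, Finset.mul_sum]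
    refine Finset.sum_congr rfl fun ij hij => ?_
    rw [Finset.HasAntidiagonal.mem_antidiagonal] at hij
    have : f ^ l = f ^ (l - ij.1) * f ^ ij.1 := by rw [← pow_add]; congr 1; omega
    rw [this]
    linear_combination (f ^ (l - ij.1) * hasseDeriv ij.2 k) * hA i ij.1
  have hBd : ∀ i l, l < L → ∀ k : K[X], k ∈ degreeLT K κ → B i l k ∈ degreeLT K (κ + L * μ) := by
    intro i l hl k hk
    simp only [B, LinearMap.sum_apply, LinearMap.comp_apply, LinearMap.mulLeft_apply]
    refine Submodule.sum_mem _ fun ij hij => ?_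
    rw [Finset.HasAntidiagonal.mem_antidiagonal] at hij
    by_cases hk0 : k = 0
    · simp [hk0]
    rw [mem_degreeLT, degree_eq_natDegree hk0] at hk
    have hk' : k.natDegree < κ := by exact_mod_cast hk
    rw [mem_degreeLT]
    refine lt_of_le_of_lt degree_le_natDegree ?_
    have h1 := natDegree_mul_le (p := f ^ (l - ij.1) * A i ij.1) (q := hasseDeriv ij.2 k)
    have h2 := natDegree_mul_le (p := f ^ (l - ij.1)) (q := A i ij.1)
    have h3 := natDegree_pow_le (p := f) (n := l - ij.1)
    have h4 := hAd i ij.1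
    have h5 := natDegree_hasseDeriv_le k ij.2
    rw [hμ] at h3
    have h6 : (l - ij.1) * μ + ij.1 * (μ - 1) ≤ L * μ := by
      calc (l - ij.1) * μ + ij.1 * (μ - 1) ≤ (l - ij.1) * μ + ij.1 * μ := by gcongr; omega
        _ = (l - ij.1 + ij.1) * μ := by ring
        _ ≤ L * μ := by gcongr; omega
    have : (f ^ (l - ij.1) * A i ij.1 * hasseDeriv ij.2 k).natDegree < κ + L * μ := by omega
    exact_mod_cast this
  -- linear system
  let V := Fin d × Fin J → degreeLT K κ
  let Φ0 : V →ₗ[K] (Fin L → K[X]) := LinearMap.pi fun l =>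
    ∑ ij : Fin d × Fin J, (LinearMap.mulLeft K (C (a ^ (ij.1 : ℕ)) * X ^ (ij.2 : ℕ))).comp
      ((B ij.1 l).comp ((degreeLT K κ).subtype.comp (LinearMap.proj ij)))
  have hΦmem : ∀ k l, Φ0 k l ∈ degreeLT K (κ + L * μ + J) := by
    intro k l
    simp only [Φ0, LinearMap.pi_apply, LinearMap.sum_apply, LinearMap.comp_apply,
      LinearMap.mulLeft_apply]
    refine Submodule.sum_mem _ fun ij _ => ?_
    have h := hBd ij.1 l l.2 _ (k ij).2
    set b := B ij.1 l (k ij) with hb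
    change (C (a ^ (ij.1 : ℕ)) * X ^ (ij.2 : ℕ)) * b ∈ _
    by_cases hb0 : b = 0
    · rw [hb0]; simp
    rw [mem_degreeLT, degree_eq_natDegree hb0] at h
    have h' : b.natDegree < κ + L * μ := by exact_mod_cast h
    rw [mem_degreeLT]
    refine lt_of_le_of_lt degree_le_natDegree ?_
    have h1 := natDegree_mul_le (p := (C (a ^ (ij.1 : ℕ)) * X ^ (ij.2 : ℕ))) (q := b)
    have h2 := natDegree_C_mul_X_pow_le (a ^ (ij.1 : ℕ)) (ij.2 : ℕ)
    have h3 := ij.2.2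
    have : ((C (a ^ (ij.1 : ℕ)) * X ^ (ij.2 : ℕ)) * b).natDegree < κ + L * μ + J := by omega
    exact_mod_cast this
  let Φ : V →ₗ[K] (Fin L → degreeLT K (κ + L * μ + J)) := LinearMap.pi fun l =>
    LinearMap.codRestrict _ ((LinearMap.proj l).comp Φ0) (fun k => hΦmem k l)
  have hfinr : ∀ m : ℕ, Module.finrank K (degreeLT K m) = m := by
    intro m
    rw [(degreeLTEquiv K m).finrank_eq]; simp
  have hfd : ∀ m : ℕ, FiniteDimensional K (degreeLT K m) := fun m =>
    (degreeLTEquiv K m).symm.finiteDimensional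
  have := hfd κ
  have := hfd (κ + L * μ + J)
  have hker : LinearMap.ker Φ ≠ ⊥ := by
    apply LinearMap.ker_ne_bot_of_finrank_lt
    rw [Module.finrank_pi_fintype, Module.finrank_pi_fintype]
    simp only [hfinr, Finset.sum_const, Finset.card_univ, Fintype.card_fin, Fintype.card_prod,
      smul_eq_mul]
    exact hcount
  obtain ⟨k, hk, hk0⟩ := (Submodule.ne_bot_iff _).1 hker
  rw [LinearMap.mem_ker] at hk
  -- the polynomial
  let R : K[X] := ∑ ij : Fin d × Fin J, f ^ (L + (ij.1 : ℕ) * e) * (k ij : K[X]) * X ^ (q * (ij.2 : ℕ))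
  have hkd : ∀ ij, (k ij : K[X]) ≠ 0 → (k ij : K[X]).natDegree < κ := by
    intro ij h
    have := (k ij).2
    rw [mem_degreeLT, degree_eq_natDegree h] at this
    exact_mod_cast this
  have hdegterm : ∀ ij : Fin d × Fin J, (k ij : K[X]) ≠ 0 →
      (f ^ (L + (ij.1 : ℕ) * e) * (k ij : K[X]) * X ^ (q * (ij.2 : ℕ))).natDegree =
      (L + (ij.1 : ℕ) * e) * μ + (k ij : K[X]).natDegree + q * (ij.2 : ℕ) := by
    intro ij h
    rw [natDegree_mul (mul_ne_zero (pow_ne_zero _ hf) h) (pow_ne_zero _ X_ne_zero),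
      natDegree_mul (pow_ne_zero _ hf) h, natDegree_pow, natDegree_X_pow, hμ]
  have hR : R ≠ 0 := by
    obtain ⟨ij0, hij0⟩ : ∃ ij, k ij ≠ 0 := by
      by_contra hcon; push Not at hcon; exact hk0 (funext hcon)
    have hij0' : (k ij0 : K[X]) ≠ 0 := by simpa using hij0
    have hdis := degree_sum_eq_of_disjoint
      (fun ij : Fin d × Fin J => f ^ (L + (ij.1 : ℕ) * e) * (k ij : K[X]) * X ^ (q * (ij.2 : ℕ)))
      Finset.univ ?_
    · intro h0
      change degree R = _ at hdis
      rw [h0, degree_zero] at hdis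
      have := Finset.le_sup (f := fun ij : Fin d × Fin J =>
        degree (f ^ (L + (ij.1 : ℕ) * e) * (k ij : K[X]) * X ^ (q * (ij.2 : ℕ)))) (Finset.mem_univ ij0)
      rw [← hdis, le_bot_iff, degree_eq_bot] at this
      exact mul_ne_zero (mul_ne_zero (pow_ne_zero _ hf) hij0') (pow_ne_zero _ X_ne_zero) this
    · rintro ij ⟨_, h1⟩ ij' ⟨_, h2⟩ hne
      have h1' : (k ij : K[X]) ≠ 0 := fun h => h1 (by simp [h])
      have h2' : (k ij' : K[X]) ≠ 0 := fun h => h2 (by simp [h])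
      simp only [Function.comp_def, Function.onFun, ne_eq]
      rw [degree_eq_natDegree h1, degree_eq_natDegree h2]
      intro heq
      have heq : _ = _ := WithBot.coe_injective heq
      rw [hdegterm ij h1', hdegterm ij' h2'] at heq
      apply hne
      obtain ⟨⟨i, hi⟩, ⟨j, hj⟩⟩ := ij
      obtain ⟨⟨i', hi'⟩, ⟨j', hj'⟩⟩ := ij'
      have b1 := hkd _ h1'
      have b2 := hkd _ h2'
      simp only at heq b1 b2
      generalize (k (⟨i, hi⟩, ⟨j, hj⟩) : K[X]).natDegree = u at *
      generalize (k (⟨i', hi'⟩, ⟨j', hj'⟩) : K[X]).natDegree = v at *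
      -- arithmetic
      obtain ⟨rfl, rfl⟩ := degree_arith q d e μ κ L i i' j j' u v hde hκ hi hi' hμ1 hd hco b1 b2 heq
      rfl
  -- vanishing
  have hvan : ∀ x ∈ S, ∀ l < L, (hasseDeriv l R).eval x = 0 := by
    intro x hxS l hl
    have hfx : f.eval x ≠ 0 := by
      intro h
      have := hS x hxS
      rw [h, zero_pow (by omega)] at this
      exact ha this.symm
    have hxq : x ^ q = x := by rw [← hq]; exact FiniteField.pow_card x
    have h0 := congrFun hk ⟨l, hl⟩
    have h0' : Φ0 k ⟨l, hl⟩ = 0 := by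
      have := congrArg Subtype.val h0
      exact this
    have h1 : (Φ0 k ⟨l, hl⟩).eval x = 0 := by rw [h0']; simp
    simp only [Φ0, LinearMap.pi_apply, LinearMap.sum_apply, LinearMap.comp_apply,
      LinearMap.mulLeft_apply] at h1
    rw [eval_finsetSum] at h1
    have hfl : (f.eval x) ^ l ≠ 0 := pow_ne_zero _ hfx
    refine (mul_eq_zero.1 ?_).resolve_right hfl
    simp only [R, map_sum]
    rw [eval_finsetSum, Finset.sum_mul]
    have : (f.eval x) ^ L * 0 = (0:K) := mul_zero _
    rw [← this, ← h1, Finset.mul_sum]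
    refine Finset.sum_congr rfl fun ij _ => ?_
    rw [hqdef, hasse_mul_Xq p n _ l (by omega)]
    have h2 := congrArg (eval x) (hB ij.1 l (k ij))
    simp only [eval_mul, eval_pow, eval_X, eval_C] at h2 ⊢
    have h3 : x ^ (p ^ n * (ij.2 : ℕ)) = x ^ (ij.2 : ℕ) := by rw [pow_mul, ← hqdef, hxq]
    rw [h3]
    have h4 : eval x f ^ (L + (ij.1 : ℕ) * e) = eval x f ^ L * a ^ (ij.1 : ℕ) := by
      rw [pow_add, mul_comm (ij.1 : ℕ) e, pow_mul, hS x hxS]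
    rw [h4] at h2
    change _ = eval x f ^ L * (a ^ (ij.1 : ℕ) * x ^ (ij.2 : ℕ) * eval x (B ij.1 l (k ij)))
    linear_combination (x ^ (ij.2 : ℕ)) * h2
  refine (card_mul_le R hR L S hvan).trans ?_
  refine natDegree_sum_le_of_forall_le _ _ fun ij _ => ?_
  by_cases h : (k ij : K[X]) = 0
  · simp [h]
  rw [hdegterm ij h]
  have h1 := hkd ij h
  have h2 : (ij.1 : ℕ) * e ≤ q := by
    have : (ij.1 : ℕ) * e ≤ d * e := Nat.mul_le_mul_right _ ij.1.2.le
    omega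
  have h3 : (ij.2 : ℕ) ≤ J := ij.2.2.le
  have h4 : κ ≤ q := by
    calc κ ≤ 1 * (κ + μ) := by omega
      _ ≤ d * (κ + μ) := Nat.mul_le_mul_right _ hd
      _ ≤ q := hκ
  have h5 := Nat.mul_le_mul_right μ h2
  have h6 := Nat.mul_le_mul_left q h3
  nlinarith
end WeilS

namespace WeilS
open Polynomial

lemma stepanov_upper {K : Type*} [Field K] [Fintype K] (p n : ℕ) [Fact p.Prime] [CharP K p]
    (hq : Fintype.card K = p ^ n) (f : K[X]) (hf : f ≠ 0) (d e μ : ℕ) (hμ : f.natDegree = μ)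
    (hμ1 : 1 ≤ μ) (hde : d * e + 1 = p ^ n) (hd : 1 ≤ d) (hco : Nat.Coprime μ d)
    (hbig : 16 * (1 + d * μ) ≤ p ^ n) (a : K) (ha : a ≠ 0) (S : Finset K)
    (hS : ∀ x ∈ S, (f.eval x) ^ e = a) :
    (S.card : ℝ) - (p ^ n : ℕ) / d ≤ (13 * μ + 28) * Real.sqrt ((p ^ n : ℕ) : ℝ) := by
  set q := p ^ n with hqd
  set L := Nat.sqrt q with hL
  have hL2 : L * L ≤ q := Nat.sqrt_le q
  have hL3 : q < (L + 1) * (L + 1) := Nat.lt_succ_sqrt q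
  have hL4 : 4 ≤ L := by rw [hL, Nat.le_sqrt]; nlinarith
  have hem : μ ≤ e := by
    by_contra h
    push Not at h
    have : d * e ≤ d * μ := Nat.mul_le_mul_left _ h.le
    omega
  obtain ⟨κ, hκ⟩ : ∃ κ, e = κ + μ := ⟨e - μ, by omega⟩
  have he1 : 1 ≤ e := by omega
  have hmod := Nat.div_add_mod L d
  have hmod2 := Nat.mod_lt L hd
  set Ld := L / d with hLd
  have hdk : d * κ + d * μ + 1 = q := by rw [← hde, hκ]; ring
  have hLdL : Ld ≤ L := Nat.div_le_self _ _
  have h := stepanov_raw p n hq f hf d e μ κ (Ld + 2 * μ + 6) L hμ hμ1 hde hd hco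
    (by rw [← hκ]; omega) (by nlinarith) ?_ a ha he1 S hS
  · rw [← hqd] at h
    have hs : (L : ℝ) ≤ Real.sqrt q := by
      apply Real.le_sqrt_of_sq_le
      have : ((L * L : ℕ) : ℝ) ≤ q := by exact_mod_cast hL2
      push_cast at this; nlinarith
    have hLpos : (0:ℝ) < L := by have : 0 < L := by omega
                                 exact_mod_cast this
    have hdpos : (0:ℝ) < d := by exact_mod_cast hd
    have h' : (S.card : ℝ) * L ≤ L * μ + q * (μ + 1 + (Ld + 2 * μ + 6)) := by exact_mod_cast h
    have hLdr : (Ld : ℝ) ≤ L / d := Nat.cast_div_le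
    have hq4 : (q : ℝ) ≤ 4 * L * L := by
      have : q ≤ 4 * L * L := by nlinarith
      exact_mod_cast this
    have hq0 : (0:ℝ) ≤ q := by positivity
    have h1 : ((S.card : ℝ) - q / d) * L ≤ ((13 * μ + 28) * L) * L := by
      have e1 : (q:ℝ) / d * L = q * (L / d) := by field_simp
      have e2 : (q:ℝ) * Ld ≤ q * (L / d) := mul_le_mul_of_nonneg_left hLdr hq0
      have e3 : (q:ℝ) * (3 * μ + 7) ≤ (4 * L * L) * (3 * μ + 7) := by gcongr
      have e4 : (L:ℝ) * μ ≤ L * L * μ := by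
        have : (1:ℝ) ≤ L := by have : 1 ≤ L := by omega
                               exact_mod_cast this
        have h0 : (0:ℝ) ≤ μ := by positivity
        nlinarith [mul_nonneg (mul_nonneg hLpos.le h0) (sub_nonneg.2 this)]
      nlinarith
    have h2 := le_of_mul_le_mul_right h1 hLpos
    refine h2.trans ?_
    gcongr
  · -- counting
    have h1 : L + d * (2 * μ + 5) ≤ d * (Ld + 2 * μ + 6) := by linarith
    have h2 : L * (Ld + 2 * μ + 6) ≤ L * L + (2 * μ + 6) * L := by
      have := Nat.mul_le_mul_left L hLdL
      linarith
    have h3 : (L + d * (2 * μ + 5)) * κ ≤ d * (Ld + 2 * μ + 6) * κ := Nat.mul_le_mul_right _ h1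
    have h4 : 4 * L ≤ q := (Nat.mul_le_mul_right L hL4).trans hL2
    have h5 : L * (L * μ) ≤ q * μ := by rw [← mul_assoc]; exact Nat.mul_le_mul_right _ hL2
    have h6 : d * (2 * μ + 5) * κ + (2 * μ + 5) * (1 + d * μ) = (2 * μ + 5) * q := by
      rw [← hdk]; ring
    have h7 : (2 * μ + 5) * (16 * (1 + d * μ)) ≤ (2 * μ + 5) * q := Nat.mul_le_mul_left _ hbig
    have h8 : (2 * μ + 6) * (4 * L) ≤ (2 * μ + 6) * q := Nat.mul_le_mul_left _ h4
    have h9 : 0 < q := by omega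
    have h10 : 0 ≤ μ * q := Nat.zero_le _
    linarith

/-- Stepanov character sum bound with non-uniform constants. -/
lemma stepanov_char {K : Type*} [Field K] [Fintype K] (p n : ℕ) [Fact p.Prime] [CharP K p]
    (hq : Fintype.card K = p ^ n) (f : K[X]) (hf : f ≠ 0) (d μ : ℕ) (hμ : f.natDegree = μ)
    (hμ1 : 1 ≤ μ) (hdq : d ∣ p ^ n - 1) (hd : 1 ≤ d) (hco : Nat.Coprime μ d)
    (hbig : 16 * (1 + d * μ) ≤ p ^ n) (Ψ : MulChar K ℂ) (hΨ : Ψ ≠ 1) (hΨd : Ψ ^ d = 1) :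
    ‖∑ x : K, Ψ (f.eval x)‖ ≤ (2 * d * (13 * μ + 28) + μ) * Real.sqrt ((p ^ n : ℕ) : ℝ) := by
  classical
  obtain ⟨e, he⟩ := hdq
  have hqpos : 16 ≤ p ^ n := by nlinarith
  have hde : d * e + 1 = p ^ n := by omega
  have he1 : 1 ≤ e := by
    rcases Nat.eq_zero_or_pos e with h | h
    · subst h; omega
    · exact h
  -- well-definedness
  have hwd : ∀ y y' : K, y ≠ 0 → y' ≠ 0 → y ^ e = y' ^ e → Ψ y = Ψ y' := by
    intro y y' hy hy' hyy
    obtain ⟨g, hg⟩ := IsCyclic.exists_generator (α := Kˣ)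
    obtain ⟨m, hm⟩ := Subgroup.mem_zpowers_iff.1 (hg (Units.mk0 y hy / Units.mk0 y' hy'))
    have hcard : orderOf g = d * e := by
      rw [orderOf_eq_card_of_forall_mem_zpowers hg, Nat.card_eq_fintype_card,
        Fintype.card_units, hq, ← hde]; simp
    have h1 : (g ^ m) ^ e = 1 := by
      rw [hm]; ext; simp [div_pow, hyy, hy']
    rw [← zpow_natCast, ← zpow_mul, ← orderOf_dvd_iff_zpow_eq_one, hcard] at h1
    have h2 : (d : ℤ) ∣ m := by
      push_cast at h1
      exact Int.dvd_of_mul_dvd_mul_right (a := (e:ℤ)) (by positivity) h1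
    obtain ⟨r, hr⟩ := h2
    have h3 : Units.mk0 y hy = Units.mk0 y' hy' * (g ^ r) ^ d := by
      rw [← zpow_natCast, ← zpow_mul, mul_comm r, ← hr, hm]; simp
    have h4 : y = y' * ((g ^ r : Kˣ) : K) ^ d := by
      have := congrArg Units.val h3
      simpa using this
    rw [h4, map_mul, map_pow, ← MulChar.pow_apply' _ (by omega), hΨd, MulChar.one_apply_coe]
    simp
  let A : Finset K := (Finset.univ.filter (fun y : K => y ≠ 0)).image (fun y => y ^ e)
  have hA : ∀ a ∈ A, ∃ y : K, y ≠ 0 ∧ y ^ e = a := by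
    intro a ha
    simpa [A] using ha
  choose! c hc0 hc using hA
  have hA0 : ∀ a ∈ A, a ≠ 0 := by
    intro a ha
    rw [← hc a ha]; exact pow_ne_zero _ (hc0 a ha)
  have hmemA : ∀ y : K, y ≠ 0 → y ^ e ∈ A := by
    intro y hy
    simp only [A, Finset.mem_image, Finset.mem_filter, Finset.mem_univ, true_and]
    exact ⟨y, hy, rfl⟩
  have hcardA : A.card ≤ d := by
    have hsub : A ⊆ (nthRoots d (1:K)).toFinset := by
      intro a ha
      rw [Multiset.mem_toFinset, mem_nthRoots hd, ← hc a ha, ← pow_mul, mul_comm]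
      have := FiniteField.pow_card_sub_one_eq_one (c a) (hc0 a ha)
      rwa [hq, ← hde, Nat.add_sub_cancel] at this
    exact (Finset.card_le_card hsub).trans ((Multiset.toFinset_card_le _).trans (card_nthRoots d 1))
  -- general fibre sum
  have hfib : ∀ g : K → K, ∑ x : K, Ψ (g x) =
      ∑ a ∈ A, Ψ (c a) * ((Finset.univ.filter (fun x : K => g x ^ e = a)).card : ℂ) := by
    intro g
    have h1 : ∑ x : K, Ψ (g x) = ∑ x ∈ Finset.univ.filter (fun x => g x ≠ 0), Ψ (g x) := by
      rw [Finset.sum_filter]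
      refine Finset.sum_congr rfl fun x _ => ?_
      split_ifs with h
      · rfl
      · push Not at h; rw [h, MulChar.map_zero]
    rw [h1, ← Finset.sum_fiberwise_of_maps_to (t := A) (g := fun x => g x ^ e)]
    · refine Finset.sum_congr rfl fun a ha => ?_
      rw [Finset.sum_congr rfl (g := fun _ => Ψ (c a))]
      · rw [Finset.sum_const, nsmul_eq_mul, mul_comm]
        congr 3
        ext x
        simp only [Finset.mem_filter, Finset.mem_univ, true_and, and_iff_right_iff_imp]
        intro h h0
        rw [h0, zero_pow (by omega)] at h
        exact hA0 a ha h.symm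
      · intro x hx
        simp only [Finset.mem_filter, Finset.mem_univ, true_and] at hx
        exact hwd _ _ hx.1 (hc0 a ha) (by rw [hx.2, hc a ha])
    · intro x hx
      exact hmemA _ (by simpa using hx)
  -- constant fibres
  have hfc : ∀ a ∈ A, (Finset.univ.filter (fun x : K => x ^ e = a)).card =
      (Finset.univ.filter (fun x : K => x ^ e = 1)).card := by
    intro a ha
    symm
    apply Finset.card_bij (fun x _ => c a * x)
    · intro x hx
      simp only [Finset.mem_filter, Finset.mem_univ, true_and] at hx ⊢
      rw [mul_pow, hx, hc a ha, mul_one]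
    · intro x _ y _ h; exact mul_left_cancel₀ (hc0 a ha) h
    · intro y hy
      simp only [Finset.mem_filter, Finset.mem_univ, true_and] at hy
      refine ⟨y / c a, ?_, ?_⟩
      · simp [div_pow, hy, hc a ha, div_self (hA0 a ha)]
      · rw [mul_div_cancel₀ _ (hc0 a ha)]
  have hsumc : ∑ a ∈ A, Ψ (c a) = 0 := by
    have h1 := hfib id
    simp only [id] at h1
    rw [MulChar.sum_eq_zero_of_ne_one hΨ] at h1
    rw [Finset.sum_congr rfl (fun a ha => by rw [hfc a ha]), ← Finset.sum_mul] at h1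
    refine (mul_eq_zero.1 h1.symm).resolve_right ?_
    have : 0 < (Finset.univ.filter (fun x : K => x ^ e = 1)).card :=
      Finset.card_pos.2 ⟨1, by simp⟩
    exact_mod_cast this.ne'
  let N : K → ℕ := fun a => (Finset.univ.filter (fun x : K => f.eval x ^ e = a)).card
  have hN : ∀ a ∈ A, (N a : ℝ) - (p ^ n : ℕ) / d ≤ (13 * μ + 28) * Real.sqrt ((p ^ n : ℕ) : ℝ) := by
    intro a ha
    exact stepanov_upper p n hq f hf d e μ hμ hμ1 hde hd hco hbig a (hA0 a ha) _
      (fun x hx => by simpa using hx)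
  have hNsum : ((p ^ n : ℕ) : ℝ) - μ ≤ ∑ a ∈ A, (N a : ℝ) := by
    have h1 : (Finset.univ.filter (fun x : K => f.eval x ≠ 0)).card = ∑ a ∈ A, N a := by
      rw [Finset.card_eq_sum_card_fiberwise (t := A) (f := fun x => f.eval x ^ e)]
      · refine Finset.sum_congr rfl fun a ha => ?_
        simp only [N]
        congr 1
        ext x
        simp only [Finset.mem_filter, Finset.mem_univ, true_and, and_iff_right_iff_imp]
        intro h h0
        rw [h0, zero_pow (by omega)] at h
        exact hA0 a ha h.symm
      · intro x hx
        exact hmemA _ (by simpa using hx)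
    have h2 : (Finset.univ.filter (fun x : K => f.eval x = 0)).card ≤ μ := by
      have : (Finset.univ.filter (fun x : K => f.eval x = 0)) ⊆ f.roots.toFinset := by
        intro x hx
        rw [Multiset.mem_toFinset, mem_roots hf]
        simpa using hx
      refine (Finset.card_le_card this).trans ((Multiset.toFinset_card_le _).trans ?_)
      rw [← hμ]; exact card_roots' f
    have h3 := Finset.card_filter_add_card_filter_not (s := (Finset.univ : Finset K)) (fun x => f.eval x = 0)
    rw [Finset.card_univ, hq] at h3
    have h4 : p ^ n ≤ μ + ∑ a ∈ A, N a := by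
      rw [← h1]
      simp only [ne_eq]
      omega
    have h5 : ((p ^ n : ℕ) : ℝ) ≤ μ + ∑ a ∈ A, (N a : ℝ) := by exact_mod_cast h4
    linarith
  have hmain : ∑ x : K, Ψ (f.eval x) = ∑ a ∈ A, Ψ (c a) * (((N a : ℝ) - (p ^ n : ℕ) / d : ℝ) : ℂ) := by
    rw [hfib]
    push_cast
    simp only [mul_sub]
    rw [Finset.sum_sub_distrib, ← Finset.sum_mul, hsumc]
    simp [N]
  rw [hmain]
  have hΨn : ∀ y, ‖Ψ y‖ ≤ 1 := by
    intro y
    by_cases hy : y = 0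
    · rw [hy, MulChar.map_zero]; simp
    · have h1 : Ψ y ^ d = 1 := by
        rw [← MulChar.pow_apply' _ (by omega), hΨd]
        exact MulChar.one_apply (isUnit_iff_ne_zero.2 hy)
      exact (Complex.norm_eq_one_of_pow_eq_one h1 (by omega)).le
  set E := (13 * μ + 28) * Real.sqrt ((p ^ n : ℕ) : ℝ) with hE
  have hE0 : 0 ≤ E := by positivity
  have hsq1 : 1 ≤ Real.sqrt ((p ^ n : ℕ) : ℝ) := by
    rw [Real.one_le_sqrt]; exact_mod_cast (by omega : 1 ≤ p ^ n)
  have habs : ∀ a ∈ A, |(N a : ℝ) - (p ^ n : ℕ) / d| ≤ 2 * E - ((N a : ℝ) - (p ^ n : ℕ) / d) := by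
    intro a ha
    have := hN a ha
    rw [abs_le]; constructor <;> linarith
  have hdpos : (0:ℝ) < d := by exact_mod_cast hd
  have hcA : (A.card : ℝ) ≤ d := by exact_mod_cast hcardA
  calc _ ≤ ∑ a ∈ A, |(N a : ℝ) - (p ^ n : ℕ) / d| := by
        refine norm_sum_le_of_le _ fun a _ => ?_
        rw [norm_mul, Complex.norm_real, Real.norm_eq_abs]
        exact mul_le_of_le_one_left (abs_nonneg _) (hΨn _)
    _ ≤ ∑ a ∈ A, (2 * E - ((N a : ℝ) - (p ^ n : ℕ) / d)) := Finset.sum_le_sum habs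
    _ = A.card * (2 * E) + A.card * ((p ^ n : ℕ) / d) - ∑ a ∈ A, (N a : ℝ) := by
        simp only [Finset.sum_sub_distrib, Finset.sum_const, nsmul_eq_mul]; ring
    _ ≤ d * (2 * E) + d * ((p ^ n : ℕ) / d) - ((p ^ n : ℕ) - μ) := by
        gcongr
    _ = 2 * d * E + μ := by field_simp; ring
    _ ≤ _ := by rw [hE]; nlinarith [(by positivity : (0:ℝ) ≤ μ)]
end WeilS

namespace WeilS
open Polynomial

section
variable {F : Type*} [Field F] [Fintype F]

lemma monics_finite (k : ℕ) : {g : F[X] | g.Monic ∧ g.natDegree = k}.Finite := by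
  have : Finite {g : F[X] // g.Monic ∧ g.natDegree = k} :=
    Finite.of_equiv _ ((monicEquivDegreeLT k).trans (degreeLTEquiv F k).toEquiv).symm
  exact Set.finite_coe_iff.1 this

/-- monic polynomials of degree k -/
noncomputable def monics (F : Type*) [Field F] [Fintype F] (k : ℕ) : Finset F[X] :=
  (monics_finite (F := F) k).toFinset

lemma mem_monics {k : ℕ} {g : F[X]} : g ∈ monics F k ↔ g.Monic ∧ g.natDegree = k := by
  simp [monics]

/-- the multiplicative function -/
noncomputable def lam (s : Finset F) (χ : F → MulChar F ℂ) (g : F[X]) : ℂ :=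
  ∏ a ∈ s, χ a (g.eval a)

lemma lam_mul (s : Finset F) (χ : F → MulChar F ℂ) (g h : F[X]) :
    lam s χ (g * h) = lam s χ g * lam s χ h := by
  simp [lam, Finset.prod_mul_distrib]

lemma lam_one (s : Finset F) (χ : F → MulChar F ℂ) : lam s χ 1 = 1 := by simp [lam]

noncomputable def cf (s : Finset F) (χ : F → MulChar F ℂ) (k : ℕ) : ℂ :=
  ∑ g ∈ monics F k, lam s χ g

lemma cf_zero (s : Finset F) (χ : F → MulChar F ℂ) : cf s χ 0 = 1 := by
  have : monics F 0 = {1} := by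
    ext g
    rw [mem_monics, Finset.mem_singleton]
    constructor
    · rintro ⟨h1, h2⟩; exact h1.natDegree_eq_zero.1 h2
    · rintro rfl; simp
  rw [cf, this, Finset.sum_singleton, lam_one]

lemma cf_eq_zero (s : Finset F) (χ : F → MulChar F ℂ) (b : F) (hb : b ∈ s) (hχ : χ b ≠ 1)
    (k : ℕ) (hk : s.card ≤ k) : cf s χ k = 0 := by
  classical
  obtain ⟨t, ht⟩ := MulChar.ne_one_iff.1 hχ
  set ℓ := Lagrange.basis s id b with hℓ
  have hℓb : ℓ.eval b = 1 := Lagrange.eval_basis_self (v := id) (Function.injective_id.injOn) hb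
  have hℓa : ∀ a ∈ s, a ≠ b → ℓ.eval a = 0 := by
    intro a ha hab
    exact Lagrange.eval_basis_of_ne (v := id) hab.symm ha
  have hℓd : ℓ.degree < k := by
    rw [hℓ, Lagrange.degree_basis (Function.injective_id.injOn) hb]
    have := Finset.card_pos.2 ⟨b, hb⟩
    exact_mod_cast (by omega : s.card - 1 < k)
  let T : F → F[X] → F[X] := fun u g => g + C ((u - 1) * g.eval b) * ℓ
  have hT : ∀ u g, g ∈ monics F k → T u g ∈ monics F k := by
    intro u g hg
    rw [mem_monics] at hg ⊢
    have hlt : (C ((u - 1) * g.eval b) * ℓ).degree < g.degree := by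
      rw [degree_eq_natDegree hg.1.ne_zero, hg.2]
      refine lt_of_le_of_lt ?_ hℓd
      rw [← smul_eq_C_mul]; exact degree_smul_le _ _
    exact ⟨hg.1.add_of_left hlt, by rw [natDegree_add_eq_left_of_degree_lt hlt, hg.2]⟩
  have hTT : ∀ u v g, T u (T v g) = T (u * v) g := by
    intro u v g
    simp only [T, eval_add, eval_mul, eval_C, hℓb, mul_one]
    have : (u - 1) * (eval b g + (v - 1) * eval b g) = (u * v - 1) * eval b g - (v - 1) * eval b g := by ring
    rw [this, C_sub]; ring
  have hT1 : ∀ g, T 1 g = g := by intro g; simp [T]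
  have hlamT : ∀ g, lam s χ (T t g) = χ b t * lam s χ g := by
    intro g
    simp only [lam]
    rw [← Finset.mul_prod_erase _ _ hb, ← Finset.mul_prod_erase s _ hb, ← mul_assoc]
    congr 1
    · rw [← map_mul]
      congr 1
      simp only [T, eval_add, eval_mul, eval_C, hℓb]; ring
    · refine Finset.prod_congr rfl fun a ha => ?_
      rw [Finset.mem_erase] at ha
      simp [T, hℓa a ha.2 ha.1]
  have : cf s χ k = χ b t * cf s χ k := by
    conv_rhs => rw [cf, Finset.mul_sum]
    rw [cf]
    symm
    refine Finset.sum_bij' (fun g _ => T t g) (fun g _ => T (t⁻¹ : Fˣ) g) (fun g hg => hT _ g hg)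
      (fun g hg => hT _ g hg) ?_ ?_ ?_
    · intro g _; rw [hTT]; simp [hT1]
    · intro g _; rw [hTT]; simp [hT1]
    · intro g _; rw [hlamT]
  have h2 : (χ b t - 1) * cf s χ k = 0 := by rw [sub_mul, ← this]; ring
  exact (mul_eq_zero.1 h2).resolve_left (sub_ne_zero.2 ht)

lemma irr_finite (k : ℕ) : {P : F[X] | P.Monic ∧ Irreducible P ∧ P.natDegree ≤ k}.Finite := by
  classical
  apply Set.Finite.subset ((Finset.range (k+1)).biUnion (monics F)).finite_toSet
  rintro P ⟨h1, _, h3⟩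
  simp only [Finset.coe_biUnion, Set.mem_iUnion, Finset.mem_coe, mem_monics, Finset.mem_range]
  exact ⟨P.natDegree, by omega, h1, rfl⟩

noncomputable def irr (F : Type*) [Field F] [Fintype F] (k : ℕ) : Finset F[X] :=
  (irr_finite (F := F) k).toFinset

lemma mem_irr {k : ℕ} {g : F[X]} : g ∈ irr F k ↔ g.Monic ∧ Irreducible g ∧ g.natDegree ≤ k := by
  simp [irr]

open Classical in
lemma degree_count (k : ℕ) (g : F[X]) (hg : g ∈ monics F k) :
    (k : ℂ) = ∑ n ∈ Finset.Icc 1 k, ∑ P ∈ (irr F k).filter (fun P => P.natDegree ∣ n),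
      (P.natDegree : ℂ) * (if P ^ (n / P.natDegree) ∣ g then 1 else 0) := by
  rw [mem_monics] at hg
  have hg0 := hg.1.ne_zero
  set M := UniqueFactorizationMonoid.normalizedFactors g with hM
  have hprod : M.prod = g := by
    have h1 := UniqueFactorizationMonoid.prod_normalizedFactors_eq hg0
    rw [← hM] at h1
    rw [h1, hg.1.normalize_eq_self]
  have hmon : ∀ P ∈ M, P.Monic ∧ Irreducible P := by
    intro P hP
    have h1 := UniqueFactorizationMonoid.irreducible_of_normalized_factor P hP
    have h2 := UniqueFactorizationMonoid.normalize_normalized_factor P hP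
    exact ⟨by rw [← h2]; exact monic_normalize h1.ne_zero, h1⟩
  have hcount : ∀ P : F[X], P.Monic → Irreducible P → ∀ m, P ^ m ∣ g ↔ m ≤ M.count P := by
    intro P hP1 hP2 m
    rw [pow_dvd_iff_le_emultiplicity, UniqueFactorizationMonoid.emultiplicity_eq_count_normalizedFactors hP2 hg0,
      hP1.normalize_eq_self]
    exact Nat.cast_le
  have hdeg : k = ∑ P ∈ irr F k, M.count P * P.natDegree := by
    have h1 : g.natDegree = (M.map natDegree).sum := by
      conv_lhs => rw [← hprod]
      exact natDegree_multiset_prod_of_monic _ (fun P hP => (hmon P hP).1)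
    rw [hg.2] at h1
    rw [Finset.sum_multiset_map_count] at h1
    refine h1.trans ?_
    simp only [smul_eq_mul]
    apply Finset.sum_subset
    · intro P hP
      rw [Multiset.mem_toFinset] at hP
      rw [mem_irr]
      refine ⟨(hmon P hP).1, (hmon P hP).2, ?_⟩
      rw [← hg.2]
      exact natDegree_le_of_dvd (UniqueFactorizationMonoid.dvd_of_mem_normalizedFactors hP) hg0
    · intro P _ hP
      rw [Multiset.mem_toFinset] at hP
      rw [Multiset.count_eq_zero.2 hP, zero_mul]
  conv_lhs => rw [hdeg]
  push_cast
  simp_rw [Finset.sum_filter]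
  rw [Finset.sum_comm]
  refine Finset.sum_congr rfl fun P hP => ?_
  rw [mem_irr] at hP
  have hPd : 0 < P.natDegree := hP.2.1.natDegree_pos
  have h1 : ∑ n ∈ Finset.Icc 1 k, (if P.natDegree ∣ n then
      (P.natDegree : ℂ) * (if P ^ (n / P.natDegree) ∣ g then 1 else 0) else 0) =
      ∑ n ∈ (Finset.Icc 1 k).filter (fun n => P.natDegree ∣ n ∧ P ^ (n / P.natDegree) ∣ g), (P.natDegree : ℂ) := by
    rw [Finset.sum_filter]
    refine Finset.sum_congr rfl fun n _ => ?_
    by_cases h1 : P.natDegree ∣ n <;> by_cases h2 : P ^ (n / P.natDegree) ∣ g <;> simp [h1, h2]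
  rw [h1, Finset.sum_const, nsmul_eq_mul]
  congr 2
  have : (Finset.Icc 1 k).filter (fun n => P.natDegree ∣ n ∧ P ^ (n / P.natDegree) ∣ g) =
    (Finset.Icc 1 (M.count P)).image (fun m => m * P.natDegree) := by
    ext n
    simp only [Finset.mem_filter, Finset.mem_Icc, Finset.mem_image]
    constructor
    · rintro ⟨⟨h1, h2⟩, ⟨m, rfl⟩, h4⟩
      rw [Nat.mul_div_cancel_left _ hPd, hcount P hP.1 hP.2.1] at h4
      refine ⟨m, ⟨?_, h4⟩, mul_comm _ _⟩
      by_contra h; have : m = 0 := by omega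
      subst this; omega
    · rintro ⟨m, ⟨h1, h2⟩, rfl⟩
      rw [Nat.mul_div_cancel _ hPd]
      have h3 := (hcount P hP.1 hP.2.1 m).2 h2
      have h4 := natDegree_le_of_dvd h3 hg0
      rw [natDegree_pow, hg.2] at h4
      refine ⟨⟨?_, h4⟩, Dvd.intro_left m rfl, h3⟩
      nlinarith
  rw [this, Finset.card_image_of_injective]
  · simp
  · intro a b h; exact Nat.eq_of_mul_eq_mul_right hPd h

open Classical in
lemma sum_multiples (s : Finset F) (χ : F → MulChar F ℂ) (k n : ℕ) (hn : n ≤ k) (Q : F[X])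
    (hQ : Q.Monic) (hQn : Q.natDegree = n) :
    ∑ g ∈ monics F k, lam s χ g * (if Q ∣ g then 1 else 0) = lam s χ Q * cf s χ (k - n) := by
  have : ∑ g ∈ monics F k, lam s χ g * (if Q ∣ g then 1 else 0) =
      ∑ g ∈ (monics F k).filter (fun g => Q ∣ g), lam s χ g := by
    rw [Finset.sum_filter]
    refine Finset.sum_congr rfl fun g _ => ?_
    split_ifs <;> simp
  rw [this, cf, Finset.mul_sum]
  symm
  refine Finset.sum_bij (fun g _ => Q * g) ?_ ?_ ?_ ?_
  · intro g hg
    rw [mem_monics] at hg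
    rw [Finset.mem_filter, mem_monics]
    refine ⟨⟨hQ.mul hg.1, ?_⟩, dvd_mul_right _ _⟩
    rw [hQ.natDegree_mul hg.1, hQn, hg.2]; omega
  · intro g _ h _ e; exact mul_left_cancel₀ hQ.ne_zero e
  · intro g hg
    rw [Finset.mem_filter, mem_monics] at hg
    obtain ⟨⟨h1, h2⟩, r, hr⟩ := hg
    have hrm : r.Monic := by rw [hr] at h1; exact hQ.of_mul_monic_left h1
    refine ⟨r, ?_, hr.symm⟩
    rw [mem_monics]
    refine ⟨hrm, ?_⟩
    rw [hr, hQ.natDegree_mul hrm, hQn] at h2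
    omega
  · intro g _; rw [lam_mul]

open Classical in
/-- power sums through irreducibles -/
noncomputable def ps (s : Finset F) (χ : F → MulChar F ℂ) (n : ℕ) : ℂ :=
  ∑ P ∈ (irr F n).filter (fun P => P.natDegree ∣ n), (P.natDegree : ℂ) * lam s χ (P ^ (n / P.natDegree))

lemma newton (s : Finset F) (χ : F → MulChar F ℂ) (k : ℕ) :
    (k : ℂ) * cf s χ k = ∑ n ∈ Finset.Icc 1 k, ps s χ n * cf s χ (k - n) := by
  classical
  have h1 : (k : ℂ) * cf s χ k = ∑ g ∈ monics F k, ∑ n ∈ Finset.Icc 1 k,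
      ∑ P ∈ (irr F k).filter (fun P => P.natDegree ∣ n),
      (P.natDegree : ℂ) * (lam s χ g * (if P ^ (n / P.natDegree) ∣ g then 1 else 0)) := by
    rw [cf, Finset.mul_sum]
    refine Finset.sum_congr rfl fun g hg => ?_
    conv_lhs => rw [degree_count k g hg]
    rw [Finset.sum_mul]
    refine Finset.sum_congr rfl fun n _ => ?_
    rw [Finset.sum_mul]
    refine Finset.sum_congr rfl fun P _ => ?_
    ring
  rw [h1, Finset.sum_comm]
  refine Finset.sum_congr rfl fun n hn => ?_
  rw [Finset.mem_Icc] at hn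
  rw [Finset.sum_comm]
  have h2 : (irr F k).filter (fun P => P.natDegree ∣ n) = (irr F n).filter (fun P => P.natDegree ∣ n) := by
    ext P
    simp only [Finset.mem_filter, mem_irr]
    constructor
    · rintro ⟨⟨a, b, c⟩, d⟩; exact ⟨⟨a, b, Nat.le_of_dvd hn.1 d⟩, d⟩
    · rintro ⟨⟨a, b, c⟩, d⟩; exact ⟨⟨a, b, c.trans hn.2⟩, d⟩
  rw [h2, ps, Finset.sum_mul]
  refine Finset.sum_congr rfl fun P hP => ?_
  rw [Finset.mem_filter, mem_irr] at hP
  rw [← Finset.mul_sum, sum_multiples s χ k n hn.2 _ (hP.1.1.pow _), mul_assoc]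
  rw [natDegree_pow, Nat.div_mul_cancel hP.2]

end
end WeilS

namespace WeilS
open Polynomial

section
variable {F K : Type*} [Field F] [Fintype F] [Field K] [Fintype K] [Algebra F K]

lemma norm_formula (x : K) (a : F) : Algebra.norm F (algebraMap F K a - x) =
    ((minpoly F x) ^ (Module.finrank F K / (minpoly F x).natDegree)).eval a := by
  have hInt0 : ∀ z : K, IsIntegral F z := fun z => Algebra.IsIntegral.isIntegral z
  set y := x - algebraMap F K a with hy
  set P := minpoly F x with hP
  have hPpos : 0 < P.natDegree := minpoly.natDegree_pos (hInt0 x)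
  have hmy : minpoly F y = P.comp (X + C a) := minpoly.sub_algebraMap x a
  have hdy : (minpoly F y).natDegree = P.natDegree := by
    rw [hmy, natDegree_comp]; simp
  have hfr : Module.finrank F (IntermediateField.adjoin F {y}) = P.natDegree := by
    rw [IntermediateField.adjoin.finrank (hInt0 y), hdy]
  have hmul := Module.finrank_mul_finrank F (IntermediateField.adjoin F {y}) K
  rw [hfr] at hmul
  have hdiv : Module.finrank F K / P.natDegree = Module.finrank (IntermediateField.adjoin F {y}) K := by
    rw [← hmul, Nat.mul_div_cancel_left _ hPpos]
  have h1 : Algebra.norm F y = ((-1) ^ P.natDegree * P.eval a) ^ (Module.finrank F K / P.natDegree) := by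
    rw [hdiv, Algebra.norm_eq_norm_adjoin]
    congr 1
    have := Algebra.PowerBasis.norm_gen_eq_coeff_zero_minpoly (IntermediateField.adjoin.powerBasis (hInt0 y))
    rw [IntermediateField.adjoin.powerBasis_gen, IntermediateField.adjoin.powerBasis_dim, hdy,
      IntermediateField.minpoly_gen, hmy] at this
    rw [this, coeff_zero_eq_eval_zero, eval_comp]
    simp
  have h2 : algebraMap F K a - x = algebraMap F K (-1) * y := by rw [hy]; simp
  rw [h2, map_mul, Algebra.norm_algebraMap, h1, mul_pow, ← pow_mul, eval_pow, ← mul_assoc, ← pow_add]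
  have h3 : P.natDegree * (Module.finrank F K / P.natDegree) = Module.finrank F K := by
    rw [hdiv, hmul]
  rw [h3, ← two_mul, pow_mul]; simp

lemma fiber_card [DecidableEq K] [DecidableEq F[X]] (P : F[X]) (hm : P.Monic) (hi : Irreducible P)
    (hd : P.natDegree ∣ Module.finrank F K) :
    (Finset.univ.filter (fun x : K => minpoly F x = P)).card = P.natDegree := by
  have hcard : Fintype.card K = Fintype.card F ^ Module.finrank F K := Module.card_eq_pow_finrank
  have hdvd : P ∣ X ^ (Fintype.card K) - X := by
    rw [hcard, ← Nat.card_eq_fintype_card]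
    exact hi.natDegree_dvd_iff_dvd_X_pow_card_pow_sub_X.1 hd
  have hK1 : 1 < Fintype.card K := Fintype.one_lt_card
  have hsplX : (X ^ (Fintype.card K) - X : K[X]).Splits := by
    rw [splits_iff_card_roots, FiniteField.roots_X_pow_card_sub_X, FiniteField.X_pow_card_sub_X_natDegree_eq _ hK1]
    simp
  have hne : (X ^ (Fintype.card K) - X : K[X]) ≠ 0 := FiniteField.X_pow_card_sub_X_ne_zero _ hK1
  have hdvdK : P.map (algebraMap F K) ∣ (X ^ (Fintype.card K) - X : K[X]) := by
    have := Polynomial.map_dvd (algebraMap F K) hdvd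
    simpa using this
  have hspl : (P.map (algebraMap F K)).Splits := hsplX.of_dvd hne hdvdK
  have hsep : P.Separable := PerfectField.separable_of_irreducible hi
  have h1 := card_rootSet_eq_natDegree (K := K) hsep hspl
  rw [← h1, ← Set.toFinset_card]
  congr 1
  ext x
  simp only [Finset.mem_filter, Finset.mem_univ, true_and, Set.mem_toFinset]
  rw [mem_rootSet]
  constructor
  · rintro rfl; exact ⟨hm.ne_zero, minpoly.aeval _ _⟩
  · rintro ⟨_, h⟩; exact (minpoly.eq_of_irreducible_of_monic hi h hm).symm

lemma ps_eq (s : Finset F) (χ : F → MulChar F ℂ) (n : ℕ) (hn : Module.finrank F K = n) (hn0 : 0 < n) :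
    ps s χ n = ∑ x : K, ∏ a ∈ s, χ a (Algebra.norm F (algebraMap F K a - x)) := by
  classical
  have hInt0 : ∀ z : K, IsIntegral F z := fun z => Algebra.IsIntegral.isIntegral z
  rw [ps, ← Finset.sum_fiberwise_of_maps_to (s := Finset.univ) (g := fun x : K => minpoly F x)
    (t := (irr F n).filter (fun P => P.natDegree ∣ n))]
  · refine Finset.sum_congr (by congr) fun P hP => ?_
    rw [Finset.mem_filter, mem_irr] at hP
    have h1 := fiber_card (K := K) P hP.1.1 hP.1.2.1 (by rw [hn]; exact hP.2)
    rw [Finset.sum_congr rfl (g := fun _ => lam s χ (P ^ (n / P.natDegree))), Finset.sum_const, nsmul_eq_mul]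
    · congr 2; rw [← h1]
    · intro x hx
      rw [Finset.mem_filter] at hx
      rw [lam]
      refine Finset.prod_congr rfl fun a _ => ?_
      rw [norm_formula, hx.2, hn]
  · intro x _
    rw [Finset.mem_filter, mem_irr]
    have h1 : (minpoly F x).natDegree ∣ n := by
      rw [← hn]; exact minpoly.degree_dvd (hInt0 x)
    exact ⟨⟨minpoly.monic (hInt0 x), minpoly.irreducible (hInt0 x), Nat.le_of_dvd hn0 h1⟩, h1⟩

end
end WeilS

namespace WeilS
open Polynomial

lemma root_large (c S : ℕ → ℂ) (m : ℕ) (C R : ℝ) (hR : 0 < R) (hc0 : c 0 = 1)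
    (hcm : ∀ k, m ≤ k → c k = 0)
    (hN : ∀ k : ℕ, (k : ℂ) * c k = ∑ n ∈ Finset.Icc 1 k, S n * c (k - n))
    (hS : ∀ n, 1 ≤ n → ‖S n‖ ≤ C * R ^ n) (L : ℂ[X]) (hL : ∀ k, L.coeff k = c k) (u0 : ℂ)
    (hu0 : L.IsRoot u0) : 1 ≤ R * ‖u0‖ := by
  by_contra hlt
  push Not at hlt
  have hC : 0 ≤ C := by
    have h1 := (norm_nonneg _).trans (hS 1 le_rfl)
    rw [pow_one] at h1
    exact nonneg_of_mul_nonneg_left h1 hR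
  have hL0 : L ≠ 0 := by
    intro h; have := hL 0; rw [h, hc0] at this; simp at this
  have hu0' : u0 ≠ 0 := by
    rintro rfl
    have h1 : L.eval 0 = 1 := by rw [← coeff_zero_eq_eval_zero, hL, hc0]
    rw [IsRoot.def] at hu0
    rw [hu0] at h1; exact zero_ne_one h1
  obtain ⟨M, hM1, hM2⟩ := L.exists_eq_pow_rootMultiplicity_mul_and_not_dvd hL0 u0
  have hr : 0 < L.rootMultiplicity u0 := (rootMultiplicity_pos hL0).2 hu0
  obtain ⟨r, hr'⟩ := Nat.exists_eq_succ_of_ne_zero hr.ne'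
  rw [hr'] at hM1
  have hMu : M.eval u0 ≠ 0 := fun h => hM2 (dvd_iff_isRoot.2 h)
  have hLnat : L.natDegree < m + 1 := by
    by_contra h
    push Not at h
    have h1 := hcm L.natDegree (by omega)
    rw [← hL] at h1
    exact hL0 (leadingCoeff_eq_zero.1 h1)
  -- sequence with S 0 = 0
  set S' : ℕ → ℂ := fun n => if n = 0 then 0 else S n with hS'
  have hS'b : ∀ n, ‖S' n‖ ≤ C * R ^ n := by
    intro n
    by_cases h : n = 0
    · simp [hS', h, hC]
    · simp only [hS', h, if_false]; exact hS n (by omega)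
  set ρ := (R * ‖u0‖ + 1) / 2 with hρ
  have hρ1 : ρ < 1 := by rw [hρ]; linarith
  have hρ0 : 0 ≤ ρ := by rw [hρ]; positivity
  have hsum : ∀ u : ℂ, R * ‖u‖ ≤ ρ → Summable (fun n => ‖S' n * u ^ n‖) ∧
      ‖∑' n, S' n * u ^ n‖ ≤ C * (1 - ρ)⁻¹ := by
    intro u hu
    have hb : ∀ n, ‖S' n * u ^ n‖ ≤ C * ρ ^ n := by
      intro n
      rw [norm_mul, norm_pow]
      calc ‖S' n‖ * ‖u‖ ^ n ≤ (C * R ^ n) * ‖u‖ ^ n := by gcongr; exact hS'b n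
        _ = C * (R * ‖u‖) ^ n := by rw [mul_pow]; ring
        _ ≤ C * ρ ^ n := by gcongr
    have hg : HasSum (fun n => C * ρ ^ n) (C * (1 - ρ)⁻¹) :=
      (hasSum_geometric_of_lt_one hρ0 hρ1).mul_left C
    exact ⟨Summable.of_nonneg_of_le (fun _ => norm_nonneg _) hb hg.summable, tsum_of_norm_bounded hg hb⟩
  have hid : ∀ u : ℂ, R * ‖u‖ ≤ ρ → u * L.derivative.eval u = L.eval u * ∑' n, S' n * u ^ n := by
    intro u hu
    have hfin : ∀ k ∉ Finset.range (m+1), c k * u ^ k = 0 := by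
      intro k hk
      rw [Finset.mem_range, not_lt] at hk
      rw [hcm k (by omega), zero_mul]
    have hLe : L.eval u = ∑' k, c k * u ^ k := by
      rw [tsum_eq_sum hfin, eval_eq_sum_range' hLnat]
      exact Finset.sum_congr rfl fun k _ => by rw [hL]
    have hcs : Summable (fun k => ‖c k * u ^ k‖) := by
      apply summable_of_ne_finset_zero (s := Finset.range (m+1))
      intro k hk; rw [hfin k hk, norm_zero]
    rw [hLe, tsum_mul_tsum_eq_tsum_sum_antidiagonal_of_summable_norm hcs (hsum u hu).1]
    have h1 : ∀ k, ∑ kl ∈ Finset.HasAntidiagonal.antidiagonal k, c kl.1 * u ^ kl.1 * (S' kl.2 * u ^ kl.2) =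
        k * c k * u ^ k := by
      intro k
      rw [hN k, Finset.Nat.antidiagonal_eq_map', Finset.sum_map]
      change ∑ n ∈ Finset.range (k+1), c (k-n) * u^(k-n) * (S' n * u^n) = _
      rw [Finset.sum_range_eq_add_Ico _ (by omega)]
      simp only [Finset.sum_mul]
      have : Finset.Ico 1 (k+1) = Finset.Icc 1 k := by ext; simp
      rw [this]
      simp only [hS', if_true, zero_mul, mul_zero, zero_add]
      refine Finset.sum_congr rfl fun n hn => ?_
      rw [Finset.mem_Icc] at hn
      rw [if_neg (by omega)]
      have : u ^ k = u ^ (k - n) * u ^ n := by rw [← pow_add]; congr 1; omega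
      rw [this]; ring
    rw [tsum_congr h1, tsum_eq_sum (s := Finset.range (m+1))]
    · rw [derivative_eval, sum_over_range' _ (by simp) (m+1) hLnat, Finset.mul_sum]
      refine Finset.sum_congr rfl fun k _ => ?_
      rw [hL]
      rcases k with _ | k
      · simp
      · simp only [Nat.add_sub_cancel, pow_succ]; push_cast; ring
    · intro k hk
      rw [mul_assoc, hfin k hk, mul_zero]
  have hder : ∀ u, L.derivative.eval u = (u - u0) ^ r * ((r + 1) * M.eval u + (u - u0) * M.derivative.eval u) := by
    intro u
    rw [hM1]
    simp [derivative_mul, derivative_pow]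
    ring
  have hLev : ∀ u, L.eval u = (u - u0) ^ (r + 1) * M.eval u := by
    intro u; conv_lhs => rw [hM1]
    simp
  have key : ∀ u : ℂ, R * ‖u‖ ≤ ρ → u ≠ u0 → ‖u * ((r + 1) * M.eval u + (u - u0) * M.derivative.eval u)‖ ≤
      ‖u - u0‖ * ‖M.eval u‖ * (C * (1 - ρ)⁻¹) := by
    intro u hu hne
    have h1 := hid u hu
    rw [hder, hLev, pow_succ] at h1
    have h2 : u * ((r + 1) * M.eval u + (u - u0) * M.derivative.eval u) =
      (u - u0) * M.eval u * ∑' n, S' n * u ^ n := by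
      apply mul_left_cancel₀ (pow_ne_zero r (sub_ne_zero.2 hne))
      linear_combination h1
    rw [h2, norm_mul, norm_mul]
    gcongr
    exact (hsum u hu).2
  have hcont1 : Continuous (fun u : ℂ => ‖u * ((r + 1) * M.eval u + (u - u0) * M.derivative.eval u)‖) := by
    have := M.continuous; have := M.derivative.continuous
    fun_prop
  have hcont2 : Continuous (fun u : ℂ => ‖u - u0‖ * ‖M.eval u‖ * (C * (1 - ρ)⁻¹)) := by
    have := M.continuous
    fun_prop
  have hle := le_of_tendsto_of_tendsto (b := nhdsWithin u0 {u0}ᶜ) (hcont1.tendsto u0 |>.mono_left nhdsWithin_le_nhds)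
    (hcont2.tendsto u0 |>.mono_left nhdsWithin_le_nhds) (by
      have h1 : ∀ᶠ u in nhds u0, R * ‖u‖ < ρ := by
        have : Continuous (fun u : ℂ => R * ‖u‖) := by fun_prop
        exact this.tendsto u0 |>.eventually_lt_const (by rw [hρ]; linarith)
      filter_upwards [nhdsWithin_le_nhds h1, self_mem_nhdsWithin] with u hu1 hu2
      exact key u hu1.le hu2)
  simp only [sub_self, zero_mul, norm_zero, add_zero] at hle
  rw [norm_le_zero_iff] at hle
  have : (r : ℂ) + 1 ≠ 0 := by exact_mod_cast Nat.succ_ne_zero r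
  exact mul_ne_zero hu0' (mul_ne_zero this hMu) hle

lemma newton_bound (c S : ℕ → ℂ) (m : ℕ) (C R : ℝ) (hR : 0 < R) (hc0 : c 0 = 1)
    (hcm : ∀ k, m ≤ k → c k = 0)
    (hN : ∀ k : ℕ, (k : ℂ) * c k = ∑ n ∈ Finset.Icc 1 k, S n * c (k - n))
    (hS : ∀ n, 1 ≤ n → ‖S n‖ ≤ C * R ^ n) : ‖S 1‖ ≤ m * R := by
  set L : ℂ[X] := ∑ k ∈ Finset.range m, Polynomial.C (c k) * X ^ k with hLdef
  have hL : ∀ k, L.coeff k = c k := by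
    intro k
    rw [hLdef, finsetSum_coeff]
    simp only [coeff_C_mul_X_pow]
    by_cases h : k < m
    · rw [Finset.sum_ite_eq, if_pos (by simpa using h)]
    · rw [Finset.sum_ite_eq, if_neg (by simpa using h), hcm k (by omega)]
  have hLe : L.eval 0 = 1 := by rw [← coeff_zero_eq_eval_zero, hL, hc0]
  have h1 : L.derivative.eval 0 = S 1 := by
    rw [← coeff_zero_eq_eval_zero, coeff_derivative, hL]
    have := hN 1
    simp [hc0] at this
    simp [this]
  have h2 := (IsAlgClosed.splits L).eval_derivative_eq_eval_mul_sum (x := 0) (by rw [hLe]; exact one_ne_zero)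
  rw [h1, hLe, one_mul] at h2
  rw [h2]
  have h3 : ‖(L.roots.map fun z ↦ 1 / (0 - z)).sum‖ ≤ ((L.roots.map fun z ↦ 1 / (0 - z)).map norm).sum :=
    norm_multiset_sum_le _
  refine h3.trans ?_
  have h4 : ((L.roots.map fun z ↦ 1 / (0 - z)).map norm).sum ≤
     Multiset.card ((L.roots.map fun z ↦ 1 / (0 - z)).map norm) • R := by
    apply Multiset.sum_le_card_nsmul
    intro x hx
    simp only [Multiset.map_map, Multiset.mem_map, Function.comp] at hx
    obtain ⟨z, hz, rfl⟩ := hx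
    have hz' := root_large c S m C R hR hc0 hcm hN hS L hL z (isRoot_of_mem_roots hz)
    have hzpos : 0 < ‖z‖ := by
      by_contra h
      have : ‖z‖ = 0 := le_antisymm (not_lt.1 h) (norm_nonneg _)
      rw [this] at hz'; linarith
    simp only [zero_sub, norm_div, norm_one, norm_neg]
    rw [div_le_iff₀ hzpos]; exact hz'
  refine h4.trans ?_
  rw [nsmul_eq_mul]
  gcongr
  simp only [Multiset.card_map]
  refine (card_roots' L).trans ?_
  rw [hLdef]
  apply natDegree_sum_le_of_forall_le
  intro k hk
  rw [Finset.mem_range] at hk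
  exact (natDegree_C_mul_X_pow_le _ _).trans hk.le

end WeilS

namespace WeilS
open Polynomial

/-- composition of a character with the norm -/
noncomputable def normChar {F : Type*} (K : Type*) [Field F] [Fintype F] [Field K] [Fintype K] [Algebra F K]
    (χ : MulChar F ℂ) : MulChar K ℂ where
  toMonoidHom := χ.toMonoidHom.comp (Algebra.norm F)
  map_nonunit' := by
    intro a ha
    have : a = 0 := by simpa using ha
    subst this
    have h1 : Algebra.norm F (0 : K) = 0 := Algebra.norm_zero
    change χ (Algebra.norm F (0:K)) = 0
    rw [h1, MulChar.map_zero]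

lemma normChar_apply {F K : Type*} [Field F] [Fintype F] [Field K] [Fintype K] [Algebra F K]
    (χ : MulChar F ℂ) (x : K) : normChar K χ x = χ (Algebra.norm F x) := rfl

lemma weil_big (p : ℕ) [Fact p.Prime] (χ : MulChar (ZMod p) ℂ) (hχ : χ ≠ 1) (s : Finset (ZMod p))
    (e : ZMod p → ℕ) (he : ∀ a ∈ s, 1 ≤ e a) (hco : Nat.Coprime (∑ a ∈ s, e a) (orderOf χ))
    (hμ0 : 1 ≤ ∑ a ∈ s, e a) (n : ℕ) (hn : 1 ≤ n) (hbig : 16*(1+orderOf χ*∑ a ∈ s, e a) ≤ p^n)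
    (K : Type) [Field K] [Fintype K] [Algebra (ZMod p) K] [CharP K p] (hfr : Module.finrank (ZMod p) K = n)
    (hcard : Fintype.card K = p ^ n) :
    ‖ps s (fun a => χ ^ (e a)) n‖ ≤ (2*(orderOf χ)*(13*(∑ a ∈ s, e a : ℕ)+28)+(∑ a ∈ s, e a : ℕ)) * Real.sqrt p ^ n := by
  classical
  have hp := (Fact.out : p.Prime)
  set d := orderOf χ with hd
  have hd0 : 0 < d := by rw [hd]; exact χ.orderOf_pos
  have hdp : d ∣ p - 1 := by
    have := χ.orderOf_dvd_card_sub_one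
    rwa [ZMod.card] at this
  set μ := ∑ a ∈ s, e a with hμ
  set X : ZMod p → MulChar (ZMod p) ℂ := fun a => χ ^ (e a) with hX
  have hXe : ∀ a ∈ s, ∀ y, X a y = χ y ^ (e a) := by
    intro a ha y
    rw [hX]; exact MulChar.pow_apply' χ (by have := he a ha; omega) y
  rw [ps_eq (K := K) s X n hfr (by omega)]
  set f : K[X] := ∏ a ∈ s, (C (algebraMap (ZMod p) K a) - Polynomial.X) ^ (e a) with hf
  have hlin : ∀ a : K, (C a - Polynomial.X : K[X]).natDegree = 1 := by
    intro a
    rw [← natDegree_neg, neg_sub]; exact natDegree_X_sub_C a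
  have hlin0 : ∀ a : K, (C a - Polynomial.X : K[X]) ≠ 0 := by
    intro a h; have := hlin a; rw [h] at this; simp at this
  have hf0 : f ≠ 0 := by
    rw [hf]; exact Finset.prod_ne_zero_iff.2 fun a _ => pow_ne_zero _ (hlin0 _)
  have hfd : f.natDegree = μ := by
    rw [hf, natDegree_prod _ _ (fun a _ => pow_ne_zero _ (hlin0 _))]
    simp [hlin, hμ]
  have hsum : ∀ x : K, ∏ a ∈ s, X a (Algebra.norm (ZMod p) (algebraMap (ZMod p) K a - x)) =
      normChar K χ (f.eval x) := by
    intro x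
    rw [hf, eval_prod, map_prod]
    refine Finset.prod_congr rfl fun a ha => ?_
    rw [hXe a ha, eval_pow, map_pow, normChar_apply]; simp
  rw [Finset.sum_congr rfl fun x _ => hsum x]
  have hΨ : normChar K χ ≠ 1 := by
    obtain ⟨t, ht⟩ := MulChar.ne_one_iff.1 hχ
    obtain ⟨y, hy⟩ := FiniteField.norm_surjective (ZMod p) K (t : ZMod p)
    intro h
    apply ht
    rw [← hy, ← normChar_apply, h, MulChar.one_apply]
    rw [isUnit_iff_ne_zero]; rintro rfl
    rw [Algebra.norm_zero] at hy
    exact t.ne_zero hy.symm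
  have hΨd : (normChar K χ) ^ d = 1 := by
    ext u
    rw [MulChar.pow_apply' _ hd0.ne', normChar_apply, ← MulChar.pow_apply' _ hd0.ne', hd, pow_orderOf_eq_one,
      MulChar.one_apply_coe, MulChar.one_apply]
    exact u.isUnit.map _
  have hdq : d ∣ p ^ n - 1 := hdp.trans (by simpa using Nat.sub_dvd_pow_sub_pow p 1 n)
  have := stepanov_char p n hcard f hf0 d μ hfd hμ0 hdq hd0 hco hbig (normChar K χ) hΨ hΨd
  refine this.trans_eq ?_
  congr 1
  push_cast
  rw [Real.sqrt_eq_iff_mul_self_eq (by positivity) (by positivity), ← mul_pow, Real.mul_self_sqrt (by positivity)]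

theorem weil (p : ℕ) [Fact p.Prime] (χ : MulChar (ZMod p) ℂ) (hχ : χ ≠ 1) (s : Finset (ZMod p))
    (e : ZMod p → ℕ) (he : ∀ a ∈ s, 1 ≤ e a) (hco : Nat.Coprime (∑ a ∈ s, e a) (orderOf χ)) :
    ‖∑ x : ZMod p, ∏ a ∈ s, χ (a - x) ^ (e a)‖ ≤ s.card * Real.sqrt p := by
  classical
  have hp := (Fact.out : p.Prime)
  set d := orderOf χ with hd
  have hd0 : 0 < d := by rw [hd]; exact χ.orderOf_pos
  have hd1 : d ≠ 1 := fun h => hχ (orderOf_eq_one_iff.1 h)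
  have hdp : d ∣ p - 1 := by
    have := χ.orderOf_dvd_card_sub_one
    rwa [ZMod.card] at this
  set μ := ∑ a ∈ s, e a with hμ
  have hμ0 : 1 ≤ μ := by
    by_contra h
    have : μ = 0 := by omega
    rw [this, Nat.coprime_zero_left] at hco
    exact hd1 hco
  obtain ⟨b, hb, hbd⟩ : ∃ b ∈ s, ¬ d ∣ e b := by
    by_contra h
    push Not at h
    have h1 : d ∣ μ := Finset.dvd_sum h
    exact hd1 (Nat.Coprime.eq_one_of_dvd hco.symm h1)
  set X : ZMod p → MulChar (ZMod p) ℂ := fun a => χ ^ (e a) with hX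
  have hXb : X b ≠ 1 := fun h => hbd (orderOf_dvd_of_pow_eq_one h)
  have hpR : (0:ℝ) < Real.sqrt p := Real.sqrt_pos.2 (by exact_mod_cast hp.pos)
  have hXe : ∀ a ∈ s, ∀ y, X a y = χ y ^ (e a) := by
    intro a ha y
    rw [hX]; exact MulChar.pow_apply' χ (by have := he a ha; omega) y
  set C0 : ℝ := 2*d*(13*μ+28)+μ with hC0
  have hbig : ∀ n : ℕ, 1 ≤ n → 16*(1+d*μ) ≤ p^n → ‖ps s X n‖ ≤ C0 * Real.sqrt p ^ n := by
    intro n hn hbig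
    letI instK : Fintype (GaloisField p n) := Fintype.ofFinite _
    have hfr : Module.finrank (ZMod p) (GaloisField p n) = n := GaloisField.finrank p (by omega)
    have hcard : Fintype.card (GaloisField p n) = p ^ n := by
      rw [← Nat.card_eq_fintype_card]; exact GaloisField.card p n (by omega)
    exact weil_big p χ hχ s e he hco hμ0 n hn hbig (GaloisField p n) hfr hcard
  obtain ⟨n0, hn0⟩ : ∃ n0, 16*(1+d*μ) < p ^ n0 := ⟨16*(1+d*μ), Nat.lt_pow_self hp.one_lt⟩
  set C1 : ℝ := C0 + ∑ n ∈ Finset.range n0, ‖ps s X n‖ / Real.sqrt p ^ n with hC1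
  have hC0' : 0 ≤ C0 := by rw [hC0]; positivity
  have hall : ∀ n, 1 ≤ n → ‖ps s X n‖ ≤ C1 * Real.sqrt p ^ n := by
    intro n hn
    by_cases h : n0 ≤ n
    · refine (hbig n hn (hn0.le.trans (Nat.pow_le_pow_right hp.pos h))).trans ?_
      gcongr
      rw [hC1]
      have : 0 ≤ ∑ n ∈ Finset.range n0, ‖ps s X n‖ / Real.sqrt p ^ n := Finset.sum_nonneg fun _ _ => by positivity
      linarith
    · have h1 : ‖ps s X n‖ / Real.sqrt p ^ n ≤ ∑ n ∈ Finset.range n0, ‖ps s X n‖ / Real.sqrt p ^ n :=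
        Finset.single_le_sum (f := fun n => ‖ps s X n‖ / Real.sqrt p ^ n) (fun _ _ => by positivity)
          (Finset.mem_range.2 (by omega))
      rw [← div_le_iff₀ (by positivity)]
      linarith
  have hfinal := newton_bound (cf s X) (ps s X) s.card C1 (Real.sqrt p) hpR (cf_zero s X)
    (fun k hk => cf_eq_zero s X b hb hXb k hk) (newton s X) hall
  rw [ps_eq (K := ZMod p) s X 1 (Module.finrank_self _) one_pos] at hfinal
  refine le_trans (le_of_eq ?_) hfinal
  congr 1
  refine Finset.sum_congr rfl fun x _ => Finset.prod_congr rfl fun a ha => ?_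
  rw [hXe a ha]
  congr 1
  simp [Algebra.norm_self]

end WeilS

namespace CS

/-- multiplicative difference -/
noncomputable def Dl {G : Type*} [Add G] (s : G) (F : G → ℂ) : G → ℂ :=
  fun n => F (n + s) * (starRingEnd ℂ) (F n)

noncomputable def dl {G : Type*} [Add G] : List G → (G → ℂ) → (G → ℂ)
  | [], f => f
  | h :: hs, f => Dl h (dl hs f)

lemma Dl_norm_le {G : Type*} [Add G] (s : G) (F : G → ℂ) (hF : ∀ n, ‖F n‖ ≤ 1) (n : G) :
    ‖Dl s F n‖ ≤ 1 := by
  rw [Dl, norm_mul, RCLike.norm_conj]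
  exact mul_le_one₀ (hF _) (norm_nonneg _) (hF _)

lemma dl_norm_le {G : Type*} [Add G] (hs : List G) (F : G → ℂ) (hF : ∀ n, ‖F n‖ ≤ 1) :
    ∀ n, ‖dl hs F n‖ ≤ 1 := by
  induction hs with
  | nil => exact hF
  | cons h hs ih => exact Dl_norm_le h _ ih

lemma Dl_mul {G : Type*} [Add G] (s : G) (F H : G → ℂ) : Dl s (F * H) = Dl s F * Dl s H := by
  funext n; simp [Dl]; ring

noncomputable def av (x : ℤ) (M : ℕ) (F : ℤ → ℂ) : ℂ := (∑ i ∈ Finset.range M, F (x + i)) / M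

/-- iterated averages -/
noncomputable def Dm (X : ℕ) : List ℕ → ((ℤ → ℂ) → ℝ) → (ℤ → ℂ) → ℝ
  | [], Φ, F => Φ F
  | w :: ws, Φ, F => (∑ h ∈ Finset.range X, ∑ h' ∈ Finset.range X,
      Dm X ws Φ (Dl ((w : ℤ) * ((h : ℤ) - h')) F)) / (X : ℝ) ^ 2

lemma av_norm_le (x : ℤ) (M : ℕ) (F : ℤ → ℂ) (hF : ∀ n, ‖F n‖ ≤ 1) : ‖av x M F‖ ≤ 1 := by
  rw [av, norm_div, Complex.norm_natCast]
  apply div_le_one_of_le₀ _ (Nat.cast_nonneg _)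
  refine (norm_sum_le _ _).trans ?_
  refine (Finset.sum_le_sum fun i _ => hF _).trans ?_
  simp

lemma sum_shift (F : ℕ → ℂ) (hF : ∀ n, ‖F n‖ ≤ 1) (M s : ℕ) :
    ‖∑ i ∈ Finset.range M, F (i + s) - ∑ i ∈ Finset.range M, F i‖ ≤ 2 * s := by
  have h1 : ∑ i ∈ Finset.range M, F (i + s) - ∑ i ∈ Finset.range M, F i =
      ∑ i ∈ Finset.range s, F (i + M) - ∑ i ∈ Finset.range s, F i := by
    have e1 := Finset.sum_range_add F s M
    have e2 := Finset.sum_range_add F M s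
    rw [add_comm s M] at e1
    rw [e1] at e2
    have e3 : ∑ i ∈ Finset.range M, F (i + s) = ∑ i ∈ Finset.range M, F (s + i) :=
      Finset.sum_congr rfl fun i _ => by rw [add_comm]
    have e4 : ∑ i ∈ Finset.range s, F (i + M) = ∑ i ∈ Finset.range s, F (M + i) :=
      Finset.sum_congr rfl fun i _ => by rw [add_comm]
    rw [e3, e4]
    linear_combination e2
  rw [h1]
  have h2 : ∀ G : ℕ → ℂ, (∀ n, ‖G n‖ ≤ 1) → ‖∑ i ∈ Finset.range s, G i‖ ≤ s := by
    intro G hG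
    refine (norm_sum_le _ _).trans ?_
    refine (Finset.sum_le_sum fun i _ => hG _).trans ?_
    simp
  refine (norm_sub_le _ _).trans ?_
  have := h2 (fun i => F (i + M)) (fun n => hF _)
  have := h2 F hF
  linarith

lemma av_shift (x : ℤ) (M : ℕ) (F : ℤ → ℂ) (hF : ∀ n, ‖F n‖ ≤ 1) (s : ℕ) :
    ‖av x M (fun n => F (n + s)) - av x M F‖ ≤ 2 * s / M := by
  rw [av, av, ← sub_div, norm_div, Complex.norm_natCast]
  gcongr
  have := sum_shift (fun i => F (x + i)) (fun n => hF _) M s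
  refine le_trans (le_of_eq ?_) this
  congr 2
  refine Finset.sum_congr rfl fun i _ => ?_
  push_cast; congr 1; ring

set_option maxHeartbeats 1000000 in
lemma vdc (x : ℤ) (M X w : ℕ) (hM : 0 < M) (hX : 0 < X) (G H : ℤ → ℂ) (hG : ∀ n, ‖G n‖ ≤ 1) (hH : ∀ n, ‖H n‖ ≤ 1)
    (hper : ∀ n, G (n + w) = G n) :
    ‖av x M (G * H)‖ ^ 2 ≤ (∑ h ∈ Finset.range X, ∑ h' ∈ Finset.range X,
      ‖av x M (Dl ((w : ℤ) * ((h : ℤ) - h')) H)‖) / (X : ℝ) ^ 2 + 3 * (2 * w * X / M) := by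
  have hX' : (0:ℝ) < X := by exact_mod_cast hX
  have hM' : (0:ℝ) < M := by exact_mod_cast hM
  have hXc : (X:ℂ) ≠ 0 := by exact_mod_cast hX.ne'
  have hMc : (M:ℂ) ≠ 0 := by exact_mod_cast hM.ne'
  set δ : ℝ := 2 * w * X / M with hδ
  have hδ0 : 0 ≤ δ := by positivity
  have hGh : ∀ h : ℕ, ∀ n, G (n + (w * h : ℕ)) = G n := by
    intro h
    induction h with
    | zero => simp
    | succ h ih => intro n; rw [← ih n, ← hper (n + (w*h : ℕ))]; congr 1; push_cast; ring
  set e : ℤ → ℂ := fun n => (∑ h ∈ Finset.range X, H (n + (w * h : ℕ))) / X with he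
  have he1 : ∀ n, ‖e n‖ ≤ 1 := by
    intro n
    rw [he, norm_div, Complex.norm_natCast]
    apply div_le_one_of_le₀ _ (Nat.cast_nonneg _)
    refine (norm_sum_le _ _).trans ?_
    refine (Finset.sum_le_sum fun i _ => hH _).trans ?_
    simp
  have hs : ∀ h ∈ Finset.range X, 2 * ((w * h : ℕ) : ℝ) / M ≤ δ := by
    intro h hh
    rw [Finset.mem_range] at hh
    rw [hδ]; push_cast
    have : (h:ℝ) ≤ X := by exact_mod_cast hh.le
    rw [← mul_assoc]
    gcongr
  -- step 1
  have h1 : ‖av x M (G * e) - av x M (G * H)‖ ≤ δ := by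
    have h2 : av x M (G * e) - av x M (G * H) =
        (∑ h ∈ Finset.range X, (av x M (fun n => (G * H) (n + (w * h : ℕ))) - av x M (G * H))) / X := by
      rw [Finset.sum_sub_distrib, Finset.sum_const, Finset.card_range, nsmul_eq_mul, sub_div, mul_div_cancel_left₀ _ hXc]
      congr 1
      simp only [av, he, Pi.mul_apply, hGh]
      rw [← Finset.sum_div, Finset.sum_comm, div_div, mul_comm (M:ℂ), ← div_div]
      congr 1
      rw [Finset.sum_div]
      refine Finset.sum_congr rfl fun i _ => ?_
      rw [← Finset.mul_sum, mul_div_assoc]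
    rw [h2, norm_div, Complex.norm_natCast, div_le_iff₀ hX']
    refine (norm_sum_le _ _).trans ?_
    have : ∀ h ∈ Finset.range X, ‖av x M (fun n => (G * H) (n + (w * h : ℕ))) - av x M (G * H)‖ ≤ δ := by
      intro h hh
      refine (av_shift x M (G * H) (fun n => ?_) (w * h)).trans (hs h hh)
      rw [Pi.mul_apply, norm_mul]; exact mul_le_one₀ (hG _) (norm_nonneg _) (hH _)
    refine (Finset.sum_le_sum this).trans ?_
    simp [mul_comm]
  set b : ℝ := (∑ i ∈ Finset.range M, ‖e (x + i)‖) / M with hb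
  have hb0 : 0 ≤ b := by positivity
  have hb1 : b ≤ 1 := by
    rw [hb]
    apply div_le_one_of_le₀ _ (Nat.cast_nonneg _)
    refine (Finset.sum_le_sum fun i _ => he1 _).trans ?_
    simp
  have h2 : ‖av x M (G * e)‖ ≤ b := by
    rw [av, norm_div, Complex.norm_natCast, hb]
    gcongr
    refine (norm_sum_le _ _).trans (Finset.sum_le_sum fun i _ => ?_)
    rw [Pi.mul_apply, norm_mul]
    exact mul_le_of_le_one_left (norm_nonneg _) (hG _)
  set a := ‖av x M (G * H)‖ with ha
  have ha1 : a ≤ 1 := av_norm_le _ _ _ fun n => by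
    rw [Pi.mul_apply, norm_mul]; exact mul_le_one₀ (hG _) (norm_nonneg _) (hH _)
  have ha0 : 0 ≤ a := norm_nonneg _
  have hab : a ≤ b + δ := by
    have := norm_sub_norm_le (av x M (G * H)) (av x M (G * e))
    rw [norm_sub_rev] at this
    linarith
  have hab2 : a ^ 2 ≤ b ^ 2 + 2 * δ := by
    by_cases h : a ≤ b
    · have := pow_le_pow_left₀ ha0 h 2; linarith
    · nlinarith
  -- step 2
  have hb2 : b ^ 2 ≤ (∑ i ∈ Finset.range M, ‖e (x + i)‖ ^ 2) / M := by
    rw [hb, div_pow, div_le_div_iff₀ (by positivity) hM']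
    have := sq_sum_le_card_mul_sum_sq (s := Finset.range M) (f := fun i : ℕ => ‖e (x + i)‖)
    rw [Finset.card_range] at this
    calc (∑ i ∈ Finset.range M, ‖e (x + i)‖) ^ 2 * M ≤ (M * ∑ i ∈ Finset.range M, ‖e (x + i)‖ ^ 2) * M := by gcongr
      _ = _ := by ring
  have h3 : (((∑ i ∈ Finset.range M, ‖e (x + i)‖ ^ 2) / M : ℝ) : ℂ) =
      (∑ h ∈ Finset.range X, ∑ h' ∈ Finset.range X,
        av x M (fun n => H (n + (w * h : ℕ)) * (starRingEnd ℂ) (H (n + (w * h' : ℕ))))) / (X : ℂ) ^ 2 := by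
    push_cast
    simp only [av]
    simp_rw [← Finset.sum_div]
    rw [div_div, mul_comm (M:ℂ), ← div_div]
    congr 1
    have h4 : ∀ i : ℕ, ((‖e (x + i)‖ : ℂ)) ^ 2 = (∑ h ∈ Finset.range X, ∑ h' ∈ Finset.range X,
        H (x + i + (w * h : ℕ)) * (starRingEnd ℂ) (H (x + i + (w * h' : ℕ)))) / (X:ℂ)^2 := by
      intro i
      rw [← Complex.mul_conj', he]
      simp only [map_div₀, map_sum, Complex.conj_natCast]
      rw [div_mul_div_comm, Finset.sum_mul_sum, sq]
    rw [Finset.sum_congr rfl fun i _ => h4 i, ← Finset.sum_div]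
    congr 1
    rw [Finset.sum_comm]
    refine Finset.sum_congr rfl fun h _ => ?_
    rw [Finset.sum_comm]
    push_cast
    rfl
  have h5 : (∑ i ∈ Finset.range M, ‖e (x + i)‖ ^ 2) / M ≤ (∑ h ∈ Finset.range X, ∑ h' ∈ Finset.range X,
      (‖av x M (Dl ((w : ℤ) * ((h : ℤ) - h')) H)‖ + δ)) / (X : ℝ) ^ 2 := by
    have hn : (∑ i ∈ Finset.range M, ‖e (x + i)‖ ^ 2) / M = ‖(((∑ i ∈ Finset.range M, ‖e (x + i)‖ ^ 2) / M : ℝ) : ℂ)‖ := by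
      rw [Complex.norm_real, Real.norm_of_nonneg (by positivity)]
    rw [hn, h3, norm_div, norm_pow, Complex.norm_natCast]
    gcongr
    refine (norm_sum_le _ _).trans (Finset.sum_le_sum fun h hh => ?_)
    refine (norm_sum_le _ _).trans (Finset.sum_le_sum fun h' hh' => ?_)
    have h6 := av_shift x M (Dl ((w : ℤ) * ((h : ℤ) - h')) H) (Dl_norm_le _ _ hH) (w * h')
    have h7 : (fun n => H (n + (w * h : ℕ)) * (starRingEnd ℂ) (H (n + (w * h' : ℕ)))) =
        fun n => (Dl ((w : ℤ) * ((h : ℤ) - h')) H) (n + (w * h' : ℕ)) := by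
      funext n
      have e1 : n + ((w * h : ℕ) : ℤ) = n + ((w * h' : ℕ) : ℤ) + (w : ℤ) * ((h : ℤ) - h') := by push_cast; ring
      rw [Dl, e1]
    rw [h7]
    have h8 := norm_sub_norm_le (av x M fun n => (Dl ((w : ℤ) * ((h : ℤ) - h')) H) (n + (w * h' : ℕ)))
      (av x M (Dl ((w : ℤ) * ((h : ℤ) - h')) H))
    have h9 := hs h' hh'
    linarith
  have h6 : (∑ h ∈ Finset.range X, ∑ h' ∈ Finset.range X,
      (‖av x M (Dl ((w : ℤ) * ((h : ℤ) - h')) H)‖ + δ)) / (X : ℝ) ^ 2 =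
      (∑ h ∈ Finset.range X, ∑ h' ∈ Finset.range X,
      ‖av x M (Dl ((w : ℤ) * ((h : ℤ) - h')) H)‖) / (X : ℝ) ^ 2 + δ := by
    simp only [Finset.sum_add_distrib, Finset.sum_const, Finset.card_range, nsmul_eq_mul]
    field_simp
  linarith

end CS

namespace CS
open Polynomial

noncomputable def cz {m : ℕ} (χ : DirichletCharacter ℂ m) : ℤ → ℂ := fun n => χ (n : ZMod m)

lemma cz_norm_le {m : ℕ} (χ : DirichletCharacter ℂ m) (n : ℤ) : ‖cz χ n‖ ≤ 1 := χ.norm_le_one _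

lemma comp_expand (f : ℤ[X]) (s : ℤ) :
    ∃ R : ℤ[X], f.comp (X + C s) = f + C s * derivative f + C s * C s * R := by
  obtain ⟨k, hk⟩ := Polynomial.binomExpansion (f.map (C : ℤ →+* ℤ[X])) X (C s)
  refine ⟨k, ?_⟩
  have h1 : ∀ g : ℤ[X], ∀ y : ℤ[X], (g.map (C : ℤ →+* ℤ[X])).eval y = g.comp y := by
    intro g y; rw [eval_map, comp]
  rw [h1, h1, derivative_map, h1, comp_X, comp_X] at hk
  rw [hk]; ring

lemma cube_exists (s : List ℤ) : ∃ N D Q : ℤ[X], N = D + C s.prod * Q ∧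
    (∀ (m : ℕ) (χ : DirichletCharacter ℂ m) (n : ℤ), dl s (cz χ) n =
      χ ((N.eval n : ℤ) : ZMod m) * (starRingEnd ℂ) (χ ((D.eval n : ℤ) : ZMod m))) ∧
    (s = [] → N = X ∧ D = 1 ∧ Q = X - 1) ∧
    ∀ (d : ℕ) (K : ℕ), s.length = K + 1 → (∀ x ∈ s, (d : ℤ) ∣ x) →
      D.map (Int.castRingHom (ZMod d)) = X ^ (2 ^ K) ∧
      Q.map (Int.castRingHom (ZMod d)) = C ((-1) ^ K * (K.factorial : ZMod d)) * X ^ (2 ^ K - (K + 1)) := by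
  induction s with
  | nil =>
    refine ⟨X, 1, X - 1, by simp, ?_, by simp, ?_⟩
    · intro m χ n; simp [dl, cz]
    · intro d K h; simp at h
  | cons a s ih =>
    obtain ⟨N, D, Q, h1, h2, h3, h4⟩ := ih
    obtain ⟨R1, hR1⟩ := comp_expand Q a
    obtain ⟨R2, hR2⟩ := comp_expand D a
    have hNc : N.comp (X + C a) = D.comp (X + C a) + C s.prod * Q.comp (X + C a) := by
      conv_lhs => rw [h1, add_comp, mul_comp, C_comp]
    refine ⟨N.comp (X + C a) * D, D.comp (X + C a) * N,
      derivative Q * D - derivative D * Q + C a * (R1 * D - R2 * Q), ?_, ?_, by simp, ?_⟩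
    · rw [hNc, hR1, hR2, List.prod_cons, C_mul]
      conv_rhs => rw [show N = D + C s.prod * Q from h1] 
      ring
    · intro m χ n
      rw [dl, Dl, h2, h2]
      simp only [eval_mul, eval_comp, eval_add, eval_X, eval_C, Int.cast_mul, map_mul, Complex.conj_conj]
      ring
    · intro d K hK hd
      have ha : (a : ZMod d) = 0 := by
        rw [ZMod.intCast_zmod_eq_zero_iff_dvd]; exact hd a (by simp)
      have hCa : (C a : ℤ[X]).map (Int.castRingHom (ZMod d)) = 0 := by
        rw [map_C]; simp [ha]
      have hDc : (D.comp (X + C a)).map (Int.castRingHom (ZMod d)) = D.map (Int.castRingHom (ZMod d)) := by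
        rw [hR2]; simp only [Polynomial.map_add, Polynomial.map_mul, hCa, zero_mul, add_zero]
      have hlen : s.length = K := by simpa using hK
      rcases K with _ | K
      · rw [List.length_eq_zero_iff] at hlen
        obtain ⟨e1, e2, e3⟩ := h3 hlen
        constructor
        · rw [Polynomial.map_mul, hDc, e1, e2]; simp
        · rw [e2, e3]; simp only [Polynomial.map_add, Polynomial.map_sub, Polynomial.map_mul, hCa, zero_mul, add_zero]; simp
      · obtain ⟨e1, e2⟩ := h4 d K hlen (fun x hx => hd x (List.mem_cons_of_mem _ hx))
        have hS : (s.prod : ZMod d) = 0 := by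
          rw [ZMod.intCast_zmod_eq_zero_iff_dvd]
          obtain ⟨x, hx⟩ : ∃ x, x ∈ s := List.exists_mem_of_ne_nil s (by rintro rfl; simp at hlen)
          exact (hd x (List.mem_cons_of_mem _ hx)).trans (List.dvd_prod hx)
        have hN : N.map (Int.castRingHom (ZMod d)) = D.map (Int.castRingHom (ZMod d)) := by
          have hC0 : (C s.prod : ℤ[X]).map (Int.castRingHom (ZMod d)) = 0 := by
            rw [map_C, eq_intCast, hS, C_0]
          rw [h1]; simp only [Polynomial.map_add, Polynomial.map_mul, hC0, zero_mul, add_zero]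
        constructor
        · rw [Polynomial.map_mul, hDc, hN, e1, ← pow_add, pow_succ 2 K, mul_two]
        · rw [Polynomial.map_add, Polynomial.map_mul, hCa, zero_mul, add_zero, Polynomial.map_sub, Polynomial.map_mul,
            Polynomial.map_mul, ← derivative_map, ← derivative_map, e1, e2]
          have hK2 : K + 1 ≤ 2 ^ K := Nat.lt_two_pow_self
          obtain ⟨r, hr⟩ := Nat.exists_eq_add_of_le hK2
          rw [derivative_C_mul, derivative_X_pow, derivative_X_pow]
          have e3 : 2 ^ K - (K + 1) = r := by omega
          have e4 : 2 ^ (K + 1) - (K + 1 + 1) = r + (2 ^ K - 1) := by rw [pow_succ]; omega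
          rw [e3, e4]
          have e5 : (X : (ZMod d)[X]) ^ (2 ^ K) = X * X ^ (2 ^ K - 1) := by
            rw [← pow_succ']; congr 1; omega
          have e6 : (C ((r : ℕ) : ZMod d)) * X ^ (r - 1) * X = C ((r : ℕ) : ZMod d) * X ^ r := by
            rcases r with _ | r
            · simp
            · rw [mul_assoc, ← pow_succ]; simp
          have e7 : ((2 ^ K : ℕ) : ZMod d) = (K : ZMod d) + 1 + r := by rw [hr]; push_cast; ring
          rw [e5, e7, Nat.factorial_succ, pow_succ, pow_add]
          push_cast
          simp only [C_mul, C_add, C_neg, C_1] at e6 ⊢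
          linear_combination (C ((-1) ^ K) * C (K.factorial : ZMod d)) * X ^ (2 ^ K - 1) * e6

lemma dl_periodic {m : ℕ} [NeZero m] (χ : DirichletCharacter ℂ m) (s : List ℤ) (w : ℤ) (h1 : (m : ℤ) ∣ s.prod * w)
    (h2 : ∀ p : ℕ, p.Prime → p ∣ m → (p : ℤ) ∣ w) (n : ℤ) :
    dl s (cz χ) (n + w) = dl s (cz χ) n := by
  obtain ⟨N, D, Q, hN, hdl, -, -⟩ := cube_exists s
  rw [hdl, hdl]
  have hunit : ∀ f : ℤ[X], IsUnit ((f.eval (n + w) : ℤ) : ZMod m) ↔ IsUnit ((f.eval n : ℤ) : ZMod m) := by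
    have hu : ∀ z : ℤ, IsUnit (z : ZMod m) ↔ ∀ p : ℕ, p.Prime → p ∣ m → ¬ (p : ℤ) ∣ z := by
      intro z
      rw [ZMod.coe_int_isUnit_iff_isCoprime, Int.isCoprime_iff_gcd_eq_one]
      constructor
      · intro h p hp hpm hpz
        have : p ∣ Int.gcd m z := Nat.dvd_gcd (by simpa using hpm) (Int.natCast_dvd.1 hpz)
        rw [h] at this
        exact hp.one_lt.ne' (Nat.dvd_one.1 this)
      · intro h
        by_contra hne
        obtain ⟨p, hp, hpd⟩ := Nat.exists_prime_and_dvd hne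
        have h5 : p ∣ m := by simpa using hpd.trans (Nat.gcd_dvd_left _ _)
        exact h p hp h5 (Int.natCast_dvd.2 (hpd.trans (Nat.gcd_dvd_right _ _)))
    intro f
    rw [hu, hu]
    refine forall_congr' fun p => forall_congr' fun hp => forall_congr' fun hpm => not_congr ?_
    have h3 : (p : ℤ) ∣ f.eval (n + w) - f.eval n := by
      have := Polynomial.sub_dvd_eval_sub (n + w) n f
      rw [add_sub_cancel_left] at this
      exact (h2 p hp hpm).trans this
    exact (dvd_iff_dvd_of_dvd_sub h3)
  by_cases hND : IsUnit ((N.eval n : ℤ) : ZMod m) ∧ IsUnit ((D.eval n : ℤ) : ZMod m)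
  · obtain ⟨hNu, hDu⟩ := hND
    have hDu' := (hunit D).2 hDu
    have key : ((N.eval (n+w) : ℤ) : ZMod m) * ((D.eval n : ℤ) : ZMod m) =
        ((N.eval n : ℤ) : ZMod m) * ((D.eval (n+w) : ℤ) : ZMod m) := by
      rw [← Int.cast_mul, ← Int.cast_mul, ← sub_eq_zero, ← Int.cast_sub, ZMod.intCast_zmod_eq_zero_iff_dvd]
      have e1 : N.eval (n+w) * D.eval n - N.eval n * D.eval (n+w) =
          s.prod * (Q.eval (n+w) * D.eval n - Q.eval n * D.eval (n + w)) := by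
        rw [hN]; simp only [eval_add, eval_mul, eval_C]; ring
      rw [e1]
      refine h1.trans (mul_dvd_mul_left _ ?_)
      have a1 := Polynomial.sub_dvd_eval_sub (n + w) n Q
      have a2 := Polynomial.sub_dvd_eval_sub (n + w) n D
      rw [add_sub_cancel_left] at a1 a2
      have : Q.eval (n+w) * D.eval n - Q.eval n * D.eval (n + w) =
        (Q.eval (n+w) - Q.eval n) * D.eval n - Q.eval n * (D.eval (n + w) - D.eval n) := by ring
      rw [this]
      exact dvd_sub (a1.mul_right _) (a2.mul_left _)
    have hn1 : ∀ u : ZMod m, IsUnit u → χ u * (starRingEnd ℂ) (χ u) = 1 := by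
      intro u hu
      rw [Complex.mul_conj, Complex.normSq_eq_norm_sq]
      have : ‖χ u‖ = 1 := by
        obtain ⟨v, rfl⟩ := hu; exact χ.unit_norm_eq_one v
      rw [this]; simp
    have k2 := congrArg χ key
    rw [map_mul, map_mul] at k2
    have := hn1 _ hDu
    have := hn1 _ hDu'
    generalize χ ((N.eval (n+w) : ℤ) : ZMod m) = A at *
    generalize χ ((N.eval n : ℤ) : ZMod m) = B at *
    generalize χ ((D.eval (n+w) : ℤ) : ZMod m) = E at *
    generalize χ ((D.eval n : ℤ) : ZMod m) = F at *
    rename_i h5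
    linear_combination (starRingEnd ℂ) E * (starRingEnd ℂ) F * k2 - A * (starRingEnd ℂ) E * this + B * (starRingEnd ℂ) F * h5
  · rw [not_and_or] at hND
    rcases hND with h | h
    · rw [MulChar.map_nonunit χ h, MulChar.map_nonunit χ (mt (hunit N).1 h)]; simp
    · rw [MulChar.map_nonunit χ h, MulChar.map_nonunit χ (mt (hunit D).1 h)]; simp

end CS

namespace CS

lemma nat_split (m : ℕ) (u : ℕ) : m ≠ 0 → ∃ a b : ℕ, a * b = m ∧ Nat.Coprime a b ∧ Nat.Coprime a u ∧
    ∀ p : ℕ, p.Prime → p ∣ b → p ∣ u := by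
  induction m using Nat.recOnPrimeCoprime with
  | zero => intro h; exact absurd rfl h
  | prime_pow p n hp =>
    intro _
    by_cases h : p ∣ u
    · refine ⟨1, p ^ n, by simp, by simp, by simp, ?_⟩
      intro r hr hrp
      rwa [(Nat.prime_dvd_prime_iff_eq hr hp).1 (hr.dvd_of_dvd_pow hrp)]
    · refine ⟨p ^ n, 1, by simp, by simp, ?_, ?_⟩
      · exact Nat.Coprime.pow_left _ ((Nat.Prime.coprime_iff_not_dvd hp).2 h)
      · intro r hr h1; exact absurd (Nat.dvd_one.1 h1) hr.one_lt.ne'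
  | coprime a b ha hb hab iha ihb =>
    intro _
    obtain ⟨a1, a2, e1, c1, d1, p1⟩ := iha (by omega)
    obtain ⟨b1, b2, e2, c2, d2, p2⟩ := ihb (by omega)
    have hab' : Nat.Coprime (a1 * a2) (b1 * b2) := by rw [e1, e2]; exact hab
    rw [Nat.coprime_mul_iff_left, Nat.coprime_mul_iff_right, Nat.coprime_mul_iff_right] at hab'
    refine ⟨a1 * b1, a2 * b2, by rw [← e1, ← e2]; ring, ?_, Nat.Coprime.mul_left d1 d2, ?_⟩
    · rw [Nat.coprime_mul_iff_left, Nat.coprime_mul_iff_right, Nat.coprime_mul_iff_right]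
      exact ⟨⟨c1, hab'.1.2⟩, hab'.2.1.symm, c2⟩
    · intro p hp h
      rcases hp.dvd_mul.1 h with h | h
      · exact p1 p hp h
      · exact p2 p hp h

/-- the component at the first factor -/
noncomputable def crtFst {a b : ℕ} (h : Nat.Coprime a b) (χ : DirichletCharacter ℂ (a * b)) :
    DirichletCharacter ℂ a where
  toFun x := χ ((ZMod.chineseRemainder h).symm (x, 1))
  map_one' := by
    rw [show ((1 : ZMod a), (1 : ZMod b)) = 1 from rfl, map_one, map_one]
  map_mul' x y := by
    rw [← map_mul, ← map_mul]; congr 2; simp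
  map_nonunit' x hx := by
    apply MulChar.map_nonunit
    intro hu
    apply hx
    have := hu.map (ZMod.chineseRemainder h)
    rw [RingEquiv.apply_symm_apply, Prod.isUnit_iff] at this
    exact this.1

noncomputable def crtSnd {a b : ℕ} (h : Nat.Coprime a b) (χ : DirichletCharacter ℂ (a * b)) :
    DirichletCharacter ℂ b where
  toFun x := χ ((ZMod.chineseRemainder h).symm (1, x))
  map_one' := by
    rw [show ((1 : ZMod a), (1 : ZMod b)) = 1 from rfl, map_one, map_one]
  map_mul' x y := by
    rw [← map_mul, ← map_mul]; congr 2; simp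
  map_nonunit' x hx := by
    apply MulChar.map_nonunit
    intro hu
    apply hx
    have := hu.map (ZMod.chineseRemainder h)
    rw [RingEquiv.apply_symm_apply, Prod.isUnit_iff] at this
    exact this.2

lemma crt_int {a b : ℕ} (h : Nat.Coprime a b) (χ : DirichletCharacter ℂ (a * b)) :
    cz χ = cz (crtFst h χ) * cz (crtSnd h χ) := by
  funext n
  simp only [cz, Pi.mul_apply]
  change _ = χ ((ZMod.chineseRemainder h).symm ((n : ZMod a), 1)) * χ ((ZMod.chineseRemainder h).symm (1, (n : ZMod b)))
  rw [← map_mul, ← map_mul]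
  congr 1
  rw [RingEquiv.eq_symm_apply]
  simp only [map_intCast, Prod.mk_mul_mk, one_mul, mul_one]
  rfl

lemma dl_mul {G : Type*} [Add G] (s : List G) (F H : G → ℂ) : dl s (F * H) = dl s F * dl s H := by
  induction s with
  | nil => rfl
  | cons a s ih => simp only [dl]; rw [ih, Dl_mul]

lemma pow_sub_le {x y : ℝ} (hx : 0 ≤ x) (hxy : x ≤ y) (hy : y ≤ 1) (n : ℕ) : y ^ n ≤ x ^ n + n * (y - x) := by
  induction n with
  | zero => simp
  | succ n ih =>
    have h1 : x ^ n ≤ y ^ n := pow_le_pow_left₀ hx hxy n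
    have h2 : y ^ n ≤ 1 := pow_le_one₀ (hx.trans hxy) hy
    have h3 : 0 ≤ x ^ n := by positivity
    rw [pow_succ, pow_succ]
    push_cast
    have h4 : x * (y ^ n) ≤ x * (x ^ n + n * (y - x)) := by gcongr
    have h5 : x * (n * (y - x)) ≤ 1 * (n * (y - x)) := by
      apply mul_le_mul_of_nonneg_right (hxy.trans hy)
      have : 0 ≤ y - x := by linarith
      positivity
    have h6 : y ^ n * (y - x) ≤ 1 * (y - x) := by
      apply mul_le_mul_of_nonneg_right h2; linarith
    nlinarith

lemma mean_pow2 (X : ℕ) (hX : 0 < X) (f : ℕ → ℕ → ℝ) (hf : ∀ i j, 0 ≤ f i j) (n : ℕ) :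
    ((∑ i ∈ Finset.range X, ∑ j ∈ Finset.range X, f i j) / (X:ℝ)^2) ^ n ≤
      (∑ i ∈ Finset.range X, ∑ j ∈ Finset.range X, f i j ^ n) / (X:ℝ)^2 := by
  have hX' : (0:ℝ) < X := by exact_mod_cast hX
  have := Real.pow_arith_mean_le_arith_mean_pow (Finset.range X ×ˢ Finset.range X) (fun _ => 1 / (X:ℝ)^2)
    (fun p => f p.1 p.2) (fun _ _ => by positivity) (by simp; field_simp) (fun _ _ => hf _ _) n
  rw [← Finset.mul_sum, ← Finset.mul_sum, Finset.sum_product, Finset.sum_product] at this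
  calc _ = _ := by rw [div_eq_mul_one_div, mul_comm]
    _ ≤ _ := this
    _ = _ := by rw [mul_comm, ← div_eq_mul_one_div]

set_option maxHeartbeats 1000000 in
lemma elim (x : ℤ) (M X B : ℕ) (hM : 0 < M) (hX : 0 < X) (ts ws : List ℕ) (hts : List.Forall₂ (fun w t => w ∣ t) ws ts) :
    (∀ t ∈ ts, t ≤ B) → ∀ (m : ℕ) [NeZero m] (ψ : DirichletCharacter ℂ m) (s : List ℤ),
    (∀ p : ℕ, p.Prime → p ∣ m → p ∣ ws.prod) → ((m:ℤ) ∣ s.prod * (ws.prod : ℕ)) → ∀ F : ℤ → ℂ, (∀ n, ‖F n‖ ≤ 1) →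
    ‖av x M (dl s (cz ψ) * F)‖ ^ (2 ^ ts.length) ≤ Dm X ts (fun F => ‖av x M F‖) F +
      3 * 2 ^ ts.length * (2 * B * X / M) := by
  have hX' : (0:ℝ) < X := by exact_mod_cast hX
  have hM' : (0:ℝ) < M := by exact_mod_cast hM
  induction hts with
  | nil =>
    intro _ m _ ψ s h1 _ F hF
    have hm : m = 1 := by
      by_contra hne
      obtain ⟨p, hp, hpm⟩ := Nat.exists_prime_and_dvd hne
      have := h1 p hp hpm
      simp at this
      exact hp.one_lt.ne' this
    subst hm
    have : dl s (cz ψ) = 1 := by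
      induction s with
      | nil => funext n; simp only [dl, cz]; rw [Subsingleton.elim ((n : ℤ) : ZMod 1) 1, map_one]; rfl
      | cons a s ih => rw [dl, ih (by simp)]; funext n; simp [Dl]
    rw [this, one_mul]
    simp [Dm]
    positivity
  | @cons w t ws ts hwt hall ih =>
    intro hB m _ ψ s h1 h2 F hF
    obtain ⟨a, b, hab, hco, hau, hbu⟩ := nat_split m ws.prod (NeZero.ne m)
    subst hab
    have ha0 : a ≠ 0 := fun h => NeZero.ne (a * b) (by simp [h])
    have hb0 : b ≠ 0 := fun h => NeZero.ne (a * b) (by simp [h])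
    have : NeZero a := ⟨ha0⟩
    have : NeZero b := ⟨hb0⟩
    rw [crt_int hco ψ, dl_mul]
    set ψ1 := crtFst hco ψ
    set ψ2 := crtSnd hco ψ
    have hper : ∀ n, dl s (cz ψ1) (n + (t:ℕ)) = dl s (cz ψ1) n := by
      intro n
      apply dl_periodic
      · have h3 : (a:ℤ) ∣ s.prod * w * (ws.prod : ℕ) := by
          refine dvd_trans ?_ (h2.trans (dvd_of_eq ?_))
          · push_cast; exact dvd_mul_right _ _
          · rw [List.prod_cons]; push_cast; ring
        have h4 : (a:ℤ) ∣ s.prod * w := by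
          refine IsCoprime.dvd_of_dvd_mul_right ?_ h3
          exact Nat.isCoprime_iff_coprime.2 hau
        exact h4.trans (mul_dvd_mul_left _ (by exact_mod_cast hwt))
      · intro p hp hpa
        have := h1 p hp (hpa.trans (dvd_mul_right _ _))
        rw [List.prod_cons, hp.dvd_mul] at this
        rcases this with h | h
        · exact_mod_cast h.trans hwt
        · exfalso
          have := Nat.dvd_gcd hpa h
          rw [hau] at this
          exact hp.one_lt.ne' (Nat.dvd_one.1 this)
    have hH : ∀ n, ‖(dl s (cz ψ2) * F) n‖ ≤ 1 := by
      intro n; rw [Pi.mul_apply, norm_mul]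
      exact mul_le_one₀ (dl_norm_le _ _ (cz_norm_le _) _) (norm_nonneg _) (hF _)
    have hv := vdc x M X t hM hX (dl s (cz ψ1)) (dl s (cz ψ2) * F) (dl_norm_le _ _ (cz_norm_le _)) hH hper
    rw [mul_assoc]
    set A := ‖av x M (dl s (cz ψ1) * (dl s (cz ψ2) * F))‖ with hA
    have hA0 : 0 ≤ A := norm_nonneg _
    have hA1 : A ≤ 1 := av_norm_le _ _ _ fun n => by
      rw [Pi.mul_apply, norm_mul]; exact mul_le_one₀ (dl_norm_le _ _ (cz_norm_le _) _) (norm_nonneg _) (hH _)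
    set f : ℕ → ℕ → ℝ := fun h h' => ‖av x M (Dl ((t : ℤ) * ((h : ℤ) - h')) (dl s (cz ψ2) * F))‖ with hf
    set E := (∑ h ∈ Finset.range X, ∑ h' ∈ Finset.range X, f h h') / (X : ℝ) ^ 2 with hE
    have hf0 : ∀ h h', 0 ≤ f h h' := fun _ _ => norm_nonneg _
    clear_value f
    have hE0 : 0 ≤ E := div_nonneg (Finset.sum_nonneg fun i _ => Finset.sum_nonneg fun j _ => hf0 i j) (sq_nonneg _)
    have hδ : 2 * (t:ℝ) * X / M ≤ 2 * B * X / M := by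
      have : (t:ℝ) ≤ B := by exact_mod_cast hB t (by simp)
      gcongr
    set δ := 2 * (B:ℝ) * X / M with hδd
    have hδ0 : 0 ≤ δ := by positivity
    have hstep : ∀ h h' : ℕ, f h h' ^ (2 ^ ts.length) ≤ Dm X ts (fun F => ‖av x M F‖) (Dl ((t : ℤ) * ((h : ℤ) - h')) F) +
      3 * 2 ^ ts.length * δ := by
      intro h h'
      have := ih (fun t ht => hB t (List.mem_cons_of_mem _ ht)) b ψ2 (((t : ℤ) * ((h : ℤ) - h')) :: s) hbu ?_
        (Dl ((t : ℤ) * ((h : ℤ) - h')) F) (Dl_norm_le _ _ hF)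
      · rw [hf]; simp only; rw [Dl_mul]; exact this
      · rw [List.prod_cons]
        have h3 : (b:ℤ) ∣ s.prod * ((w :: ws).prod : ℕ) := by
          refine dvd_trans ?_ h2
          push_cast; exact dvd_mul_left _ _
        rw [List.prod_cons] at h3
        obtain ⟨c, hc⟩ := hwt
        refine h3.trans ⟨c * (h - h'), ?_⟩
        rw [hc]; push_cast; ring
    have hmain : A ^ (2 ^ (t :: ts).length) ≤ E ^ (2 ^ ts.length) + 2 ^ ts.length * (3 * δ) := by
      rw [List.length_cons, pow_succ', pow_mul]
      have hA2 : A ^ 2 ≤ 1 := pow_le_one₀ hA0 hA1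
      by_cases hc : A ^ 2 ≤ E
      · have := pow_le_pow_left₀ (by positivity) hc (2 ^ ts.length)
        have : 0 ≤ 2 ^ ts.length * (3 * δ) := by positivity
        linarith
      · have h3 := pow_sub_le hE0 (not_le.1 hc).le hA2 (2 ^ ts.length)
        have h4 : (((2 ^ ts.length : ℕ) : ℝ)) * (A ^ 2 - E) ≤ (2 ^ ts.length : ℕ) * (3 * δ) := by
          apply mul_le_mul_of_nonneg_left _ (Nat.cast_nonneg _); linarith
        push_cast at h4 h3
        linarith
    have hmp := mean_pow2 X hX f hf0 (2 ^ ts.length)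
    have hsum : (∑ i ∈ Finset.range X, ∑ j ∈ Finset.range X, f i j ^ (2 ^ ts.length)) / (X:ℝ)^2 ≤
      Dm X (t :: ts) (fun F => ‖av x M F‖) F + 3 * 2 ^ ts.length * δ := by
      rw [Dm, div_add' _ _ _ (by positivity)]
      gcongr
      refine (Finset.sum_le_sum fun i _ => Finset.sum_le_sum fun j _ => hstep i j).trans (le_of_eq ?_)
      simp only [Finset.sum_add_distrib, Finset.sum_const, Finset.card_range, nsmul_eq_mul]
      ring
    rw [← hE] at hmp
    have e9 : (3:ℝ) * 2 ^ (t :: ts).length * δ = 3 * 2 ^ ts.length * δ + 2 ^ ts.length * (3 * δ) := by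
      rw [List.length_cons, pow_succ]; ring
    rw [e9]
    linarith

end CS

namespace CS

lemma exists_div (P V : ℕ) (hV : 1 ≤ V) (u : ℕ) : u ≠ 0 → (∀ p : ℕ, p.Prime → p ∣ u → p ≤ P) → V ≤ u →
    ∃ w, w ∣ u ∧ V ≤ w ∧ w ≤ V * P ∨ w ∣ u ∧ w = V := by
  induction u using Nat.strong_induction_on with
  | _ u ih =>
    intro hu0 hP hV'
    by_cases h1 : u = V
    · exact ⟨u, Or.inr ⟨dvd_rfl, h1⟩⟩
    have hu1 : u ≠ 1 := by omega
    obtain ⟨p, hp, hpu⟩ := Nat.exists_prime_and_dvd hu1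
    obtain ⟨v, hv⟩ := hpu
    have hv0 : v ≠ 0 := by rintro rfl; simp at hv; exact hu0 hv
    by_cases h2 : V ≤ v
    · have hlt : v < u := by rw [hv]; nlinarith [hp.two_le, Nat.pos_of_ne_zero hv0]
      obtain ⟨w, hw⟩ := ih v hlt hv0 (fun r hr hrv => hP r hr (by rw [hv]; exact hrv.mul_left _)) h2
      refine ⟨w, ?_⟩
      rcases hw with ⟨a, b⟩ | ⟨a, b⟩
      · exact Or.inl ⟨by rw [hv]; exact a.mul_left _, b⟩
      · exact Or.inr ⟨by rw [hv]; exact a.mul_left _, b⟩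
    · refine ⟨u, Or.inl ⟨dvd_rfl, hV', ?_⟩⟩
      have : p ≤ P := hP p hp (by rw [hv]; exact dvd_mul_right _ _)
      rw [hv]; nlinarith

lemma factor_list (P V : ℕ) (hV : 1 ≤ V) (hP1 : 1 ≤ P) (k : ℕ) : ∀ u : ℕ, u ≠ 0 → (∀ p : ℕ, p.Prime → p ∣ u → p ≤ P) →
    u ≤ V ^ k → ∃ ws : List ℕ, ws.length = k ∧ ws.prod = u ∧ ∀ w ∈ ws, w ≤ V * P := by
  induction k with
  | zero => intro u h0 _ h; exact ⟨[], by simp, by simp at h ⊢; omega, by simp⟩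
  | succ k ih =>
    intro u h0 hP hu
    by_cases hVu : V ≤ u
    · have : ∃ w, w ∣ u ∧ V ≤ w ∧ w ≤ V * P := by
        obtain ⟨w, h | h⟩ := exists_div P V hV u h0 hP hVu
        · exact ⟨w, h⟩
        · exact ⟨w, h.1, h.2.ge, by rw [h.2]; nlinarith⟩
      obtain ⟨w, ⟨v, rfl⟩, h2, h3⟩ := this
      have hv0 : v ≠ 0 := by rintro rfl; simp at h0
      obtain ⟨ws, a, b, c⟩ := ih v hv0 (fun p hp hpv => hP p hp (hpv.mul_left _)) (by
        have : V * v ≤ V * V ^ k := by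
          calc V * v ≤ w * v := Nat.mul_le_mul_right _ h2
            _ ≤ _ := by rw [← pow_succ']; exact hu
        exact Nat.le_of_mul_le_mul_left this (by omega))
      exact ⟨w :: ws, by simp [a], by simp [b], by
        intro x hx
        rcases List.mem_cons.1 hx with rfl | hx
        · exact h3
        · exact c x hx⟩
    · obtain ⟨ws, a, b, c⟩ := ih 1 (by simp) (by
        intro p hp h; exact absurd (Nat.dvd_one.1 h) hp.one_lt.ne') (Nat.one_le_pow _ _ (by omega))
      refine ⟨u :: ws, by simp [a], by simp [b], ?_⟩
      intro x hx
      rcases List.mem_cons.1 hx with rfl | hx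
      · nlinarith
      · exact c x hx

lemma Dm_append (X : ℕ) (ts1 ts2 : List ℕ) (Φ : (ℤ → ℂ) → ℝ) (F : ℤ → ℂ) :
    Dm X (ts1 ++ ts2) Φ F = Dm X ts1 (fun F => Dm X ts2 Φ F) F := by
  induction ts1 generalizing F with
  | nil => rfl
  | cons t ts ih => simp only [List.cons_append, Dm, ih]

lemma Dm_le_one (X : ℕ) (ts : List ℕ) (Φ : (ℤ → ℂ) → ℝ) (hΦ : ∀ F, (∀ n, ‖F n‖ ≤ 1) → Φ F ≤ 1) :
    ∀ F : ℤ → ℂ, (∀ n, ‖F n‖ ≤ 1) → Dm X ts Φ F ≤ 1 := by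
  induction ts with
  | nil => exact hΦ
  | cons t ts ih =>
    intro F hF
    rw [Dm]
    apply div_le_one_of_le₀ _ (sq_nonneg _)
    refine (Finset.sum_le_sum fun i _ => Finset.sum_le_sum fun j _ => ih _ (Dl_norm_le _ _ hF)).trans ?_
    simp [sq]

lemma count_dvd (d X : ℕ) (hd : 0 < d) (hdX : d ∣ X) :
    ∑ h ∈ Finset.range X, ∑ h' ∈ Finset.range X, (if (d:ℤ) ∣ (h:ℤ) - h' then (1:ℝ) else 0) = (X:ℝ)^2 / d := by
  obtain ⟨c, rfl⟩ := hdX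
  have h1 : ∀ h ∈ Finset.range (d * c), ∑ h' ∈ Finset.range (d * c), (if (d:ℤ) ∣ (h:ℤ) - h' then (1:ℝ) else 0) = c := by
    intro h _
    rw [Finset.sum_boole]
    have h2 := Nat.count_modEq_card (d * c) hd h
    rw [Nat.mul_mod_right, Nat.mul_div_cancel_left _ hd] at h2
    simp at h2
    rw [Nat.count_eq_card_filter_range] at h2
    simp only [Nat.modEq_iff_dvd] at h2
    exact_mod_cast h2
  rw [Finset.sum_congr rfl h1]
  simp
  have : (d:ℝ) ≠ 0 := by exact_mod_cast hd.ne'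
  field_simp

lemma badprob (X d : ℕ) (hd : 0 < d) (hX : 0 < X) (hdX : d ∣ X) (Φ : (ℤ → ℂ) → ℝ) (hΦ : ∀ F, (∀ n, ‖F n‖ ≤ 1) → Φ F ≤ 1)
    (β : ℝ) (hβ : 0 ≤ β) (F : ℤ → ℂ) (hF : ∀ n, ‖F n‖ ≤ 1) (ts : List ℕ) : ∀ (s : List ℤ),
    (∀ hs : List ℤ, hs.length = ts.length → (∀ h ∈ hs, ¬ (d:ℤ) ∣ h) →
      Φ (dl ((List.zipWith (fun (t : ℕ) h => (t:ℤ) * h) ts hs).reverse ++ s) F) ≤ β) →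
    Dm X ts Φ (dl s F) ≤ β + ts.length / d := by
  have hd' : (0:ℝ) < d := by exact_mod_cast hd
  have hX' : (0:ℝ) < X := by exact_mod_cast hX
  induction ts with
  | nil => intro s h; have := h [] rfl (by simp); simpa [Dm] using this
  | cons t ts ih =>
    intro s hs
    rw [Dm, div_le_iff₀ (by positivity)]
    have h1 : ∀ h ∈ Finset.range X, ∀ h' ∈ Finset.range X, Dm X ts Φ (Dl ((t:ℤ) * ((h:ℤ) - h')) (dl s F)) ≤
        (β + ts.length / d) + (if (d:ℤ) ∣ (h:ℤ) - h' then (1:ℝ) else 0) := by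
      intro h _ h' _
      split_ifs with hc
      · have := Dm_le_one X ts Φ hΦ (Dl ((t:ℤ) * ((h:ℤ) - h')) (dl s F)) (Dl_norm_le _ _ (dl_norm_le _ _ hF))
        have : 0 ≤ β + ts.length / d := by positivity
        linarith
      · rw [add_zero]
        apply ih ((t:ℤ) * ((h:ℤ) - h') :: s)
        intro hs' hl hnd
        have := hs (((h:ℤ) - h') :: hs') (by simp [hl]) (by
          intro x hx
          rcases List.mem_cons.1 hx with rfl | hx
          · exact hc
          · exact hnd x hx)
        simpa using this
    refine (Finset.sum_le_sum fun h hh => Finset.sum_le_sum fun h' hh' => h1 h hh h' hh').trans ?_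
    simp only [Finset.sum_add_distrib, Finset.sum_const, Finset.card_range, nsmul_eq_mul]
    rw [count_dvd d X hd hdX]
    apply le_of_eq
    rw [List.length_cons]
    push_cast
    field_simp
    ring

lemma av_smooth (x : ℤ) (M d r : ℕ) (hr : 0 < r) (F : ℤ → ℂ) (hF : ∀ n, ‖F n‖ ≤ 1) :
    ‖av x M (fun n => (∑ t ∈ Finset.range r, F (n + (d * t : ℕ))) / r) - av x M F‖ ≤ 2 * (d * r) / M := by
  have hr' : (0:ℝ) < r := by exact_mod_cast hr
  have hrc : (r:ℂ) ≠ 0 := by exact_mod_cast hr.ne'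
  have h2 : av x M (fun n => (∑ t ∈ Finset.range r, F (n + (d * t : ℕ))) / r) - av x M F =
      (∑ t ∈ Finset.range r, (av x M (fun n => F (n + (d * t : ℕ))) - av x M F)) / r := by
    rw [Finset.sum_sub_distrib, Finset.sum_const, Finset.card_range, nsmul_eq_mul, sub_div, mul_div_cancel_left₀ _ hrc]
    congr 1
    simp only [av]
    rw [← Finset.sum_div, Finset.sum_comm, div_div, mul_comm (r:ℂ), ← div_div, ← Finset.sum_div]
  rw [h2, norm_div, Complex.norm_natCast, div_le_iff₀ hr']
  refine (norm_sum_le _ _).trans ?_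
  have : ∀ t ∈ Finset.range r, ‖av x M (fun n => F (n + (d * t : ℕ))) - av x M F‖ ≤ 2 * (d * r) / M := by
    intro t ht
    refine (av_shift x M F hF (d * t)).trans ?_
    rw [Finset.mem_range] at ht
    have : (t:ℝ) ≤ r := by exact_mod_cast ht.le
    push_cast
    gcongr
  refine (Finset.sum_le_sum this).trans ?_
  simp [mul_comm]

/-- averages of iterated differences -/
noncomputable def U {G : Type*} [AddCommGroup G] [Fintype G] : ℕ → (G → ℂ) → ℝ
  | 0, f => ‖∑ x, f x‖ / Fintype.card G
  | k+1, f => (∑ h, U k (Dl h f)) / Fintype.card G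

lemma sum_range_zmod {A : Type*} [AddCommMonoid A] (r : ℕ) [NeZero r] (g : ZMod r → A) :
    ∑ t ∈ Finset.range r, g (t : ZMod r) = ∑ y, g y := by
  refine Finset.sum_nbij' (fun t => (t : ZMod r)) ZMod.val ?_ ?_ ?_ ?_ ?_
  · simp
  · intro a _; simp [ZMod.val_lt]
  · intro a ha; simp at ha; simp [ZMod.val_natCast, Nat.mod_eq_of_lt ha]
  · intro a _; simp
  · simp

lemma Dm_le_U (x : ℤ) (M r : ℕ) [NeZero r] (hM : 0 < M) (ts : List ℕ) (hts : ∀ t ∈ ts, Nat.Coprime t r) :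
    ∀ f : ZMod r → ℂ, (∀ y, ‖f y‖ ≤ 1) →
    Dm r ts (fun F => ‖av x M F‖) (fun n => f n) ≤ U ts.length f + 2 * r / M := by
  have hr : 0 < r := Nat.pos_of_ne_zero (NeZero.ne r)
  have hr' : (0:ℝ) < r := by exact_mod_cast hr
  have hM' : (0:ℝ) < M := by exact_mod_cast hM
  have hMc : (M:ℂ) ≠ 0 := by exact_mod_cast hM.ne'
  induction ts with
  | nil =>
    intro f hf
    simp only [Dm, List.length_nil, U]
    have h1 := av_smooth x M 1 r hr (fun n => f (n : ZMod r)) (fun n => hf _)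
    have h2 : (fun n : ℤ => (∑ t ∈ Finset.range r, f ((n + (1 * t : ℕ) : ℤ) : ZMod r)) / (r:ℂ)) =
        fun n => (∑ y, f y) / r := by
      funext n
      congr 1
      push_cast
      simp only [one_mul]
      rw [sum_range_zmod r (fun y => f (n + y))]
      exact Fintype.sum_equiv (Equiv.addLeft (n : ZMod r)) _ _ (fun y => rfl)
    rw [h2] at h1
    have h3 : av x M (fun n => (∑ y, f y) / (r:ℂ)) = (∑ y, f y) / r := by
      simp only [av, Finset.sum_const, Finset.card_range, nsmul_eq_mul]
      rw [mul_div_cancel_left₀ _ hMc]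
    rw [h3] at h1
    have h4 := norm_sub_norm_le (av x M fun n => f (n : ZMod r)) ((∑ y, f y) / r)
    rw [norm_sub_rev] at h4
    rw [ZMod.card]
    have h5 : ‖(∑ y, f y) / (r:ℂ)‖ = ‖∑ y, f y‖ / r := by rw [norm_div, Complex.norm_natCast]
    rw [h5] at h4
    push_cast at h1
    rw [one_mul] at h1
    linarith
  | cons t ts ih =>
    intro f hf
    rw [Dm, List.length_cons, U, ZMod.card]
    have hDl : ∀ s : ℤ, Dl s (fun n : ℤ => f n) = fun n : ℤ => Dl (s : ZMod r) f n := by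
      intro s; funext n; simp [Dl]
    have hu : IsUnit (t : ZMod r) := (ZMod.isUnit_iff_coprime t r).2 (hts t (by simp))
    have hsum : ∀ h : ℕ, ∑ h' ∈ Finset.range r, U ts.length (Dl (((t:ℤ) * ((h:ℤ) - h') : ℤ) : ZMod r) f) =
        ∑ y, U ts.length (Dl y f) := by
      intro h
      push_cast
      rw [sum_range_zmod r (fun y => U ts.length (Dl ((t : ZMod r) * (h - y)) f))]
      obtain ⟨u, hu⟩ := hu
      rw [← hu]
      exact Fintype.sum_equiv ((Equiv.subLeft (h : ZMod r)).trans (Units.mulLeft u)) _ _ (fun y => rfl)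
    have h1 : ∀ h ∈ Finset.range r, ∀ h' ∈ Finset.range r, Dm r ts (fun F => ‖av x M F‖) (Dl ((t:ℤ) * ((h:ℤ) - h')) (fun n => f n)) ≤
        U ts.length (Dl (((t:ℤ) * ((h:ℤ) - h') : ℤ) : ZMod r) f) + 2 * r / M := by
      intro h _ h' _
      rw [hDl]
      exact ih (fun t ht => hts t (by simp [ht])) _ (Dl_norm_le _ _ hf)
    rw [div_le_iff₀ (by positivity)]
    refine (Finset.sum_le_sum fun h hh => Finset.sum_le_sum fun h' hh' => h1 h hh h' hh').trans ?_
    simp only [Finset.sum_add_distrib, hsum, Finset.sum_const, Finset.card_range, nsmul_eq_mul]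
    apply le_of_eq
    field_simp

lemma U_prod {G G1 G2 : Type*} [AddCommGroup G] [Fintype G] [AddCommGroup G1] [Fintype G1] [AddCommGroup G2] [Fintype G2]
    (e : G ≃+ G1 × G2) (k : ℕ) : ∀ (f1 : G1 → ℂ) (f2 : G2 → ℂ),
    U k (fun g => f1 (e g).1 * f2 (e g).2) = U k f1 * U k f2 := by
  have hc : (Fintype.card G : ℝ) = Fintype.card G1 * Fintype.card G2 := by
    rw [Fintype.card_congr e.toEquiv, Fintype.card_prod]; push_cast; rfl
  induction k with
  | zero =>
    intro f1 f2
    simp only [U]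
    rw [hc, div_mul_div_comm, ← norm_mul, Finset.sum_mul_sum, ← Finset.sum_product']
    congr 2
    exact Fintype.sum_equiv e.toEquiv _ _ (fun g => rfl)
  | succ k ih =>
    intro f1 f2
    simp only [U]
    rw [hc, div_mul_div_comm, Finset.sum_mul_sum, ← Finset.sum_product']
    congr 1
    refine Fintype.sum_equiv e.toEquiv _ _ (fun h => ?_)
    have : Dl h (fun g => f1 (e g).1 * f2 (e g).2) = fun g => (Dl (e h).1 f1) (e g).1 * (Dl (e h).2 f2) (e g).2 := by
      funext g; simp [Dl]; ring
    rw [this, ih]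
    rfl

end CS

namespace CS
open Polynomial

/-- working form of primitivity -/
def Pr {q : ℕ} (χ : DirichletCharacter ℂ q) : Prop :=
  ∀ d : ℕ, d ∣ q → d < q → ∃ n : ℤ, (d:ℤ) ∣ n - 1 ∧ cz χ n ≠ 1 ∧ cz χ n ≠ 0

lemma Pr_of_primitive {q : ℕ} [NeZero q] (χ : DirichletCharacter ℂ q) (h : χ.IsPrimitive) : Pr χ := by
  intro d hd hlt
  by_contra hcon
  push Not at hcon
  have hf : χ.FactorsThrough d := by
    rw [DirichletCharacter.factorsThrough_iff_ker_unitsMap hd]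
    intro u hu
    rw [MonoidHom.mem_ker] at hu ⊢
    rw [Units.ext_iff, MulChar.coe_toUnitHom, Units.val_one]
    have h1 : ((u : ZMod q).val : ZMod d) = 1 := by
      have := congrArg Units.val hu
      rw [ZMod.unitsMap_val, Units.val_one] at this
      rw [ZMod.natCast_val]; exact this
    have h2 : (d:ℤ) ∣ ((u : ZMod q).val : ℤ) - 1 := by
      rw [← ZMod.intCast_zmod_eq_zero_iff_dvd]; push_cast; rw [h1]; simp
    have h3 : cz χ ((u : ZMod q).val : ℤ) = χ u := by
      simp [cz]
    have h4 := hcon _ h2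
    rw [h3] at h4
    by_contra hne
    have h5 := h4 hne
    have := χ.unit_norm_eq_one u
    rw [h5] at this
    simp at this
  have h6 : χ.conductor ≤ d := Nat.sInf_le hf
  rw [DirichletCharacter.isPrimitive_def] at h
  omega

lemma cz_one_mod {q : ℕ} (χ : DirichletCharacter ℂ q) {m n : ℤ} (h : (q:ℤ) ∣ m - n) : cz χ m = cz χ n := by
  unfold cz
  congr 1
  rw [← sub_eq_zero, ← Int.cast_sub, ZMod.intCast_zmod_eq_zero_iff_dvd]; exact h

lemma cz_one {q : ℕ} (χ : DirichletCharacter ℂ q) : cz χ 1 = 1 := by simp [cz]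

lemma cz_mul {q : ℕ} (χ : DirichletCharacter ℂ q) (m n : ℤ) : cz χ (m * n) = cz χ m * cz χ n := by simp [cz]

lemma Pr_fst {a b : ℕ} (ha : a ≠ 0) (hb : b ≠ 0) (h : Nat.Coprime a b) (χ : DirichletCharacter ℂ (a * b)) (hχ : Pr χ) :
    Pr (crtFst h χ) := by
  intro d hd hlt
  obtain ⟨n, h1, h2, h3⟩ := hχ (d * b) (Nat.mul_dvd_mul_right hd b) (Nat.mul_lt_mul_of_pos_right hlt (Nat.pos_of_ne_zero hb))
  have h4 : cz (crtSnd h χ) n = 1 := by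
    rw [cz_one_mod (crtSnd h χ) (n := 1), cz_one]
    exact dvd_trans (by push_cast; exact dvd_mul_left _ _) h1
  rw [crt_int h χ, Pi.mul_apply, h4, mul_one] at h2 h3
  exact ⟨n, dvd_trans (by push_cast; exact dvd_mul_right _ _) h1, h2, h3⟩

lemma Pr_snd {a b : ℕ} (ha : a ≠ 0) (hb : b ≠ 0) (h : Nat.Coprime a b) (χ : DirichletCharacter ℂ (a * b)) (hχ : Pr χ) :
    Pr (crtSnd h χ) := by
  intro d hd hlt
  obtain ⟨n, h1, h2, h3⟩ := hχ (a * d) (Nat.mul_dvd_mul_left a hd) (Nat.mul_lt_mul_of_pos_left hlt (Nat.pos_of_ne_zero ha))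
  have h4 : cz (crtFst h χ) n = 1 := by
    rw [cz_one_mod (crtFst h χ) (n := 1), cz_one]
    exact dvd_trans (by push_cast; exact dvd_mul_right _ _) h1
  rw [crt_int h χ, Pi.mul_apply, h4, one_mul] at h2 h3
  exact ⟨n, dvd_trans (by push_cast; exact dvd_mul_left _ _) h1, h2, h3⟩

lemma unit_iff {p a : ℕ} (hp : p.Prime) (ha : 1 ≤ a) (z : ℤ) : IsUnit (z : ZMod (p ^ a)) ↔ ¬ (p:ℤ) ∣ z := by
  rw [ZMod.coe_int_isUnit_iff_isCoprime]
  push_cast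
  rw [IsCoprime.pow_left_iff (by omega), Prime.coprime_iff_not_dvd (Nat.prime_iff_prime_int.1 hp)]

lemma hom_mul {q : ℕ} (χ : DirichletCharacter ℂ q) (c : ℤ) (h : (q:ℤ) ∣ c * c) (t : ℕ) :
    cz χ (1 + c * t) = cz χ (1 + c) ^ t := by
  induction t with
  | zero => simp [cz]
  | succ t ih =>
    rw [pow_succ, ← ih, ← cz_mul]
    apply cz_one_mod
    have : 1 + c * ((t + 1 : ℕ) : ℤ) - (1 + c * t) * (1 + c) = (c * c) * (-t) := by push_cast; ring
    rw [this]; exact h.mul_right _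

lemma Pr_ne {p a : ℕ} (hp : p.Prime) (ha : 2 ≤ a) (ψ : DirichletCharacter ℂ (p ^ a)) (hψ : Pr ψ) (y : ℤ)
    (hy : ¬ (p:ℤ) ∣ y) : cz ψ (1 + p ^ (a - 1) * y) ≠ 1 := by
  intro h1
  obtain ⟨n, ⟨z, hz⟩, h2, -⟩ := hψ (p ^ (a - 1)) (pow_dvd_pow _ (by omega)) (Nat.pow_lt_pow_right hp.one_lt (by omega))
  apply h2
  have hp' : Prime (p:ℤ) := Nat.prime_iff_prime_int.1 hp
  have hco : IsCoprime (p:ℤ) y := (Prime.coprime_iff_not_dvd hp').2 hy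
  obtain ⟨u, v, huv⟩ := hco
  -- z = z*u*p + z*v*y ; choose natural t ≡ z v mod p
  have hp0 : (0:ℤ) < p := by exact_mod_cast hp.pos
  set t : ℕ := ((z * v) % p).toNat with ht
  have htz : (t:ℤ) = (z * v) % p := Int.toNat_of_nonneg (Int.emod_nonneg _ hp0.ne')
  have h3 := hom_mul ψ (p ^ (a - 1) * y) (by
    push_cast
    refine (pow_dvd_pow (p:ℤ) (show a ≤ (a - 1) + (a - 1) by omega)).trans ?_
    rw [pow_add]; exact ⟨y * y, by ring⟩) t
  rw [h1, one_pow] at h3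
  rw [← h3]
  apply cz_one_mod
  have e0 := Int.mul_ediv_add_emod (z * v) p
  rw [← htz] at e0
  have e1 : n - (1 + p ^ (a - 1) * y * t) = (p:ℤ) ^ (a - 1) * p * (z * u + y * (z * v / p)) := by
    push_cast at hz
    linear_combination hz - (p:ℤ) ^ (a - 1) * z * huv - (p:ℤ)^(a-1) * y * e0
  rw [e1, ← pow_succ, Nat.sub_add_cancel (by omega)]
  push_cast
  exact dvd_mul_right _ _

lemma dl_vals {p : ℕ} (s : List ℤ) (hs : ∀ x ∈ s, (p:ℤ) ∣ x) (N D Q : ℤ[X]) (h1 : N = D + C s.prod * Q)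
    (h3 : s = [] → N = X ∧ D = 1 ∧ Q = X - 1)
    (h4 : ∀ (d : ℕ) (K : ℕ), s.length = K + 1 → (∀ x ∈ s, (d : ℤ) ∣ x) →
      D.map (Int.castRingHom (ZMod d)) = X ^ (2 ^ K) ∧
      Q.map (Int.castRingHom (ZMod d)) = C ((-1) ^ K * (K.factorial : ZMod d)) * X ^ (2 ^ K - (K + 1))) (n : ℤ) :
    (∃ e, 1 ≤ e ∧ ((N.eval n : ℤ) : ZMod p) = (n : ZMod p) ^ e) ∧ (∃ e, ((D.eval n : ℤ) : ZMod p) = (n : ZMod p) ^ e) := by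
  rcases hl : s.length with _ | K
  · obtain ⟨a, b, -⟩ := h3 (List.length_eq_zero_iff.1 hl)
    exact ⟨⟨1, le_rfl, by rw [a]; simp⟩, ⟨0, by rw [b]; simp⟩⟩
  · obtain ⟨a, -⟩ := h4 p K hl hs
    have hD : ((D.eval n : ℤ) : ZMod p) = (n : ZMod p) ^ (2 ^ K) := by
      have := Polynomial.eval_intCast_map (Int.castRingHom (ZMod p)) D n
      rw [a] at this
      simpa using this.symm
    have hS : (s.prod : ZMod p) = 0 := by
      rw [ZMod.intCast_zmod_eq_zero_iff_dvd]
      obtain ⟨x, hx⟩ : ∃ x, x ∈ s := List.exists_mem_of_ne_nil s (by rintro rfl; simp at hl)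
      exact (hs x hx).trans (List.dvd_prod hx)
    refine ⟨⟨2 ^ K, Nat.one_le_two_pow, ?_⟩, ⟨_, hD⟩⟩
    rw [h1, eval_add, eval_mul, eval_C, Int.cast_add, Int.cast_mul, hS, hD]; simp

lemma dl_zero {p a : ℕ} (hp : p.Prime) (ha : 1 ≤ a) (ψ : DirichletCharacter ℂ (p ^ a)) (s : List ℤ)
    (hs : ∀ x ∈ s, (p:ℤ) ∣ x) (n : ℤ) (hn : (p:ℤ) ∣ n) : dl s (cz ψ) n = 0 := by
  obtain ⟨N, D, Q, h1, h2, h3, h4⟩ := cube_exists s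
  obtain ⟨⟨e, he, hN⟩, -⟩ := dl_vals s hs N D Q h1 h3 h4 n
  rw [h2, MulChar.map_nonunit, zero_mul]
  rw [unit_iff hp ha, not_not, ← ZMod.intCast_zmod_eq_zero_iff_dvd, hN, (ZMod.intCast_zmod_eq_zero_iff_dvd _ _).2 hn,
    zero_pow (by omega)]

lemma unit_conj {m : ℕ} [NeZero m] (χ : DirichletCharacter ℂ m) (u : ZMod m) (hu : IsUnit u) :
    χ u * (starRingEnd ℂ) (χ u) = 1 := by
  rw [Complex.mul_conj, Complex.normSq_eq_norm_sq]
  have : ‖χ u‖ = 1 := by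
    obtain ⟨v, rfl⟩ := hu; exact χ.unit_norm_eq_one v
  rw [this]; simp

lemma dl_unit {p a : ℕ} (hp : p.Prime) (ha : 1 ≤ a) (ψ : DirichletCharacter ℂ (p ^ a)) (s : List ℤ)
    (hs : ∀ x ∈ s, (p:ℤ) ∣ x) (n : ℤ) (hn : ¬ (p:ℤ) ∣ n) : dl s (cz ψ) n * (starRingEnd ℂ) (dl s (cz ψ) n) = 1 := by
  obtain ⟨N, D, Q, h1, h2, h3, h4⟩ := cube_exists s
  obtain ⟨⟨e, he, hN⟩, ⟨e', hD⟩⟩ := dl_vals s hs N D Q h1 h3 h4 n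
  have : Fact p.Prime := ⟨hp⟩
  have hn' : (n : ZMod p) ≠ 0 := by rwa [Ne, ZMod.intCast_zmod_eq_zero_iff_dvd]
  have : NeZero (p ^ a) := ⟨pow_ne_zero _ hp.ne_zero⟩
  have u1 : IsUnit ((N.eval n : ℤ) : ZMod (p ^ a)) := by
    rw [unit_iff hp ha, ← ZMod.intCast_zmod_eq_zero_iff_dvd, hN]; exact pow_ne_zero _ hn'
  have u2 : IsUnit ((D.eval n : ℤ) : ZMod (p ^ a)) := by
    rw [unit_iff hp ha, ← ZMod.intCast_zmod_eq_zero_iff_dvd, hD]; exact pow_ne_zero _ hn'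
  rw [h2]
  have e1 := unit_conj ψ _ u1
  have e2 := unit_conj ψ _ u2
  rw [map_mul, Complex.conj_conj]
  generalize ψ ((N.eval n : ℤ) : ZMod (p ^ a)) = A at *
  generalize ψ ((D.eval n : ℤ) : ZMod (p ^ a)) = B at *
  linear_combination B * (starRingEnd ℂ) B * e1 + e2

set_option maxHeartbeats 1000000 in
lemma dl_shift {p a β : ℕ} (hp : p.Prime) (hβ : 1 ≤ β) (hβa : β ≤ a) (ψ : DirichletCharacter ℂ (p ^ a)) (s : List ℤ) (τ : ℤ)
    (hs : ∀ x ∈ s, ((p ^ β : ℕ) : ℤ) ∣ x) (hτ : ((p ^ β : ℕ) : ℤ) ∣ τ)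
    (hd : ((p ^ a : ℕ) : ℤ) ∣ τ * s.prod * (p ^ β : ℕ)) (n n' : ℤ) (hn : ((p ^ a : ℕ) : ℤ) ∣ n * n' - 1) :
    dl s (cz ψ) (n + τ) = dl s (cz ψ) n *
      cz ψ (1 + τ * s.prod * ((-1) ^ s.length * s.length.factorial * n' ^ (s.length + 1))) := by
  have : NeZero (p ^ a) := ⟨pow_ne_zero _ hp.ne_zero⟩
  have ha : 1 ≤ a := hβ.trans hβa
  have hpβ : (p:ℤ) ∣ ((p ^ β : ℕ) : ℤ) := by exact_mod_cast dvd_pow_self p (by omega)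
  have hpn : ¬ (p:ℤ) ∣ n := by
    intro h
    have h1 : (p:ℤ) ∣ n * n' - 1 := by
      refine dvd_trans ?_ hn
      exact_mod_cast dvd_pow_self p (by omega)
    have h2 : (p:ℤ) ∣ 1 := by
      have := dvd_sub (h.mul_right n') h1
      simpa using this
    exact (Nat.prime_iff_prime_int.1 hp).not_unit (isUnit_of_dvd_one h2)
  have hf := dl_unit hp ha ψ s (fun x hx => hpβ.trans (hs x hx)) n hpn
  have hτs : ∀ x ∈ τ :: s, ((p ^ β : ℕ) : ℤ) ∣ x := by
    intro x hx
    rcases List.mem_cons.1 hx with rfl | hx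
    · exact hτ
    · exact hs x hx
  obtain ⟨N, D, Q, h1, h2, h3, h4⟩ := cube_exists (τ :: s)
  obtain ⟨-, e', hDu⟩ := dl_vals (τ :: s) (fun x hx => hpβ.trans (hτs x hx)) N D Q h1 h3 h4 n
  obtain ⟨hD, hQ⟩ := h4 (p ^ β) s.length (by simp) hτs
  have hD' : ((D.eval n : ℤ) : ZMod (p ^ β)) = (n : ZMod (p ^ β)) ^ (2 ^ s.length) := by
    have := Polynomial.eval_intCast_map (Int.castRingHom (ZMod (p ^ β))) D n
    rw [hD] at this
    simpa using this.symm
  have hQ' : ((Q.eval n : ℤ) : ZMod (p ^ β)) = (-1) ^ s.length * (s.length.factorial : ZMod (p ^ β)) *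
      (n : ZMod (p ^ β)) ^ (2 ^ s.length - (s.length + 1)) := by
    have := Polynomial.eval_intCast_map (Int.castRingHom (ZMod (p ^ β))) Q n
    rw [hQ, eval_mul, eval_C, eval_pow, eval_X] at this
    simpa using this.symm
  set κ : ℤ := (-1) ^ s.length * s.length.factorial with hκ
  have hnn : (n : ZMod (p ^ β)) * (n' : ZMod (p ^ β)) = 1 := by
    rw [← sub_eq_zero]
    have : ((n * n' - 1 : ℤ) : ZMod (p ^ β)) = 0 := by
      rw [ZMod.intCast_zmod_eq_zero_iff_dvd]
      refine dvd_trans ?_ hn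
      exact_mod_cast pow_dvd_pow p hβa
    push_cast at this; exact this
  have hQD : ((p ^ β : ℕ) : ℤ) ∣ Q.eval n - D.eval n * (κ * n' ^ (s.length + 1)) := by
    rw [← ZMod.intCast_zmod_eq_zero_iff_dvd]
    rw [Int.cast_sub, Int.cast_mul, hD', hQ', hκ]
    push_cast
    have hK2 : s.length + 1 ≤ 2 ^ s.length := Nat.lt_two_pow_self
    obtain ⟨r, hr⟩ := Nat.exists_eq_add_of_le hK2
    rw [hr, Nat.add_sub_cancel_left, pow_add (n : ZMod (p ^ β))]
    have : (n : ZMod (p ^ β)) ^ (s.length + 1) * (n' : ZMod (p ^ β)) ^ (s.length + 1) = 1 := by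
      rw [← mul_pow, hnn, one_pow]
    linear_combination (-((-1) ^ s.length * (s.length.factorial : ZMod (p ^ β)) * (n : ZMod (p ^ β)) ^ r)) * this
  have : Fact p.Prime := ⟨hp⟩
  have hn0 : (n : ZMod p) ≠ 0 := by rwa [Ne, ZMod.intCast_zmod_eq_zero_iff_dvd]
  have u2 : IsUnit ((D.eval n : ℤ) : ZMod (p ^ a)) := by
    rw [unit_iff hp ha, ← ZMod.intCast_zmod_eq_zero_iff_dvd, hDu]; exact pow_ne_zero _ hn0
  have e2 := unit_conj ψ _ u2
  have hN : cz ψ (N.eval n) = cz ψ (D.eval n) * cz ψ (1 + τ * s.prod * (κ * n' ^ (s.length + 1))) := by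
    rw [← cz_mul]
    apply cz_one_mod
    rw [h1, eval_add, eval_mul, eval_C, List.prod_cons]
    have : D.eval n + τ * s.prod * Q.eval n - D.eval n * (1 + τ * s.prod * (κ * n' ^ (s.length + 1))) =
      τ * s.prod * (Q.eval n - D.eval n * (κ * n' ^ (s.length + 1))) := by ring
    rw [this]
    exact hd.trans (mul_dvd_mul_left _ hQD)
  have h5 := h2 (p ^ a) ψ n
  rw [dl, Dl] at h5
  change _ = cz ψ (N.eval n) * (starRingEnd ℂ) (cz ψ (D.eval n)) at h5
  change cz ψ (D.eval n) * (starRingEnd ℂ) (cz ψ (D.eval n)) = 1 at e2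
  rw [hN] at h5
  generalize cz ψ (1 + τ * s.prod * (κ * n' ^ (s.length + 1))) = Z at *
  generalize dl s (cz ψ) (n + τ) = A at *
  generalize dl s (cz ψ) n = B at *
  linear_combination (-A) * hf + B * h5 + B * Z * e2

end CS

namespace CS

lemma exists_inv {p a : ℕ} (hp : p.Prime) (n : ℤ) (hn : ¬ (p:ℤ) ∣ n) : ∃ n' : ℤ, ((p ^ a : ℕ) : ℤ) ∣ n * n' - 1 := by
  have h1 : IsCoprime ((p:ℤ)^a) n := IsCoprime.pow_left ((Prime.coprime_iff_not_dvd (Nat.prime_iff_prime_int.1 hp)).2 hn)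
  obtain ⟨u, v, h⟩ := h1
  exact ⟨v, ⟨-u, by push_cast; linear_combination h⟩⟩

lemma s2_core {p a b : ℕ} (hp : p.Prime) (ha : 2 ≤ a) (hb : 1 ≤ b) (hba : b ≤ a) (ψ : DirichletCharacter ℂ (p ^ a)) (hψ : Pr ψ)
    (s : List ℤ) (hs : ∀ x ∈ s, ((p ^ b : ℕ) : ℤ) ∣ x)
    (hd : ((p ^ a : ℕ) : ℤ) ∣ (p ^ b : ℕ) * s.prod * (p ^ b : ℕ))
    (hnd : ¬ ((p ^ a : ℕ) : ℤ) ∣ (p ^ b : ℕ) * s.prod * s.length.factorial) (n : ℤ) :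
    ∑ t ∈ Finset.range (p ^ b), dl s (cz ψ) (n + (p ^ b * t : ℕ)) = 0 := by
  have hpb : (p:ℤ) ∣ ((p ^ b : ℕ) : ℤ) := by exact_mod_cast dvd_pow_self p (by omega)
  have hp' := Nat.prime_iff_prime_int.1 hp
  by_cases hn : (p:ℤ) ∣ n
  · apply Finset.sum_eq_zero
    intro t _
    apply dl_zero hp (by omega) ψ s (fun x hx => hpb.trans (hs x hx))
    refine dvd_add hn ?_
    push_cast at hpb ⊢
    exact hpb.mul_right _
  obtain ⟨n', hn'⟩ := exists_inv (a := a) hp n hn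
  have hpn' : ¬ (p:ℤ) ∣ n' := by
    intro h
    have h1 : (p:ℤ) ∣ n * n' - 1 := by
      refine dvd_trans ?_ hn'
      exact_mod_cast dvd_pow_self p (by omega)
    have h2 : (p:ℤ) ∣ 1 := by
      have := dvd_sub (h.mul_left n) h1
      simpa using this
    exact hp'.not_isUnit (isUnit_of_dvd_one h2)
  set c : ℤ := (p ^ b : ℕ) * s.prod * ((-1) ^ s.length * s.length.factorial * n' ^ (s.length + 1)) with hc
  have hcc : ((p ^ a : ℕ) : ℤ) ∣ c * c := by
    by_cases hs0 : s = []
    · subst hs0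
      simp only [List.prod_nil, mul_one] at hd
      refine hd.trans ⟨(n' ) ^ 2, ?_⟩
      rw [hc]; simp; ring
    · obtain ⟨x, hx⟩ := List.exists_mem_of_ne_nil s hs0
      have h1 : ((p ^ b : ℕ) : ℤ) ∣ s.prod := (hs x hx).trans (List.dvd_prod hx)
      refine hd.trans ?_
      obtain ⟨y, hy⟩ := h1
      refine ⟨s.prod * ((-1) ^ s.length * s.length.factorial * n' ^ (s.length + 1)) ^ 2, ?_⟩
      rw [hc]; ring
  have hterm : ∀ t : ℕ, dl s (cz ψ) (n + (p ^ b * t : ℕ)) = dl s (cz ψ) n * cz ψ (1 + c) ^ t := by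
    intro t
    rw [dl_shift hp hb hba ψ s ((p ^ b * t : ℕ) : ℤ) hs (by push_cast; exact dvd_mul_right _ _) ?_ n n' hn', ← hom_mul ψ c hcc]
    · congr 2
      rw [hc]; push_cast; ring
    · refine hd.trans ⟨t, ?_⟩
      push_cast; ring
  rw [Finset.sum_congr rfl fun t _ => hterm t, ← Finset.mul_sum]
  have hz1 : cz ψ (1 + c) ^ (p ^ b) = 1 := by
    rw [← hom_mul ψ c hcc, ← cz_one ψ]
    apply cz_one_mod
    have : 1 + c * ((p ^ b : ℕ) : ℤ) - 1 = ((p ^ b : ℕ) * s.prod * (p ^ b : ℕ)) *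
        ((-1) ^ s.length * s.length.factorial * n' ^ (s.length + 1)) := by rw [hc]; ring
    rw [this]
    exact hd.mul_right _
  have hz2 : cz ψ (1 + c) ≠ 1 := by
    intro hz
    have hcnd : ¬ (p:ℤ) ^ a ∣ c := by
      intro h
      apply hnd
      have h3 : IsCoprime ((p:ℤ) ^ a) ((-1) ^ s.length * n' ^ (s.length + 1)) := by
        apply IsCoprime.pow_left
        rw [Prime.coprime_iff_not_dvd hp']
        intro h4
        rcases hp'.dvd_or_dvd h4 with h5 | h5
        · have := hp'.dvd_of_dvd_pow h5
          exact hp'.not_isUnit (isUnit_of_dvd_unit this (by simp))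
        · exact hpn' (hp'.dvd_of_dvd_pow h5)
      have h6 : c = ((p ^ b : ℕ) * s.prod * s.length.factorial) * ((-1) ^ s.length * n' ^ (s.length + 1)) := by
        rw [hc]; ring
      rw [h6] at h
      push_cast at h ⊢
      exact h3.dvd_of_dvd_mul_right h
    have hfin : FiniteMultiplicity (p:ℤ) c := by
      refine ⟨a, fun h => hcnd ((pow_dvd_pow _ (by omega)).trans h)⟩
    obtain ⟨c', hc', hpc'⟩ := hfin.exists_eq_pow_mul_and_not_dvd
    set v := multiplicity (p:ℤ) c with hv
    have hva : v < a := by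
      by_contra hge
      apply hcnd
      rw [hc']
      exact (pow_dvd_pow _ (by omega)).mul_right _
    have h7 := hom_mul ψ c hcc (p ^ (a - 1 - v))
    rw [hz, one_pow] at h7
    have h8 := Pr_ne hp ha ψ hψ c' hpc'
    apply h8
    rw [← h7]
    congr 2
    rw [hc']
    have : a - 1 = (a - 1 - v) + v := by omega
    rw [this, pow_add]
    have e : a - 1 - v + v - v = a - 1 - v := by omega
    push_cast
    rw [e]; ring
  rw [geom_sum_eq hz2, hz1]
  simp

lemma s2_av {p a b : ℕ} (hp : p.Prime) (ha : 2 ≤ a) (hb : 1 ≤ b) (hba : b ≤ a) (ψ : DirichletCharacter ℂ (p ^ a)) (hψ : Pr ψ)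
    (s : List ℤ) (hs : ∀ x ∈ s, ((p ^ b : ℕ) : ℤ) ∣ x)
    (hd : ((p ^ a : ℕ) : ℤ) ∣ (p ^ b : ℕ) * s.prod * (p ^ b : ℕ))
    (hnd : ¬ ((p ^ a : ℕ) : ℤ) ∣ (p ^ b : ℕ) * s.prod * s.length.factorial) (x : ℤ) (M : ℕ) :
    ‖av x M (dl s (cz ψ))‖ ≤ 2 * ((p:ℝ) ^ b * p ^ b) / M := by
  have h1 := av_smooth x M (p ^ b) (p ^ b) (pow_pos hp.pos _) (dl s (cz ψ)) (dl_norm_le _ _ (cz_norm_le _))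
  simp only [s2_core hp ha hb hba ψ hψ s hs hd hnd, zero_div] at h1
  have h2 : av x M (fun _ => (0:ℂ)) = 0 := by simp [av]
  rw [h2, zero_sub, norm_neg] at h1
  push_cast at h1
  exact h1

/-- additive character attached to the top layer -/
noncomputable def theta {p a : ℕ} (hp : p.Prime) (ha : 2 ≤ a) (ψ : DirichletCharacter ℂ (p ^ a)) : AddChar (ZMod p) ℂ where
  toFun y := cz ψ (1 + p ^ (a - 1) * (y.val : ℤ))
  map_zero_eq_one' := by simp [cz]
  map_add_eq_mul' x y := by
    rw [← cz_mul]
    apply cz_one_mod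
    have : NeZero p := ⟨hp.ne_zero⟩
    obtain ⟨z, hz⟩ : (p:ℤ) ∣ ((x + y).val : ℤ) - (x.val + y.val) := by
      rw [← ZMod.intCast_zmod_eq_zero_iff_dvd]; simp
    have h2 : a - 1 + 1 = a := by omega
    obtain ⟨r, hr⟩ : (p:ℤ) ^ a ∣ p ^ (a - 1) * p ^ (a - 1) := by
      rw [← pow_add]; exact pow_dvd_pow _ (by omega)
    refine ⟨z - r * (x.val * y.val), ?_⟩
    have h3 : (p:ℤ) ^ (a - 1) * p = p ^ a := by rw [← pow_succ, h2]
    push_cast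
    linear_combination (p:ℤ) ^ (a - 1) * hz - (x.val * y.val : ℤ) * hr + z * h3

lemma theta_int {p a : ℕ} (hp : p.Prime) (ha : 2 ≤ a) (ψ : DirichletCharacter ℂ (p ^ a)) (z : ℤ) :
    cz ψ (1 + p ^ (a - 1) * z) = theta hp ha ψ (z : ZMod p) := by
  change _ = cz ψ (1 + p ^ (a - 1) * ((z : ZMod p).val : ℤ))
  apply cz_one_mod
  have : NeZero p := ⟨hp.ne_zero⟩
  obtain ⟨c, hc⟩ : (p:ℤ) ∣ z - ((z : ZMod p).val : ℤ) := by
    rw [← ZMod.intCast_zmod_eq_zero_iff_dvd]; simp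
  refine ⟨c, ?_⟩
  have h2 : a - 1 + 1 = a := by omega
  have h3 : (p:ℤ) ^ (a - 1) * p = p ^ a := by rw [← pow_succ, h2]
  push_cast
  linear_combination (p:ℤ) ^ (a - 1) * hc + c * h3

lemma theta_ne {p a : ℕ} (hp : p.Prime) (ha : 2 ≤ a) (ψ : DirichletCharacter ℂ (p ^ a)) (hψ : Pr ψ) (y : ZMod p) (hy : y ≠ 0) :
    theta hp ha ψ y ≠ 1 := by
  have : NeZero p := ⟨hp.ne_zero⟩
  have := theta_int hp ha ψ (y.val : ℤ)
  simp at this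
  rw [← this]
  have h2 := Pr_ne hp ha ψ hψ (y.val : ℤ) (by
    rw [← ZMod.intCast_zmod_eq_zero_iff_dvd]; simpa using hy)
  simpa using h2

/-- S1 shift: f(n+pt) = f(n) θ(t c n^{-(K+1)}) -/
lemma s1_shift {p a : ℕ} [Fact p.Prime] (hp : p.Prime) (ha : 2 ≤ a) (ψ : DirichletCharacter ℂ (p ^ a))
    (s : List ℤ) (hs : ∀ x ∈ s, (p : ℤ) ∣ x) (Cc : ℤ) (e : ℕ) (he : 1 ≤ e) (he2 : e + 1 ≤ a) (hprod : p ^ e * s.prod = p ^ (a - 1) * Cc) (n t : ℤ) :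
    dl s (cz ψ) (n + p ^ e * t) = dl s (cz ψ) n * theta hp ha ψ ((t : ZMod p) *
      ((Cc * ((-1) ^ s.length * s.length.factorial) : ℤ) : ZMod p) * ((n : ZMod p)⁻¹) ^ (s.length + 1)) := by
  by_cases hn : (p:ℤ) ∣ n
  · rw [dl_zero hp (by omega) ψ s hs n hn, dl_zero hp (by omega) ψ s hs, zero_mul]
    exact dvd_add hn ((dvd_pow_self _ (by omega)).mul_right _)
  obtain ⟨n', hn'⟩ := exists_inv (a := a) hp n hn
  have hn0 : (n : ZMod p) ≠ 0 := by rwa [Ne, ZMod.intCast_zmod_eq_zero_iff_dvd]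
  have hinv : (n : ZMod p)⁻¹ = (n' : ZMod p) := by
    apply inv_eq_of_mul_eq_one_right
    rw [← sub_eq_zero]
    have : ((n * n' - 1 : ℤ) : ZMod p) = 0 := by
      rw [ZMod.intCast_zmod_eq_zero_iff_dvd]
      refine dvd_trans ?_ hn'
      exact_mod_cast dvd_pow_self p (by omega)
    push_cast at this; exact this
  have h2 : a - 1 + 1 = a := by omega
  have h3 : (p:ℤ) ^ (a - 1) * p = p ^ a := by rw [← pow_succ, h2]
  rw [dl_shift hp (le_refl 1) (by omega) ψ s (p ^ e * t) (by simpa using hs) ?_ ?_ n n' hn']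
  · congr 1
    rw [hinv]
    have h4 := theta_int hp ha ψ (t * (Cc * ((-1) ^ s.length * s.length.factorial)) * n' ^ (s.length + 1))
    push_cast at h4 ⊢
    rw [← h4]
    congr 2
    linear_combination t * ((-1) ^ s.length * s.length.factorial * n' ^ (s.length + 1)) * hprod
  · simp only [pow_one]
    exact (dvd_pow_self _ (by omega)).mul_right _
  · refine ⟨t * Cc, ?_⟩
    push_cast
    linear_combination (t * p) * hprod + t * Cc * h3

end CS

namespace CS

def sg (b : Bool) (z : ℂ) : ℂ := if b then z else (starRingEnd ℂ) z

lemma sg_not (b : Bool) (z : ℂ) : (starRingEnd ℂ) (sg b z) = sg (!b) z := by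
  cases b <;> simp [sg]

lemma sg_mul (b : Bool) (z w : ℂ) : sg b (z * w) = sg b z * sg b w := by
  cases b <;> simp [sg]

/-- signed cube -/
def Sc {G : Type*} [AddCommGroup G] : List G → List (G × Bool)
  | [] => [(0, true)]
  | h :: hs => (Sc hs).map (fun x => (x.1 + h, x.2)) ++ (Sc hs).map (fun x => (x.1, !x.2))

lemma Sc_length {G : Type*} [AddCommGroup G] (hs : List G) : (Sc hs).length = 2 ^ hs.length := by
  induction hs with
  | nil => simp [Sc]
  | cons h hs ih => simp [Sc, ih, pow_succ]; ring

lemma Sc_zero {G : Type*} [AddCommGroup G] (hs : List G) : ∃ b, ((0 : G), b) ∈ Sc hs := by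
  induction hs with
  | nil => simp [Sc]
  | cons h hs ih =>
    obtain ⟨b, hb⟩ := ih
    refine ⟨!b, ?_⟩
    simp only [Sc, List.mem_append, List.mem_map]
    exact Or.inr ⟨_, hb, rfl⟩

lemma dl_Sc {G : Type*} [AddCommGroup G] (f : G → ℂ) (hs : List G) : ∀ n,
    dl hs f n = ((Sc hs).map (fun x => sg x.2 (f (n + x.1)))).prod := by
  induction hs with
  | nil => intro n; simp [dl, Sc, sg]
  | cons h hs ih =>
    intro n
    simp only [dl, Dl, Sc, List.map_append, List.prod_append, List.map_map]
    rw [ih, ih, map_list_prod, List.map_map]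
    congr 3
    · funext x
      simp only [Function.comp]
      rw [add_assoc, add_comm h]
    · funext x
      simp only [Function.comp]
      rw [sg_not]

def Nd {G H : Type*} [AddCommGroup G] [AddCommGroup H] (π : G →+ H) (hs : List G) : Prop :=
  ((Sc hs).map (fun x => π x.1)).Nodup

lemma Nd_nil {G H : Type*} [AddCommGroup G] [AddCommGroup H] (π : G →+ H) : Nd π [] := by
  simp [Nd, Sc]

lemma Nd_cons {G H : Type*} [AddCommGroup G] [AddCommGroup H] (π : G →+ H) (h : G) (hs : List G)
    (h1 : Nd π hs) (h2 : ∀ x ∈ Sc hs, ∀ y ∈ Sc hs, π h ≠ π y.1 - π x.1) : Nd π (h :: hs) := by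
  unfold Nd at *
  rw [Sc]
  rw [List.map_append, List.map_map, List.map_map, List.nodup_append]
  refine ⟨?_, ?_, ?_⟩
  · have : (Sc hs).map ((fun x : G × Bool => π x.1) ∘ (fun x => (x.1 + h, x.2))) =
      ((Sc hs).map (fun x => π x.1)).map (fun y => y + π h) := by
      rw [List.map_map]; apply List.map_congr_left; intro x _; simp
    rw [this]
    exact h1.map (add_left_injective _)
  · exact h1
  · intro a ha b hb
    simp only [List.mem_map, Function.comp] at ha hb
    obtain ⟨x, hx, rfl⟩ := ha
    obtain ⟨y, hy, rfl⟩ := hb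
    intro h3
    apply h2 x hx y hy
    rw [map_add] at h3
    rw [← h3]; abel

lemma fiber_card {G : Type*} [AddCommGroup G] [Fintype G] {p : ℕ} [NeZero p] [DecidableEq G] (π : G →+ ZMod p)
    (hπ : Function.Surjective π) (y : ZMod p) :
    (((Finset.univ.filter (fun g => π g = y)).card : ℕ) : ℝ) = Fintype.card G / p := by
  have h1 : ∀ z, (Finset.univ.filter (fun g => π g = z)).card = (Finset.univ.filter (fun g => π g = y)).card := by
    intro z
    obtain ⟨g0, hg0⟩ := hπ (y - z)
    refine Finset.card_bij (fun g _ => g + g0) ?_ ?_ ?_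
    · intro a ha
      simp at ha ⊢
      rw [ha, hg0]; abel
    · intro a _ b _ h; exact add_right_cancel h
    · intro b hb
      simp at hb
      refine ⟨b - g0, ?_, by abel⟩
      simp [hb, hg0]
  have h2 : Fintype.card G = ∑ z : ZMod p, (Finset.univ.filter (fun g => π g = z)).card := by
    rw [← Finset.card_univ]
    exact Finset.card_eq_sum_card_fiberwise (fun _ _ => Finset.mem_coe.2 (Finset.mem_univ _))
  rw [Finset.sum_congr rfl (fun z _ => h1 z), Finset.sum_const, Finset.card_univ, ZMod.card] at h2
  have hp : (p : ℝ) ≠ 0 := by exact_mod_cast NeZero.ne p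
  rw [h2]
  simp only [nsmul_eq_mul]
  push_cast
  field_simp

lemma pre_card {G : Type*} [AddCommGroup G] [Fintype G] {p : ℕ} [NeZero p] [DecidableEq G] (π : G →+ ZMod p)
    (hπ : Function.Surjective π) (B : Finset (ZMod p)) :
    (((Finset.univ.filter (fun g => π g ∈ B)).card : ℕ) : ℝ) = B.card * (Fintype.card G / p) := by
  have : (Finset.univ.filter (fun g => π g ∈ B)).card = ∑ z ∈ B, (Finset.univ.filter (fun g => π g = z)).card := by
    rw [Finset.card_eq_sum_card_fiberwise (f := π) (t := B)]
    · apply Finset.sum_congr rfl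
      intro z hz
      congr 1
      ext g
      simp only [Finset.mem_filter, Finset.mem_univ, true_and]
      constructor
      · exact fun h => h.2
      · exact fun h => ⟨h ▸ hz, h⟩
    · intro g hg
      simpa using hg
  rw [this]; push_cast
  rw [Finset.sum_congr rfl (fun z _ => fiber_card π hπ z), Finset.sum_const, nsmul_eq_mul]

lemma U_le_one {G : Type*} [AddCommGroup G] [Fintype G] (k : ℕ) : ∀ f : G → ℂ, (∀ g, ‖f g‖ ≤ 1) → U k f ≤ 1 := by
  induction k with
  | zero =>
    intro f hf
    rw [U]
    apply div_le_one_of_le₀ _ (Nat.cast_nonneg _)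
    refine (norm_sum_le _ _).trans ((Finset.sum_le_sum fun i _ => hf _).trans ?_)
    simp
  | succ k ih =>
    intro f hf
    rw [U]
    apply div_le_one_of_le₀ _ (Nat.cast_nonneg _)
    refine (Finset.sum_le_sum fun i _ => ih _ (Dl_norm_le _ _ hf)).trans ?_
    simp

lemma U_bad {G : Type*} [AddCommGroup G] [Fintype G] {p : ℕ} [NeZero p] (π : G →+ ZMod p)
    (hπ : Function.Surjective π) (f : G → ℂ) (hf : ∀ g, ‖f g‖ ≤ 1) (β : ℝ) (hβ : 0 ≤ β) (k : ℕ) : ∀ (hs : List G),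
    Nd π hs → (∀ hs' : List G, hs'.length = hs.length + k → Nd π hs' → ‖∑ x, dl hs' f x‖ / Fintype.card G ≤ β) →
    U k (dl hs f) ≤ β + (∑ i ∈ Finset.range k, 4 ^ (hs.length + i)) / p := by
  classical
  have hG : (0:ℝ) < Fintype.card G := by exact_mod_cast Fintype.card_pos
  have hp : (0:ℝ) < p := by exact_mod_cast Nat.pos_of_ne_zero (NeZero.ne p)
  induction k with
  | zero =>
    intro hs h1 h2
    simpa [U] using h2 hs rfl h1
  | succ k ih =>
    intro hs h1 h2
    rw [U]
    set B : Finset (ZMod p) := ((Sc hs).toFinset ×ˢ (Sc hs).toFinset).image (fun z => π z.2.1 - π z.1.1) with hB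
    have hBc : (B.card : ℝ) ≤ 4 ^ hs.length := by
      have : B.card ≤ 2 ^ hs.length * 2 ^ hs.length := by
        refine Finset.card_image_le.trans ?_
        rw [Finset.card_product]
        have := List.toFinset_card_le (Sc hs)
        rw [Sc_length] at this
        exact Nat.mul_le_mul this this
      calc (B.card : ℝ) ≤ ((2 ^ hs.length * 2 ^ hs.length : ℕ) : ℝ) := by exact_mod_cast this
        _ = 4 ^ hs.length := by push_cast; rw [← mul_pow]; norm_num
    set γ : ℝ := β + (∑ i ∈ Finset.range k, 4 ^ (hs.length + 1 + i)) / p with hγ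
    have hγ0 : 0 ≤ γ := by positivity
    have key : ∀ h : G, U k (Dl h (dl hs f)) ≤ γ + (if π h ∈ B then 1 else 0) := by
      intro h
      by_cases hh : π h ∈ B
      · rw [if_pos hh]
        have := U_le_one k (Dl h (dl hs f)) (Dl_norm_le _ _ (dl_norm_le _ _ hf))
        linarith
      · rw [if_neg hh, add_zero]
        refine ih (h :: hs) (Nd_cons π h hs h1 ?_) ?_
        · intro x hx y hy h3
          apply hh
          rw [hB, Finset.mem_image]
          exact ⟨(x, y), by simp [hx, hy], h3.symm⟩
        · intro hs' h4 h5
          exact h2 hs' (by simp at h4; omega) h5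
    have h6 : ∑ h : G, U k (Dl h (dl hs f)) ≤ Fintype.card G * γ + B.card * (Fintype.card G / p) := by
      refine (Finset.sum_le_sum fun h _ => key h).trans ?_
      rw [Finset.sum_add_distrib, Finset.sum_const, Finset.card_univ, nsmul_eq_mul, ← Finset.sum_filter, Finset.sum_const, nsmul_eq_mul, mul_one,
        pre_card π hπ]
    rw [div_le_iff₀ hG]
    refine h6.trans ?_
    have h7 : (∑ i ∈ Finset.range (k+1), (4:ℝ) ^ (hs.length + i)) = 4 ^ hs.length + ∑ i ∈ Finset.range k, (4:ℝ) ^ (hs.length + 1 + i) := by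
      rw [Finset.sum_range_succ']; simp; rw [add_comm]; congr 1
      apply Finset.sum_congr rfl; intro i _; ring
    rw [h7]
    have h8 : (B.card:ℝ) * (Fintype.card G / p) ≤ 4 ^ hs.length * (Fintype.card G / p) := by gcongr
    calc _ ≤ Fintype.card G * γ + 4 ^ hs.length * (Fintype.card G / p) := by linarith
      _ = _ := by rw [hγ]; field_simp; ring

lemma U_bad' {G : Type*} [AddCommGroup G] [Fintype G] {p : ℕ} [NeZero p] (π : G →+ ZMod p)
    (hπ : Function.Surjective π) (f : G → ℂ) (hf : ∀ g, ‖f g‖ ≤ 1) (β : ℝ) (hβ : 0 ≤ β) (k : ℕ)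
    (h : ∀ hs' : List G, hs'.length = k → Nd π hs' → ‖∑ x, dl hs' f x‖ / Fintype.card G ≤ β) :
    U k f ≤ β + 4 ^ k / p := by
  refine (U_bad π hπ f hf β hβ k [] (Nd_nil π) (by simpa using h)).trans ?_
  gcongr
  simp only [List.length_nil, zero_add]
  rw [geom_sum_eq (by norm_num)]
  have : (1:ℝ) ≤ 4 ^ k := one_le_pow₀ (by norm_num)
  rw [div_le_iff₀ (by norm_num)]; linarith

end CS

namespace CS

lemma dl_finset {G : Type*} [AddCommGroup G] [DecidableEq G] (f : G → ℂ) (hs : List G) (hn : (Sc hs).Nodup) (n : G) :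
    dl hs f n = ∏ x ∈ (Sc hs).toFinset, sg x.2 (f (n + x.1)) := by
  rw [dl_Sc, List.prod_toFinset _ hn]

lemma Nd_nodup {G H : Type*} [AddCommGroup G] [AddCommGroup H] (π : G →+ H) (hs : List G) (h : Nd π hs) :
    (Sc hs).Nodup := List.Nodup.of_map _ h

lemma Nd_inj {G H : Type*} [AddCommGroup G] [AddCommGroup H] (π : G →+ H) (hs : List G) (h : Nd π hs) :
    ∀ x ∈ Sc hs, ∀ y ∈ Sc hs, π x.1 = π y.1 → x = y :=
  List.inj_on_of_nodup_map h

/-- generic L1 -/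
lemma L1_gen (p : ℕ) [Fact p.Prime] (ψ : MulChar (ZMod p) ℂ) (hψ : ψ ≠ 1) (A : Finset (ZMod p)) (h0 : 0 ∈ A)
    (e : ZMod p → ℕ) (he : ∀ a ∈ A, 1 ≤ e a) (hd : orderOf ψ ∣ ∑ a ∈ A, e a) (hc : Nat.Coprime (e 0) (orderOf ψ)) :
    ‖∑ n, ∏ a ∈ A, ψ (n + a) ^ (e a)‖ ≤ A.card * Real.sqrt p + 1 := by
  classical
  set B := (A.erase 0).image (fun a => a⁻¹) with hB
  have hinj : Set.InjOn (fun a : ZMod p => a⁻¹) (A.erase 0 : Finset (ZMod p)) := fun x _ y _ h => inv_injective h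
  have hsum : ∑ b ∈ B, e b⁻¹ = ∑ a ∈ A.erase 0, e a := by
    rw [hB, Finset.sum_image hinj]; simp
  have hs2 : e 0 + ∑ a ∈ A.erase 0, e a = ∑ a ∈ A, e a := Finset.add_sum_erase _ _ h0
  have hw := WeilS.weil p ψ hψ B (fun b => e b⁻¹) ?_ ?_
  rotate_left
  · intro b hb
    rw [hB, Finset.mem_image] at hb
    obtain ⟨a, ha, rfl⟩ := hb
    simpa using he a (Finset.mem_of_mem_erase ha)
  · rw [hsum]
    rw [← hs2] at hd
    have h1 := (Nat.Coprime.coprime_dvd_left (Nat.gcd_dvd_right (∑ a ∈ A.erase 0, e a) (orderOf ψ)) (Nat.Coprime.symm hc))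
    have h2 : Nat.gcd (∑ a ∈ A.erase 0, e a) (orderOf ψ) ∣ e 0 := by
      have h3 := (Nat.gcd_dvd_right (∑ a ∈ A.erase 0, e a) (orderOf ψ)).trans hd
      exact (Nat.dvd_add_left (Nat.gcd_dvd_left _ _)).1 h3
    exact Nat.Coprime.eq_one_of_dvd h1 h2
  have hψu : ∀ y : ZMod p, y ≠ 0 → ψ y ^ (∑ a ∈ A, e a) = 1 := by
    intro y hy
    obtain ⟨c, hc⟩ := hd
    rw [hc, pow_mul, ← MulChar.pow_apply' ψ, pow_orderOf_eq_one, MulChar.one_apply (Ne.isUnit hy), one_pow]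
    exact (orderOf_pos ψ).ne'
  have hprod : ∀ y : ZMod p, y ≠ 0 → ∏ a ∈ A, ψ (y⁻¹ + a) ^ (e a) = ∏ a ∈ A, ψ (1 + a * y) ^ (e a) := by
    intro y hy
    have h1 : ∀ a, ψ (1 + a * y) ^ (e a) = ψ (y⁻¹ + a) ^ (e a) * ψ y ^ (e a) := by
      intro a
      rw [← mul_pow, ← map_mul]; congr 2; field_simp
    rw [Finset.prod_congr rfl (fun a _ => h1 a), Finset.prod_mul_distrib, Finset.prod_pow_eq_pow_sum, hψu y hy, mul_one]
  have hz : ∏ a ∈ A, ψ (0 + a) ^ (e a) = 0 := by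
    apply Finset.prod_eq_zero h0
    rw [add_zero, MulChar.map_zero, zero_pow (by have := he 0 h0; omega)]
  have e1 : ∑ n, ∏ a ∈ A, ψ (n + a) ^ (e a) = ∑ y ∈ Finset.univ.erase (0 : ZMod p), ∏ a ∈ A, ψ (1 + a * y) ^ (e a) := by
    rw [← Finset.add_sum_erase _ _ (Finset.mem_univ (0 : ZMod p)), hz, zero_add]
    refine Finset.sum_nbij' (fun n => n⁻¹) (fun n => n⁻¹) ?_ ?_ ?_ ?_ ?_
    · intro a ha; simpa using ha
    · intro a ha; simpa using ha
    · intro a _; simp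
    · intro a _; simp
    · intro a ha
      rw [← hprod a⁻¹ (by simpa using ha), inv_inv]
  have e2 : ∑ y : ZMod p, ∏ a ∈ A, ψ (1 + a * y) ^ (e a) = 1 + ∑ y ∈ Finset.univ.erase (0 : ZMod p), ∏ a ∈ A, ψ (1 + a * y) ^ (e a) := by
    rw [← Finset.add_sum_erase _ _ (Finset.mem_univ (0 : ZMod p))]
    simp
  have e3 : ∑ y : ZMod p, ∏ a ∈ A, ψ (1 + a * y) ^ (e a) = (∏ a ∈ A.erase 0, ψ a ^ (e a)) * ∑ x, ∏ b ∈ B, ψ (b - x) ^ (e b⁻¹) := by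
    rw [Finset.mul_sum]
    refine Fintype.sum_equiv (Equiv.neg _) _ _ ?_
    intro y
    rw [hB, Finset.prod_image hinj, ← Finset.prod_mul_distrib, ← Finset.mul_prod_erase _ _ h0]
    simp only [zero_mul, add_zero, map_one, one_pow, one_mul, inv_inv]
    apply Finset.prod_congr rfl
    intro a ha
    rw [← mul_pow, ← map_mul]
    congr 2
    have : a ≠ 0 := Finset.ne_of_mem_erase ha
    simp only [Equiv.neg_apply]
    field_simp
    ring
  have hψ1 : ∀ z : ZMod p, ‖ψ z‖ ≤ 1 := DirichletCharacter.norm_le_one ψ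
  have hn : ‖∏ a ∈ A.erase 0, ψ a ^ (e a)‖ ≤ 1 := by
    rw [norm_prod]
    apply Finset.prod_le_one (fun _ _ => norm_nonneg _)
    intro a _
    rw [norm_pow]; exact pow_le_one₀ (norm_nonneg _) (hψ1 a)
  have hBc : (B.card : ℝ) ≤ A.card := by
    have : B.card ≤ A.card := Finset.card_image_le.trans (Finset.card_le_card (Finset.erase_subset _ _))
    exact_mod_cast this
  have e4 : ∑ n, ∏ a ∈ A, ψ (n + a) ^ (e a) = (∏ a ∈ A.erase 0, ψ a ^ (e a)) * ∑ x, ∏ b ∈ B, ψ (b - x) ^ (e b⁻¹) - 1 := by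
    rw [e1, ← e3, e2]; ring
  rw [e4]
  refine (norm_sub_le _ _).trans ?_
  rw [norm_mul, norm_one]
  have : ‖∏ a ∈ A.erase 0, ψ a ^ (e a)‖ * ‖∑ x, ∏ b ∈ B, ψ (b - x) ^ (e b⁻¹)‖ ≤ 1 * (A.card * Real.sqrt p) := by
    apply mul_le_mul hn (hw.trans _) (norm_nonneg _) zero_le_one
    gcongr
  linarith

lemma Sc_sum {G : Type*} [AddCommGroup G] (hs : List G) (h : hs ≠ []) (d : ℕ) (hd : 1 ≤ d) :
    d ∣ ((Sc hs).map (fun x => if x.2 then 1 else d - 1)).sum := by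
  cases hs with
  | nil => exact absurd rfl h
  | cons g hs =>
    rw [Sc, List.map_append, List.map_map, List.map_map, List.sum_append]
    generalize Sc hs = l
    induction l with
    | nil => simp
    | cons x l ih =>
      obtain ⟨c, hc⟩ := ih
      simp only [List.map_cons, List.sum_cons, Function.comp] at hc ⊢
      refine ⟨c + 1, ?_⟩
      rw [mul_add, ← hc]
      obtain ⟨x1, x2⟩ := x
      cases x2 <;> simp <;> omega

lemma L1 (p : ℕ) [Fact p.Prime] (ψ : MulChar (ZMod p) ℂ) (hψ : ψ ≠ 1) (k : ℕ) :
    U k (fun n => ψ n) ≤ (2 ^ k * Real.sqrt p + 1 + 4 ^ k) / p := by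
  classical
  have hp : (0:ℝ) < p := by exact_mod_cast (Fact.out : p.Prime).pos
  have hψ1 : ∀ z : ZMod p, ‖ψ z‖ ≤ 1 := DirichletCharacter.norm_le_one ψ
  have := U_bad' (AddMonoidHom.id (ZMod p)) (fun x => ⟨x, rfl⟩) (fun n => ψ n) hψ1 ((2 ^ k * Real.sqrt p + 1) / p) (by positivity) k ?_
  · refine this.trans (le_of_eq ?_); ring
  intro hs hk hN
  rw [ZMod.card]
  gcongr
  by_cases hs0 : hs = []
  · subst hs0
    simp only [dl]
    rw [MulChar.sum_eq_zero_of_ne_one hψ, norm_zero]; positivity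
  set d := orderOf ψ with hdd
  have hd2 : 2 ≤ d := by
    have h1 : 0 < d := orderOf_pos ψ
    have h2 : d ≠ 1 := by rw [hdd, Ne, orderOf_eq_one_iff]; exact hψ
    omega
  have hconj : ∀ z : ZMod p, (starRingEnd ℂ) (ψ z) = ψ z ^ (d - 1) := by
    intro z
    by_cases hz : z = 0
    · rw [hz, MulChar.map_zero, zero_pow (by omega)]; simp
    · have h1 : ψ z ^ (d - 1) * ψ z = 1 := by
        rw [← pow_succ, show d - 1 + 1 = d by omega, ← MulChar.pow_apply' ψ (by omega), hdd, pow_orderOf_eq_one, MulChar.one_apply (Ne.isUnit hz)]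
      have h2 : (starRingEnd ℂ) (ψ z) * ψ z = 1 := by
        rw [mul_comm, Complex.mul_conj, Complex.normSq_eq_norm_sq]
        have : ‖ψ z‖ = 1 := by
          have h3 : ‖ψ z‖ ^ d = 1 := by
            rw [← norm_pow, ← MulChar.pow_apply' ψ (by omega), hdd, pow_orderOf_eq_one, MulChar.one_apply (Ne.isUnit hz), norm_one]
          exact (pow_eq_one_iff_of_nonneg (norm_nonneg _) (by omega)).1 h3
        rw [this]; simp
      have h0 : ψ z ≠ 0 := right_ne_zero_of_mul_eq_one h2
      exact mul_right_cancel₀ h0 (h2.trans h1.symm)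
  have hnd := Nd_nodup _ _ hN
  set A := (Sc hs).toFinset.image Prod.fst with hA
  have hinj : Set.InjOn (Prod.fst : ZMod p × Bool → ZMod p) ((Sc hs).toFinset : Finset _) := by
    intro x hx y hy h
    exact Nd_inj _ _ hN x (by simpa using hx) y (by simpa using hy) h
  set e : ZMod p → ℕ := fun a => if (a, true) ∈ Sc hs then 1 else d - 1 with he
  have hex : ∀ x ∈ Sc hs, e x.1 = if x.2 then 1 else d - 1 := by
    rintro ⟨a, b⟩ hx
    cases b
    · simp only [he]
      rw [if_neg]
      · simp
      · intro h
        have := Nd_inj _ _ hN _ hx _ h rfl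
        simp at this
    · simp [he, hx]
  have hg := L1_gen p ψ hψ A ?_ e ?_ ?_ ?_
  · have e1 : ∀ n, dl hs (fun n => ψ n) n = ∏ a ∈ A, ψ (n + a) ^ (e a) := by
      intro n
      rw [dl_finset _ _ hnd, hA, Finset.prod_image hinj]
      apply Finset.prod_congr rfl
      intro x hx
      rw [hex x (by simpa using hx)]
      obtain ⟨a, b⟩ := x
      cases b
      · simp [sg, hconj]
      · simp [sg]
    rw [Finset.sum_congr rfl (fun n _ => e1 n)]
    refine hg.trans ?_
    have : (A.card : ℝ) ≤ 2 ^ k := by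
      have : A.card ≤ 2 ^ k := by
        refine Finset.card_image_le.trans ?_
        refine (List.toFinset_card_le _).trans ?_
        rw [Sc_length, hk]
      exact_mod_cast this
    gcongr
  · obtain ⟨b, hb⟩ := Sc_zero hs
    rw [hA, Finset.mem_image]
    exact ⟨_, by simpa using hb, rfl⟩
  · intro a _
    simp only [he]; split_ifs <;> omega
  · rw [hA, Finset.sum_image hinj, Finset.sum_congr rfl (fun x hx => hex x (by simpa using hx)), List.sum_toFinset _ hnd]
    exact Sc_sum hs hs0 d (by omega)
  · simp only [he]
    split_ifs
    · simp
    · rw [← hdd]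
      have h9 : ∀ m : ℕ, Nat.Coprime (m + 1 - 1) (m + 1) := by intro m; simp
      have := h9 (d - 1)
      rwa [show d - 1 + 1 = d by omega] at this


/-- zeros of signed sums of poles -/
lemma poles {p : ℕ} [Fact p.Prime] {ι : Type*} [DecidableEq ι] (A : Finset ι) (hA : A.Nonempty) (v : ι → ZMod p) (hv : Set.InjOn v A)
    (ε : ι → ZMod p) (hε : ∀ i ∈ A, ε i ≠ 0) (J : ℕ) (hJ : 1 ≤ J) :
    ∃ B : Finset (ZMod p), B.card ≤ A.card * J ∧
      ∀ m, (∀ i ∈ A, m + v i ≠ 0) → ∑ i ∈ A, ε i * (m + v i)⁻¹ ^ J = 0 → m ∈ B := by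
  classical
  set Q : Polynomial (ZMod p) := ∑ i ∈ A, Polynomial.C (ε i) * ∏ j ∈ A.erase i, (Polynomial.X + Polynomial.C (v j)) ^ J with hQ
  have hev : ∀ m, Q.eval m = ∑ i ∈ A, ε i * ∏ j ∈ A.erase i, (m + v j) ^ J := by
    intro m
    rw [hQ, Polynomial.eval_finsetSum]
    apply Finset.sum_congr rfl
    intro i _
    rw [Polynomial.eval_mul, Polynomial.eval_C, Polynomial.eval_prod]
    simp
  have hQ0 : Q ≠ 0 := by
    obtain ⟨i0, hi0⟩ := hA
    intro h
    have h1 := hev (-(v i0))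
    rw [h, Polynomial.eval_zero, Finset.sum_eq_single_of_mem i0 hi0] at h1
    · symm at h1
      rw [mul_eq_zero, Finset.prod_eq_zero_iff] at h1
      rcases h1 with h1 | ⟨j, hj, h1⟩
      · exact hε i0 hi0 h1
      · have h2 := (pow_eq_zero_iff (by omega)).1 h1
        have h3 : v j = v i0 := by linear_combination h2
        exact Finset.ne_of_mem_erase hj (hv (Finset.mem_of_mem_erase hj) hi0 h3)
    · intro j _ hj
      rw [Finset.prod_eq_zero (i := i0) (Finset.mem_erase.2 ⟨hj.symm, hi0⟩), mul_zero]
      rw [neg_add_cancel, zero_pow (by omega)]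
  refine ⟨Q.roots.toFinset, ?_, ?_⟩
  · refine (Multiset.toFinset_card_le _).trans ((Polynomial.card_roots' _).trans ?_)
    rw [hQ]
    apply Polynomial.natDegree_sum_le_of_forall_le
    intro i hi
    refine (Polynomial.natDegree_C_mul_le _ _).trans ((Polynomial.natDegree_prod_le _ _).trans ?_)
    have : ∀ j ∈ A.erase i, ((Polynomial.X + Polynomial.C (v j)) ^ J).natDegree ≤ J := by
      intro j _
      refine Polynomial.natDegree_pow_le.trans ?_
      rw [Polynomial.natDegree_X_add_C, mul_one]
    refine (Finset.sum_le_sum this).trans ?_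
    rw [Finset.sum_const, smul_eq_mul]
    exact Nat.mul_le_mul_right _ (Finset.card_le_card (Finset.erase_subset _ _))
  · intro m hm hs
    rw [Multiset.mem_toFinset, Polynomial.mem_roots hQ0, Polynomial.IsRoot, hev]
    have : ∑ i ∈ A, ε i * ∏ j ∈ A.erase i, (m + v j) ^ J = (∏ j ∈ A, (m + v j) ^ J) * ∑ i ∈ A, ε i * (m + v i)⁻¹ ^ J := by
      rw [Finset.mul_sum]
      apply Finset.sum_congr rfl
      intro i hi
      rw [← Finset.mul_prod_erase _ _ hi]
      have h1 : (m + v i) ^ J * (m + v i)⁻¹ ^ J = 1 := by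
        rw [← mul_pow, mul_inv_cancel₀ (hm i hi), one_pow]
      linear_combination (-(ε i * ∏ j ∈ A.erase i, (m + v j) ^ J)) * h1
    rw [this, hs, mul_zero]

def sn (b : Bool) {p : ℕ} : ZMod p := if b then 1 else -1

lemma addchar_sum {A : Type*} [AddCommGroup A] {ι : Type*} [DecidableEq ι] (θ : AddChar A ℂ) (s : Finset ι) (g : ι → A) :
    θ (∑ i ∈ s, g i) = ∏ i ∈ s, θ (g i) := by
  induction s using Finset.induction_on with
  | empty => simp
  | insert a s ha ih => rw [Finset.sum_insert ha, Finset.prod_insert ha, AddChar.map_add_eq_mul, ih]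

lemma L2 {p e : ℕ} [Fact p.Prime] (he : 2 ≤ e) (f : ZMod (p ^ e) → ℂ) (hf : ∀ g, ‖f g‖ ≤ 1)
    (hz : ∀ n : ℤ, (p:ℤ) ∣ n → f n = 0) (θ : AddChar (ZMod p) ℂ) (hθ : ∀ y, y ≠ 0 → θ y ≠ 1) (c : ZMod p) (hc : c ≠ 0)
    (J : ℕ) (hJ : 1 ≤ J)
    (hsh : ∀ n t : ℤ, f ((n + p ^ (e - 1) * t : ℤ)) = f n * θ (t * c * ((n : ZMod p)⁻¹) ^ J)) (k : ℕ) :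
    U k f ≤ (2 ^ k * J + 4 ^ k) / p := by
  classical
  have hpp : p.Prime := Fact.out
  have : NeZero (p ^ e) := ⟨pow_ne_zero _ hpp.ne_zero⟩
  have hp : (0:ℝ) < p := by exact_mod_cast hpp.pos
  have hpe : p ∣ p ^ e := dvd_pow_self p (by omega)
  set ρ := ZMod.castHom hpe (ZMod p) with hρ
  have hsurj : Function.Surjective ρ.toAddMonoidHom := ZMod.castHom_surjective hpe
  have := U_bad' ρ.toAddMonoidHom hsurj f hf (2 ^ k * J / p) (by positivity) k ?_
  · refine this.trans (le_of_eq ?_); ring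
  intro hs hk hN
  have hnd := Nd_nodup _ _ hN
  have hInt0 : ∀ g : ZMod (p ^ e), ∃ n : ℤ, (n : ZMod (p ^ e)) = g := ZMod.intCast_surjective
  have hρi : ∀ n : ℤ, ρ (n : ZMod (p ^ e)) = (n : ZMod p) := fun n => by simp
  have hz' : ∀ g, ρ g = 0 → f g = 0 := by
    intro g hg
    obtain ⟨n, rfl⟩ := hInt0 g
    rw [hρi, ZMod.intCast_zmod_eq_zero_iff_dvd] at hg
    exact hz n hg
  have hsh' : ∀ (g : ZMod (p ^ e)) (t : ℤ), f (g + p ^ (e - 1) * t) = f g * θ (t * c * (ρ g)⁻¹ ^ J) := by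
    intro g t
    obtain ⟨n, rfl⟩ := hInt0 g
    rw [hρi, ← hsh]; push_cast; rfl
  set A := (Sc hs).toFinset with hA
  have hAne : A.Nonempty := by
    obtain ⟨b, hb⟩ := Sc_zero hs
    exact ⟨_, by rw [hA, List.mem_toFinset]; exact hb⟩
  have hinj : Set.InjOn (fun x : ZMod (p ^ e) × Bool => ρ x.1) (A : Finset _) := by
    intro x hx y hy h
    exact Nd_inj _ _ hN x (by simpa [hA] using hx) y (by simpa [hA] using hy) h
  set R : ZMod p → ZMod p := fun m => ∑ x ∈ A, (c * sn x.2) * (m + ρ x.1)⁻¹ ^ J with hR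
  obtain ⟨B, hBc, hB⟩ := poles A hAne (fun x => ρ x.1) hinj (fun x => c * sn x.2) (by
    rintro ⟨x, b⟩ _
    cases b <;> simp [sn, hc]) J hJ
  have hDsh : ∀ (g : ZMod (p ^ e)) (t : ℤ), dl hs f (g + p ^ (e - 1) * t) = dl hs f g * θ (t * R (ρ g)) := by
    intro g t
    rw [dl_finset _ _ hnd, dl_finset _ _ hnd]
    have h1 : θ (t * R (ρ g)) = ∏ x ∈ A, sg x.2 (θ (t * c * (ρ (g + x.1))⁻¹ ^ J)) := by
      have h2 : (t : ZMod p) * R (ρ g) = ∑ x ∈ A, sn x.2 * ((t : ZMod p) * c * (ρ (g + x.1))⁻¹ ^ J) := by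
        rw [hR, Finset.mul_sum]
        apply Finset.sum_congr rfl
        intro x _
        rw [map_add]; ring
      rw [h2, addchar_sum]
      apply Finset.prod_congr rfl
      rintro ⟨x, b⟩ _
      cases b
      · simp only [sn, sg]
        simp only [Bool.false_eq_true, if_false, neg_mul, one_mul]
        rw [AddChar.map_neg_eq_conj]
      · simp [sn, sg]
    rw [h1, ← Finset.prod_mul_distrib]
    apply Finset.prod_congr rfl
    intro x _
    rw [← sg_mul, ← hsh', add_right_comm]
  set S := ∑ g, dl hs f g with hS
  have hpS : (p : ℂ) * S = ∑ g, dl hs f g * ∑ t : ZMod p, θ (t * R (ρ g)) := by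
    have h1 : ∀ t : ZMod p, S = ∑ g, dl hs f g * θ (t * R (ρ g)) := by
      intro t
      obtain ⟨t', rfl⟩ := ZMod.intCast_surjective t
      rw [hS, ← Finset.sum_congr rfl (fun g _ => hDsh g t')]
      exact (Fintype.sum_equiv (Equiv.addRight _) _ _ (fun g => rfl)).symm
    have h2 : ∑ t : ZMod p, S = (p : ℂ) * S := by
      rw [Finset.sum_const, Finset.card_univ, ZMod.card, nsmul_eq_mul]
    rw [← h2, Finset.sum_congr rfl (fun t _ => h1 t), Finset.sum_comm]
    apply Finset.sum_congr rfl
    intro g _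
    rw [Finset.mul_sum]
  have hts : ∀ y : ZMod p, ∑ t : ZMod p, θ (t * y) = if y = 0 then (p : ℂ) else 0 := by
    intro y
    split_ifs with hy
    · subst hy; simp [ZMod.card]
    · have h1 : ∑ t : ZMod p, θ (t * y) = ∑ t, θ t :=
        Fintype.sum_equiv (Equiv.mulRight₀ y hy) _ _ (fun t => rfl)
      rw [h1]
      apply AddChar.sum_eq_zero_of_ne_one
      intro h
      exact hθ 1 one_ne_zero (by rw [h]; rfl)
  have hS2 : S = ∑ g, if R (ρ g) = 0 then dl hs f g else 0 := by
    have hpc : (p:ℂ) ≠ 0 := by exact_mod_cast hpp.ne_zero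
    apply mul_left_cancel₀ hpc
    rw [hpS, Finset.mul_sum]
    apply Finset.sum_congr rfl
    intro g _
    rw [hts]; split_ifs <;> ring
  have hcard : (0:ℝ) < Fintype.card (ZMod (p ^ e)) := by exact_mod_cast Fintype.card_pos
  have hnorm : ‖S‖ ≤ ((Finset.univ.filter (fun g => ρ.toAddMonoidHom g ∈ B)).card : ℝ) := by
    rw [hS2]
    refine (norm_sum_le _ _).trans ?_
    rw [Finset.card_filter]
    push_cast
    apply Finset.sum_le_sum
    intro g _
    split_ifs with h1 h2
    · exact dl_norm_le _ _ hf _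
    · rw [dl_finset _ _ hnd, norm_le_zero_iff]
      by_contra h3
      apply h2
      apply hB _ _ h1
      intro x hx h4
      apply h3
      apply Finset.prod_eq_zero hx
      rw [hz' _ (by rw [map_add]; exact h4)]
      simp [sg]
    · simp
    · simp
  rw [pre_card _ hsurj] at hnorm
  rw [div_le_iff₀ hcard]
  refine hnorm.trans ?_
  have h9 : (B.card : ℝ) ≤ 2 ^ k * J := by
    have h1 : A.card ≤ 2 ^ k := by
      refine (List.toFinset_card_le _).trans ?_
      rw [Sc_length, hk]
    have := hBc.trans (Nat.mul_le_mul_right J h1)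
    exact_mod_cast this
  calc (B.card : ℝ) * (Fintype.card (ZMod (p ^ e)) / p) ≤ (2 ^ k * J) * (Fintype.card (ZMod (p ^ e)) / p) := by gcongr
    _ = _ := by ring

end CS

namespace CS

lemma forall2_zip (ws : List ℕ) : ∀ vs : List ℕ, vs.length = ws.length →
    List.Forall₂ (fun w t => w ∣ t) ws (List.zipWith (fun v w => v * w) vs ws) := by
  induction ws with
  | nil => intro vs h; simp at h; subst h; simp
  | cons w ws ih =>
    intro vs h
    cases vs with
    | nil => simp at h
    | cons v vs =>
      simp only [List.zipWith_cons_cons]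
      refine List.Forall₂.cons (Dvd.intro_left v rfl) (ih vs (by simpa using h))

lemma mem_zip_le (Bv Bw : ℕ) : ∀ vs ws : List ℕ, (∀ v ∈ vs, v ≤ Bv) → (∀ w ∈ ws, w ≤ Bw) →
    ∀ t ∈ List.zipWith (fun v w => v * w) vs ws, t ≤ Bv * Bw := by
  intro vs
  induction vs with
  | nil => intro ws _ _ t ht; simp at ht
  | cons v vs ih =>
    intro ws hv hw t ht
    cases ws with
    | nil => simp at ht
    | cons w ws =>
      simp only [List.zipWith_cons_cons, List.mem_cons] at ht
      rcases ht with rfl | ht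
      · exact Nat.mul_le_mul (hv v (by simp)) (hw w (by simp))
      · exact ih ws (fun v hv' => hv v (by simp [hv'])) (fun w hw' => hw w (by simp [hw'])) t ht

lemma reduce (P V k r u : ℕ) (hP : 1 ≤ P) (hV : 1 ≤ V) (h : Nat.Coprime r u) (hu : u ≠ 0)
    (χ : DirichletCharacter ℂ (r * u)) (hsm : ∀ p : ℕ, p.Prime → p ∣ u → p ≤ P) (huV : u ≤ V ^ k) :
    ∃ ws : List ℕ, ws.length = k ∧ (∀ w ∈ ws, Nat.Coprime w r ∧ w ≤ V * P) ∧
      ∀ (vs : List ℕ) (Bv : ℕ), vs.length = k → (∀ v ∈ vs, v ≤ Bv) → ∀ (x : ℤ) (M X : ℕ), 0 < M → 0 < X →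
        ‖av x M (cz χ)‖ ^ (2 ^ k) ≤ Dm X (List.zipWith (fun v w => v * w) vs ws) (fun F => ‖av x M F‖) (cz (crtFst h χ)) +
          3 * 2 ^ k * (2 * ((Bv * (V * P) : ℕ) : ℝ) * X / M) := by
  have : NeZero u := ⟨hu⟩
  obtain ⟨ws, h1, h2, h3⟩ := factor_list P V hV hP k u hu hsm huV
  refine ⟨ws, h1, ?_, ?_⟩
  · intro w hw
    refine ⟨?_, h3 w hw⟩
    have : w ∣ u := h2 ▸ List.dvd_prod hw
    exact (Nat.Coprime.coprime_dvd_right this h).symm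
  · intro vs Bv hvs hB x M X hM hX
    have hl : (List.zipWith (fun v w => v * w) vs ws).length = k := by
      rw [List.length_zipWith, h1, hvs, min_self]
    have := elim x M X (Bv * (V * P)) hM hX _ ws (forall2_zip ws vs (by rw [hvs, h1]))
      (mem_zip_le Bv (V * P) vs ws hB h3) u (crtSnd h χ) [] (by rw [h2]; exact fun p _ h => h) (by rw [h2]; simp)
      (cz (crtFst h χ)) (cz_norm_le _)
    rw [hl] at this
    rw [crt_int h χ, mul_comm]
    exact this

lemma Phi_le (x : ℤ) (M : ℕ) : ∀ F : ℤ → ℂ, (∀ n, ‖F n‖ ≤ 1) → (fun F => ‖av x M F‖) F ≤ 1 :=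
  fun F hF => av_norm_le x M F hF

/-- product of shifts -/
lemma zip_prod : ∀ (ts : List ℕ) (hs : List ℤ), hs.length = ts.length →
    (List.zipWith (fun (t : ℕ) h => (t:ℤ) * h) ts hs).prod = (ts.prod : ℕ) * hs.prod := by
  intro ts
  induction ts with
  | nil => intro hs h; simp at h; subst h; simp
  | cons t ts ih =>
    intro hs h
    cases hs with
    | nil => simp at h
    | cons g hs =>
      simp only [List.zipWith_cons_cons, List.prod_cons]
      rw [ih hs (by simpa using h)]
      push_cast; ring

lemma zip_dvd (d : ℤ) : ∀ (ts : List ℕ) (hs : List ℤ), (∀ t ∈ ts, d ∣ (t:ℤ)) →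
    ∀ y ∈ List.zipWith (fun (t : ℕ) h => (t:ℤ) * h) ts hs, d ∣ y := by
  intro ts
  induction ts with
  | nil => intro hs _ y hy; simp at hy
  | cons t ts ih =>
    intro hs h y hy
    cases hs with
    | nil => simp at hy
    | cons g hs =>
      simp only [List.zipWith_cons_cons, List.mem_cons] at hy
      rcases hy with rfl | hy
      · exact (h t (by simp)).mul_right _
      · exact ih hs (fun t ht => h t (by simp [ht])) y hy

lemma zipmul_prod : ∀ (vs ws : List ℕ), vs.length = ws.length →
    (List.zipWith (fun v w => v * w) vs ws).prod = vs.prod * ws.prod := by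
  intro vs
  induction vs with
  | nil => intro ws h; simp at h; symm at h; simp at h; subst h; simp
  | cons t ts ih =>
    intro hs h
    cases hs with
    | nil => simp at h
    | cons g hs =>
      simp only [List.zipWith_cons_cons, List.prod_cons]
      rw [ih hs (by simpa using h)]
      ring

lemma not_dvd_mul {p : ℕ} (hp : p.Prime) (A B : ℕ) (x y : ℤ) (hx : ¬ (p:ℤ) ^ (A + 1) ∣ x) (hy : ¬ (p:ℤ) ^ (B + 1) ∣ y) :
    ¬ (p:ℤ) ^ (A + B + 1) ∣ x * y := by
  have hp' : Prime (p:ℤ) := Nat.prime_iff_prime_int.1 hp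
  have h1 := emultiplicity_lt_iff_not_dvd.2 hx
  have h2 := emultiplicity_lt_iff_not_dvd.2 hy
  rw [← emultiplicity_lt_iff_not_dvd, emultiplicity_mul hp']
  have e1 : emultiplicity (p:ℤ) x ≠ ⊤ := ne_top_of_lt h1
  have e2 : emultiplicity (p:ℤ) y ≠ ⊤ := ne_top_of_lt h2
  obtain ⟨m, hm⟩ := ENat.ne_top_iff_exists.1 e1
  obtain ⟨n, hn⟩ := ENat.ne_top_iff_exists.1 e2
  rw [← hm] at h1 ⊢
  rw [← hn] at h2 ⊢
  norm_cast at *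
  omega

/-- valuation bound for products of integers none divisible by `p^(g+1)` -/
lemma not_dvd_prod {p : ℕ} (hp : p.Prime) (g : ℕ) : ∀ hs : List ℤ, (∀ h ∈ hs, ¬ (p : ℤ) ^ (g + 1) ∣ h) →
    ¬ (p : ℤ) ^ (hs.length * g + 1) ∣ hs.prod := by
  have hp' : Prime (p:ℤ) := Nat.prime_iff_prime_int.1 hp
  intro hs
  induction hs with
  | nil =>
    intro _ h
    simp only [List.length_nil, zero_mul, zero_add, pow_one, List.prod_nil] at h
    exact hp'.not_isUnit (isUnit_of_dvd_one h)
  | cons x hs ih =>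
    intro h
    have := not_dvd_mul hp g (hs.length * g) x hs.prod (h x (by simp)) (ih (fun y hy => h y (by simp [hy])))
    rw [List.prod_cons, List.length_cons]
    rwa [show (hs.length + 1) * g + 1 = g + hs.length * g + 1 by ring]

lemma not_dvd_fact {p : ℕ} (hp : p.Prime) (k : ℕ) : ¬ (p:ℤ) ^ (k + 1) ∣ (k.factorial : ℤ) := by
  intro h
  have h1 : p ^ (k + 1) ∣ k.factorial := by exact_mod_cast h
  have : Fact p.Prime := ⟨hp⟩
  have h2 : k + 1 ≤ padicValNat p k.factorial := (padicValNat_dvd_iff_le (Nat.factorial_ne_zero k)).1 h1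
  have h3 := sub_one_mul_padicValNat_factorial (p := p) k
  have h4 : 1 * padicValNat p k.factorial ≤ (p - 1) * padicValNat p k.factorial :=
    Nat.mul_le_mul_right _ (by have := hp.two_le; omega)
  omega

lemma s2_arith (k a g c : ℕ) (hk : 1 ≤ k) (hg : (k + 1) ^ 2 + k * (k + 2) * (g + 2) < a) (hc : c = (a - 1) / (k + 2)) :
    2 ≤ a ∧ a ≤ (k + 2) * (c + 1) ∧ (k + 1) * (c + 1) + k * (g + 1) < a ∧ c * k ≤ a ∧ c + 1 ≤ a ∧ g + 1 ≤ (c + 1) + (c + 1) := by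
  have hc1 : (k + 2) * c ≤ a - 1 := by rw [hc]; exact Nat.mul_div_le _ _
  have hc2 : a - 1 < (k + 2) * (c + 1) := by
    have := Nat.lt_div_mul_add (a := a - 1) (b := k + 2) (by omega)
    rw [← hc] at this; linarith
  obtain ⟨a', rfl⟩ : ∃ a', a = a' + 1 := ⟨a - 1, by omega⟩
  simp only [Nat.add_sub_cancel] at hc1 hc2
  have ha2 : 1 ≤ a' := by nlinarith [Nat.zero_le (k*(k+2)*(g+2))]
  have hb2 : (k + 1) * (c + 1) + k * (g + 1) < a' + 1 := by
    have e1 : (k+2) * ((k + 1) * (c + 1) + k * (g + 1)) ≤ (k+1) * a' + (k+1)*(k+2) + k * (k + 2) * (g + 1) := by nlinarith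
    have e2 : (k+1) * a' + (k+1)*(k+2) + k * (k + 2) * (g + 1) < (k + 2) * (a' + 1) := by nlinarith
    exact Nat.lt_of_mul_lt_mul_left (e1.trans_lt e2)
  refine ⟨by omega, by omega, hb2, by nlinarith, by nlinarith, ?_⟩
  by_contra hcon
  push Not at hcon
  have : (k+2) * (2 * (c + 1)) ≤ (k + 2) * g := Nat.mul_le_mul_left _ (by omega)
  nlinarith

set_option maxHeartbeats 1000000 in
/-- Case S2 -/
lemma caseS2 (P V k : ℕ) (hk : 1 ≤ k) (hP : 1 ≤ P) (hV : 1 ≤ V) (p a u : ℕ) (hp : p.Prime) (hpP : p ≤ P) (h : Nat.Coprime (p ^ a) u) (hu : u ≠ 0)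
    (χ : DirichletCharacter ℂ (p ^ a * u)) (hχ : Pr χ) (hsm : ∀ p : ℕ, p.Prime → p ∣ u → p ≤ P) (huV : p ^ a * u ≤ V ^ k)
    (g : ℕ) (hg : (k + 1) ^ 2 + k * (k + 2) * (g + 2) < a) (x : ℤ) (M : ℕ) (hM : 0 < M) :
    ‖av x M (cz χ)‖ ^ (2 ^ k) ≤ k / (p:ℝ) ^ (g + 1) + 8 * 2 ^ k * (V ^ 4 * P ^ 4) / M := by
  have hpos : 0 < p ^ a := pow_pos hp.pos _
  have h1 : u ≤ V ^ k := le_trans (Nat.le_mul_of_pos_left u hpos) huV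
  have h2 : p ^ a ≤ V ^ k := le_trans (Nat.le_mul_of_pos_right _ (Nat.pos_of_ne_zero hu)) huV
  obtain ⟨ws, hw1, hw2, hw3⟩ := reduce P V k (p ^ a) u hP hV h hu χ hsm h1
  -- b = ceil(a/(k+2))
  set c := (a - 1) / (k + 2) with hc
  obtain ⟨ha2, hb1, hb2, hck, hba, hgc⟩ := s2_arith k a g c hk hg hc
  clear_value c
  have hcV : p ^ c ≤ V := by
    by_contra hcon
    push Not at hcon
    have e1 : V ^ k < (p ^ c) ^ k := Nat.pow_lt_pow_left hcon (by omega)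
    have e2 : (p ^ c) ^ k ≤ p ^ a := by
      rw [← pow_mul]; exact Nat.pow_le_pow_right hp.pos hck
    omega
  have hbV : p ^ (c + 1) ≤ V * P := by rw [pow_succ]; exact Nat.mul_le_mul hcV hpP
  have hb0 : 1 ≤ c + 1 := by omega
  generalize c + 1 = b at *
  have hpb : 0 < p ^ b := pow_pos hp.pos _
  have hpg : 0 < p ^ (g + 1) := pow_pos hp.pos _
  have hpR : (0:ℝ) < p := by exact_mod_cast hp.pos
  set ts := List.zipWith (fun v w => v * w) (List.replicate k (p ^ b)) ws with hts
  have htl : ts.length = k := by rw [hts]; simp [hw1]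
  have hmain := hw3 (List.replicate k (p ^ b)) (V * P) (by simp) (by
    intro v hv; rw [List.eq_of_mem_replicate hv]; exact hbV) x M (p ^ b * p ^ b) hM (Nat.mul_pos hpb hpb)
  rw [← hts] at hmain
  have htd : ∀ t ∈ ts, ((p ^ b : ℕ) : ℤ) ∣ (t : ℤ) := by
    intro t ht
    rw [hts] at ht
    obtain ⟨i, hi, rfl⟩ := List.mem_iff_getElem.1 ht
    simp
  have hprod : ts.prod = (p ^ b) ^ k * ws.prod := by
    rw [hts, zipmul_prod _ _ (by simp [hw1])]; simp
  have hwco : ¬ (p:ℤ) ∣ ((ws.prod : ℕ) : ℤ) := by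
    intro hd
    have hd' : p ∣ ws.prod := by exact_mod_cast hd
    obtain ⟨w, hw, hpw⟩ := (Prime.dvd_prod_iff hp.prime).1 hd'
    have := (hw2 w hw).1
    have := Nat.Coprime.coprime_dvd_left hpw (Nat.Coprime.coprime_dvd_right (dvd_pow_self p (by omega)) this)
    exact hp.one_lt.ne' (by simpa using this)
  have hbad := badprob (p ^ b * p ^ b) (p ^ (g + 1)) hpg (Nat.mul_pos hpb hpb)
    (by rw [← pow_add]; exact pow_dvd_pow _ hgc)
    (fun F => ‖av x M F‖) (Phi_le x M) (2 * ((p:ℝ) ^ b * p ^ b) / M) (by positivity) (cz (crtFst h χ)) (cz_norm_le _) ts [] ?_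
  · rw [htl] at hbad
    simp only [dl] at hbad
    refine hmain.trans ?_
    push_cast at hbad ⊢
    have hb3 : (p:ℝ) ^ b ≤ V * P := by exact_mod_cast hbV
    have hM' : (0:ℝ) < M := by exact_mod_cast hM
    have hVP : (1:ℝ) ≤ V * P := by
      have : 1 ≤ V * P := Nat.mul_pos hV hP
      exact_mod_cast this
    have e1 : 2 * ((p:ℝ) ^ b * p ^ b) / M ≤ 2 * ((V * P) * (V * P)) / M := by gcongr
    have e2 : 3 * 2 ^ k * (2 * ((V:ℝ) * P * (V * P)) * ((p:ℝ) ^ b * p ^ b) / M) ≤ 3 * 2 ^ k * (2 * ((V:ℝ) * P * (V * P)) * ((V * P) * (V * P)) / M) := by gcongr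
    have e3 : 2 * (((V:ℝ) * P) * (V * P)) / M ≤ 2 * 2 ^ k * (V ^ 4 * P ^ 4) / M := by
      apply div_le_div_of_nonneg_right _ hM'.le
      have : (1:ℝ) ≤ 2 ^ k := one_le_pow₀ (by norm_num)
      calc 2 * (((V:ℝ) * P) * (V * P)) = 2 * 1 * ((V * P)^2 * 1) := by ring
        _ ≤ 2 * 2 ^ k * ((V * P)^2 * (V * P)^2) := by gcongr; exact one_le_pow₀ hVP
        _ = _ := by ring
    have e4 : 3 * 2 ^ k * (2 * ((V:ℝ) * P * (V * P)) * ((V * P) * (V * P)) / M) = 6 * 2 ^ k * (V ^ 4 * P ^ 4) / M := by ring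
    have e5 : 2 * 2 ^ k * ((V:ℝ) ^ 4 * P ^ 4) / M + 6 * 2 ^ k * (V ^ 4 * P ^ 4) / M = 8 * 2 ^ k * (V ^ 4 * P ^ 4) / M := by ring
    linarith
  · intro hs hl hnd
    simp only [List.append_nil]
    have hsl : (List.zipWith (fun (t : ℕ) h => (t:ℤ) * h) ts hs).reverse.length = k := by simp [hl, htl]
    have hsp : (List.zipWith (fun (t : ℕ) h => (t:ℤ) * h) ts hs).reverse.prod = ((p:ℤ) ^ b) ^ k * (ws.prod : ℕ) * hs.prod := by
      rw [List.prod_reverse, zip_prod _ _ hl, hprod]; push_cast; ring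
    have hsq : ∀ a, (p:ℤ) ^ a ∣ hs.prod → a < k * g + 1 := by
      intro a ha
      have := not_dvd_prod hp g hs (by intro y hy; have := hnd y hy; push_cast at this; exact this)
      rw [hl, htl] at this
      by_contra hcon
      push Not at hcon
      exact this ((pow_dvd_pow _ hcon).trans ha)
    refine s2_av hp ha2 hb0 hba (crtFst h χ) (Pr_fst hpos.ne' hu h χ hχ) _ ?_ ?_ ?_ x M
    · intro y hy
      exact zip_dvd _ _ _ htd y (List.mem_reverse.1 hy)
    · rw [hsp]
      push_cast
      refine (pow_dvd_pow _ hb1).trans ?_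
      refine ⟨(ws.prod : ℕ) * hs.prod, ?_⟩
      push_cast
      ring
    · rw [hsp, hsl]
      intro hd
      push_cast at hd
      have e0 : ¬ (p:ℤ) ^ (k * g + 1) ∣ hs.prod := fun h => absurd (hsq _ h) (by omega)
      have e1 := not_dvd_mul hp (k * g) k _ _ e0 (not_dvd_fact hp k)
      have e2 := not_dvd_mul hp 0 (k * g + k) _ _ (by simpa using hwco) e1
      have e3 : (p:ℤ) ^ (b * (k + 1)) * p ^ (k * g + k + 1) ∣ p ^ (b * (k + 1)) * ((ws.prod : ℕ) * (hs.prod * k.factorial)) := by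
        rw [← pow_add]
        refine (pow_dvd_pow _ ?_).trans (hd.trans (dvd_of_eq ?_))
        · nlinarith
        · push_cast; ring
      rw [mul_dvd_mul_iff_left (pow_ne_zero _ (by exact_mod_cast hp.ne_zero))] at e3
      apply e2
      push_cast at e3
      rwa [zero_add]

end CS

namespace CS

lemma split_list (p P V k a : ℕ) (hk : 1 ≤ k) (hp : 1 ≤ p) (hpP : p ≤ P) (hV : 1 ≤ V) (ha : p ^ a ≤ V ^ k) :
    ∃ bs : List ℕ, bs.length ≤ k ∧ bs.sum = a ∧ ∀ b ∈ bs, 1 ≤ b ∧ p ^ b ≤ V * P := by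
  by_cases hak : a ≤ k
  · refine ⟨List.replicate a 1, by simpa, by simp, ?_⟩
    intro b hb
    rw [List.eq_of_mem_replicate hb]
    refine ⟨le_refl _, ?_⟩
    rw [pow_one]; nlinarith
  · push Not at hak
    have h1 := Nat.div_add_mod a k
    have h2 := Nat.mod_lt a (show k > 0 by omega)
    have h3 : 1 ≤ a / k := (Nat.one_le_div_iff (by omega)).2 hak.le
    have h4 : p ^ (a / k) ≤ V := by
      by_contra hcon
      push Not at hcon
      have e1 : V ^ k < (p ^ (a / k)) ^ k := Nat.pow_lt_pow_left hcon (by omega)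
      have e2 : (p ^ (a / k)) ^ k ≤ p ^ a := by
        rw [← pow_mul]; exact Nat.pow_le_pow_right hp (Nat.div_mul_le_self a k)
      omega
    refine ⟨List.replicate (a % k) (a / k + 1) ++ List.replicate (k - a % k) (a / k), ?_, ?_, ?_⟩
    · simp; omega
    · simp
      obtain ⟨m, hm⟩ : ∃ m, k = a % k + m := ⟨k - a % k, by omega⟩
      generalize a % k = r at *
      generalize a / k = q at *
      subst hm
      rw [Nat.add_sub_cancel_left]
      linarith
    · intro b hb
      rw [List.mem_append] at hb
      rcases hb with hb | hb
      · rw [List.eq_of_mem_replicate hb, pow_succ]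
        exact ⟨by omega, Nat.mul_le_mul h4 hpP⟩
      · rw [List.eq_of_mem_replicate hb]
        refine ⟨h3, h4.trans (Nat.le_mul_of_pos_right _ (by omega))⟩

lemma zip_one : ∀ ws : List ℕ, List.zipWith (fun v w => v * w) (List.replicate ws.length 1) ws = ws := by
  intro ws
  induction ws with
  | nil => rfl
  | cons w ws ih => simp [List.replicate_succ, ih]

lemma prod_pow_map (p : ℕ) (bs : List ℕ) : (bs.map (fun b => p ^ b)).prod = p ^ bs.sum := by
  induction bs with
  | nil => simp
  | cons b bs ih => simp [ih, pow_add]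

lemma descend {r : ℕ} [NeZero r] (f : ℤ → ℂ) (hf : ∀ n t : ℤ, f (n + r * t) = f n) :
    (fun n : ℤ => (fun y : ZMod r => f ((y.val : ℕ) : ℤ)) (n : ZMod r)) = f := by
  funext n
  simp only
  have h1 : (((n : ZMod r).val : ℕ) : ℤ) = n % r := ZMod.val_intCast n
  rw [h1]
  have h2 := hf (n % r) (n / r)
  rw [← h2, Int.emod_add_mul_ediv]

set_option maxHeartbeats 1000000 in
/-- Case S1, inner estimate -/
lemma s1_inner {p a : ℕ} [Fact p.Prime] (hp : p.Prime) (ha : 2 ≤ a) (ψ : DirichletCharacter ℂ (p ^ a)) (hψ : Pr ψ)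
    (s : List ℤ) (hs : ∀ x ∈ s, (p : ℤ) ∣ x) (Cc : ℤ) (hprod : s.prod = p ^ (a - 2) * Cc) (hCc : ¬ (p:ℤ) ∣ Cc)
    (hsp : s.length < p) (ts : List ℕ) (hts : ∀ t ∈ ts, Nat.Coprime t p) (x : ℤ) (M : ℕ) (hM : 0 < M) :
    Dm (p ^ 2) ts (fun F => ‖av x M F‖) (dl s (cz ψ)) ≤
      (2 ^ ts.length * (s.length + 1) + 4 ^ ts.length) / p + 2 * (p:ℝ) ^ 2 / M := by
  have : NeZero (p ^ 2) := ⟨pow_ne_zero _ hp.ne_zero⟩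
  have : NeZero (p ^ a) := ⟨pow_ne_zero _ hp.ne_zero⟩
  have hp' : Prime (p:ℤ) := Nat.prime_iff_prime_int.1 hp
  have hper : ∀ n t : ℤ, dl s (cz ψ) (n + (p ^ 2 : ℕ) * t) = dl s (cz ψ) n := by
    intro n t
    apply dl_periodic
    · rw [hprod]
      push_cast
      refine ⟨Cc * t, ?_⟩
      have : (p:ℤ) ^ a = p ^ (a - 2) * p ^ 2 := by rw [← pow_add]; congr 1; omega
      rw [this]; ring
    · intro r hr hra
      have := (Nat.prime_dvd_prime_iff_eq hr hp).1 (hr.dvd_of_dvd_pow hra)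
      rw [this]; push_cast
      exact (dvd_pow_self _ (by norm_num)).mul_right _
  have hd := descend (r := p ^ 2) (dl s (cz ψ)) hper
  set f : ZMod (p ^ 2) → ℂ := fun y => dl s (cz ψ) ((y.val : ℕ) : ℤ) with hf
  have hfn : ∀ n : ℤ, f n = dl s (cz ψ) n := fun n => congrFun hd n
  have hf1 : ∀ y, ‖f y‖ ≤ 1 := fun y => dl_norm_le _ _ (cz_norm_le _) _
  rw [← hd]
  refine (Dm_le_U x M (p ^ 2) hM ts (fun t ht => (Nat.Coprime.pow_right 2 (hts t ht))) f hf1).trans ?_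
  have hc : ((Cc * ((-1) ^ s.length * s.length.factorial) : ℤ) : ZMod p) ≠ 0 := by
    rw [Ne, ZMod.intCast_zmod_eq_zero_iff_dvd]
    intro h
    rcases hp'.dvd_or_dvd h with h | h
    · exact hCc h
    · rcases hp'.dvd_or_dvd h with h | h
      · have := hp'.dvd_of_dvd_pow h
        rw [dvd_neg] at this
        exact hp'.not_isUnit (isUnit_of_dvd_one this)
      · have h' : p ∣ s.length.factorial := by exact_mod_cast h
        have := (hp.dvd_factorial).1 h'
        omega
  have hU := L2 (le_refl 2) f hf1 ?_ (theta hp ha ψ) (theta_ne hp ha ψ hψ) _ hc (s.length + 1) (by omega) ?_ ts.length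
  · push_cast at hU ⊢
    linarith
  · intro n hn
    rw [hfn]
    exact dl_zero hp (by omega) ψ s hs n hn
  · intro n t
    rw [hfn, hfn]
    have := s1_shift hp ha ψ s hs Cc 1 (le_refl 1) (by omega) (by
      rw [hprod, ← mul_assoc, ← pow_add]; congr 2; omega) n t
    exact this

set_option maxHeartbeats 1000000 in
/-- Case S1 -/
lemma caseS1 (P V k : ℕ) (hk : 1 ≤ k) (hP : 1 ≤ P) (hV : 1 ≤ V) (p a u : ℕ) (hp : p.Prime) (hpP : p ≤ P) (ha : 2 ≤ a)
    (h : Nat.Coprime (p ^ a) u) (hu : u ≠ 0)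
    (χ : DirichletCharacter ℂ (p ^ a * u)) (hχ : Pr χ) (hsm : ∀ p : ℕ, p.Prime → p ∣ u → p ≤ P) (huV : p ^ a * u ≤ V ^ k)
    (hkp : k < p) (x : ℤ) (M : ℕ) (hM : 0 < M) :
    ‖av x M (cz χ)‖ ^ (2 ^ k) ≤ (2 ^ k * (k + 1) + 4 ^ k + k) / p + 8 * 2 ^ k * (V ^ 4 * P ^ 4) / M := by
  have : Fact p.Prime := ⟨hp⟩
  have hp' : Prime (p:ℤ) := Nat.prime_iff_prime_int.1 hp
  have hpos : 0 < p ^ a := pow_pos hp.pos _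
  have h1 : u ≤ V ^ k := le_trans (Nat.le_mul_of_pos_left u hpos) huV
  have h2 : p ^ a ≤ V ^ k := le_trans (Nat.le_mul_of_pos_right _ (Nat.pos_of_ne_zero hu)) huV
  obtain ⟨ws, hw1, hw2, hw3⟩ := reduce P V k (p ^ a) u hP hV h hu χ hsm h1
  have hwp : ∀ w ∈ ws, Nat.Coprime w p := fun w hw => Nat.Coprime.coprime_dvd_right (dvd_pow_self p (by omega)) (hw2 w hw).1
  obtain ⟨bs, hb1, hb2, hb3⟩ := split_list p P V k (a - 2) hk hp.pos hpP hV
    (le_trans (Nat.pow_le_pow_right hp.pos (by omega)) h2)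
  set j := bs.length with hj
  have hpVP : p ≤ V * P := by nlinarith
  have hmain := hw3 (bs.map (fun b => p ^ b) ++ List.replicate (k - j) 1) (V * P) (by simp; omega) (by
    intro v hv
    rw [List.mem_append, List.mem_map] at hv
    rcases hv with ⟨b, hb, rfl⟩ | hv
    · exact (hb3 b hb).2
    · rw [List.eq_of_mem_replicate hv]; exact Nat.mul_pos hV hP) x M (p ^ 2) hM (pow_pos hp.pos _)
  have hbw : bs.length ≤ ws.length := by rw [hw1]; exact hb1
  have htake : (ws.take j).length = j := by rw [List.length_take, hw1]; omega
  have hdrop : (ws.drop j).length = k - j := by rw [List.length_drop, hw1]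
  set ts := List.zipWith (fun v w => v * w) (bs.map (fun b => p ^ b)) (ws.take j) with hts
  have hz : List.zipWith (fun v w => v * w) (bs.map (fun b => p ^ b) ++ List.replicate (k - j) 1) ws = ts ++ ws.drop j := by
    conv_lhs => rw [← List.take_append_drop j ws]
    rw [List.zipWith_append (by simp [hj, hbw])]
    rw [hts]
    congr 1
    rw [← hdrop]
    exact zip_one _
  rw [hz, Dm_append] at hmain
  have htl : ts.length = j := by rw [hts]; simp [hj, hbw]
  have hdm : ∀ w ∈ ws.drop j, Nat.Coprime w p := fun w hw => hwp w (List.mem_of_mem_drop hw)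
  have htm : ∀ w ∈ ws.take j, Nat.Coprime w p := fun w hw => hwp w (List.mem_of_mem_take hw)
  have htd : ∀ t ∈ ts, (p : ℤ) ∣ (t : ℤ) := by
    intro t ht
    rw [hts] at ht
    obtain ⟨i, hi, rfl⟩ := List.mem_iff_getElem.1 ht
    simp
    apply Dvd.dvd.mul_right
    apply dvd_pow_self
    have := (hb3 _ (List.getElem_mem (l := bs) (n := i) (by simp at hi; omega))).1
    omega
  have htp : ts.prod = p ^ (a - 2) * (ws.take j).prod := by
    rw [hts, zipmul_prod _ _ (by simp [hj, hbw]), prod_pow_map, hb2]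
  have hwco : ¬ (p:ℤ) ∣ (((ws.take j).prod : ℕ) : ℤ) := by
    intro hd
    have hd' : p ∣ (ws.take j).prod := by exact_mod_cast hd
    obtain ⟨w, hw, hpw⟩ := (Prime.dvd_prod_iff hp.prime).1 hd'
    have := Nat.Coprime.coprime_dvd_left hpw (htm w hw)
    exact hp.one_lt.ne' (by simpa using this)
  have hpR : (0:ℝ) < p := by exact_mod_cast hp.pos
  have hbad := badprob (p ^ 2) p hp.pos (pow_pos hp.pos _) (dvd_pow_self _ (by norm_num))
    (fun F => Dm (p ^ 2) (ws.drop j) (fun F => ‖av x M F‖) F) (fun F hF => Dm_le_one _ _ _ (Phi_le x M) F hF)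
    ((2 ^ (k - j) * (j + 1) + 4 ^ (k - j)) / p + 2 * (p:ℝ) ^ 2 / M) (by positivity) (cz (crtFst h χ)) (cz_norm_le _) ts [] ?_
  · rw [htl] at hbad
    simp only [dl] at hbad
    refine hmain.trans ?_
    push_cast at hbad ⊢
    have hb3 : (p:ℝ) ≤ P := by exact_mod_cast hpP
    have hM' : (0:ℝ) < M := by exact_mod_cast hM
    have hV1 : (1:ℝ) ≤ V := by exact_mod_cast hV
    have hP1 : (1:ℝ) ≤ P := by exact_mod_cast hP
    have hjk : (j:ℝ) ≤ k := by exact_mod_cast hb1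
    have f1 : (2:ℝ) ^ (k - j) ≤ 2 ^ k := pow_le_pow_right₀ (by norm_num) (by omega)
    have f2 : (4:ℝ) ^ (k - j) ≤ 4 ^ k := pow_le_pow_right₀ (by norm_num) (by omega)
    have e0 : ((2:ℝ) ^ (k - j) * (j + 1) + 4 ^ (k - j)) / p ≤ (2 ^ k * (k + 1) + 4 ^ k) / p := by gcongr
    have e0' : (j:ℝ) / p ≤ k / p := by gcongr
    have hk2 : (1:ℝ) ≤ 2 ^ k := one_le_pow₀ (by norm_num)
    have e1 : 2 * (p:ℝ) ^ 2 / M ≤ (2:ℝ) * 2 ^ k * ((V:ℝ) ^ 4 * (P:ℝ) ^ 4) / M := by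
      apply div_le_div_of_nonneg_right _ hM'.le
      calc 2 * (p:ℝ) ^ 2 = (2:ℝ) * 1 * (1 * (p:ℝ) ^ 2) := by ring
        _ ≤ (2:ℝ) * 2 ^ k * ((V:ℝ) ^ 4 * (P:ℝ) ^ 4) := by
          gcongr
          · exact one_le_pow₀ hV1
          · calc (p:ℝ)^2 ≤ (P:ℝ) ^ 2 := by gcongr
              _ ≤ (P:ℝ) ^ 4 := pow_le_pow_right₀ hP1 (by norm_num)
    have e2 : 3 * 2 ^ k * (2 * ((V:ℝ) * P * (V * P)) * (p:ℝ) ^ 2 / M) ≤ 6 * 2 ^ k * (V ^ 4 * P ^ 4) / M := by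
      calc 3 * 2 ^ k * (2 * ((V:ℝ) * P * (V * P)) * (p:ℝ) ^ 2 / M) ≤ 3 * 2 ^ k * (2 * ((V:ℝ) * P * (V * P)) * (V * P) ^ 2 / M) := by
            gcongr; nlinarith
        _ = _ := by ring
    have e5 : 2 * 2 ^ k * ((V:ℝ) ^ 4 * P ^ 4) / M + 6 * 2 ^ k * (V ^ 4 * P ^ 4) / M = 8 * 2 ^ k * (V ^ 4 * P ^ 4) / M := by ring
    have e6 : ((2:ℝ) ^ k * (k + 1) + 4 ^ k + k) / p = (2 ^ k * (k + 1) + 4 ^ k) / p + k / p := by ring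
    rw [e6]
    linarith
  · intro hs hl hnd
    simp only [List.append_nil]
    have hsl : (List.zipWith (fun (t : ℕ) h => (t:ℤ) * h) ts hs).reverse.length = j := by simp [hl, htl]
    have hsp : (List.zipWith (fun (t : ℕ) h => (t:ℤ) * h) ts hs).reverse.prod = (p:ℤ) ^ (a - 2) * (((ws.take j).prod : ℕ) * hs.prod) := by
      rw [List.prod_reverse, zip_prod _ _ hl, htp]; push_cast; ring
    have hin := s1_inner hp ha (crtFst h χ) (Pr_fst hpos.ne' hu h χ hχ) _ ?_ _ hsp ?_ ?_ (ws.drop j) hdm x M hM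
    · rw [hsl, hdrop] at hin
      exact hin
    · intro y hy
      exact zip_dvd _ _ _ htd y (List.mem_reverse.1 hy)
    · intro hd
      rcases hp'.dvd_or_dvd hd with hd | hd
      · exact hwco hd
      · have := not_dvd_prod hp 0 hs (by intro y hy; simpa using hnd y hy)
        simp at this
        exact this hd
    · rw [hsl]; omega

end CS

namespace CS

lemma loc_arith (k p : ℕ) (hY : (4 ^ (k + 2)) ^ 4 ≤ p) :
    (2 ^ k * Real.sqrt p + 1 + 4 ^ k) / (p:ℝ) ≤ Real.exp (-(Real.log p / 4)) := by
  have hB : (1:ℕ) ≤ (4 ^ (k + 2)) ^ 4 := Nat.one_le_iff_ne_zero.2 (by positivity)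
  have hp : (0:ℝ) < p := by exact_mod_cast (lt_of_lt_of_le hB hY)
  set y : ℝ := Real.exp (Real.log p / 4) with hy
  have hy0 : 0 < y := Real.exp_pos _
  have hy4 : y ^ 4 = p := by
    rw [hy, ← Real.exp_nat_mul]; push_cast
    rw [show (4:ℝ) * (Real.log p / 4) = Real.log p by ring, Real.exp_log hp]
  have hsq : Real.sqrt p = y ^ 2 := by
    rw [← hy4, show y ^ 4 = (y ^ 2) ^ 2 by ring, Real.sqrt_sq (by positivity)]
  have hyB : (4:ℝ) ^ (k + 2) ≤ y := by
    have : ((4:ℝ) ^ (k + 2)) ^ 4 ≤ y ^ 4 := by rw [hy4]; exact_mod_cast hY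
    exact le_of_pow_le_pow_left₀ (by norm_num) hy0.le this
  rw [Real.exp_neg, ← hy, hsq, div_le_iff₀ hp, ← hy4]
  have e : y⁻¹ * y ^ 4 = y ^ 3 := by field_simp
  rw [e]
  have h2 : (2:ℝ) ^ k ≤ 4 ^ k := pow_le_pow_left₀ (by norm_num) (by norm_num) k
  have h1 : (1:ℝ) ≤ 4 ^ k := one_le_pow₀ (by norm_num)
  have h4 : (4:ℝ) ^ (k + 2) = 16 * 4 ^ k := by rw [pow_add]; ring
  rw [h4] at hyB
  generalize (4:ℝ) ^ k = A at *
  generalize (2:ℝ) ^ k = B at *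
  have hy1 : 1 ≤ y := by linarith
  have e1 : B * y ^ 2 ≤ y / 16 * y ^ 2 := by gcongr; linarith
  have e2 : y ≤ y ^ 3 := by nlinarith [mul_self_nonneg (y-1), mul_self_nonneg y]
  nlinarith

lemma Uloc {k p a r : ℕ} [NeZero r] (hp : p.Prime) (ha : 1 ≤ a) (hr : r = p ^ a) (ψ : DirichletCharacter ℂ r)
    (hψ : Pr ψ) (hY : (4 ^ (k + 2)) ^ 4 ≤ p) : U k (fun n : ZMod r => ψ n) ≤ Real.exp (-(Real.log p / 4)) := by
  have : Fact p.Prime := ⟨hp⟩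
  have hpR : (0:ℝ) < p := by exact_mod_cast hp.pos
  refine le_trans ?_ (loc_arith k p hY)
  rcases Nat.lt_or_ge a 2 with h | h
  · obtain rfl : a = 1 := by omega
    rw [pow_one] at hr
    subst hr
    have hne : ψ ≠ 1 := by
      rintro rfl
      obtain ⟨n, -, h2, h3⟩ := hψ 1 (one_dvd _) hp.one_lt
      apply h2
      simp only [cz] at h3 ⊢
      by_cases hu : IsUnit (n : ZMod r)
      · exact MulChar.one_apply hu
      · exact absurd (MulChar.map_nonunit _ hu) h3
    convert L1 r ψ hne k using 2
  · subst hr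
    have hs := L2 (p := p) (e := a) h (fun n => ψ n) (fun g => ψ.norm_le_one g) (fun n hn => dl_zero hp ha ψ [] (by simp) n hn)
      (theta hp h ψ) (theta_ne hp h ψ hψ) 1 one_ne_zero 1 (le_refl 1) (by
        intro n t
        have := s1_shift hp h ψ [] (by simp) 1 (a - 1) (by omega) (by omega) (by simp) n t
        simpa [dl, cz] using this) k
    have h2 : U k (fun n : ZMod (p ^ a) => ψ n) ≤ (2 ^ k * 1 + 4 ^ k) / p := by
      convert hs using 2
      norm_num
    refine h2.trans ?_
    apply div_le_div_of_nonneg_right _ hpR.le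
    have : (1:ℝ) ≤ Real.sqrt p := by
      rw [Real.one_le_sqrt]; exact_mod_cast hp.one_lt.le
    nlinarith [pow_pos (show (0:ℝ) < 2 by norm_num) k]

/-- all prime powers exactly dividing `r` are good -/
def Good (Y : ℕ) (Z : ℝ) (r : ℕ) : Prop :=
  ∀ p a : ℕ, p.Prime → 1 ≤ a → p ^ a ∣ r → ¬ p ^ (a + 1) ∣ r → Y ≤ p ∧ (a = 1 ∨ ((p ^ a : ℕ) : ℝ) ≤ Real.exp Z)

lemma Good_left {Y : ℕ} {Z : ℝ} {a b : ℕ} (hab : Nat.Coprime a b) (h : Good Y Z (a * b)) : Good Y Z a := by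
  intro p c hp hc h1 h2
  refine h p c hp hc (h1.mul_right b) ?_
  intro h3
  have hpa : p ∣ a := (dvd_pow_self p (by omega)).trans h1
  have : Nat.Coprime (p ^ (c + 1)) b := by
    apply Nat.Coprime.pow_left
    exact Nat.Coprime.coprime_dvd_left hpa hab
  exact h2 (this.dvd_of_dvd_mul_right h3)

lemma U_glob (k Y : ℕ) (Z : ℝ) (hZ : 1 ≤ Z) (hY : (4 ^ (k + 2)) ^ 4 ≤ Y) : ∀ r : ℕ, ∀ _ : NeZero r,
    ∀ ψ : DirichletCharacter ℂ r, Pr ψ → Good Y Z r → U k (fun n : ZMod r => ψ n) ≤ Real.exp (-(Real.log r / (4 * Z))) := by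
  intro r
  induction r using Nat.recOnPrimeCoprime with
  | zero => intro h0; exact absurd rfl h0.ne
  | prime_pow p a hp =>
    intro _ ψ hψ hg
    rcases Nat.eq_zero_or_pos a with rfl | ha
    · simp only [pow_zero, Nat.cast_one, Real.log_one, zero_div, neg_zero, Real.exp_zero]
      exact U_le_one k _ (fun g => ψ.norm_le_one g)
    · obtain ⟨h1, h2⟩ := hg p a hp ha dvd_rfl (by
        intro h
        have := (Nat.pow_dvd_pow_iff_le_right hp.one_lt).1 h
        omega)
      refine (Uloc hp ha rfl ψ hψ (hY.trans h1)).trans ?_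
      apply Real.exp_le_exp.2
      have hp4 : 4 ≤ p := le_trans (le_trans (by
        calc 4 = (4 ^ 1) ^ 1 := by norm_num
          _ ≤ (4 ^ (k + 2)) ^ 1 := Nat.pow_le_pow_left (Nat.pow_le_pow_right (by norm_num) (by omega)) 1
          _ ≤ _ := Nat.pow_le_pow_right (by positivity) (by norm_num)) hY) h1
      have hlp : 1 ≤ Real.log p := by
        rw [Real.le_log_iff_exp_le (by exact_mod_cast hp.pos)]
        have : (4:ℝ) ≤ p := by exact_mod_cast hp4
        linarith [Real.exp_one_lt_d9]
      have key : Real.log ((p ^ a : ℕ) : ℝ) ≤ Z * Real.log p := by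
        rcases h2 with rfl | h2
        · rw [pow_one]; nlinarith
        · have := Real.log_le_log (by exact_mod_cast pow_pos hp.pos a) h2
          rw [Real.log_exp] at this
          nlinarith
      rw [neg_le_neg_iff, div_le_div_iff₀ (by positivity) (by norm_num)]
      nlinarith
  | coprime a b ha hb hab iha ihb =>
    intro _ ψ hψ hg
    have hza : NeZero a := ⟨by omega⟩
    have hzb : NeZero b := ⟨by omega⟩
    have h1 := iha hza (crtFst hab ψ) (Pr_fst (by omega) (by omega) hab ψ hψ) (Good_left hab hg)
    have h2 := ihb hzb (crtSnd hab ψ) (Pr_snd (by omega) (by omega) hab ψ hψ) (Good_left hab.symm (by rwa [mul_comm]))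
    have e := U_prod (ZMod.chineseRemainder hab).toAddEquiv k (fun n => crtFst hab ψ n) (fun n => crtSnd hab ψ n)
    have e2 : (fun g : ZMod (a * b) => ψ g) = fun g => crtFst hab ψ ((ZMod.chineseRemainder hab).toAddEquiv g).1 *
        crtSnd hab ψ ((ZMod.chineseRemainder hab).toAddEquiv g).2 := by
      funext g
      have h := congrFun (crt_int hab ψ) (g.val : ℤ)
      simp only [cz, Pi.mul_apply] at h
      have hg : (((g.val : ℕ) : ℤ) : ZMod (a * b)) = g := by simp
      rw [hg] at h
      rw [h]
      have hh : ZMod.chineseRemainder hab g = ((((g.val : ℕ) : ℤ) : ZMod a), (((g.val : ℕ) : ℤ) : ZMod b)) := by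
        conv_lhs => rw [← hg]
        rw [map_intCast]; rfl
      change _ = crtFst hab ψ (ZMod.chineseRemainder hab g).1 * crtSnd hab ψ (ZMod.chineseRemainder hab g).2
      rw [hh]
    rw [e2]
    have e3 : U k (fun g => crtFst hab ψ ((ZMod.chineseRemainder hab).toAddEquiv g).1 *
        crtSnd hab ψ ((ZMod.chineseRemainder hab).toAddEquiv g).2) = U k (fun n => crtFst hab ψ n) * U k (fun n => crtSnd hab ψ n) := by
      convert e
    rw [e3]
    have hl : Real.log ((a * b : ℕ) : ℝ) = Real.log a + Real.log b := by
      push_cast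
      exact Real.log_mul (by exact_mod_cast hza.ne) (by exact_mod_cast hzb.ne)
    rw [hl, show -((Real.log a + Real.log b) / (4 * Z)) = -(Real.log a / (4 * Z)) + -(Real.log b / (4 * Z)) by ring, Real.exp_add]
    by_cases hpos : 0 ≤ U k (fun n => crtSnd hab ψ n)
    · exact mul_le_mul h1 h2 hpos (Real.exp_pos _).le
    · exfalso
      apply hpos
      have : ∀ (k : ℕ) (f : ZMod b → ℂ), 0 ≤ U k f := by
        intro k
        induction k with
        | zero => intro f; simp only [U]; positivity
        | succ k ih => intro f; simp only [U]; exact div_nonneg (Finset.sum_nonneg fun h _ => ih _) (by positivity)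
      exact this _ _

set_option maxHeartbeats 1000000 in
/-- Case M -/
lemma caseM (P V k Y : ℕ) (Z : ℝ) (hZ : 1 ≤ Z) (hY : (4 ^ (k + 2)) ^ 4 ≤ Y) (hP : 1 ≤ P) (hV : 1 ≤ V) (r u : ℕ) (hr : r ≠ 0)
    (hrP : r ≤ P ^ 2) (h : Nat.Coprime r u) (hu : u ≠ 0) (hg : Good Y Z r)
    (χ : DirichletCharacter ℂ (r * u)) (hχ : Pr χ) (hsm : ∀ p : ℕ, p.Prime → p ∣ u → p ≤ P) (huV : u ≤ V ^ k)
    (x : ℤ) (M : ℕ) (hM : 0 < M) :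
    ‖av x M (cz χ)‖ ^ (2 ^ k) ≤ Real.exp (-(Real.log r / (4 * Z))) + 8 * 2 ^ k * ((V:ℝ) ^ 4 * (P:ℝ) ^ 4) / M := by
  have : NeZero r := ⟨hr⟩
  obtain ⟨ws, hw1, hw2, hw3⟩ := reduce P V k r u hP hV h hu χ hsm huV
  have hmain := hw3 (List.replicate ws.length 1) 1 (by simp [hw1]) (by
    intro v hv; rw [List.eq_of_mem_replicate hv]) x M r hM (Nat.pos_of_ne_zero hr)
  rw [zip_one] at hmain
  have hU := Dm_le_U x M r hM ws (fun t ht => (hw2 t ht).1) (fun n => crtFst h χ n) (fun y => (crtFst h χ).norm_le_one y)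
  rw [hw1] at hU
  have hU2 := U_glob k Y Z hZ hY r this (crtFst h χ) (Pr_fst hr hu h χ hχ) hg
  have hU3 : Dm r ws (fun F => ‖av x M F‖) (cz (crtFst h χ)) ≤ Real.exp (-(Real.log r / (4 * Z))) + 2 * r / M := by
    refine le_trans hU ?_
    gcongr
  refine hmain.trans ?_
  have hM' : (0:ℝ) < M := by exact_mod_cast hM
  have hV1 : (1:ℝ) ≤ V := by exact_mod_cast hV
  have hP1 : (1:ℝ) ≤ P := by exact_mod_cast hP
  have hk2 : (1:ℝ) ≤ 2 ^ k := one_le_pow₀ (by norm_num)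
  have hrR : (r:ℝ) ≤ (P:ℝ) ^ 2 := by exact_mod_cast hrP
  push_cast
  have p4 : (P:ℝ) ^ 2 ≤ (P:ℝ) ^ 4 := pow_le_pow_right₀ hP1 (by norm_num)
  have p34 : (P:ℝ) ^ 3 ≤ (P:ℝ) ^ 4 := pow_le_pow_right₀ hP1 (by norm_num)
  have v4 : (V:ℝ) ≤ (V:ℝ) ^ 4 := le_self_pow₀ hV1 (by norm_num)
  have v4' : (1:ℝ) ≤ (V:ℝ) ^ 4 := one_le_pow₀ hV1
  have e1 : 2 * (r:ℝ) / M ≤ 2 * 2 ^ k * ((V:ℝ) ^ 4 * (P:ℝ) ^ 4) / M := by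
    apply div_le_div_of_nonneg_right _ hM'.le
    calc 2 * (r:ℝ) = (2:ℝ) * 1 * (1 * r) := by ring
      _ ≤ (2:ℝ) * 2 ^ k * ((V:ℝ) ^ 4 * (P:ℝ) ^ 4) := by
        gcongr
        exact hrR.trans p4
  have e2 : 3 * 2 ^ k * (2 * (1 * ((V:ℝ) * P)) * (r:ℝ) / M) ≤ 6 * 2 ^ k * ((V:ℝ) ^ 4 * (P:ℝ) ^ 4) / M := by
    calc 3 * 2 ^ k * (2 * (1 * ((V:ℝ) * P)) * (r:ℝ) / M) ≤ 3 * 2 ^ k * (2 * (1 * ((V:ℝ) * P)) * (P:ℝ) ^ 2 / M) := by gcongr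
      _ = 6 * 2 ^ k * (V * (P:ℝ) ^ 3) / M := by ring
      _ ≤ _ := by gcongr
  have e5 : 2 * 2 ^ k * ((V:ℝ) ^ 4 * (P:ℝ) ^ 4) / M + 6 * 2 ^ k * ((V:ℝ) ^ 4 * (P:ℝ) ^ 4) / M = 8 * 2 ^ k * ((V:ℝ) ^ 4 * (P:ℝ) ^ 4) / M := by ring
  linarith
end CS

namespace CS

lemma choose_r (P : ℕ) (hP : 1 ≤ P) : ∀ n : ℕ, n ≠ 0 → (∀ p a : ℕ, p.Prime → 1 ≤ a → p ^ a ∣ n → ¬ p ^ (a + 1) ∣ n → p ^ a ≤ P) → P ≤ n →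
    ∃ r u : ℕ, n = r * u ∧ Nat.Coprime r u ∧ P ≤ r ∧ r ≤ P ^ 2 := by
  intro n
  induction n using Nat.recOnPrimeCoprime with
  | zero => intro h; exact absurd rfl h
  | prime_pow p a hp =>
    intro _ h1 h2
    refine ⟨p ^ a, 1, by simp, by simp, h2, ?_⟩
    rcases Nat.eq_zero_or_pos a with rfl | ha
    · rw [pow_zero]; exact Nat.one_le_pow _ _ hP
    · have := h1 p a hp ha dvd_rfl (by
        intro h
        have := (Nat.pow_dvd_pow_iff_le_right hp.one_lt).1 h
        omega)
      nlinarith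
  | coprime a b ha hb hab iha ihb =>
    intro _ h1 h2
    have cop : ∀ a b : ℕ, Nat.Coprime a b → (∀ p c : ℕ, p.Prime → 1 ≤ c → p ^ c ∣ a * b → ¬ p ^ (c + 1) ∣ a * b → p ^ c ≤ P) →
        (∀ p c : ℕ, p.Prime → 1 ≤ c → p ^ c ∣ a → ¬ p ^ (c + 1) ∣ a → p ^ c ≤ P) := by
      intro a b hab h p c hp hc h1 h2
      refine h p c hp hc (h1.mul_right b) ?_
      intro h3
      have hpa : p ∣ a := (dvd_pow_self p (by omega)).trans h1
      exact h2 (((Nat.Coprime.coprime_dvd_left hpa hab).pow_left (c + 1)).dvd_of_dvd_mul_right h3)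
    have main : ∀ a b : ℕ, Nat.Coprime a b → (∃ r u : ℕ, a = r * u ∧ Nat.Coprime r u ∧ P ≤ r ∧ r ≤ P ^ 2) →
        ∃ r u : ℕ, a * b = r * u ∧ Nat.Coprime r u ∧ P ≤ r ∧ r ≤ P ^ 2 := by
      rintro a b hab ⟨r, u, rfl, h2, h3, h4⟩
      exact ⟨r, u * b, by ring, Nat.Coprime.mul_right h2 (Nat.Coprime.coprime_dvd_left (dvd_mul_right _ _) hab), h3, h4⟩
    by_cases hPa : P ≤ a
    · exact main a b hab (iha (by omega) (cop a b hab h1) hPa)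
    by_cases hPb : P ≤ b
    · rw [mul_comm]
      exact main b a hab.symm (ihb (by omega) (cop b a hab.symm (by rwa [mul_comm])) hPb)
    · push Not at hPa hPb
      exact ⟨a * b, 1, by simp, by simp, h2, by nlinarith⟩

lemma bad_bound (Y : ℕ) (E : ℝ) (hE : 1 ≤ E) (b : ℕ) (hb : b ≠ 0) (h1 : ∀ p : ℕ, p.Prime → p ∣ b → p < Y)
    (h2 : ∀ p a : ℕ, p.Prime → 1 ≤ a → p ^ a ∣ b → ¬ p ^ (a + 1) ∣ b → ((p ^ a : ℕ) : ℝ) ≤ E) : (b : ℝ) ≤ E ^ Y := by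
  have h := Nat.prod_primeFactors_pow_factorization hb
  have hc : b.primeFactors.card ≤ Y := by
    have : b.primeFactors ⊆ Finset.range Y := by
      intro p hp
      rw [Nat.mem_primeFactors] at hp
      exact Finset.mem_range.2 (h1 p hp.1 hp.2.1)
    simpa using Finset.card_le_card this
  calc (b:ℝ) = ((∏ p ∈ b.primeFactors, p ^ (b.factorization p) : ℕ) : ℝ) := by exact_mod_cast h
    _ = ∏ p ∈ b.primeFactors, ((p ^ (b.factorization p) : ℕ) : ℝ) := by push_cast; rfl
    _ ≤ ∏ p ∈ b.primeFactors, E := by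
      apply Finset.prod_le_prod
      · intro i _; positivity
      · intro p hp
        rw [Nat.mem_primeFactors] at hp
        refine h2 p _ hp.1 ?_ (Nat.ordProj_dvd _ _) (Nat.pow_succ_factorization_not_dvd hb hp.1)
        exact (hp.1.dvd_iff_one_le_factorization hb).1 hp.2.1
    _ = E ^ b.primeFactors.card := by rw [Finset.prod_const]
    _ ≤ E ^ Y := pow_le_pow_right₀ hE hc

lemma find_r (P Y : ℕ) (Z : ℝ) (hZ : 0 ≤ Z) (hP : 1 ≤ P) (hYZ : (Y:ℝ) ≤ Real.exp Z) (hZP : Real.exp Z ≤ P) (hEP : Real.exp Z ^ Y ≤ P)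
    (q : ℕ) (hq : P ^ 3 ≤ q) (hsm : ∀ p : ℕ, p.Prime → p ∣ q → p ≤ P)
    (hno : ∀ p a : ℕ, p.Prime → 2 ≤ a → p ^ a ∣ q → ¬ p ^ (a + 1) ∣ q → ((p ^ a : ℕ) : ℝ) ≤ Real.exp Z) :
    ∃ r u : ℕ, q = r * u ∧ Nat.Coprime r u ∧ P ≤ r ∧ r ≤ P ^ 2 ∧ Good Y Z r := by
  have hq0 : q ≠ 0 := by have := Nat.one_le_pow 3 P hP; omega
  obtain ⟨g, b, hgb, hco, hgu, hbu⟩ := nat_split q (Nat.factorial (Y - 1)) hq0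
  have hb0 : b ≠ 0 := by rintro rfl; simp at hgb; exact hq0 hgb.symm
  have hg0 : g ≠ 0 := by rintro rfl; simp at hgb; exact hq0 hgb.symm
  have hgY : ∀ p : ℕ, p.Prime → p ∣ g → Y ≤ p := by
    intro p hp hpg
    by_contra hcon
    have h1 : p ∣ Nat.factorial (Y - 1) := (hp.dvd_factorial).2 (by omega)
    have := Nat.Coprime.eq_one_of_dvd (Nat.Coprime.coprime_dvd_left hpg hgu) h1
    exact hp.one_lt.ne' this
  have hbY : ∀ p : ℕ, p.Prime → p ∣ b → p < Y := by
    intro p hp hpb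
    have := (hp.dvd_factorial).1 (hbu p hp hpb)
    have := hp.two_le
    omega
  have ex : ∀ a b : ℕ, Nat.Coprime a b → ∀ p c : ℕ, p.Prime → 1 ≤ c → p ^ c ∣ a → ¬ p ^ (c + 1) ∣ a → ¬ p ^ (c + 1) ∣ a * b := by
    intro a b hab p c hp hc h1 h2 h3
    have hpa : p ∣ a := (dvd_pow_self p (by omega)).trans h1
    exact h2 (((Nat.Coprime.coprime_dvd_left hpa hab).pow_left (c + 1)).dvd_of_dvd_mul_right h3)
  have hbE : (b:ℝ) ≤ Real.exp Z ^ Y := by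
    apply bad_bound Y _ (Real.one_le_exp hZ) b hb0 hbY
    intro p a hp ha h1 h2
    rcases Nat.lt_or_ge a 2 with h | h
    · obtain rfl : a = 1 := by omega
      rw [pow_one] at h1 ⊢
      refine le_trans ?_ hYZ
      exact_mod_cast (hbY p hp h1).le
    · refine hno p a hp h (by rw [← hgb]; exact h1.mul_left g) ?_
      rw [← hgb, mul_comm]
      exact ex b g hco.symm p a hp ha h1 h2
  have hbP : b ≤ P := by exact_mod_cast hbE.trans hEP
  have hgP : P ≤ g := by
    by_contra hcon
    push Not at hcon
    have : g * b < P ^ 3 := by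
      calc g * b ≤ g * P := Nat.mul_le_mul_left _ hbP
        _ < P * P := Nat.mul_lt_mul_of_pos_right hcon hP
        _ ≤ P * P * P := Nat.le_mul_of_pos_right _ hP
        _ = P ^ 3 := by ring
    omega
  have hgpp : ∀ p a : ℕ, p.Prime → 1 ≤ a → p ^ a ∣ g → ¬ p ^ (a + 1) ∣ g → (a = 1 ∨ ((p ^ a : ℕ) : ℝ) ≤ Real.exp Z) := by
    intro p a hp ha h1 h2
    rcases Nat.lt_or_ge a 2 with h | h
    · left; omega
    · right
      refine hno p a hp h (by rw [← hgb]; exact h1.mul_right b) ?_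
      rw [← hgb]
      exact ex g b hco p a hp ha h1 h2
  have hgood : Good Y Z g := fun p a hp ha h1 h2 => ⟨hgY p hp ((dvd_pow_self p (by omega)).trans h1), hgpp p a hp ha h1 h2⟩
  obtain ⟨r, u, rfl, h2, h3, h4⟩ := choose_r P hP g hg0 (by
    intro p a hp ha h1 h2
    rcases hgpp p a hp ha h1 h2 with rfl | h
    · rw [pow_one] at h1 ⊢
      exact hsm p hp (by rw [← hgb]; exact h1.mul_right b)
    · exact_mod_cast h.trans hZP) hgP
  refine ⟨r, u * b, by rw [← hgb]; ring, Nat.Coprime.mul_right h2 (Nat.Coprime.coprime_dvd_left (dvd_mul_right _ _) hco), h3, h4, Good_left h2 hgood⟩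
end CS

namespace CS

lemma k_arith (k : ℕ) (hk : 32 ≤ k) : 8 * (k + 2) ^ 2 ≤ 2 ^ k ∧ (32 * (k + 1)) ^ 3 ≤ 2 ^ k := by
  induction k, hk using Nat.le_induction with
  | base => norm_num
  | succ n hn ih =>
    obtain ⟨h1, h2⟩ := ih
    rw [pow_succ 2 n]
    constructor
    · nlinarith
    · have : (32 * (n + 1 + 1)) ^ 3 ≤ 2 * (32 * (n + 1)) ^ 3 := by
        rw [mul_pow, mul_pow, ← mul_assoc, mul_comm 2, mul_assoc]
        apply Nat.mul_le_mul_left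
        nlinarith [mul_le_mul hn hn (by norm_num) (by omega)]
      omega

/-- numbers: error term -/
lemma err_arith (N PR MR LP : ℝ) (hN : 16 ≤ N) (hP : 0 < PR) (hlog : Real.log PR = LP) (hL : N ^ 2 ≤ LP) (hM : PR ^ 600 ≤ MR) :
    8 * N * ((PR ^ 133) ^ 4 * PR ^ 4) / MR ≤ Real.exp (-N ^ 2) / 2 := by
  have hM0 : 0 < MR := lt_of_lt_of_le (by positivity) hM
  have hPe : PR = Real.exp LP := by rw [← hlog, Real.exp_log hP]
  have hN2 : Real.exp N ≤ Real.exp LP := Real.exp_le_exp.2 (by nlinarith)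
  have hNe : N ≤ Real.exp N := by linarith [Real.add_one_le_exp N]
  have hPN : N ≤ PR := by rw [hPe]; linarith
  have hPN2 : Real.exp (N ^ 2) ≤ PR := by rw [hPe]; exact Real.exp_le_exp.2 hL
  rw [div_le_iff₀ hM0, Real.exp_neg]
  have : 8 * N * ((PR ^ 133) ^ 4 * PR ^ 4) * (2 * Real.exp (N ^ 2)) ≤ MR := by
    calc 8 * N * ((PR ^ 133) ^ 4 * PR ^ 4) * (2 * Real.exp (N ^ 2)) = 16 * N * Real.exp (N ^ 2) * PR ^ 536 := by ring
      _ ≤ PR * PR * PR * PR ^ 536 := by gcongr; linarith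
      _ = PR ^ 539 := by ring
      _ ≤ PR ^ 600 := pow_le_pow_right₀ (by linarith) (by norm_num)
      _ ≤ MR := hM
  have he := Real.exp_pos (N ^ 2)
  rw [show (Real.exp (N ^ 2))⁻¹ / 2 * MR = MR / (2 * Real.exp (N ^ 2)) by field_simp, le_div_iff₀ (by positivity)]
  exact this

lemma half_exp (N a : ℝ) (hN : 16 ≤ N) (ha : 2 * N ^ 2 ≤ a) : N ^ 3 * Real.exp (-a) ≤ Real.exp (-N ^ 2) / 2 := by
  have h1 : 2 * N ^ 3 ≤ Real.exp (N ^ 2) := by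
    have h4 : N ^ 2 / 4 ≤ Real.exp (N ^ 2 / 4) := by linarith [Real.add_one_le_exp (N ^ 2 / 4)]
    have e : Real.exp (N ^ 2) = Real.exp (N ^ 2 / 4) ^ 4 := by rw [← Real.exp_nat_mul]; congr 1; push_cast; ring
    rw [e]
    have hN4 : N ≤ N ^ 2 / 4 := by nlinarith
    calc 2 * N ^ 3 ≤ N * N ^ 3 := by gcongr; linarith
      _ = N ^ 4 := by ring
      _ ≤ _ := pow_le_pow_left₀ (by linarith) (by linarith) 4
  have h2 : Real.exp (-a) ≤ Real.exp (-N ^ 2) * Real.exp (-N ^ 2) := by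
    rw [← Real.exp_add]; exact Real.exp_le_exp.2 (by linarith)
  have h3 : Real.exp (N ^ 2) * Real.exp (-N ^ 2) = 1 := by rw [← Real.exp_add]; simp
  calc N ^ 3 * Real.exp (-a) ≤ (Real.exp (N ^ 2) / 2) * (Real.exp (-N ^ 2) * Real.exp (-N ^ 2)) := by gcongr; linarith
    _ = (Real.exp (N ^ 2) * Real.exp (-N ^ 2)) * Real.exp (-N ^ 2) / 2 := by ring
    _ = _ := by rw [h3, one_mul]

lemma g_exists (k a : ℕ) (hk : 32 ≤ k) (ha : 2 ^ k ≤ a) : ∃ g : ℕ, (k + 1) ^ 2 + k * (k + 2) * (g + 2) < a ∧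
    a ≤ (g + 1) * (4 * (k + 2) ^ 2) := by
  have h := (k_arith k hk).1
  have hpos : 0 < 2 * (k + 2) ^ 2 := by positivity
  set t := a / (2 * (k + 2) ^ 2) with ht
  have h1 : t * (2 * (k + 2) ^ 2) ≤ a := Nat.div_mul_le_self _ _
  have h2 : a < (t + 1) * (2 * (k + 2) ^ 2) := by
    have := Nat.lt_div_mul_add hpos (a := a)
    rw [← ht] at this
    linarith
  have h3 : 1 ≤ t := (Nat.one_le_div_iff hpos).2 (by linarith)
  clear_value t
  refine ⟨t - 1, ?_, ?_⟩
  · obtain ⟨s, rfl⟩ : ∃ s, t = s + 1 := ⟨t - 1, by omega⟩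
    rw [Nat.add_sub_cancel]
    have e1 : k * (k + 2) * (s + 2) ≤ (k + 2) ^ 2 * (s + 2) := by gcongr; nlinarith
    have e2 : (k + 1) ^ 2 < (k + 2) ^ 2 := by gcongr; omega
    have e3 : 8 * (k + 2) ^ 2 ≤ a := h.trans ha
    have e4 : 2 * ((k + 2) ^ 2 * (s + 1)) ≤ a := by linarith
    have e5 : (k + 2) ^ 2 * (s + 2) = (k + 2) ^ 2 * (s + 1) + (k + 2) ^ 2 := by ring
    omega
  · rw [Nat.sub_add_cancel h3]
    have : (t + 1) * (2 * (k + 2) ^ 2) ≤ (2 * t) * (2 * (k + 2) ^ 2) := Nat.mul_le_mul_right _ (by omega)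
    linarith

lemma two_case (a b c d : ℝ) (h : a ≤ b + c) (hb : b ≤ d / 2) (hc : c ≤ d / 2) : a ≤ d := by linarith

set_option maxHeartbeats 1000000 in
lemma core (k P q : ℕ) (hk : 32 ≤ k) (hP : 1 ≤ P) (hPk : ((2:ℝ) ^ k) ^ 32 ≤ Real.log P) (hq : q ≤ (P ^ 133) ^ k) (hq3 : P ^ 3 ≤ q)
    (hsm : ∀ p : ℕ, p.Prime → p ∣ q → p ≤ P) (χ : DirichletCharacter ℂ q) (hχ : Pr χ) (x : ℤ) (M : ℕ) (hM : P ^ 600 ≤ M) :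
    ‖av x M (cz χ)‖ ^ (2 ^ k) ≤ Real.exp (-((2:ℝ) ^ k) ^ 2) := by
  have hM0 : 0 < M := lt_of_lt_of_le (Nat.one_le_pow _ _ hP) hM
  have hPR : (0:ℝ) < P := by exact_mod_cast hP
  have hV : 1 ≤ P ^ 133 := Nat.one_le_pow _ _ hP
  have hq0 : q ≠ 0 := by have := Nat.one_le_pow 3 P hP; omega
  have hMR : (P:ℝ) ^ 600 ≤ M := by exact_mod_cast hM
  obtain ⟨ka1, ka2⟩ := k_arith k hk
  have hN16 : 65536 ≤ (2:ℝ) ^ k := by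
    calc (65536:ℝ) = 2 ^ 16 := by norm_num
      _ ≤ 2 ^ k := pow_le_pow_right₀ (by norm_num) (by omega)
  have hkN : (k:ℝ) + 1 ≤ 2 ^ k := by
    have : k < 2 ^ k := Nat.lt_two_pow_self
    exact_mod_cast this
  have hk8 : 8 * ((k:ℝ) + 2) ^ 2 ≤ 2 ^ k := by exact_mod_cast ka1
  have h4N : (4:ℝ) ^ k = (2 ^ k) ^ 2 := by rw [← pow_mul, mul_comm, pow_mul]; norm_num
  set N : ℝ := (2:ℝ) ^ k with hNdef
  clear_value N
  have hNone : 1 ≤ N := by linarith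
  have hLN : N ^ 32 ≤ Real.log P := hPk
  have hL2 : N ^ 2 ≤ Real.log P := (pow_le_pow_right₀ hNone (by norm_num)).trans hLN
  have herr := err_arith N P M _ (by linarith) hPR rfl hL2 hMR
  by_cases hS : ∃ p a : ℕ, p.Prime ∧ 2 ≤ a ∧ p ^ a ∣ q ∧ ¬ p ^ (a + 1) ∣ q ∧ Real.exp (N ^ 4) < ((p ^ a : ℕ) : ℝ)
  · obtain ⟨p, a, hp, ha, hd, hnd, hE⟩ := hS
    obtain ⟨u, rfl⟩ := hd
    have hu : u ≠ 0 := by rintro rfl; simp at hq0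
    have hcop : Nat.Coprime (p ^ a) u := by
      apply Nat.Coprime.pow_left
      rw [hp.coprime_iff_not_dvd]
      intro h
      apply hnd
      rw [pow_succ]
      exact Nat.mul_dvd_mul_left _ h
    have hpP : p ≤ P := hsm p hp ((dvd_pow_self p (by omega)).mul_right u)
    have hsm' : ∀ p : ℕ, p.Prime → p ∣ u → p ≤ P := fun p hp h => hsm p hp (h.mul_left _)
    have hp0 : (0:ℝ) < p := by exact_mod_cast hp.pos
    have hlog : N ^ 4 ≤ a * Real.log p := by
      have := Real.log_le_log (Real.exp_pos _) hE.le
      rw [Real.log_exp] at this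
      push_cast at this
      rwa [Real.log_pow] at this
    have hlp : 0 ≤ Real.log p := Real.log_nonneg (by exact_mod_cast hp.one_lt.le)
    have hpe : (p:ℝ) = Real.exp (Real.log p) := (Real.exp_log hp0).symm
    by_cases haN : 2 ^ k ≤ a
    · obtain ⟨g, hg1, hg2⟩ := g_exists k a hk haN
      have hmain := caseS2 P (P ^ 133) k (by omega) hP hV p a u hp hpP hcop hu χ hχ hsm' hq g hg1 x M hM0
      push_cast at hmain
      rw [← hNdef] at hmain
      refine two_case _ _ _ _ hmain ?_ herr
      have hpg : (p:ℝ) ^ (g + 1) = Real.exp ((g + 1) * Real.log p) := by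
        conv_lhs => rw [hpe, ← Real.exp_nat_mul]
        push_cast; rfl
      have hg2' : (a:ℝ) ≤ (g + 1) * (4 * (k + 2) ^ 2) := by exact_mod_cast hg2
      have hgl : 2 * N ^ 2 ≤ (g + 1) * Real.log p := by
        have h1 : N ^ 4 ≤ ((g + 1) * Real.log p) * N := by
          calc N ^ 4 ≤ a * Real.log p := hlog
            _ ≤ (g + 1) * (4 * (k + 2) ^ 2) * Real.log p := by gcongr
            _ = ((g + 1) * Real.log p) * (4 * (k + 2) ^ 2) := by ring
            _ ≤ ((g + 1) * Real.log p) * N := by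
              gcongr
              nlinarith
        have h2 : N ^ 3 ≤ (g + 1) * Real.log p := by
          have : N ^ 3 * N ≤ ((g + 1) * Real.log p) * N := by linarith [show N ^ 3 * N = N ^ 4 by ring]
          exact le_of_mul_le_mul_right this (by linarith)
        have h3 : 2 * N ^ 2 ≤ N * N ^ 2 := by gcongr; linarith
        linarith [show N * N ^ 2 = N ^ 3 by ring]
      have := half_exp N _ (by linarith) hgl
      rw [hpg, div_eq_mul_inv, ← Real.exp_neg]
      refine le_trans ?_ this
      gcongr
      have : N ≤ N ^ 3 := le_self_pow₀ hNone (by norm_num)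
      linarith
    · push Not at haN
      have haN' : (a:ℝ) ≤ N := by rw [hNdef]; exact_mod_cast haN.le
      have hlp3 : N ^ 3 ≤ Real.log p := by
        have : N ^ 3 * N ≤ Real.log p * N := by nlinarith [show N ^ 3 * N = N ^ 4 by ring]
        exact le_of_mul_le_mul_right this (by linarith)
      have hlp2 : 2 * N ^ 2 ≤ Real.log p := by
        have h3 : 2 * N ^ 2 ≤ N * N ^ 2 := by gcongr; linarith
        linarith [show N * N ^ 2 = N ^ 3 by ring]
      have hkp : k < p := by
        have h1 : Real.log p + 1 ≤ p := by
          conv_rhs => rw [hpe]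
          exact Real.add_one_le_exp _
        have : N ≤ N ^ 3 := le_self_pow₀ hNone (by norm_num)
        have : (k:ℝ) < p := by linarith
        exact_mod_cast this
      have hmain := caseS1 P (P ^ 133) k (by omega) hP hV p a u hp hpP ha hcop hu χ hχ hsm' hq hkp x M hM0
      push_cast at hmain
      rw [h4N, ← hNdef] at hmain
      refine two_case _ _ _ _ hmain ?_ herr
      have := half_exp N _ (by linarith) hlp2
      refine le_trans ?_ this
      rw [div_eq_mul_inv]
      have e : (p:ℝ)⁻¹ = Real.exp (-Real.log p) := by rw [Real.exp_neg, Real.exp_log hp0]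
      rw [e]
      gcongr
      have hk0 : (0:ℝ) ≤ k := by positivity
      nlinarith [mul_le_mul_of_nonneg_left hkN (show 0 ≤ N by linarith), mul_le_mul_of_nonneg_right hN16 (show 0 ≤ N^2 by positivity)]
  · push Not at hS
    have hNpos : 0 < N := by linarith
    have hY1 : (((4 ^ (k + 2)) ^ 4 : ℕ) : ℝ) ≤ N ^ 9 := by
      push_cast
      rw [pow_add, h4N]
      calc (((N ^ 2) * 4 ^ 2) ^ 4 : ℝ) = 65536 * N ^ 8 := by ring
        _ ≤ N * N ^ 8 := by gcongr
        _ = N ^ 9 := by ring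
    have hZ1 : (1:ℝ) ≤ N ^ 4 := one_le_pow₀ hNone
    have hZP' : Real.exp (N ^ 4 * N ^ 9) ≤ P := by
      rw [← Real.le_log_iff_exp_le hPR]
      calc N ^ 4 * N ^ 9 = N ^ 13 := by ring
        _ ≤ N ^ 32 := pow_le_pow_right₀ hNone (by norm_num)
        _ ≤ _ := hLN
    obtain ⟨r, u, rfl, h2, h3, h4, h5⟩ := find_r P ((4 ^ (k + 2)) ^ 4) (N ^ 4) (by linarith) hP (by
        refine hY1.trans ?_
        have h1 : N ^ 4 / 3 ≤ Real.exp (N ^ 4 / 3) := by linarith [Real.add_one_le_exp (N ^ 4 / 3)]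
        have e : Real.exp (N ^ 4) = Real.exp (N ^ 4 / 3) ^ 3 := by rw [← Real.exp_nat_mul]; congr 1; push_cast; ring
        rw [e, show N ^ 9 = (N ^ 3) ^ 3 by ring]
        apply pow_le_pow_left₀ (by positivity)
        refine le_trans ?_ h1
        have : 3 * N ^ 3 ≤ N * N ^ 3 := by gcongr; linarith
        linarith [show N * N ^ 3 = N ^ 4 by ring]) (by
        refine le_trans (Real.exp_le_exp.2 ?_) hZP'
        nlinarith [one_le_pow₀ hNone (n := 9)]) (by
        refine le_trans ?_ hZP'
        rw [← Real.exp_nat_mul]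
        apply Real.exp_le_exp.2
        rw [mul_comm]
        gcongr) q hq3 hsm hS
    have hr0 : r ≠ 0 := by rintro rfl; simp at hq0
    have hu0 : u ≠ 0 := by rintro rfl; simp at hq0
    have hmain := caseM P (P ^ 133) k ((4 ^ (k + 2)) ^ 4) (N ^ 4) hZ1 le_rfl hP hV r u hr0 h4 h2 hu0 h5 χ hχ
      (fun p hp h => hsm p hp (h.mul_left _)) (le_trans (Nat.le_mul_of_pos_left u (Nat.pos_of_ne_zero hr0)) hq) x M hM0
    push_cast at hmain
    rw [← hNdef] at hmain
    refine two_case _ _ _ _ hmain ?_ herr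
    have hlr : N ^ 32 ≤ Real.log r := hLN.trans (Real.log_le_log hPR (by exact_mod_cast h3))
    have := half_exp N (Real.log r / (4 * N ^ 4)) (by linarith) (by
      rw [le_div_iff₀ (by positivity)]
      refine le_trans ?_ hlr
      calc 2 * N ^ 2 * (4 * N ^ 4) = 8 * N ^ 6 := by ring
        _ ≤ N * N ^ 6 := by gcongr; linarith
        _ = N ^ 7 := by ring
        _ ≤ N ^ 32 := pow_le_pow_right₀ hNone (by norm_num))
    refine le_trans ?_ this
    have h1 : 1 ≤ N ^ 3 := one_le_pow₀ hNone
    nlinarith [Real.exp_pos (-(Real.log r / (4 * N ^ 4)))]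

lemma complete_av {q : ℕ} (hq : 1 < q) (χ : DirichletCharacter ℂ q) (hχ : Pr χ) (x : ℤ) (M : ℕ) :
    ‖∑ i ∈ Finset.range M, cz χ (x + i)‖ ≤ q := by
  have : NeZero q := ⟨by omega⟩
  have hne : χ ≠ 1 := by
    rintro rfl
    obtain ⟨n, -, h2, h3⟩ := hχ 1 (one_dvd _) hq
    apply h2
    simp only [cz] at h3 ⊢
    by_cases hu : IsUnit (n : ZMod q)
    · exact MulChar.one_apply hu
    · exact absurd (MulChar.map_nonunit _ hu) h3
  have hblock : ∀ y : ℤ, ∑ i ∈ Finset.range q, cz χ (y + i) = 0 := by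
    intro y
    have h := sum_range_zmod q (fun z : ZMod q => χ ((y : ZMod q) + z))
    have h2 : ∑ z : ZMod q, χ ((y : ZMod q) + z) = ∑ z : ZMod q, χ z :=
      Fintype.sum_equiv (Equiv.addLeft (y : ZMod q)) _ _ (fun z => by simp)
    rw [h2, MulChar.sum_eq_zero_of_ne_one hne] at h
    rw [← h]
    apply Finset.sum_congr rfl
    intro i _
    simp [cz]
  induction M using Nat.strong_induction_on generalizing x with
  | _ M ih =>
    rcases Nat.lt_or_ge M q with h | h
    · calc ‖∑ i ∈ Finset.range M, cz χ (x + i)‖ ≤ ∑ i ∈ Finset.range M, ‖cz χ (x + i)‖ := norm_sum_le _ _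
        _ ≤ ∑ i ∈ Finset.range M, 1 := Finset.sum_le_sum fun i _ => cz_norm_le _ _
        _ = M := by simp
        _ ≤ q := by exact_mod_cast h.le
    · obtain ⟨m, rfl⟩ := Nat.exists_eq_add_of_le h
      rw [Finset.sum_range_add, hblock, zero_add]
      have := ih m (by omega) (x + q)
      refine le_trans (le_of_eq ?_) this
      congr 1
      apply Finset.sum_congr rfl
      intro i _
      congr 1
      push_cast; ring

/-- Part I main theorem. -/
theorem partI : ∃ l0 : ℝ, 1 ≤ l0 ∧ ∀ (P : ℕ) (l : ℝ), l = Real.log (Real.log P) → l0 ≤ l → ∀ q : ℕ, 1 < q → Real.log q ≤ 4 * l * Real.log P →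
    (∀ p : ℕ, p.Prime → p ∣ q → p ≤ P) → ∀ χ : DirichletCharacter ℂ q, Pr χ → ∀ (x : ℤ) (M : ℕ), P ^ 600 ≤ M →
    ‖∑ i ∈ Finset.range M, cz χ (x + i)‖ ≤ M * Real.exp (-l ^ 3) := by
  refine ⟨1024, by norm_num, ?_⟩
  intro P l hl hl0 q hq1 hq hsm χ hχ x M hM
  set k := ⌊l / 32⌋₊ with hkd
  have hk1 : (k:ℝ) ≤ l / 32 := Nat.floor_le (by linarith)
  have hk2 : l / 32 < k + 1 := Nat.lt_floor_add_one _
  have hk : 32 ≤ k := Nat.le_floor (by push_cast; linarith)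
  obtain ⟨ka1, ka2⟩ := k_arith k hk
  have hkR : (32:ℝ) ≤ k := by exact_mod_cast hk
  have hlogpos : 0 < Real.log P := by
    by_contra hcon
    push Not at hcon
    have hP0 : Real.log P = 0 := le_antisymm hcon (Real.log_natCast_nonneg P)
    rw [hP0, Real.log_zero] at hl
    linarith
  have hLe : Real.log P = Real.exp l := by rw [hl, Real.exp_log hlogpos]
  have hP2 : 1 < P := by
    by_contra hcon
    have : P = 0 ∨ P = 1 := by omega
    rcases this with rfl | rfl <;> simp at hlogpos
  have hPR : (0:ℝ) < P := by exact_mod_cast (by omega : 0 < P)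
  have hPe : (P:ℝ) = Real.exp (Real.log P) := (Real.exp_log hPR).symm
  have hPk : ((2:ℝ) ^ k) ^ 32 ≤ Real.log P := by
    rw [hLe, ← pow_mul]
    have h2 : (2:ℝ) ≤ Real.exp 1 := by linarith [Real.exp_one_gt_d9]
    calc (2:ℝ) ^ (k * 32) ≤ Real.exp 1 ^ (k * 32) := pow_le_pow_left₀ (by norm_num) h2 _
      _ = Real.exp ((k * 32 : ℕ) : ℝ) := by rw [← Real.exp_nat_mul, mul_one]
      _ ≤ _ := Real.exp_le_exp.2 (by push_cast; linarith)
  have hMR : (P:ℝ) ^ 600 ≤ M := by exact_mod_cast hM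
  have hM0 : (0:ℝ) < M := lt_of_lt_of_le (by positivity) hMR
  have hN : l ^ 3 ≤ (2:ℝ) ^ k := by
    have : ((32:ℝ) * (k + 1)) ^ 3 ≤ 2 ^ k := by exact_mod_cast ka2
    refine le_trans (pow_le_pow_left₀ (by linarith) ?_ 3) this
    linarith
  set N : ℝ := (2:ℝ) ^ k with hNd
  have hNone : 1 ≤ N := one_le_pow₀ (by norm_num)
  suffices hs : ‖∑ i ∈ Finset.range M, cz χ (x + i)‖ ≤ M * Real.exp (-N) by
    refine hs.trans ?_
    gcongr
  by_cases hq3 : P ^ 3 ≤ q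
  · have hqV : q ≤ (P ^ 133) ^ k := by
      have : Real.log q ≤ Real.log (((P ^ 133) ^ k : ℕ) : ℝ) := by
        push_cast
        rw [Real.log_pow, Real.log_pow]
        refine hq.trans ?_
        rw [← mul_assoc]
        apply mul_le_mul_of_nonneg_right _ hlogpos.le
        push_cast
        linarith
      have := (Real.log_le_log_iff (by exact_mod_cast (by omega : 0 < q)) (by positivity)).1 this
      exact_mod_cast this
    have := core k P q hk (by omega) hPk hqV hq3 hsm χ hχ x M hM
    have h2 : ‖av x M (cz χ)‖ ≤ Real.exp (-N) := by
      have e : Real.exp (-((2:ℝ) ^ k) ^ 2) = Real.exp (-N) ^ (2 ^ k) := by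
        rw [← Real.exp_nat_mul]; congr 1; push_cast; rw [hNd]; ring
      rw [e] at this
      exact le_of_pow_le_pow_left₀ (by positivity) (Real.exp_pos _).le this
    rw [av, norm_div, Complex.norm_natCast, div_le_iff₀ hM0] at h2
    linarith
  · push Not at hq3
    refine (complete_av hq1 χ hχ x M).trans ?_
    have hqR : (q:ℝ) ≤ (P:ℝ) ^ 3 := by exact_mod_cast hq3.le
    have hNL : N ≤ Real.log P := (le_self_pow₀ hNone (by norm_num)).trans hPk
    have : Real.exp N ≤ P := by rw [← Real.le_log_iff_exp_le hPR]; exact hNL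
    rw [Real.exp_neg, ← div_eq_mul_inv, le_div_iff₀ (Real.exp_pos _)]
    have hP1 : (1:ℝ) ≤ P := by exact_mod_cast hP2.le
    calc (q:ℝ) * Real.exp N ≤ (P:ℝ) ^ 3 * P := by gcongr
      _ = (P:ℝ) ^ 4 := by ring
      _ ≤ (P:ℝ) ^ 600 := pow_le_pow_right₀ hP1 (by norm_num)
      _ ≤ M := hMR
end CS

namespace CS

/-- Bound for the logarithmic derivative of a zero-free function (Borel–Carathéodory). -/
lemma logDeriv_core (h : ℂ → ℂ) (hd : Differentiable ℂ h) (s0 : ℂ) (R B : ℝ) (hR : 0 < R)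
    (hB : 0 < B) (hz : ∀ s ∈ Metric.ball s0 R, h s ≠ 0)
    (hb : ∀ s ∈ Metric.ball s0 R, ‖h s‖ ≤ Real.exp B * ‖h s0‖) :
    ‖deriv h s0 / h s0‖ ≤ 2 * B / R := by
  have h0 : h s0 ≠ 0 := hz s0 (Metric.mem_ball_self hR)
  set g : ℂ → ℂ := fun z => h (s0 + z) / h s0 with hg
  have hgd : Differentiable ℂ g := by
    intro z
    exact ((hd _).comp z (by fun_prop)).div_const _
  have hmem : ∀ z ∈ Metric.ball (0:ℂ) R, s0 + z ∈ Metric.ball s0 R := by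
    intro z hz; simpa [dist_eq_norm] using hz
  have hgz : ∀ z ∈ Metric.ball (0:ℂ) R, g z ≠ 0 := fun z hz' => div_ne_zero (hz _ (hmem z hz')) h0
  have hgdd : Differentiable ℂ (deriv g) := by
    have := (hgd.contDiff (n := 2)).differentiable_deriv_two
    exact this
  have hex : DifferentiableOn ℂ (fun z => deriv g z / g z) (Metric.ball 0 R) :=
    fun z hz' => ((hgdd z).div (hgd z) (hgz z hz')).differentiableWithinAt
  obtain ⟨k, hk0, hk⟩ := (hex.isExactOn_ball).with_val_at 0 0
  have hkd : DifferentiableOn ℂ k (Metric.ball 0 R) :=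
    fun z hz' => (hk z hz').differentiableAt.differentiableWithinAt
  have hg0 : g 0 = 1 := by simp [hg, h0]
  -- exp k = g
  have hexp : ∀ z ∈ Metric.ball (0:ℂ) R, Complex.exp (k z) = g z := by
    have hder : ∀ z ∈ Metric.ball (0:ℂ) R, HasDerivAt (fun z => Complex.exp (- k z) * g z) 0 z := by
      intro z hz'
      have h1 := ((hk z hz').neg.cexp).mul (hgd z).hasDerivAt
      have := hgz z hz'
      have h2 : Complex.exp (- k z) * -(deriv g z / g z) * g z + Complex.exp (- k z) * deriv g z = 0 := by
        field_simp
        ring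
      exact h2 ▸ h1
    intro z hz'
    have hc := (convex_ball (0:ℂ) R).is_const_of_fderivWithin_eq_zero (𝕜 := ℂ)
      (f := fun z => Complex.exp (- k z) * g z)
      (fun z hz' => (hder z hz').differentiableAt.differentiableWithinAt)
      (fun z hz' => by
        rw [fderivWithin_of_isOpen Metric.isOpen_ball hz']
        have := (hder z hz').hasFDerivAt.fderiv
        rw [this]; ext; simp) hz' (Metric.mem_ball_self hR)
    simp only [hk0, hg0, neg_zero, Complex.exp_zero, mul_one, Complex.exp_neg] at hc
    have := Complex.exp_ne_zero (k z)
    field_simp at hc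
    exact hc.symm
  have hmaps : Set.MapsTo k (Metric.ball 0 R) {z | z.re ≤ B} := by
    intro z hz'
    have h1 : ‖g z‖ ≤ Real.exp B := by
      rw [hg]; simp only [norm_div]
      rw [div_le_iff₀ (norm_pos_iff.2 h0)]
      exact hb _ (hmem z hz')
    rw [← hexp z hz', Complex.norm_exp] at h1
    exact Real.exp_le_exp.1 h1
  have hderk : HasDerivAt k (deriv h s0 / h s0) 0 := by
    have h1 := hk 0 (Metric.mem_ball_self hR)
    rw [hg0, div_one] at h1
    have : HasDerivAt g (deriv h s0 / h s0) 0 := by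
      have h2 : HasDerivAt h (deriv h s0) (s0 + 0) := by simpa using (hd s0).hasDerivAt
      have := (h2.comp_const_add s0 0).div_const (h s0)
      exact this
    rwa [this.deriv] at h1
  have hbc : ∀ z ∈ Metric.ball (0:ℂ) R, ‖k z‖ ≤ 2 * B * ‖z‖ / (R - ‖z‖) := fun z hz' =>
    Complex.borelCaratheodory_zero hB hkd hmaps hR hz' hk0
  have ht : Filter.Tendsto (fun z => ‖z⁻¹ * k z‖) (nhdsWithin 0 {0}ᶜ) (nhds ‖deriv h s0 / h s0‖) := by
    have := (hasDerivAt_iff_tendsto_slope.1 hderk).norm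
    refine this.congr ?_
    intro z; simp [slope_def_field, hk0, div_eq_mul_inv, mul_comm]
  have ht2 : Filter.Tendsto (fun z : ℂ => 2 * B / (R - ‖z‖)) (nhdsWithin 0 {0}ᶜ) (nhds (2 * B / R)) := by
    have : ContinuousAt (fun z : ℂ => 2 * B / (R - ‖z‖)) 0 := by
      refine ContinuousAt.div (by fun_prop) (by fun_prop) ?_
      simp [hR.ne']
    have := this.tendsto
    simp only [norm_zero, sub_zero] at this
    exact this.mono_left nhdsWithin_le_nhds
  refine le_of_tendsto_of_tendsto ht ht2 ?_
  filter_upwards [self_mem_nhdsWithin, nhdsWithin_le_nhds (Metric.ball_mem_nhds (0:ℂ) hR)] with z hz1 hz2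
  have hzz : 0 < ‖z‖ := norm_pos_iff.2 hz1
  have h1 := hbc z hz2
  have h2 : 0 < R - ‖z‖ := by simpa using hz2
  rw [norm_mul, norm_inv]
  calc ‖z‖⁻¹ * ‖k z‖ ≤ ‖z‖⁻¹ * (2 * B * ‖z‖ / (R - ‖z‖)) := by gcongr
    _ = 2 * B / (R - ‖z‖) := by field_simp

/-- Removing zeros improves the bound. -/
lemma factor_bound (f h : ℂ → ℂ) (hd : Differentiable ℂ h) (s0 : ℂ) (r B : ℝ) (hr : 0 < r)
    (L : List ℂ) (hL : ∀ ρ ∈ L, ρ ∈ Metric.closedBall s0 (r/3))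
    (hf : ∀ s, f s = h s * (L.map (fun ρ => s - ρ)).prod)
    (hb : ∀ s ∈ Metric.closedBall s0 r, ‖f s‖ ≤ Real.exp B * ‖f s0‖) :
    ∀ s ∈ Metric.closedBall s0 r, ‖h s‖ ≤ Real.exp B * (1/2)^L.length * ‖h s0‖ := by
  have key : ∀ L : List ℂ, (∀ ρ ∈ L, ρ ∈ Metric.closedBall s0 (r/3)) → ∀ s, ‖s - s0‖ = r →
      ‖(L.map (fun ρ => s0 - ρ)).prod‖ ≤ (1/2)^L.length * ‖(L.map (fun ρ => s - ρ)).prod‖ ∧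
      0 < ‖(L.map (fun ρ => s - ρ)).prod‖ := by
    intro L
    induction L with
    | nil => intro _ s _; simp
    | cons ρ L ih =>
      intro hL s hs
      have h1 := ih (fun ρ hρ => hL ρ (List.mem_cons_of_mem _ hρ)) s hs
      have h2 : ‖s0 - ρ‖ ≤ r/3 := by
        have := hL ρ (by simp)
        rwa [Metric.mem_closedBall, dist_comm, dist_eq_norm] at this
      have h3 : 2*r/3 ≤ ‖s - ρ‖ := by
        have : ‖s - s0‖ ≤ ‖s - ρ‖ + ‖s0 - ρ‖ := by
          calc ‖s - s0‖ = ‖(s - ρ) - (s0 - ρ)‖ := by congr 1; ring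
            _ ≤ _ := norm_sub_le _ _
        linarith
      simp only [List.map_cons, List.prod_cons, norm_mul, List.length_cons, pow_succ]
      refine ⟨?_, mul_pos (by linarith) h1.2⟩
      calc ‖s0 - ρ‖ * ‖(L.map (fun ρ => s0 - ρ)).prod‖
          ≤ (1/2 * ‖s - ρ‖) * ((1/2)^L.length * ‖(L.map (fun ρ => s - ρ)).prod‖) := by
            apply mul_le_mul _ h1.1 (norm_nonneg _) (by positivity)
            linarith
        _ = _ := by ring
  intro s hs
  refine Complex.norm_le_of_forall_mem_frontier_norm_le (U := Metric.ball s0 r) Metric.isBounded_ball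
    hd.diffContOnCl ?_ ?_
  · intro z hz
    rw [frontier_ball _ hr.ne', Metric.mem_sphere, dist_eq_norm] at hz
    obtain ⟨h1, h2⟩ := key L hL z hz
    have h3 := hb z (by rw [Metric.mem_closedBall, dist_eq_norm, hz])
    rw [hf, hf, norm_mul, norm_mul] at h3
    have : ‖h z‖ * ‖(L.map (fun ρ => z - ρ)).prod‖ ≤
        (Real.exp B * (1/2)^L.length * ‖h s0‖) * ‖(L.map (fun ρ => z - ρ)).prod‖ := by
      refine h3.trans ?_
      calc _ ≤ Real.exp B * (‖h s0‖ * ((1/2)^L.length * ‖(L.map (fun ρ => z - ρ)).prod‖)) := by gcongr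
        _ = _ := by ring
    exact le_of_mul_le_mul_right this h2
  · rwa [closure_ball _ hr.ne']

lemma logDeriv_list (f h : ℂ → ℂ) (hd : Differentiable ℂ h) (s0 : ℂ) (L : List ℂ)
    (hf : ∀ s, f s = h s * (L.map (fun ρ => s - ρ)).prod) (h0 : f s0 ≠ 0) :
    deriv f s0 / f s0 = deriv h s0 / h s0 + (L.map (fun ρ => 1/(s0 - ρ))).sum := by
  induction L generalizing h with
  | nil =>
    have : f = h := by ext s; simp [hf]
    simp [this]
  | cons ρ L ih =>
    have h1 := ih (fun s => h s * (s - ρ)) (by fun_prop) (fun s => by rw [hf]; simp [mul_assoc])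
    have hh := h0
    rw [hf] at hh
    simp only [List.map_cons, List.prod_cons] at hh
    have h3 : h s0 ≠ 0 := left_ne_zero_of_mul hh
    have h4 : s0 - ρ ≠ 0 := left_ne_zero_of_mul (right_ne_zero_of_mul hh)
    rw [h1]
    have h2 : deriv (fun s => h s * (s - ρ)) s0 = deriv h s0 * (s0 - ρ) + h s0 := by
      have := ((hd s0).hasDerivAt.mul ((hasDerivAt_id s0).sub_const ρ)).deriv
      simp only [id, mul_one] at this
      exact this
    rw [h2]
    simp only [List.map_cons, List.sum_cons]
    field_simp
    ring

/-- Landau's local lemma. -/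
lemma landau (f : ℂ → ℂ) (s0 : ℂ) (r B : ℝ) (hr : 0 < r) (hB : 0 < B) (h0 : f s0 ≠ 0)
    (hb : ∀ s ∈ Metric.closedBall s0 r, ‖f s‖ ≤ Real.exp B * ‖f s0‖)
    (hre : ∀ s, f s = 0 → s.re < s0.re) (L : List ℂ)
    (hL : ∀ ρ ∈ L, ρ ∈ Metric.closedBall s0 (r/3)) (h : ℂ → ℂ) (hd : Differentiable ℂ h)
    (hf : ∀ s, f s = h s * (L.map (fun ρ => s - ρ)).prod) :
    -(deriv f s0 / f s0).re ≤ 6 * B / r - (L.map (fun ρ => (1/(s0 - ρ)).re)).sum := by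
  obtain ⟨m, hm⟩ : ∃ m : ℕ, Real.exp B < 2^m := pow_unbounded_of_one_lt _ (by norm_num)
  have key : ∀ m : ℕ, ∀ (L : List ℂ) (h : ℂ → ℂ), Real.exp B < 2^(m + L.length) →
      (∀ ρ ∈ L, ρ ∈ Metric.closedBall s0 (r/3)) → Differentiable ℂ h →
      (∀ s, f s = h s * (L.map (fun ρ => s - ρ)).prod) →
      -(deriv f s0 / f s0).re ≤ 6 * B / r - (L.map (fun ρ => (1/(s0 - ρ)).re)).sum := by
    intro m
    induction m with
    | zero =>
      intro L h hm hL hd hf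
      exfalso
      have h1 := factor_bound f h hd s0 r B hr L hL hf hb s0 (Metric.mem_closedBall_self hr.le)
      have h2 : 0 < ‖h s0‖ := by
        rw [hf] at h0; exact norm_pos_iff.2 (left_ne_zero_of_mul h0)
      have h3 : 1 ≤ Real.exp B * (1/2)^L.length := by
        by_contra hc
        push Not at hc
        nlinarith
      rw [zero_add] at hm
      have h4 : Real.exp B * (1/2)^L.length < 1 := by
        rw [one_div, inv_pow, ← div_eq_mul_inv, div_lt_one (by positivity)]
        exact hm
      linarith
    | succ m ih =>
      intro L h hm hL hd hf
      by_cases hz : ∃ ρ ∈ Metric.closedBall s0 (r/3), h ρ = 0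
      · obtain ⟨ρ, hρ, hρ0⟩ := hz
        have hds : Differentiable ℂ (dslope h ρ) := by
          rw [← differentiableOn_univ, Complex.differentiableOn_dslope (Filter.univ_mem)]
          exact hd.differentiableOn
        have h1 := ih (ρ :: L) (dslope h ρ) (by
            simp only [List.length_cons]; convert hm using 2; ring)
          (by
            intro x hx
            rcases List.mem_cons.1 hx with rfl | hx
            · exact hρ
            · exact hL x hx) hds
          (by
            intro s
            rw [hf]
            have := sub_smul_dslope h ρ s
            rw [hρ0, sub_zero, smul_eq_mul] at this
            simp only [List.map_cons, List.prod_cons]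
            rw [← this]; ring)
        refine h1.trans ?_
        simp only [List.map_cons, List.sum_cons]
        have h2 : 0 ≤ (1/(s0 - ρ)).re := by
          rw [one_div, Complex.inv_re]
          have := hre ρ (by rw [hf, hρ0, zero_mul])
          apply div_nonneg _ (Complex.normSq_nonneg _)
          rw [Complex.sub_re]; linarith
        linarith
      · push Not at hz
        have h1 := logDeriv_core h hd s0 (r/3) B (by linarith) hB
          (fun s hs => hz s (Metric.ball_subset_closedBall hs))
          (fun s hs => by
            have h1 := factor_bound f h hd s0 r B hr L hL hf hb s
              (Metric.ball_subset_closedBall (Metric.ball_subset_ball (by linarith) hs))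
            refine h1.trans ?_
            have : (1/2:ℝ)^L.length ≤ 1 := pow_le_one₀ (by norm_num) (by norm_num)
            have : Real.exp B * (1/2)^L.length ≤ Real.exp B := mul_le_of_le_one_right (Real.exp_pos _).le this
            gcongr)
        rw [logDeriv_list f h hd s0 L hf h0]
        have h2 := (Complex.abs_re_le_norm (deriv h s0 / h s0)).trans h1
        have h3 := (abs_le.1 h2).1
        have h4 : ((L.map (fun ρ => 1/(s0 - ρ))).sum).re = (L.map (fun ρ => (1/(s0 - ρ)).re)).sum := by
          have := map_list_sum Complex.reAddGroupHom (L.map (fun ρ => 1/(s0 - ρ)))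
          rw [List.map_map] at this
          exact this
        rw [Complex.add_re, h4]
        have : 2 * B / (r/3) = 6 * B / r := by field_simp; norm_num
        linarith
  exact key m L h (by
    refine hm.trans_le ?_
    exact pow_le_pow_right₀ (by norm_num) (by omega)) hL hd hf

end CS

namespace CS

/-- `(n+1)^(-s)` -/
noncomputable def pw (s : ℂ) (n : ℕ) : ℂ := ((n + 1 : ℝ) : ℂ) ^ (-s)

lemma pw_norm (s : ℂ) (n : ℕ) : ‖pw s n‖ = (n + 1 : ℝ) ^ (-s.re) := by
  rw [pw, Complex.norm_cpow_eq_rpow_re_of_pos (by positivity)]; simp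

lemma pw_diff (n : ℕ) : Differentiable ℂ (fun s => pw s n) := by
  intro s
  unfold pw
  have : ((n + 1 : ℝ) : ℂ) ≠ 0 := by exact_mod_cast (by positivity : (n + 1 : ℝ) ≠ 0)
  exact (differentiableAt_id.neg).const_cpow (Or.inl this)

lemma hasDeriv_cpow (s : ℂ) (t : ℝ) (ht : 0 < t) :
    HasDerivAt (fun x : ℝ => (x : ℂ) ^ (-s)) (-s * (t : ℂ) ^ (-s - 1)) t := by
  by_cases hs : s = 0
  · subst hs; simp only [neg_zero, Complex.cpow_zero, zero_mul]; exact hasDerivAt_const _ _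
  · have h1 := hasDerivAt_ofReal_cpow_const' (x := t) (r := -s - 1) ht.ne' (by
      intro h; apply hs; simpa using h)
    have h2 := h1.const_mul (-s)
    refine h2.congr_of_eventuallyEq ?_ |>.congr_deriv rfl
    filter_upwards with x
    have : -s - 1 + 1 = -s := by ring
    rw [this]
    have : -s ≠ 0 := neg_ne_zero.2 hs
    field_simp

lemma cpow_sub_le (s : ℂ) (hs : -1 ≤ s.re) (x y : ℝ) (hx : 0 < x) (hxy : x ≤ y) :
    ‖(y : ℂ) ^ (-s) - (x : ℂ) ^ (-s)‖ ≤ ‖s‖ * x ^ (-s.re - 1) * (y - x) := by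
  have := (convex_Icc x y).norm_image_sub_le_of_norm_hasDerivWithin_le (𝕜 := ℝ)
    (f := fun t : ℝ => (t : ℂ) ^ (-s)) (f' := fun t : ℝ => -s * (t : ℂ) ^ (-s - 1))
    (C := ‖s‖ * x ^ (-s.re - 1))
    (fun t ht => (hasDeriv_cpow s t (hx.trans_le ht.1)).hasDerivWithinAt)
    (fun t ht => by
      rw [norm_mul, norm_neg, Complex.norm_cpow_eq_rpow_re_of_pos (hx.trans_le ht.1)]
      simp only [Complex.sub_re, Complex.neg_re, Complex.one_re]
      gcongr ?_ * ?_
      exact Real.rpow_le_rpow_of_nonpos hx ht.1 (by linarith))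
    (Set.left_mem_Icc.2 hxy) (Set.right_mem_Icc.2 hxy)
  rwa [Real.norm_of_nonneg (by linarith)] at this

lemma pw_sub_le (s : ℂ) (hs : -1 ≤ s.re) (n : ℕ) :
    ‖pw s (n+1) - pw s n‖ ≤ ‖s‖ * (n + 1 : ℝ) ^ (-s.re - 1) := by
  have := cpow_sub_le s hs (n + 1) ((n + 1 : ℕ) + 1) (by positivity) (by push_cast; linarith)
  unfold pw
  refine this.trans (le_of_eq ?_)
  push_cast; ring

/-- the second order difference for zeta -/
lemma pw_sub2_le (s : ℂ) (hs : 0 ≤ s.re) (n : ℕ) :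
    ‖(s - 1) * pw s n - (pw (s-1) n - pw (s-1) (n+1))‖ ≤ ‖s - 1‖ * ‖s‖ * (n + 1 : ℝ) ^ (-s.re - 1) := by
  set x : ℝ := n + 1 with hx
  have hx0 : 0 < x := by positivity
  have hD : ∀ t ∈ Set.Icc x (x+1), HasDerivAt
      (fun t : ℝ => (t : ℂ) ^ (-(s-1)) + (s - 1) * (x : ℂ)^(-s) * t)
      (-(s-1) * (t:ℂ)^(-(s-1) - 1) + (s-1) * (x:ℂ)^(-s) * 1) t := by
    intro t ht
    exact (hasDeriv_cpow (s-1) t (hx0.trans_le ht.1)).add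
      ((Complex.ofRealCLM.hasDerivAt (x := t)).const_mul _)
  have := (convex_Icc x (x+1)).norm_image_sub_le_of_norm_hasDerivWithin_le (𝕜 := ℝ)
    (C := ‖s - 1‖ * ‖s‖ * x ^ (-s.re - 1)) (fun t ht => (hD t ht).hasDerivWithinAt)
    (fun t ht => by
      have e : -(s-1) * (t:ℂ)^(-(s-1) - 1) + (s-1) * (x:ℂ)^(-s) * 1 =
        -(s-1) * ((t:ℂ)^(-s) - (x:ℂ)^(-s)) := by
          have : -(s-1) - 1 = -s := by ring
          rw [this]; ring
      rw [e, norm_mul, norm_neg, mul_assoc]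
      gcongr
      refine (cpow_sub_le s (by linarith) x t hx0 ht.1).trans ?_
      have : t - x ≤ 1 := by linarith [ht.2]
      exact mul_le_of_le_one_right (by positivity) this)
    (Set.left_mem_Icc.2 (by linarith : x ≤ x + 1)) (Set.right_mem_Icc.2 (by linarith : x ≤ x + 1))
  have h1 : ‖x + 1 - x‖ = 1 := by simp
  rw [h1, mul_one] at this
  refine le_trans (le_of_eq ?_) this
  congr 1
  unfold pw
  rw [← hx]
  have : (((n + 1 : ℕ) : ℝ) + 1 : ℝ) = x + 1 := by rw [hx]; push_cast; ring
  rw [this]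
  push_cast; ring

lemma summable_pw (d : ℝ) (hd : 0 < d) : Summable (fun n : ℕ => (n + 1 : ℝ) ^ (-d - 1)) := by
  have h := (Real.summable_nat_rpow (p := -d - 1)).2 (by linarith)
  have := (summable_nat_add_iff 1).2 h
  simpa using this

/-- Analytic continuation of a representation by a normally convergent series. -/
lemma cont_sum (u : ℕ → ℂ → ℂ) (hu : ∀ n, Differentiable ℂ (u n)) (G : ℂ → ℂ) (hG : Differentiable ℂ G)
    (C : ℝ) (hC : 0 ≤ C) (hb : ∀ n s, 0 < s.re → ‖u n s‖ ≤ C * (1 + ‖s‖)^2 * (n + 1 : ℝ) ^ (-s.re - 1))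
    (h1 : ∀ s, 1 < s.re → HasSum (fun n => u n s) (G s)) (s : ℂ) (hs : 0 < s.re) :
    HasSum (fun n => u n s) (G s) := by
  have hsum : Summable (fun n => u n s) := by
    refine Summable.of_norm_bounded ?_ (fun n => hb n s hs)
    exact (summable_pw s.re hs).mul_left _
  set d := s.re / 2 with hd
  set R := ‖s‖ + 3 with hR
  set U : Set ℂ := {z | d < z.re} ∩ Metric.ball 0 R with hU
  have hUo : IsOpen U := (isOpen_lt continuous_const Complex.continuous_re).inter Metric.isOpen_ball
  have hUc : Convex ℝ U := (convex_halfSpace_re_gt d).inter (convex_ball _ _)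
  have hd0 : 0 < d := by positivity
  have hsre : s.re ≤ ‖s‖ := Complex.re_le_norm s
  have hsU : s ∈ U := ⟨by simp only [Set.mem_ofPred_eq]; linarith, by simp [hR]⟩
  have hF : DifferentiableOn ℂ (fun z => ∑' n, u n z) U := by
    refine differentiableOn_tsum_of_summable_norm (u := fun n => C * (1 + R)^2 * (n + 1 : ℝ) ^ (-d - 1))
      ((summable_pw d hd0).mul_left _) (fun n => (hu n).differentiableOn) hUo ?_
    intro n z hz
    have hz1 : d < z.re := hz.1
    have hz2 : ‖z‖ < R := by simpa using hz.2
    refine (hb n z (by linarith)).trans ?_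
    gcongr ?_ * (1 + ?_)^2 * ?_
    exact Real.rpow_le_rpow_of_exponent_le (by linarith [(Nat.cast_nonneg n : (0:ℝ) ≤ n)]) (by linarith)
  set z0 : ℂ := ((s.re + 2 : ℝ) : ℂ) with hz0
  have hz0re : z0.re = s.re + 2 := by simp [hz0]
  have hz0U : z0 ∈ U := by
    refine ⟨by simp only [Set.mem_ofPred_eq]; linarith, ?_⟩
    rw [mem_ball_zero_iff, hz0, Complex.norm_real, Real.norm_of_nonneg (by linarith)]
    linarith
  have heq := (hF.analyticOnNhd hUo).eqOn_of_preconnected_of_eventuallyEq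
    (hG.differentiableOn.analyticOnNhd hUo) hUc.isPreconnected hz0U (by
      have : {z : ℂ | 1 < z.re} ∈ nhds z0 :=
        (isOpen_lt continuous_const Complex.continuous_re).mem_nhds (by
          simp only [Set.mem_ofPred_eq]; linarith)
      filter_upwards [this] with z hz
      exact (h1 z hz).tsum_eq)
  have := heq hsU
  simp only at this
  rw [← this]
  exact hsum.hasSum

/-- Abel summation -/
lemma abel (a p : ℕ → ℂ) (N : ℕ) :
    ∑ n ∈ Finset.range N, (∑ i ∈ Finset.range (n+1), a i) * (p n - p (n+1)) =
      ∑ n ∈ Finset.range N, a n * p n - (∑ i ∈ Finset.range N, a i) * p N := by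
  induction N with
  | zero => simp
  | succ N ih =>
    rw [Finset.sum_range_succ, ih, Finset.sum_range_succ, Finset.sum_range_succ _ N]
    ring

lemma term_eq_pw (f : ℕ → ℂ) (s : ℂ) (n : ℕ) : LSeries.term f s (n+1) = f (n+1) * pw s n := by
  rw [LSeries.term_of_ne_zero (by omega), pw, div_eq_mul_inv, ← Complex.cpow_neg]
  push_cast; rfl

lemma LSeries_hasSum_pw {q : ℕ} [NeZero q] (χ : DirichletCharacter ℂ q) (s : ℂ) (hs : 1 < s.re) :
    HasSum (fun n : ℕ => cz χ (1 + n) * pw s n) (LSeries (fun n => χ n) s) := by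
  have h1 := (DirichletCharacter.LSeriesSummable_of_one_lt_re χ hs).LSeriesHasSum
  unfold LSeriesHasSum at h1
  rw [← hasSum_nat_add_iff' 1] at h1
  simp only [Finset.range_one, Finset.sum_singleton, LSeries.term_zero, sub_zero] at h1
  have e : (fun n : ℕ => cz χ (1 + n) * pw s n) = fun n => LSeries.term (fun n => χ n) s (n + 1) := by
    ext n
    rw [term_eq_pw]
    unfold cz
    push_cast
    rw [add_comm]
  rw [e]; exact h1

lemma L_hasSum {q : ℕ} [NeZero q] (χ : DirichletCharacter ℂ q) (hχ : χ ≠ 1) (K : ℝ) (hK : 0 ≤ K)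
    (hS : ∀ N : ℕ, ‖∑ i ∈ Finset.range N, cz χ (1 + i)‖ ≤ K) (s : ℂ) (hs : 0 < s.re) :
    HasSum (fun n : ℕ => (∑ i ∈ Finset.range (n+1), cz χ (1 + i)) * (pw s n - pw s (n+1)))
      (χ.LFunction s) := by
  have hb : ∀ (n : ℕ) (s : ℂ), 0 < s.re →
      ‖(∑ i ∈ Finset.range (n+1), cz χ (1 + i)) * (pw s n - pw s (n+1))‖ ≤
        K * (1 + ‖s‖)^2 * (n + 1 : ℝ) ^ (-s.re - 1) := by
    intro n s hs
    rw [norm_mul, norm_sub_rev, mul_assoc]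
    have h1 := pw_sub_le s (by linarith) n
    have h2 : ‖s‖ ≤ (1 + ‖s‖)^2 := by nlinarith [norm_nonneg s]
    apply mul_le_mul (hS _) (h1.trans _) (norm_nonneg _) hK
    gcongr
  refine cont_sum (fun n s => (∑ i ∈ Finset.range (n+1), cz χ (1 + i)) * (pw s n - pw s (n+1)))
    (fun n => (((pw_diff n).sub (pw_diff (n+1))).const_mul _)) _
    (DirichletCharacter.differentiable_LFunction hχ) K hK hb ?_ s hs
  intro s hs
  have hsum : Summable (fun n : ℕ => (∑ i ∈ Finset.range (n+1), cz χ (1 + i)) * (pw s n - pw s (n+1))) := by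
    refine Summable.of_norm_bounded ?_ (fun n => hb n s (by linarith))
    exact (summable_pw s.re (by linarith)).mul_left _
  rw [hsum.hasSum_iff_tendsto_nat]
  have h1 := (LSeries_hasSum_pw χ s hs).tendsto_sum_nat
  rw [← DirichletCharacter.LFunction_eq_LSeries χ hs] at h1
  have h2 : Filter.Tendsto (fun N : ℕ => (∑ i ∈ Finset.range N, cz χ (1 + i)) * pw s N) Filter.atTop (nhds 0) := by
    rw [tendsto_zero_iff_norm_tendsto_zero]
    have h3 : Filter.Tendsto (fun N : ℕ => K * (N + 1 : ℝ) ^ (-s.re)) Filter.atTop (nhds 0) := by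
      have := (tendsto_rpow_neg_atTop (show 0 < s.re by linarith)).comp
        (tendsto_natCast_atTop_atTop.atTop_add (tendsto_const_nhds (x := (1:ℝ))))
      simpa using this.const_mul K
    refine squeeze_zero (fun _ => norm_nonneg _) (fun N => ?_) h3
    rw [norm_mul, pw_norm]
    gcongr
    exact hS N
  have h4 := h1.sub h2
  rw [sub_zero] at h4
  refine h4.congr (fun N => ?_)
  rw [abel]

/-- the constant of tail sums -/
noncomputable def C0 : ℝ := ∑' n : ℕ, (n + 1 : ℝ) ^ (-(1/4:ℝ) - 1)

lemma C0_nonneg : 0 ≤ C0 := tsum_nonneg fun n => by positivity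

lemma tail_le (u : ℕ → ℂ) (G : ℂ) (h : HasSum u G) (D : ℝ) (hD : 0 ≤ D)
    (hu : ∀ n : ℕ, ‖u n‖ ≤ D * (n + 1 : ℝ) ^ (-(3/2:ℝ))) (N : ℕ) :
    ‖G - ∑ n ∈ Finset.range N, u n‖ ≤ D * C0 * (N + 1 : ℝ) ^ (-(1/4:ℝ)) := by
  have h1 := (hasSum_nat_add_iff' N).2 h
  have hsm := summable_pw (1/4) (by norm_num)
  have h2 : Summable (fun n : ℕ => D * (N + 1 : ℝ) ^ (-(1/4:ℝ)) * (n + 1 : ℝ) ^ (-(1/4:ℝ) - 1)) :=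
    hsm.mul_left _
  have h3 := tsum_of_norm_bounded (f := fun n => u (n + N)) h2.hasSum (fun n => by
    refine (hu (n + N)).trans ?_
    rw [mul_assoc]
    gcongr
    have : (-(3/2:ℝ)) = -(1/4) + (-(1/4) - 1) := by norm_num
    rw [this, Real.rpow_add (by positivity)]
    have hn : (0:ℝ) ≤ n := Nat.cast_nonneg n
    have hN : (0:ℝ) ≤ N := Nat.cast_nonneg N
    gcongr ?_ * ?_
    · apply Real.rpow_le_rpow_of_nonpos (by positivity) (by push_cast; linarith) (by norm_num)
    · apply Real.rpow_le_rpow_of_nonpos (by positivity) (by push_cast; linarith) (by norm_num))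
  rw [h1.tsum_eq] at h3
  refine h3.trans (le_of_eq ?_)
  rw [tsum_mul_left, C0]; ring

/-- Approximation by partial sums, for nontrivial characters. -/
lemma L_approx {q : ℕ} [NeZero q] (χ : DirichletCharacter ℂ q) (hχ : χ ≠ 1) (K : ℝ) (hK : 0 ≤ K)
    (hS : ∀ N : ℕ, ‖∑ i ∈ Finset.range N, cz χ (1 + i)‖ ≤ K) (s : ℂ) (hs : 1/2 ≤ s.re) (N : ℕ) :
    ‖χ.LFunction s - ∑ n ∈ Finset.range N, cz χ (1 + n) * pw s n‖ ≤
      K * (1 + ‖s‖ * C0) * (N + 1 : ℝ) ^ (-(1/4:ℝ)) := by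
  have h := tail_le _ _ (L_hasSum χ hχ K hK hS s (by linarith)) (K * ‖s‖) (by positivity) (fun n => by
    rw [norm_mul, norm_sub_rev, mul_assoc]
    have h1 := pw_sub_le s (by linarith) n
    apply mul_le_mul (hS _) (h1.trans _) (norm_nonneg _) hK
    gcongr
    · linarith [(Nat.cast_nonneg n : (0:ℝ) ≤ n)]
    · linarith) N
  rw [abel] at h
  have h2 : ‖(∑ i ∈ Finset.range N, cz χ (1 + i)) * pw s N‖ ≤ K * (N + 1 : ℝ) ^ (-(1/4:ℝ)) := by
    rw [norm_mul, pw_norm]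
    have : (N + 1 : ℝ) ^ (-s.re) ≤ (N + 1 : ℝ) ^ (-(1/4:ℝ)) :=
      Real.rpow_le_rpow_of_exponent_le (by linarith [(Nat.cast_nonneg N : (0:ℝ) ≤ N)]) (by linarith)
    apply mul_le_mul (hS _) this (by positivity) hK
  calc _ = ‖(χ.LFunction s - (∑ n ∈ Finset.range N, cz χ (1 + n) * pw s n -
        (∑ i ∈ Finset.range N, cz χ (1 + i)) * pw s N)) -
        (∑ i ∈ Finset.range N, cz χ (1 + i)) * pw s N‖ := by congr 1; ring
    _ ≤ _ := norm_sub_le _ _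
    _ ≤ K * ‖s‖ * C0 * (N + 1 : ℝ) ^ (-(1/4:ℝ)) + K * (N + 1 : ℝ) ^ (-(1/4:ℝ)) := add_le_add h h2
    _ = _ := by ring

/-- `(s-1)ζ(s)`, entire. -/
noncomputable def Zf (s : ℂ) : ℂ := DirichletCharacter.LFunctionTrivChar₁ 1 s

lemma Zf_diff : Differentiable ℂ Zf := DirichletCharacter.differentiable_LFunctionTrivChar₁ 1

lemma Zf_eq (s : ℂ) (hs : s ≠ 1) : Zf s = (s - 1) * riemannZeta s := by
  simp only [Zf, DirichletCharacter.LFunctionTrivChar₁]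
  rw [Function.update_of_ne hs, DirichletCharacter.LFunctionTrivChar, DirichletCharacter.LFunction_modOne_eq]

lemma zeta_hasSum (s : ℂ) (hs : 1 < s.re) : HasSum (fun n : ℕ => pw s n) (riemannZeta s) := by
  have h := LSeries_hasSum_pw (1 : DirichletCharacter ℂ 1) s hs
  rw [← DirichletCharacter.LFunction_eq_LSeries _ hs, DirichletCharacter.LFunction_modOne_eq] at h
  convert h using 2 with n
  unfold cz
  rw [MulChar.one_apply (isUnit_of_subsingleton _), one_mul]

lemma Zf_hasSum (s : ℂ) (hs : 0 < s.re) :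
    HasSum (fun n : ℕ => (s - 1) * pw s n - (pw (s-1) n - pw (s-1) (n+1))) (Zf s - 1) := by
  have hb : ∀ (n : ℕ) (s : ℂ), 0 < s.re → ‖(s - 1) * pw s n - (pw (s-1) n - pw (s-1) (n+1))‖ ≤
      1 * (1 + ‖s‖)^2 * (n + 1 : ℝ) ^ (-s.re - 1) := by
    intro n s hs
    refine (pw_sub2_le s hs.le n).trans ?_
    have : ‖s - 1‖ ≤ ‖s‖ + 1 := by simpa using norm_sub_le s 1
    have : ‖s - 1‖ * ‖s‖ ≤ 1 * (1 + ‖s‖)^2 := by nlinarith [norm_nonneg s, norm_nonneg (s-1)]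
    exact mul_le_mul_of_nonneg_right this (by positivity)
  have hd : ∀ n : ℕ, Differentiable ℂ (fun s => pw (s-1) n) := fun n =>
    (pw_diff n).comp (differentiable_id.sub_const 1)
  refine cont_sum (fun n s => (s - 1) * pw s n - (pw (s-1) n - pw (s-1) (n+1)))
    (fun n => ((differentiable_id.sub_const 1).mul (pw_diff n)).sub ((hd n).sub (hd (n+1))))
    (fun s => Zf s - 1) (Zf_diff.sub_const 1) 1 zero_le_one hb ?_ s hs
  intro s hs
  have hsum : Summable (fun n : ℕ => (s - 1) * pw s n - (pw (s-1) n - pw (s-1) (n+1))) := by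
    refine Summable.of_norm_bounded ?_ (fun n => hb n s (by linarith))
    exact (summable_pw s.re (by linarith)).mul_left _
  rw [hsum.hasSum_iff_tendsto_nat]
  have h1 := ((zeta_hasSum s hs).mul_left (s-1)).tendsto_sum_nat
  have hs1 : s ≠ 1 := by rintro rfl; simp at hs
  rw [← Zf_eq s hs1] at h1
  have h2 : Filter.Tendsto (fun N : ℕ => pw (s-1) N) Filter.atTop (nhds 0) := by
    rw [tendsto_zero_iff_norm_tendsto_zero]
    have h3 : Filter.Tendsto (fun N : ℕ => (N + 1 : ℝ) ^ (-(s-1).re)) Filter.atTop (nhds 0) := by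
      have := (tendsto_rpow_neg_atTop (show 0 < (s-1).re by simp; linarith)).comp
        (tendsto_natCast_atTop_atTop.atTop_add (tendsto_const_nhds (x := (1:ℝ))))
      exact this
    exact h3.congr (fun N => (pw_norm _ _).symm)
  have h4 := (h1.sub_const 1).add h2
  rw [add_zero] at h4
  refine h4.congr (fun N => ?_)
  rw [Finset.sum_sub_distrib, Finset.sum_range_sub']
  have : pw (s-1) 0 = 1 := by simp [pw]
  rw [this]; ring

lemma Zf_approx (s : ℂ) (hs : 1/2 ≤ s.re) (N : ℕ) :
    ‖Zf s - (s - 1) * ∑ n ∈ Finset.range N, pw s n - pw (s-1) N‖ ≤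
      ‖s - 1‖ * ‖s‖ * C0 * (N + 1 : ℝ) ^ (-(1/4:ℝ)) := by
  have h := tail_le _ _ (Zf_hasSum s (by linarith)) (‖s - 1‖ * ‖s‖) (by positivity) (fun n => by
    refine (pw_sub2_le s (by linarith) n).trans ?_
    gcongr
    · linarith [(Nat.cast_nonneg n : (0:ℝ) ≤ n)]
    · linarith) N
  rw [Finset.sum_sub_distrib, Finset.sum_range_sub', ← Finset.mul_sum] at h
  have : pw (s-1) 0 = 1 := by simp [pw]
  rw [this] at h
  refine le_trans (le_of_eq ?_) h
  congr 1; ring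

end CS

namespace CS

lemma rpow_le_inv_mul (σ θ x N : ℝ) (hσ : 1 - θ ≤ σ) (hθ : 0 ≤ θ) (hx : 1 ≤ x) (hN : x ≤ N) :
    x ^ (-σ) ≤ x⁻¹ * N ^ θ := by
  have h1 : x ^ (-σ) ≤ x ^ (-1 + θ) := Real.rpow_le_rpow_of_exponent_le hx (by linarith)
  rw [Real.rpow_add (by linarith), Real.rpow_neg_one] at h1
  refine h1.trans ?_
  gcongr

lemma harm_le (N : ℕ) : ∑ n ∈ Finset.range N, ((n:ℝ) + 1)⁻¹ ≤ 1 + Real.log N := by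
  have := harmonic_le_one_add_log N
  unfold harmonic at this
  push_cast at this
  exact this

lemma first_part (σ θ : ℝ) (N : ℕ) (hσ : 1 - θ ≤ σ) (hθ : 0 ≤ θ) :
    ∑ n ∈ Finset.range N, ((n:ℝ) + 1) ^ (-σ) ≤ (N:ℝ) ^ θ * (1 + Real.log N) := by
  calc _ ≤ ∑ n ∈ Finset.range N, ((n:ℝ) + 1)⁻¹ * (N:ℝ) ^ θ := by
        apply Finset.sum_le_sum
        intro n hn
        apply rpow_le_inv_mul σ θ _ _ hσ hθ (by linarith [(Nat.cast_nonneg n : (0:ℝ) ≤ n)])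
        have := Finset.mem_range.1 hn
        exact_mod_cast this
    _ = (N:ℝ) ^ θ * ∑ n ∈ Finset.range N, ((n:ℝ) + 1)⁻¹ := by rw [← Finset.sum_mul, mul_comm]
    _ ≤ _ := by gcongr; exact harm_le N

lemma block_le {q : ℕ} (χ : DirichletCharacter ℂ q) (s : ℂ) (hs : 0 ≤ s.re) (y M : ℕ) :
    ‖∑ i ∈ Finset.range M, cz χ (1 + ((y + i : ℕ) : ℤ)) * pw s (y + i)‖ ≤
      ((y:ℝ) + 1) ^ (-s.re) * (‖∑ i ∈ Finset.range M, cz χ ((1 + y : ℤ) + i)‖ +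
        M * (‖s‖ * M / (y + 1))) := by
  have h1 : ∑ i ∈ Finset.range M, cz χ (1 + ((y + i : ℕ) : ℤ)) * pw s (y + i) =
      (∑ i ∈ Finset.range M, cz χ ((1 + y : ℤ) + i)) * pw s y +
      ∑ i ∈ Finset.range M, cz χ ((1 + y : ℤ) + i) * (pw s (y + i) - pw s y) := by
    rw [Finset.sum_mul, ← Finset.sum_add_distrib]
    apply Finset.sum_congr rfl
    intro i _
    have : (1 + ((y + i : ℕ) : ℤ)) = (1 + y : ℤ) + i := by push_cast; ring
    rw [this]; ring
  rw [h1, mul_add]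
  refine (norm_add_le _ _).trans (add_le_add ?_ ?_)
  · rw [norm_mul, pw_norm, mul_comm]
  · calc _ ≤ ∑ i ∈ Finset.range M, ‖s‖ * ((y:ℝ) + 1) ^ (-s.re - 1) * M := by
          apply norm_sum_le_of_le
          intro i hi
          have hi' : (i:ℝ) ≤ M := by exact_mod_cast (Finset.mem_range.1 hi).le
          have h2 := cpow_sub_le s (by linarith) (y + 1) (((y + i : ℕ) : ℝ) + 1) (by positivity) (by
            push_cast; linarith [(Nat.cast_nonneg i : (0:ℝ) ≤ i)])
          have h3 : ‖pw s (y + i) - pw s y‖ ≤ ‖s‖ * ((y:ℝ) + 1) ^ (-s.re - 1) * M := by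
            refine h2.trans ?_
            gcongr
            push_cast; linarith
          rw [norm_mul]
          calc _ ≤ 1 * ‖pw s (y + i) - pw s y‖ := by gcongr; exact cz_norm_le _ _
            _ ≤ _ := by rw [one_mul]; exact h3
      _ = _ := by
        rw [Finset.sum_const, Finset.card_range, nsmul_eq_mul, Real.rpow_sub_one (by positivity)]
        ring

lemma sum_blocks (g : ℕ → ℂ) (N0 M J : ℕ) : ∑ n ∈ Finset.range (N0 + J * M), g n =
    ∑ n ∈ Finset.range N0, g n + ∑ j ∈ Finset.range J, ∑ i ∈ Finset.range M, g (N0 + j * M + i) := by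
  induction J with
  | zero => simp
  | succ J ih =>
    have : N0 + (J + 1) * M = N0 + J * M + M := by ring
    rw [this, Finset.sum_range_add, ih, Finset.sum_range_succ _ J, add_assoc]

lemma L_gen {q : ℕ} [NeZero q] (χ : DirichletCharacter ℂ q) (hχ : χ ≠ 1) (K : ℝ) (hK : 0 ≤ K)
    (hS : ∀ N : ℕ, ‖∑ i ∈ Finset.range N, cz χ (1 + i)‖ ≤ K) (M N0 J : ℕ) (hM : 1 ≤ M) (hN0 : M ≤ N0)
    (ε θ : ℝ) (hε : 0 ≤ ε) (hθ : 0 ≤ θ) (hθ2 : θ ≤ 1/2)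
    (hB : ∀ x : ℤ, ‖∑ i ∈ Finset.range M, cz χ (x + i)‖ ≤ M * ε)
    (s : ℂ) (hs : 1 - θ ≤ s.re) :
    ‖χ.LFunction s‖ ≤ (N0:ℝ) ^ θ * (1 + Real.log N0) +
      ((N0 + J * M : ℕ) : ℝ) ^ θ * (1 + Real.log J) * (ε + ‖s‖ * M / N0) +
      K * (1 + ‖s‖ * C0) * (((N0 + J * M : ℕ) : ℝ) + 1) ^ (-(1/4:ℝ)) := by
  have h1 := L_approx χ hχ K hK hS s (by linarith) (N0 + J * M)
  have h2 : ‖∑ n ∈ Finset.range N0, cz χ (1 + n) * pw s n‖ ≤ (N0:ℝ) ^ θ * (1 + Real.log N0) := by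
    refine le_trans (norm_sum_le_of_le _ (fun n _ => ?_)) (first_part s.re θ N0 hs hθ)
    rw [norm_mul, pw_norm]
    exact mul_le_of_le_one_left (by positivity) (cz_norm_le _ _)
  have hM0 : (0:ℝ) < M := by exact_mod_cast hM
  have hN0' : (M:ℝ) ≤ N0 := by exact_mod_cast hN0
  have h3 : ‖∑ j ∈ Finset.range J, ∑ i ∈ Finset.range M,
      cz χ (1 + ((N0 + j * M + i : ℕ):ℤ)) * pw s (N0 + j * M + i)‖ ≤
      ((N0 + J * M : ℕ) : ℝ) ^ θ * (1 + Real.log J) * (ε + ‖s‖ * M / N0) := by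
    calc _ ≤ ∑ j ∈ Finset.range J, ((j:ℝ) + 1)⁻¹ * (((N0 + J * M : ℕ) : ℝ) ^ θ * (ε + ‖s‖ * M / N0)) := by
          apply norm_sum_le_of_le
          intro j hj
          have hj' : j + 1 ≤ J := Finset.mem_range.1 hj
          refine (block_le χ s (by linarith) (N0 + j * M) M).trans ?_
          have hy : ((j:ℝ) + 1) * M ≤ ((N0 + j * M : ℕ) : ℝ) + 1 := by push_cast; nlinarith
          have hy0 : (N0:ℝ) ≤ ((N0 + j * M : ℕ) : ℝ) + 1 := by
            have : (0:ℝ) ≤ j * M := by positivity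
            push_cast; linarith
          have hyJ : ((N0 + j * M : ℕ) : ℝ) + 1 ≤ ((N0 + J * M : ℕ) : ℝ) := by
            have : N0 + j * M + 1 ≤ N0 + J * M := by nlinarith
            exact_mod_cast this
          have hr := rpow_le_inv_mul s.re θ (((N0 + j * M : ℕ) : ℝ) + 1) _ hs hθ (by
            linarith [(Nat.cast_nonneg (N0 + j * M) : (0:ℝ) ≤ (N0 + j * M : ℕ))]) hyJ
          have hr2 : (((N0 + j * M : ℕ) : ℝ) + 1)⁻¹ ≤ (((j:ℝ) + 1) * M)⁻¹ :=
            inv_anti₀ (by positivity) hy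
          have hN00 : (0:ℝ) < N0 := by linarith
          calc _ ≤ ((((j:ℝ) + 1) * M)⁻¹ * ((N0 + J * M : ℕ) : ℝ) ^ θ) * (M * ε + M * (‖s‖ * M / N0)) := by
                gcongr
                · exact hr.trans (mul_le_mul_of_nonneg_right hr2 (by positivity))
                · exact hB _
            _ = _ := by field_simp
      _ = (∑ j ∈ Finset.range J, ((j:ℝ) + 1)⁻¹) * (((N0 + J * M : ℕ) : ℝ) ^ θ * (ε + ‖s‖ * M / N0)) := by
          rw [Finset.sum_mul]
      _ ≤ (1 + Real.log J) * (((N0 + J * M : ℕ) : ℝ) ^ θ * (ε + ‖s‖ * M / N0)) := by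
          gcongr; exact harm_le J
      _ = _ := by ring
  rw [sum_blocks] at h1
  set A := ∑ n ∈ Finset.range N0, cz χ (1 + n) * pw s n
  set B := ∑ j ∈ Finset.range J, ∑ i ∈ Finset.range M,
      cz χ (1 + ((N0 + j * M + i : ℕ):ℤ)) * pw s (N0 + j * M + i)
  calc ‖χ.LFunction s‖ = ‖A + B + (χ.LFunction s - (A + B))‖ := by congr 1; ring
    _ ≤ ‖A + B‖ + ‖χ.LFunction s - (A + B)‖ := norm_add_le _ _
    _ ≤ (‖A‖ + ‖B‖) + ‖χ.LFunction s - (A + B)‖ := by gcongr; exact norm_add_le _ _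
    _ ≤ _ := add_le_add (add_le_add h2 h3) h1

/-- size relations for `P = exp (exp l)` -/
lemma size_rel (P : ℕ) (l : ℝ) (hl : l = Real.log (Real.log P)) (h1 : 1 ≤ l) :
    Real.log P = Real.exp l ∧ (P:ℝ) = Real.exp (Real.exp l) ∧ l + 1 ≤ Real.exp l ∧ l ≤ P := by
  have h0 : 0 < Real.log (P:ℝ) := by
    rcases lt_trichotomy (Real.log (P:ℝ)) 0 with h | h | h
    · exact absurd h (not_lt.2 (Real.log_natCast_nonneg P))
    · rw [h, Real.log_zero] at hl; linarith
    · exact h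
  have hP : (0:ℝ) < P := by
    rcases Nat.eq_zero_or_pos P with h | h
    · rw [h] at h0; simp at h0
    · exact_mod_cast h
  have e1 : Real.log P = Real.exp l := by rw [hl, Real.exp_log h0]
  have e2 : (P:ℝ) = Real.exp (Real.exp l) := by rw [← e1, Real.exp_log hP]
  refine ⟨e1, e2, Real.add_one_le_exp l, ?_⟩
  rw [e2]
  linarith [Real.add_one_le_exp l, Real.add_one_le_exp (Real.exp l)]

lemma cube_le_exp (l : ℝ) (h : 24 ≤ l) : l^3 ≤ Real.exp l := by
  have h1 := Real.pow_div_factorial_le_exp l (by linarith) 4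
  have : l^3 ≤ l^4 / (Nat.factorial 4 : ℕ) := by
    rw [le_div_iff₀ (by positivity)]
    have : ((Nat.factorial 4 : ℕ):ℝ) = 24 := by norm_num [Nat.factorial]
    rw [this]
    nlinarith [pow_pos (show (0:ℝ) < l by linarith) 3]
  linarith

lemma arith_mid (l : ℝ) (h : 700 ≤ l) :
    Real.exp (644 * l^2) * (1 + 40 * l * Real.exp l) * (2 * Real.exp (-l^3)) ≤ 1 := by
  have h1 : 1 + 40 * l * Real.exp l ≤ Real.exp (2*l + 40) := by
    have a1 : l ≤ Real.exp l := by linarith [Real.add_one_le_exp l]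
    have a2 : 41 ≤ Real.exp 40 := by linarith [Real.add_one_le_exp (40:ℝ)]
    have a3 : 1 ≤ Real.exp l := by linarith
    have e : Real.exp (2*l+40) = Real.exp l * Real.exp l * Real.exp 40 := by
      rw [← Real.exp_add, ← Real.exp_add]; congr 1; ring
    rw [e]
    have : 1 + 40 * l * Real.exp l ≤ Real.exp l * Real.exp l * 41 := by nlinarith
    refine this.trans ?_
    gcongr
  have h2 : 2 ≤ Real.exp 1 := by linarith [Real.add_one_le_exp (1:ℝ)]
  calc _ ≤ Real.exp (644 * l^2) * Real.exp (2*l + 40) * (Real.exp 1 * Real.exp (-l^3)) := by gcongr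
    _ = Real.exp (644 * l^2 + (2*l+40) + (1 + -l^3)) := by rw [← Real.exp_add, ← Real.exp_add, ← Real.exp_add]
    _ ≤ 1 := by
      rw [Real.exp_le_one_iff]
      nlinarith [mul_nonneg (show 0 ≤ l - 700 by linarith) (sq_nonneg l)]

lemma arith_first (c l : ℝ) (hc : 1 ≤ c) (h : c + 1 ≤ l) (A : ℝ) (hA : A = Real.exp (c * l) * (1 + c * Real.exp l)) :
    A ≤ Real.exp ((c + 2) * l) := by
  rw [hA]
  have a1 : 1 + c * Real.exp l ≤ Real.exp l * Real.exp l := by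
    have : c + 1 ≤ Real.exp l := by linarith [Real.add_one_le_exp l]
    nlinarith [Real.exp_pos l]
  calc _ ≤ Real.exp (c*l) * (Real.exp l * Real.exp l) := by gcongr
    _ = _ := by rw [← Real.exp_add, ← Real.exp_add]; congr 1; ring

end CS

namespace CS

lemma norm_le_7P (P : ℕ) (hP : (3:ℝ) ≤ P) (s : ℂ) (h0 : 0 ≤ s.re) (h2 : s.re ≤ 3) (h3 : |s.im| ≤ 6 * P) :
    ‖s‖ ≤ 7 * P := by
  refine (Complex.norm_le_abs_re_add_abs_im s).trans ?_
  rw [abs_of_nonneg h0]; linarith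

lemma rpow_theta (x E l c : ℝ) (hx : 0 < x) (hE : 0 < E) (hl : 0 ≤ l) (h : Real.log x ≤ c * E) :
    x ^ (l / E) ≤ Real.exp (c * l) := by
  rw [Real.rpow_def_of_pos hx]
  apply Real.exp_le_exp.2
  calc Real.log x * (l/E) ≤ c * E * (l/E) := by gcongr
    _ = c * l := by field_simp

set_option maxHeartbeats 1000000 in
/-- upper bound for nontrivial primitive L-functions -/
theorem L_bound : ∃ l0 : ℝ, 1 ≤ l0 ∧ ∀ (P : ℕ) (l : ℝ), l = Real.log (Real.log P) → l0 ≤ l →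
    ∀ (q : ℕ) [NeZero q], 1 < q → Real.log q ≤ 4 * l * Real.log P →
    (∀ p : ℕ, p.Prime → p ∣ q → p ≤ P) → ∀ χ : DirichletCharacter ℂ q, Pr χ → χ ≠ 1 →
    ∀ s : ℂ, 1 - l / Real.log P ≤ s.re → s.re ≤ 3 → |s.im| ≤ 6 * P →
    ‖χ.LFunction s‖ ≤ Real.exp (606 * l) := by
  obtain ⟨l0, hl0, hI⟩ := partI
  refine ⟨max l0 (max 700 (7 * C0 + 1)), by linarith [le_max_left l0 (max 700 (7 * C0 + 1))], ?_⟩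
  intro P l hl hll q _ hq hlq hsm χ hχ hχ1 s hs1 hs2 hs3
  have hl1 : l0 ≤ l := (le_max_left _ _).trans hll
  have hl2 : 700 ≤ l := ((le_max_left _ _).trans (le_max_right _ _)).trans hll
  have hl3 : 7 * C0 + 1 ≤ l := ((le_max_right _ _).trans (le_max_right _ _)).trans hll
  obtain ⟨hE, hP, hlE, hlP⟩ := size_rel P l hl (by linarith)
  have hcube := cube_le_exp l (by linarith)
  set E := Real.exp l with hEdef
  have hE0 : 0 < E := Real.exp_pos l
  have hPpos : (0:ℝ) < P := by linarith
  have hq0 : (1:ℝ) < q := by exact_mod_cast hq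
  have hlogq0 : 0 ≤ Real.log q := Real.log_nonneg hq0.le
  have hC0 := C0_nonneg
  rw [hE] at hs1 hlq
  have hθ : l / E ≤ 1/2 := by
    rw [div_le_iff₀ hE0]
    have h := Real.quadratic_le_exp_of_nonneg (show 0 ≤ l by linarith)
    nlinarith
  have hsre : 0 ≤ s.re := by linarith
  have hsn := norm_le_7P P (by linarith) s hsre hs2 hs3
  have hP1 : 1 ≤ P := by exact_mod_cast (by linarith : (1:ℝ) ≤ P)
  have hMN : P^600 ≤ P^603 := Nat.pow_le_pow_right hP1 (by norm_num)
  have hM1 : 1 ≤ P^600 := Nat.one_le_pow _ _ hP1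
  have hgen := L_gen χ hχ1 q (by positivity) (fun N => complete_av hq χ hχ 1 N) (P^600) (P^603) ((q*P)^8)
    hM1 hMN (Real.exp (-l^3)) (l / E) (Real.exp_pos _).le (by positivity) hθ
    (fun x => hI P l hl hl1 q hq (by rw [hE]; exact hlq) hsm χ hχ x _ le_rfl) s hs1
  set N1 : ℕ := P^603 + (q*P)^8 * P^600 with hN1
  have hqP1 : (1:ℝ) ≤ (q:ℝ) * P := by nlinarith
  -- first
  have b1 : ((P^603 : ℕ):ℝ) ^ (l/E) * (1 + Real.log ((P^603:ℕ):ℝ)) ≤ Real.exp (605 * l) := by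
    have hlog : Real.log ((P^603:ℕ):ℝ) = 603 * E := by push_cast; rw [Real.log_pow, hE]; push_cast; ring
    have := rpow_theta ((P^603:ℕ):ℝ) E l 603 (by exact_mod_cast (by positivity)) hE0 (by linarith) hlog.le
    rw [hlog]
    calc _ ≤ Real.exp (603 * l) * (1 + 603 * E) := by gcongr
      _ ≤ Real.exp ((603 + 2) * l) := arith_first 603 l (by norm_num) (by linarith) _ rfl
      _ = _ := by norm_num
  have hN1pos : (0:ℝ) < N1 := by
    have : 0 < N1 := by positivity
    exact_mod_cast this
  have hlogN1 : Real.log N1 ≤ 644 * l * E := by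
    have hle : (N1:ℝ) ≤ ((q:ℝ)*P)^8 * (P:ℝ)^604 := by
      rw [hN1]; push_cast
      have a : (1:ℝ) ≤ ((q:ℝ)*P)^8 := one_le_pow₀ hqP1
      have b : (P:ℝ)^600 ≤ (P:ℝ)^603 := by exact_mod_cast hMN
      have c : (2:ℝ) * (P:ℝ)^603 ≤ (P:ℝ)^604 := by
        rw [pow_succ (P:ℝ) 603, mul_comm]; gcongr; linarith
      have d : 0 ≤ (P:ℝ)^603 := by positivity
      generalize ((q:ℝ)*P)^8 = X at *
      generalize (P:ℝ)^603 = Y at *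
      generalize (P:ℝ)^600 = Y' at *
      generalize (P:ℝ)^604 = Y'' at *
      nlinarith
    calc Real.log N1 ≤ Real.log (((q:ℝ)*P)^8 * (P:ℝ)^604) := Real.log_le_log hN1pos hle
      _ = 8 * (Real.log q + E) + 604 * E := by
        rw [Real.log_mul (by positivity) (by positivity), Real.log_pow, Real.log_pow,
          Real.log_mul (by positivity) (by positivity), hE]; push_cast; ring
      _ ≤ _ := by nlinarith
  have hlogJ : Real.log (((q*P)^8 : ℕ):ℝ) ≤ 40 * l * E := by
    push_cast
    rw [Real.log_pow, Real.log_mul (by positivity) (by positivity), hE]; push_cast; nlinarith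
  have b2 : (N1:ℝ) ^ (l/E) * (1 + Real.log (((q*P)^8 : ℕ):ℝ)) *
      (Real.exp (-l^3) + ‖s‖ * ((P^600:ℕ):ℝ) / ((P^603:ℕ):ℝ)) ≤ 1 := by
    have c1 := rpow_theta (N1:ℝ) E l (644 * l) hN1pos hE0 (by linarith) hlogN1
    have c2 : ‖s‖ * ((P^600:ℕ):ℝ) / ((P^603:ℕ):ℝ) ≤ Real.exp (-l^3) := by
      have e1 : ‖s‖ * ((P^600:ℕ):ℝ) / ((P^603:ℕ):ℝ) = ‖s‖ / (P:ℝ)^3 := by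
        push_cast; field_simp
      rw [e1]
      calc ‖s‖ / (P:ℝ)^3 ≤ 7 * P / (P:ℝ)^3 := by gcongr
        _ = (7 / P) * (P:ℝ)⁻¹ := by field_simp
        _ ≤ 1 * (P:ℝ)⁻¹ := by gcongr; rw [div_le_one hPpos]; linarith
        _ = Real.exp (-E) := by rw [one_mul, hP, Real.exp_neg]
        _ ≤ _ := by apply Real.exp_le_exp.2; linarith
    have hlogJ0 : 0 ≤ Real.log (((q*P)^8 : ℕ):ℝ) := Real.log_natCast_nonneg _
    refine le_trans ?_ (arith_mid l hl2)
    have e2 : 644 * l * l = 644 * l^2 := by ring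
    rw [e2] at c1
    have c3 : Real.exp (-l^3) + ‖s‖ * ((P^600:ℕ):ℝ) / ((P^603:ℕ):ℝ) ≤ 2 * Real.exp (-l^3) := by linarith
    rw [← hEdef]
    apply mul_le_mul (mul_le_mul c1 (by linarith) (by positivity) (Real.exp_pos _).le) c3 (by positivity) (by positivity)
  have b3 : (q:ℝ) * (1 + ‖s‖ * C0) * ((N1:ℝ) + 1) ^ (-(1/4:ℝ)) ≤ 1 := by
    have d1 : ((N1:ℝ) + 1) ^ (-(1/4:ℝ)) ≤ (((q:ℝ)*P)^2)⁻¹ := by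
      have : ((q:ℝ)*P)^8 ≤ (N1:ℝ) + 1 := by
        have : (q*P)^8 ≤ N1 := by rw [hN1]; nlinarith [Nat.zero_le (P^603), Nat.zero_le ((q*P)^8)]
        have : (((q*P)^8 : ℕ):ℝ) ≤ N1 := by exact_mod_cast this
        push_cast at this; linarith
      calc ((N1:ℝ) + 1) ^ (-(1/4:ℝ)) ≤ (((q:ℝ)*P)^8) ^ (-(1/4:ℝ)) :=
            Real.rpow_le_rpow_of_nonpos (by positivity) this (by norm_num)
        _ = _ := by
          rw [Real.rpow_neg (by positivity), ← Real.rpow_natCast, ← Real.rpow_mul (by positivity),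
            ← Real.rpow_natCast]
          norm_num
    calc _ ≤ (q:ℝ) * (1 + 7 * P * C0) * (((q:ℝ)*P)^2)⁻¹ := by gcongr
      _ ≤ 1 := by
        rw [← div_eq_mul_inv, div_le_one (by positivity)]
        have : 1 + 7 * P * C0 ≤ (P:ℝ)^2 := by nlinarith
        calc (q:ℝ) * (1 + 7 * P * C0) ≤ q * (P:ℝ)^2 := by gcongr
          _ ≤ ((q:ℝ)*P)^2 := by rw [mul_pow]; gcongr; nlinarith
  have hfin : Real.exp (605 * l) + 1 + 1 ≤ Real.exp (606 * l) := by
    have : Real.exp (606 * l) = Real.exp (605 * l) * E := by rw [hEdef, ← Real.exp_add]; congr 1; ring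
    rw [this]
    have : 1 ≤ Real.exp (605 * l) := Real.one_le_exp (by linarith)
    nlinarith
  linarith

set_option maxHeartbeats 1000000 in
/-- upper bound for zeta -/
theorem Z_bound : ∃ l0 : ℝ, 1 ≤ l0 ∧ ∀ (P : ℕ) (l : ℝ), l = Real.log (Real.log P) → l0 ≤ l →
    ∀ s : ℂ, 1 - l / Real.log P ≤ s.re → s.re ≤ 3 → |s.im| ≤ 6 * P →
    ‖Zf s‖ ≤ (1 + ‖s - 1‖) * Real.exp (606 * l) := by
  refine ⟨max 700 (7 * C0 + 1), by linarith [le_max_left 700 (7 * C0 + 1)], ?_⟩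
  intro P l hl hll s hs1 hs2 hs3
  have hl2 : 700 ≤ l := ((le_max_left _ _)).trans hll
  have hl3 : 7 * C0 + 1 ≤ l := ((le_max_right _ _)).trans hll
  obtain ⟨hE, hP, hlE, hlP⟩ := size_rel P l hl (by linarith)
  set E := Real.exp l with hEdef
  have hE0 : 0 < E := Real.exp_pos l
  have hPpos : (0:ℝ) < P := by linarith
  have hC0 := C0_nonneg
  rw [hE] at hs1
  have hθ : l / E ≤ 1/2 := by
    rw [div_le_iff₀ hE0]
    have h := Real.quadratic_le_exp_of_nonneg (show 0 ≤ l by linarith)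
    nlinarith
  have hsre : 0 ≤ s.re := by linarith
  have hsn := norm_le_7P P (by linarith) s hsre hs2 hs3
  have hP1 : 1 ≤ P := by exact_mod_cast (by linarith : (1:ℝ) ≤ P)
  have h := Zf_approx s (by linarith) (P^602)
  have hlog : Real.log ((P^602:ℕ):ℝ) = 602 * E := by push_cast; rw [Real.log_pow, hE]; push_cast; ring
  have b1 : ‖∑ n ∈ Finset.range (P^602), pw s n‖ ≤ Real.exp (604 * l) := by
    have := rpow_theta ((P^602:ℕ):ℝ) E l 602 (by exact_mod_cast (by positivity)) hE0 (by linarith) hlog.le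
    calc _ ≤ ∑ n ∈ Finset.range (P^602), ((n:ℝ) + 1) ^ (-s.re) := by
          apply norm_sum_le_of_le; intro n _; rw [pw_norm]
      _ ≤ ((P^602:ℕ):ℝ) ^ (l/E) * (1 + Real.log ((P^602:ℕ):ℝ)) := first_part _ _ _ hs1 (by positivity)
      _ ≤ Real.exp (602 * l) * (1 + 602 * E) := by rw [hlog]; gcongr
      _ ≤ Real.exp ((602 + 2) * l) := arith_first 602 l (by norm_num) (by linarith) _ rfl
      _ = _ := by norm_num
  have b2 : ‖pw (s-1) (P^602)‖ ≤ Real.exp (604 * l) := by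
    rw [pw_norm]
    have h603 : (((P^602:ℕ):ℝ) + 1) ≤ ((P^603:ℕ):ℝ) := by
      have a : (1:ℝ) ≤ (P:ℝ)^602 := one_le_pow₀ (by linarith)
      push_cast
      rw [pow_succ (P:ℝ) 602]
      generalize (P:ℝ)^602 = X at *
      nlinarith
    have hlog3 : Real.log ((P^603:ℕ):ℝ) = 603 * E := by push_cast; rw [Real.log_pow, hE]; push_cast; ring
    have := rpow_theta ((P^603:ℕ):ℝ) E l 603 (by exact_mod_cast (by positivity)) hE0 (by linarith) hlog3.le
    calc _ ≤ (((P^602:ℕ):ℝ) + 1) ^ (l/E) := by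
          apply Real.rpow_le_rpow_of_exponent_le
          · linarith [(Nat.cast_nonneg (P^602) : (0:ℝ) ≤ ((P^602:ℕ):ℝ))]
          · simp only [Complex.sub_re, Complex.one_re]; linarith
      _ ≤ ((P^603:ℕ):ℝ) ^ (l/E) := by gcongr
      _ ≤ _ := this
      _ ≤ _ := by apply Real.exp_le_exp.2; linarith
  have b3 : ‖s‖ * C0 * (((P^602:ℕ):ℝ) + 1) ^ (-(1/4:ℝ)) ≤ 1 := by
    have d1 : (((P^602:ℕ):ℝ) + 1) ^ (-(1/4:ℝ)) ≤ ((P:ℝ)^2)⁻¹ := by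
      have : ((P:ℝ))^8 ≤ (((P^602:ℕ):ℝ) + 1) := by
        have : P^8 ≤ P^602 := Nat.pow_le_pow_right hP1 (by norm_num)
        have : ((P^8 : ℕ):ℝ) ≤ ((P^602:ℕ):ℝ) := by exact_mod_cast this
        push_cast at this ⊢; linarith
      calc (((P^602:ℕ):ℝ) + 1) ^ (-(1/4:ℝ)) ≤ ((P:ℝ)^8) ^ (-(1/4:ℝ)) :=
            Real.rpow_le_rpow_of_nonpos (by positivity) this (by norm_num)
        _ = _ := by
          rw [Real.rpow_neg (by positivity), ← Real.rpow_natCast, ← Real.rpow_mul (by positivity),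
            ← Real.rpow_natCast]
          norm_num
    calc _ ≤ (7 * P * C0) * ((P:ℝ)^2)⁻¹ := by gcongr
      _ ≤ 1 := by
        rw [← div_eq_mul_inv, div_le_one (by positivity)]
        nlinarith
  have hx : 1 ≤ Real.exp (604 * l) := Real.one_le_exp (by linarith)
  have hfin : 3 * Real.exp (604 * l) ≤ Real.exp (606 * l) := by
    have : Real.exp (606 * l) = Real.exp (604 * l) * (E * E) := by
      rw [hEdef, ← Real.exp_add, ← Real.exp_add]; congr 1; ring
    rw [this, mul_comm]
    gcongr
    nlinarith
  set S := ∑ n ∈ Finset.range (P^602), pw s n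
  set R := Zf s - (s-1) * S - pw (s-1) (P^602) with hR
  have e : Zf s = R + (s-1) * S + pw (s-1) (P^602) := by rw [hR]; ring
  have hn0 := norm_nonneg (s-1)
  rw [e]
  calc _ ≤ ‖R‖ + ‖s-1‖ * ‖S‖ + ‖pw (s-1) (P^602)‖ := by
        refine (norm_add_le _ _).trans ?_
        gcongr
        refine (norm_add_le _ _).trans ?_
        rw [norm_mul]
    _ ≤ ‖s - 1‖ * 1 + ‖s-1‖ * Real.exp (604 * l) + Real.exp (604 * l) := by
        gcongr
        refine h.trans ?_
        calc _ = ‖s - 1‖ * (‖s‖ * C0 * (((P^602:ℕ):ℝ) + 1) ^ (-(1/4:ℝ))) := by ring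
          _ ≤ _ := by gcongr
    _ ≤ (1 + ‖s - 1‖) * (3 * Real.exp (604 * l)) := by nlinarith
    _ ≤ _ := by gcongr

end CS

namespace CS

lemma omega_le (Q : ℕ) (hQ : Q ≠ 0) : (Q.primeFactors.card : ℝ) ≤ 2 * Real.log Q := by
  have h1 : 2 ^ Q.primeFactors.card ≤ Q := by
    calc 2 ^ Q.primeFactors.card ≤ ∏ p ∈ Q.primeFactors, p :=
          Finset.pow_card_le_prod _ _ _ (fun p hp => (Nat.prime_of_mem_primeFactors hp).two_le)
      _ ≤ Q := Nat.le_of_dvd (Nat.pos_of_ne_zero hQ) (Nat.prod_primeFactors_dvd Q)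
  have h2 : (2:ℝ) ^ Q.primeFactors.card ≤ Q := by exact_mod_cast h1
  have h3 := Real.log_le_log (by positivity) h2
  rw [Real.log_pow] at h3
  have := Real.log_two_gt_d9
  nlinarith [(Nat.cast_nonneg Q.primeFactors.card : (0:ℝ) ≤ Q.primeFactors.card)]

lemma prod_bound (l E σ : ℝ) (hE : E = Real.exp l) (hl : 700 ≤ l) (Q : ℕ) (hQ : Q ≠ 0)
    (hlQ : Real.log Q ≤ 4 * l * E) (hσ : 1 - l / E ≤ σ) :
    ∏ p ∈ Q.primeFactors, (1 + (p:ℝ) ^ (-σ)) ≤ Real.exp (13 * l) := by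
  have hcube := cube_le_exp l (by linarith)
  rw [← hE] at hcube
  have hE0 : 0 < E := hE ▸ Real.exp_pos l
  have hE1 : 8 * l ≤ E := by nlinarith [mul_nonneg (show 0 ≤ l - 700 by linarith) (sq_nonneg l)]
  have hE2 : 4 * l^2 ≤ E := by nlinarith [mul_nonneg (show 0 ≤ l - 700 by linarith) (sq_nonneg l)]
  have hθ : l / E ≤ 1/2 := by rw [div_le_iff₀ hE0]; linarith
  have hθ0 : 0 ≤ l / E := by positivity
  have h1 : ∏ p ∈ Q.primeFactors, (1 + (p:ℝ) ^ (-σ)) ≤ Real.exp (∑ p ∈ Q.primeFactors, (p:ℝ) ^ (-σ)) := by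
    rw [Real.exp_sum]
    apply Finset.prod_le_prod
    · intro p _; positivity
    · intro p _; linarith [Real.add_one_le_exp ((p:ℝ) ^ (-σ))]
  refine h1.trans (Real.exp_le_exp.2 ?_)
  set N : ℕ := ⌊E^4⌋₊ with hN
  have hEone : 1 ≤ E := by linarith
  have hN1 : 1 ≤ N := Nat.le_floor (by simpa using one_le_pow₀ hEone)
  have hNle : (N:ℝ) ≤ E^4 := Nat.floor_le (by positivity)
  have hNpos : (0:ℝ) < N := by exact_mod_cast hN1
  have hlogE : Real.log (E^4) = 4 * l := by rw [Real.log_pow, hE, Real.log_exp]; push_cast; ring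
  have hlogN : Real.log N ≤ 4 * l := hlogE ▸ Real.log_le_log hNpos hNle
  rw [← Finset.sum_filter_add_sum_filter_not Q.primeFactors (fun p => p ≤ N)]
  have a1 : ∑ p ∈ Q.primeFactors.filter (fun p => p ≤ N), (p:ℝ) ^ (-σ) ≤ 3 * (1 + 4 * l) := by
    calc _ ≤ ∑ p ∈ (Finset.range N).image (fun n : ℕ => n + 1), ((p:ℕ):ℝ) ^ (-σ) := by
          apply Finset.sum_le_sum_of_subset_of_nonneg
          · intro p hp
            rw [Finset.mem_filter] at hp
            have := (Nat.prime_of_mem_primeFactors hp.1).pos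
            exact Finset.mem_image.2 ⟨p - 1, Finset.mem_range.2 (by omega), by omega⟩
          · intro p _ _; positivity
      _ = ∑ n ∈ Finset.range N, ((n:ℝ) + 1) ^ (-σ) := by
          rw [Finset.sum_image (fun a _ b _ h => Nat.succ_injective h)]
          push_cast; rfl
      _ ≤ (N:ℝ) ^ (l/E) * (1 + Real.log N) := first_part σ (l/E) N hσ hθ0
      _ ≤ 3 * (1 + 4 * l) := by
          have hl0 := Real.log_natCast_nonneg N
          have : (N:ℝ) ^ (l/E) ≤ 3 := by
            rw [Real.rpow_def_of_pos hNpos]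
            calc Real.exp (Real.log N * (l/E)) ≤ Real.exp 1 := by
                  apply Real.exp_le_exp.2
                  calc Real.log N * (l/E) ≤ 4 * l * (l/E) := by gcongr
                    _ = 4 * l^2 / E := by ring
                    _ ≤ 1 := by rw [div_le_one hE0]; exact hE2
              _ ≤ 3 := by linarith [Real.exp_one_lt_d9]
          gcongr
  have a2 : ∑ p ∈ Q.primeFactors.filter (fun p => ¬ p ≤ N), (p:ℝ) ^ (-σ) ≤ 8 := by
    calc _ ≤ ∑ p ∈ Q.primeFactors.filter (fun p => ¬ p ≤ N), (E^2)⁻¹ := by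
          apply Finset.sum_le_sum
          intro p hp
          rw [Finset.mem_filter, not_le] at hp
          have h2 : E^4 ≤ p := ((Nat.floor_lt (by positivity)).1 hp.2).le
          have h3 : (1:ℝ) ≤ p := (one_le_pow₀ hEone).trans h2
          calc (p:ℝ) ^ (-σ) ≤ (p:ℝ) ^ (-(1/2:ℝ)) := Real.rpow_le_rpow_of_exponent_le h3 (by linarith)
            _ ≤ (E^4) ^ (-(1/2:ℝ)) := Real.rpow_le_rpow_of_nonpos (by positivity) h2 (by norm_num)
            _ = (E^2)⁻¹ := by
              rw [Real.rpow_neg (by positivity), ← Real.rpow_natCast, ← Real.rpow_mul (by positivity),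
                ← Real.rpow_natCast]
              norm_num
      _ ≤ (Q.primeFactors.card : ℝ) * (E^2)⁻¹ := by
          rw [Finset.sum_const, nsmul_eq_mul]
          gcongr
          exact Finset.filter_subset _ _
      _ ≤ (2 * (4 * l * E)) * (E^2)⁻¹ := by
          gcongr
          exact (omega_le Q hQ).trans (by linarith)
      _ = 8 * (l / E) := by field_simp; ring
      _ ≤ 8 := by linarith
  linarith

lemma euler_norm_le (Q : ℕ) (s : ℂ) (f : ℕ → ℂ) (hf : ∀ n, ‖f n‖ ≤ 1) :
    ‖∏ p ∈ Q.primeFactors, (1 - f p * (p:ℂ) ^ (-s))‖ ≤ ∏ p ∈ Q.primeFactors, (1 + (p:ℝ) ^ (-s.re)) := by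
  rw [norm_prod]
  apply Finset.prod_le_prod
  · intro p _; positivity
  · intro p hp
    have hp0 := (Nat.prime_of_mem_primeFactors hp).pos
    refine (norm_sub_le _ _).trans ?_
    rw [norm_one, norm_mul, Complex.norm_natCast_cpow_of_pos hp0]
    gcongr
    rw [Complex.neg_re]
    exact mul_le_of_le_one_left (by positivity) (hf p)

open Classical in
/-- entire function: `L(s,χ)` or `(s-1)L(s,χ₀)` -/
noncomputable def FL {Q : ℕ} [NeZero Q] (χ : DirichletCharacter ℂ Q) : ℂ → ℂ :=
  if χ = 1 then DirichletCharacter.LFunctionTrivChar₁ Q else χ.LFunction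

open Classical in
/-- indicator of the trivial character -/
noncomputable def dt {Q : ℕ} (χ : DirichletCharacter ℂ Q) : ℝ := if χ = 1 then 1 else 0

lemma FL_diff {Q : ℕ} [NeZero Q] (χ : DirichletCharacter ℂ Q) : Differentiable ℂ (FL χ) := by
  unfold FL
  split_ifs with h
  · exact DirichletCharacter.differentiable_LFunctionTrivChar₁ Q
  · exact DirichletCharacter.differentiable_LFunction h

lemma FL_one {Q : ℕ} [NeZero Q] (s : ℂ) (hs : s ≠ 1) :
    FL (1 : DirichletCharacter ℂ Q) s = (s - 1) * (1 : DirichletCharacter ℂ Q).LFunction s := by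
  simp only [FL, if_true, DirichletCharacter.LFunctionTrivChar₁]
  rw [Function.update_of_ne hs]

lemma FL_ne {Q : ℕ} [NeZero Q] (χ : DirichletCharacter ℂ Q) (h : χ ≠ 1) : FL χ = χ.LFunction := by
  simp [FL, h]

lemma FL_zero_re {Q : ℕ} [NeZero Q] (χ : DirichletCharacter ℂ Q) (s : ℂ) (h : FL χ s = 0) : s.re < 1 := by
  by_contra hc
  push Not at hc
  by_cases hχ : χ = 1
  · subst hχ
    by_cases hs : s = 1
    · subst hs
      simp only [FL, if_true] at h
      exact DirichletCharacter.LFunctionTrivChar₁_apply_one_ne_zero Q h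
    · rw [FL_one s hs] at h
      exact mul_ne_zero (sub_ne_zero.2 hs)
        (DirichletCharacter.LFunction_ne_zero_of_one_le_re _ (Or.inr hs) hc) h
  · rw [FL_ne χ hχ] at h
    exact DirichletCharacter.LFunction_ne_zero_of_one_le_re _ (Or.inl hχ) hc h

/-- `-Re L'/L` -/
noncomputable def ld {Q : ℕ} [NeZero Q] (χ : DirichletCharacter ℂ Q) (s : ℂ) : ℝ :=
  -(deriv χ.LFunction s / χ.LFunction s).re

lemma ld_eq {Q : ℕ} [NeZero Q] (χ : DirichletCharacter ℂ Q) (s : ℂ) (hs : 1 < s.re) :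
    ld χ s = -(deriv (FL χ) s / FL χ s).re + dt χ * (1/(s-1)).re := by
  have hs1 : s ≠ 1 := by rintro rfl; simp at hs
  by_cases hχ : χ = 1
  · subst hχ
    have h1 : deriv (FL (1 : DirichletCharacter ℂ Q)) s =
        (s - 1) * deriv (1 : DirichletCharacter ℂ Q).LFunction s + (1 : DirichletCharacter ℂ Q).LFunction s := by
      have := DirichletCharacter.deriv_LFunctionTrivChar₁_apply_of_ne_one Q hs1
      simpa only [FL, if_true] using this
    have h2 : (1 : DirichletCharacter ℂ Q).LFunction s ≠ 0 :=
      DirichletCharacter.LFunction_ne_zero_of_one_le_re _ (Or.inr hs1) hs.le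
    have h3 : s - 1 ≠ 0 := sub_ne_zero.2 hs1
    rw [h1, FL_one s hs1, ld]
    have : ((s - 1) * deriv (1 : DirichletCharacter ℂ Q).LFunction s + (1 : DirichletCharacter ℂ Q).LFunction s) /
        ((s - 1) * (1 : DirichletCharacter ℂ Q).LFunction s) =
        deriv (1 : DirichletCharacter ℂ Q).LFunction s / (1 : DirichletCharacter ℂ Q).LFunction s + 1/(s-1) := by
      field_simp
    rw [this, Complex.add_re]
    simp only [dt, if_true]; ring
  · simp [ld, FL_ne χ hχ, dt, hχ]

/-- bound for the real zeta near 1 -/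
lemma zeta_le (σ : ℝ) (h1 : 1 < σ) (h2 : σ ≤ 2) :
    Summable (fun n : ℕ => ((n:ℝ) + 1) ^ (-σ)) ∧ ∑' n : ℕ, ((n:ℝ) + 1) ^ (-σ) ≤ (1 + 2 * C0) / (σ - 1) := by
  have hz := zeta_hasSum (σ : ℂ) (by simpa using h1)
  have hre := Complex.hasSum_re hz
  have e : ∀ n : ℕ, (pw (σ:ℂ) n).re = ((n:ℝ) + 1) ^ (-σ) := by
    intro n
    unfold pw
    rw [← Complex.ofReal_neg, ← Complex.ofReal_cpow (by positivity), Complex.ofReal_re]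
  simp only [e] at hre
  refine ⟨hre.summable, ?_⟩
  rw [hre.tsum_eq]
  have h3 := Zf_approx (σ:ℂ) (by simp; linarith) 0
  have hne : (σ:ℂ) ≠ 1 := by
    intro h; have : σ = 1 := by exact_mod_cast h
    linarith
  have hn1 : ‖(σ:ℂ) - 1‖ = σ - 1 := by
    rw [← Complex.ofReal_one, ← Complex.ofReal_sub, Complex.norm_real, Real.norm_of_nonneg (by linarith)]
  have hn2 : ‖(σ:ℂ)‖ = σ := by rw [Complex.norm_real, Real.norm_of_nonneg (by linarith)]
  have hp0 : pw ((σ:ℂ) - 1) 0 = 1 := by simp [pw]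
  have hC0 := C0_nonneg
  rw [Finset.range_zero, Finset.sum_empty, mul_zero, sub_zero, hp0, hn1, hn2] at h3
  have h4 : ‖Zf σ‖ ≤ 1 + 2 * C0 := by
    have h5 : ‖Zf σ‖ ≤ ‖Zf σ - 1‖ + 1 := by
      have := norm_add_le (Zf σ - 1) 1
      simpa using this
    have h6 : (σ - 1) * σ * C0 * (((0:ℕ):ℝ) + 1) ^ (-(1/4:ℝ)) ≤ 2 * C0 := by
      simp only [Nat.cast_zero, zero_add, Real.one_rpow, mul_one]
      gcongr
      nlinarith
    linarith
  rw [Zf_eq _ hne, norm_mul, hn1] at h4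
  rw [le_div_iff₀ (by linarith), mul_comm]
  refine le_trans ?_ h4
  gcongr
  exact Complex.re_le_norm _

lemma L_lower {Q : ℕ} [NeZero Q] (χ : DirichletCharacter ℂ Q) (s : ℂ) (h1 : 1 < s.re) (h2 : s.re ≤ 2) :
    (s.re - 1) / (1 + 2 * C0) ≤ ‖χ.LFunction s‖ := by
  have hC0 := C0_nonneg
  obtain ⟨hsm, hz⟩ := zeta_le s.re h1 h2
  have hmul := DirichletCharacter.LSeries.mul_mu_eq_one χ h1
  rw [← DirichletCharacter.LFunction_eq_LSeries χ h1] at hmul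
  set g : ℕ → ℂ := (fun n : ℕ => χ n) * fun n : ℕ => (ArithmeticFunction.moebius n : ℂ) with hg
  have hgn : ∀ n, ‖g n‖ ≤ 1 := by
    intro n
    rw [hg, Pi.mul_apply, norm_mul]
    have : ‖(ArithmeticFunction.moebius n : ℂ)‖ ≤ 1 := by
      rw [Complex.norm_intCast]
      exact_mod_cast ArithmeticFunction.abs_moebius_le_one
    exact mul_le_one₀ (DirichletCharacter.norm_le_one χ _) (norm_nonneg _) this
  have hM : ‖LSeries g s‖ ≤ (1 + 2 * C0) / (s.re - 1) := by
    have hsum : LSeriesSummable g s :=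
      LSeriesSummable_of_bounded_of_one_lt_re (m := 1) (fun n _ => hgn n) h1
    have e : LSeries g s = ∑' n : ℕ, LSeries.term g s (n+1) := by
      rw [LSeries, hsum.tsum_eq_zero_add, LSeries.term_zero, zero_add]
    rw [e]
    refine (tsum_of_norm_bounded hsm.hasSum ?_).trans hz
    intro n
    rw [term_eq_pw, norm_mul, pw_norm]
    exact mul_le_of_le_one_left (by positivity) (hgn _)
  have h3 : ‖χ.LFunction s‖ * ‖LSeries g s‖ = 1 := by
    rw [← norm_mul, hmul, norm_one]
  have hs0 : 0 < s.re - 1 := by linarith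
  have h4 : 1 ≤ ‖χ.LFunction s‖ * ((1 + 2 * C0) / (s.re - 1)) := by
    calc (1:ℝ) = ‖χ.LFunction s‖ * ‖LSeries g s‖ := h3.symm
      _ ≤ _ := by gcongr
  rw [div_le_iff₀ (by positivity)]
  have : ‖χ.LFunction s‖ * ((1 + 2 * C0) / (s.re - 1)) = ‖χ.LFunction s‖ * (1 + 2 * C0) / (s.re - 1) := by ring
  rw [this, le_div_iff₀ hs0] at h4
  linarith

end CS

namespace CS

lemma FL_triv {Q : ℕ} [NeZero Q] (s : ℂ) :
    FL (1 : DirichletCharacter ℂ Q) s = Zf s * ∏ p ∈ Q.primeFactors, (1 - 1 * (p:ℂ) ^ (-s)) := by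
  have h' : Continuous fun s ↦ Zf s * ∏ p ∈ Q.primeFactors, (1 - 1 * (p:ℂ) ^ (-s)) :=
    Zf_diff.continuous.mul <| continuous_finsetProd _ fun p hp ↦ by
        have : NeZero p := ⟨(Nat.prime_of_mem_primeFactors hp).ne_zero⟩
        fun_prop
  refine congrFun ((FL_diff (1 : DirichletCharacter ℂ Q)).continuous.ext_on (dense_compl_singleton 1) h' ?_) s
  intro s hs
  have hs' : s ≠ 1 := hs
  have : (1 : DirichletCharacter ℂ Q).LFunction s = (∏ p ∈ Q.primeFactors, (1 - (p : ℂ) ^ (-s))) * riemannZeta s :=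
    DirichletCharacter.LFunctionTrivChar_eq_mul_riemannZeta (N := Q) hs'
  simp only [FL_one s hs', Zf_eq s hs', one_mul]
  rw [this]; ring

theorem FL_bound : ∃ l0 : ℝ, 700 ≤ l0 ∧ ∀ (P : ℕ) (l : ℝ), l = Real.log (Real.log P) → l0 ≤ l →
    ∀ (Q : ℕ) [NeZero Q], Real.log Q ≤ 4 * l * Real.log P →
    (∀ p : ℕ, p.Prime → p ∣ Q → p ≤ P) → ∀ χ : DirichletCharacter ℂ Q,
    ∀ s : ℂ, 1 - l / Real.log P ≤ s.re → s.re ≤ 3 → |s.im| ≤ 6 * P →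
    ‖FL χ s‖ ≤ (1 + dt χ * ‖s - 1‖) * Real.exp (620 * l) := by
  obtain ⟨l1, hl1, hL⟩ := L_bound
  obtain ⟨l2, hl2, hZ⟩ := Z_bound
  refine ⟨max 700 (max l1 l2), le_max_left _ _, ?_⟩
  intro P l hl hll Q _ hlQ hsm χ s hs1 hs2 hs3
  have b0 : 700 ≤ l := (le_max_left _ _).trans hll
  have b1 : l1 ≤ l := ((le_max_left _ _).trans (le_max_right _ _)).trans hll
  have b2 : l2 ≤ l := ((le_max_right _ _).trans (le_max_right _ _)).trans hll
  obtain ⟨hE, -, -, -⟩ := size_rel P l hl (by linarith)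
  have hpb := prod_bound l (Real.log P) s.re hE b0 Q (NeZero.ne Q) hlQ hs1
  have hexp : Real.exp (606 * l) * Real.exp (13 * l) ≤ Real.exp (620 * l) := by
    rw [← Real.exp_add]; apply Real.exp_le_exp.2; linarith
  by_cases hχ : χ = 1
  · subst hχ
    rw [FL_triv, norm_mul]
    have h1 := hZ P l hl b2 s hs1 hs2 hs3
    have h2 := (euler_norm_le Q s (fun _ => 1) (fun _ => by simp)).trans hpb
    have hd : dt (1 : DirichletCharacter ℂ Q) = 1 := by simp [dt]
    rw [hd, one_mul]
    calc _ ≤ ((1 + ‖s - 1‖) * Real.exp (606 * l)) * Real.exp (13 * l) := by gcongr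
      _ = (1 + ‖s-1‖) * (Real.exp (606 * l) * Real.exp (13 * l)) := by ring
      _ ≤ _ := by gcongr
  · have hd : dt χ = 0 := by simp [dt, hχ]
    rw [hd, zero_mul, add_zero, one_mul, FL_ne χ hχ]
    have hn0 : NeZero χ.conductor := ⟨χ.conductor_ne_zero⟩
    have hc1 : χ.conductor ≠ 1 := fun h => hχ (χ.eq_one_iff_conductor_eq_one.2 h)
    have hc2 : 1 < χ.conductor := by have := hn0.1; omega
    have hp1 : χ.primitiveCharacter ≠ 1 := by
      intro h
      apply hχ
      rw [← χ.changeLevel_primitiveCharacter, h, DirichletCharacter.changeLevel_one]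
    have e := DirichletCharacter.LFunction_changeLevel χ.conductor_dvd_level χ.primitiveCharacter
      (s := s) (Or.inl hp1)
    rw [χ.changeLevel_primitiveCharacter] at e
    rw [e, norm_mul]
    have hle : χ.conductor ≤ Q := Nat.le_of_dvd (Nat.pos_of_ne_zero (NeZero.ne Q)) χ.conductor_dvd_level
    have hlog : Real.log χ.conductor ≤ 4 * l * Real.log P :=
      (Real.log_le_log (by exact_mod_cast (by omega : 0 < χ.conductor)) (by exact_mod_cast hle)).trans hlQ
    have h1 := hL P l hl b1 χ.conductor hc2 hlog
      (fun p hp hd => hsm p hp (hd.trans χ.conductor_dvd_level)) χ.primitiveCharacter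
      (Pr_of_primitive _ χ.primitiveCharacter_isPrimitive) hp1 s hs1 hs2 hs3
    have h2 := (euler_norm_le Q s (fun n => χ.primitiveCharacter n)
      (fun n => DirichletCharacter.norm_le_one _ _)).trans hpb
    calc _ ≤ Real.exp (606 * l) * Real.exp (13 * l) := by gcongr
      _ ≤ _ := hexp

/-- absolute constant in the Landau lemma -/
theorem landau_unif (a : ℝ) (ha : 0 < a) (ha1 : a ≤ 1) : ∃ l0 : ℝ, 700 ≤ l0 ∧ ∀ (P : ℕ) (l : ℝ),
    l = Real.log (Real.log P) → l0 ≤ l →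
    ∀ (Q : ℕ) [NeZero Q], Real.log Q ≤ 4 * l * Real.log P →
    (∀ p : ℕ, p.Prime → p ∣ Q → p ≤ P) → ∀ χ : DirichletCharacter ℂ Q,
    ∀ s0 : ℂ, s0.re = 1 + a / Real.log P → |s0.im| ≤ 5 * P →
    ∀ L : List ℂ, (∀ ρ ∈ L, ρ ∈ Metric.closedBall s0 (l / Real.log P / 3)) →
    ∀ h : ℂ → ℂ, Differentiable ℂ h → (∀ s, FL χ s = h s * (L.map (fun ρ => s - ρ)).prod) →
    ld χ s0 ≤ 3744 * Real.log P + dt χ * (1 / (s0 - 1)).re - (L.map (fun ρ => (1/(s0 - ρ)).re)).sum := by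
  obtain ⟨l1, hl1, hF⟩ := FL_bound
  have hC0 := C0_nonneg
  refine ⟨max l1 (3 * (1 + 2 * C0) / a^2), hl1.trans (le_max_left _ _), ?_⟩
  intro P l hl hll Q _ hlQ hsm χ s0 hs0 him L hL h hd hfac
  have b1 : l1 ≤ l := (le_max_left _ _).trans hll
  have b2 : 3 * (1 + 2 * C0) / a^2 ≤ l := (le_max_right _ _).trans hll
  have b0 : 700 ≤ l := hl1.trans b1
  obtain ⟨hE, -, hlE, hlP⟩ := size_rel P l hl (by linarith)
  set E := Real.log P with hEd
  have hcube := cube_le_exp l (by linarith)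
  rw [← hE] at hcube hlE
  have hE0 : 0 < E := by linarith
  have hP1 : (1:ℝ) ≤ P := by linarith
  have haE : 0 < a / E := by positivity
  have haE1 : a / E ≤ 1 := by rw [div_le_one hE0]; linarith
  have hr : 0 < l / E := by positivity
  have hr1 : l / E ≤ 1 := by rw [div_le_one hE0]; linarith
  have h1re : 1 < s0.re := by rw [hs0]; linarith
  have hs1 : s0 ≠ 1 := by intro h; rw [h] at h1re; simp at h1re
  have hne : FL χ s0 ≠ 0 := fun h0 => by
    have := FL_zero_re χ s0 h0; linarith
  have hlow := L_lower χ s0 h1re (by rw [hs0]; linarith)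
  have hn1 : a / E ≤ ‖s0 - 1‖ := by
    have := Complex.re_le_norm (s0 - 1)
    rw [Complex.sub_re, Complex.one_re, hs0] at this; linarith
  have hK : (1 + 2 / (a/E)) * ((1 + 2 * C0) / (a / E)) ≤ Real.exp (4 * l) := by
    have e1 : (1 + 2 / (a/E)) ≤ 3 / (a / E) := by
      have : 1 ≤ 1 / (a/E) := by rw [le_div_iff₀ haE]; linarith
      have e : 3 / (a/E) = 1 / (a/E) + 2 / (a/E) := by ring
      rw [e]; linarith
    calc _ ≤ 3 / (a / E) * ((1 + 2 * C0) / (a / E)) := by gcongr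
      _ = (3 * (1 + 2 * C0) / a^2) * E^2 := by field_simp
      _ ≤ E * E^2 := by gcongr; linarith
      _ = Real.exp (3 * l) := by rw [hE, ← Real.exp_nat_mul, ← Real.exp_add]; push_cast; ring_nf
      _ ≤ _ := Real.exp_le_exp.2 (by linarith)
  have hb : ∀ s ∈ Metric.closedBall s0 (l / E), ‖FL χ s‖ ≤ Real.exp (624 * l) * ‖FL χ s0‖ := by
    intro s hs
    rw [Metric.mem_closedBall, dist_eq_norm] at hs
    have hre := (Complex.abs_re_le_norm (s - s0)).trans hs
    have him' := (Complex.abs_im_le_norm (s - s0)).trans hs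
    rw [Complex.sub_re, abs_le] at hre
    rw [Complex.sub_im, abs_le] at him'
    have h3 := hF P l hl b1 Q hlQ hsm χ s (by linarith) (by linarith)
      (by rw [abs_le] at him ⊢; constructor <;> linarith)
    refine h3.trans ?_
    have h4 : 1 + dt χ * ‖s - 1‖ ≤ (1 + 2 / (a/E)) * ((1 + 2 * C0) / (a / E)) * ‖FL χ s0‖ := by
      have hlow' : 1 ≤ ((1 + 2 * C0) / (a / E)) * ‖χ.LFunction s0‖ := by
        have e : s0.re - 1 = a / E := by rw [hs0]; ring
        rw [e, div_le_iff₀ (by positivity)] at hlow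
        have : ((1 + 2 * C0) / (a / E)) * ‖χ.LFunction s0‖ = (‖χ.LFunction s0‖ * (1 + 2 * C0)) / (a/E) := by ring
        rw [this, le_div_iff₀ haE]; linarith
      have p1 : 0 ≤ 2 / (a/E) := by positivity
      by_cases hχ : χ = 1
      · have hd1 : dt χ = 1 := by simp [dt, hχ]
        have e : ‖FL χ s0‖ = ‖s0 - 1‖ * ‖χ.LFunction s0‖ := by
          subst hχ; rw [FL_one s0 hs1, norm_mul]
        have t1 : ‖s - 1‖ ≤ ‖s0 - 1‖ + 1 := by
          have : s - 1 = (s - s0) + (s0 - 1) := by ring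
          rw [this]
          refine (norm_add_le _ _).trans (by linarith)
        have t2 : 1 + ‖s - 1‖ ≤ (1 + 2 / (a/E)) * ‖s0 - 1‖ := by
          have : 2 ≤ 2 / (a/E) * ‖s0 - 1‖ := by
            calc (2:ℝ) = 2 / (a/E) * (a/E) := by field_simp
              _ ≤ _ := by gcongr
          nlinarith
        rw [hd1, one_mul, e]
        calc 1 + ‖s-1‖ ≤ (1 + 2 / (a/E)) * ‖s0 - 1‖ * 1 := by linarith
          _ ≤ (1 + 2 / (a/E)) * ‖s0 - 1‖ * (((1 + 2 * C0) / (a / E)) * ‖χ.LFunction s0‖) := by gcongr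
          _ = _ := by ring
      · have hd1 : dt χ = 0 := by simp [dt, hχ]
        rw [hd1, FL_ne χ hχ, mul_assoc, zero_mul, add_zero]
        calc (1:ℝ) ≤ ((1 + 2 * C0) / (a / E)) * ‖χ.LFunction s0‖ := hlow'
          _ ≤ _ := le_mul_of_one_le_left (by positivity) (by linarith)
    have e4 : Real.exp (624 * l) = Real.exp (4 * l) * Real.exp (620 * l) := by
      rw [← Real.exp_add]; ring_nf
    have h5 : 1 + dt χ * ‖s - 1‖ ≤ Real.exp (4 * l) * ‖FL χ s0‖ := h4.trans (by gcongr)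
    calc _ ≤ (Real.exp (4 * l) * ‖FL χ s0‖) * Real.exp (620 * l) := by gcongr
      _ = _ := by rw [e4]; ring
  have hfin := landau (FL χ) s0 (l / E) (624 * l) hr (by linarith) hne hb
    (fun s h0 => (FL_zero_re χ s h0).trans h1re) L hL h hd hfac
  rw [ld_eq χ s0 h1re]
  have e5 : 6 * (624 * l) / (l / E) = 3744 * E := by field_simp; ring
  rw [e5] at hfin
  linarith

end CS

namespace CS

lemma ld_hasSum {Q : ℕ} [NeZero Q] (χ : DirichletCharacter ℂ Q) (s : ℂ) (hs : 1 < s.re) :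
    HasSum (fun n : ℕ => ArithmeticFunction.vonMangoldt n * (χ n * (n:ℂ) ^ (-s)).re) (ld χ s) := by
  have h1 := (DirichletCharacter.LSeriesSummable_twist_vonMangoldt χ hs).hasSum
  have h2 := Complex.hasSum_re h1
  have h3 : (∑' n, LSeries.term ((fun n : ℕ => χ n) * fun n : ℕ => (ArithmeticFunction.vonMangoldt n : ℂ)) s n).re = ld χ s := by
    have := DirichletCharacter.LSeries_twist_vonMangoldt_eq χ hs
    rw [← DirichletCharacter.deriv_LFunction_eq_deriv_LSeries χ hs, ← DirichletCharacter.LFunction_eq_LSeries χ hs] at this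
    unfold LSeries at this
    rw [this, ld, neg_div, Complex.neg_re]
  rw [h3] at h2
  have e : (fun n : ℕ => ArithmeticFunction.vonMangoldt n * (χ n * (n:ℂ) ^ (-s)).re) =
     fun n => (LSeries.term ((fun n : ℕ => χ n) * fun n : ℕ => (ArithmeticFunction.vonMangoldt n : ℂ)) s n).re := by
    funext n
    by_cases hn : n = 0
    · subst hn; simp
    · rw [LSeries.term_of_ne_zero hn, Pi.mul_apply, Complex.cpow_neg, ← Complex.re_ofReal_mul]
      congr 1
      ring
  rw [e]; exact h2

lemma re_cpow (n : ℕ) (hn : n ≠ 0) (σ t : ℝ) : ∃ w : ℂ, ‖w‖ = 1 ∧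
    ∀ k : ℕ, (n:ℂ) ^ (-(⟨σ, k * t⟩ : ℂ)) = (((n:ℝ) ^ (-σ) : ℝ) : ℂ) * w ^ k := by
  have hn0 : (n:ℂ) ≠ 0 := by exact_mod_cast hn
  refine ⟨(n:ℂ) ^ (-(I * t)), ?_, ?_⟩
  · rw [Complex.norm_natCast_cpow_of_pos (Nat.pos_of_ne_zero hn)]; simp
  · intro k
    rw [← Complex.cpow_nat_mul, Complex.ofReal_cpow (by positivity), Complex.ofReal_natCast, ← Complex.cpow_add _ _ hn0]
    congr 1
    apply Complex.ext <;> simp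

lemma norm_one_of_unit {Q : ℕ} [NeZero Q] (χ : DirichletCharacter ℂ Q) (n : ℕ) (h : IsUnit (n : ZMod Q)) :
    ‖χ n‖ = 1 := by
  obtain ⟨u, hu⟩ := h
  rw [← hu]; exact DirichletCharacter.unit_norm_eq_one χ u

lemma pos341 {Q : ℕ} [NeZero Q] (χ : DirichletCharacter ℂ Q) (σ t : ℝ) (hσ : 1 < σ) :
    0 ≤ 3 * ld (1 : DirichletCharacter ℂ Q) ⟨σ, 0⟩ + 4 * ld χ ⟨σ, t⟩ + ld (χ^2) ⟨σ, 2 * t⟩ := by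
  have h := ((((ld_hasSum (1 : DirichletCharacter ℂ Q) ⟨σ, 0⟩ hσ).mul_left 3).add
    ((ld_hasSum χ ⟨σ, t⟩ hσ).mul_left 4)).add (ld_hasSum (χ^2) ⟨σ, 2 * t⟩ hσ))
  refine h.nonneg ?_
  intro n
  by_cases hn : n = 0
  · subst hn; simp
  obtain ⟨w, hw, hk⟩ := re_cpow n hn σ t
  have k0 := hk 0
  have k1 := hk 1
  have k2 := hk 2
  simp only [Nat.cast_zero, zero_mul, pow_zero, mul_one, Nat.cast_one, one_mul, pow_one, Nat.cast_ofNat] at k0 k1 k2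
  rw [k0, k1, k2]
  have hΛ : 0 ≤ ArithmeticFunction.vonMangoldt n := ArithmeticFunction.vonMangoldt_nonneg
  have hp : 0 ≤ (n:ℝ) ^ (-σ) := by positivity
  by_cases hu : IsUnit (n : ZMod Q)
  · have hz := norm_one_of_unit χ n hu
    rw [MulChar.one_apply hu, MulChar.pow_apply' _ two_ne_zero]
    set z := χ n * w with hzd
    have hz1 : ‖z‖ = 1 := by rw [hzd, norm_mul, hz, hw, mul_one]
    have hz2 : z.re^2 + z.im^2 = 1 := by
      have := Complex.sq_norm z
      rw [hz1, Complex.normSq_apply] at this; nlinarith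
    have e1 : (χ n * (((n:ℝ) ^ (-σ) : ℝ) * w)).re = (n:ℝ) ^ (-σ) * z.re := by
      rw [← Complex.re_ofReal_mul, hzd]; congr 1; ring
    have e2 : ((χ n)^2 * (((n:ℝ) ^ (-σ) : ℝ) * w^2)).re = (n:ℝ) ^ (-σ) * (2 * z.re^2 - 1) := by
      have : (z^2).re = 2 * z.re^2 - 1 := by rw [sq, Complex.mul_re]; nlinarith
      rw [← this, ← Complex.re_ofReal_mul, hzd]; congr 1; ring
    rw [e1, e2, one_mul, Complex.ofReal_re]
    have : 3 * (ArithmeticFunction.vonMangoldt n * (n:ℝ) ^ (-σ)) + 4 * (ArithmeticFunction.vonMangoldt n * ((n:ℝ) ^ (-σ) * z.re)) +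
       ArithmeticFunction.vonMangoldt n * ((n:ℝ) ^ (-σ) * (2 * z.re^2 - 1)) =
       ArithmeticFunction.vonMangoldt n * (n:ℝ) ^ (-σ) * (2 * (1 + z.re)^2) := by ring
    rw [this]; positivity
  · rw [MulChar.map_nonunit _ hu, MulChar.map_nonunit _ hu, MulChar.map_nonunit _ hu]; simp

lemma pos2 {Q : ℕ} [NeZero Q] (χ : DirichletCharacter ℂ Q) (σ : ℝ) (hσ : 1 < σ) :
    0 ≤ ld (1 : DirichletCharacter ℂ Q) ⟨σ, 0⟩ + ld χ ⟨σ, 0⟩ := by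
  have h := ((ld_hasSum (1 : DirichletCharacter ℂ Q) ⟨σ, 0⟩ hσ).add (ld_hasSum χ ⟨σ, 0⟩ hσ))
  refine h.nonneg ?_
  intro n
  by_cases hn : n = 0
  · subst hn; simp
  obtain ⟨w, hw, hk⟩ := re_cpow n hn σ 0
  have k0 := hk 0
  simp only [Nat.cast_zero, zero_mul, pow_zero, mul_one] at k0
  rw [k0]
  have hΛ : 0 ≤ ArithmeticFunction.vonMangoldt n := ArithmeticFunction.vonMangoldt_nonneg
  have hp : 0 ≤ (n:ℝ) ^ (-σ) := by positivity
  by_cases hu : IsUnit (n : ZMod Q)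
  · have hz := norm_one_of_unit χ n hu
    have h1 := (abs_le.1 ((Complex.abs_re_le_norm (χ n)).trans hz.le)).1
    rw [MulChar.one_apply hu, one_mul, Complex.ofReal_re, Complex.re_mul_ofReal, ← mul_add]
    apply mul_nonneg hΛ
    nlinarith
  · rw [MulChar.map_nonunit _ hu, MulChar.map_nonunit _ hu]; simp

lemma pos4 {Q : ℕ} [NeZero Q] (χ₁ χ₂ : DirichletCharacter ℂ Q) (σ : ℝ) (hσ : 1 < σ)
    (hr : ∀ a, (χ₁ a).im = 0) :
    0 ≤ ld (1 : DirichletCharacter ℂ Q) ⟨σ, 0⟩ + ld χ₁ ⟨σ, 0⟩ + ld χ₂ ⟨σ, 0⟩ + ld (χ₁ * χ₂) ⟨σ, 0⟩ := by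
  have h := (((ld_hasSum (1 : DirichletCharacter ℂ Q) ⟨σ, 0⟩ hσ).add (ld_hasSum χ₁ ⟨σ, 0⟩ hσ)).add
    (ld_hasSum χ₂ ⟨σ, 0⟩ hσ)).add (ld_hasSum (χ₁ * χ₂) ⟨σ, 0⟩ hσ)
  refine h.nonneg ?_
  intro n
  by_cases hn : n = 0
  · subst hn; simp
  obtain ⟨w, hw, hk⟩ := re_cpow n hn σ 0
  have k0 := hk 0
  simp only [Nat.cast_zero, zero_mul, pow_zero, mul_one] at k0
  rw [k0]
  have hΛ : 0 ≤ ArithmeticFunction.vonMangoldt n := ArithmeticFunction.vonMangoldt_nonneg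
  have hp : 0 ≤ (n:ℝ) ^ (-σ) := by positivity
  by_cases hu : IsUnit (n : ZMod Q)
  · have h1 := (abs_le.1 ((Complex.abs_re_le_norm (χ₁ n)).trans (norm_one_of_unit χ₁ n hu).le)).1
    have h2 := (abs_le.1 ((Complex.abs_re_le_norm (χ₂ n)).trans (norm_one_of_unit χ₂ n hu).le)).1
    rw [MulChar.one_apply hu, one_mul, Complex.ofReal_re, Complex.re_mul_ofReal, Complex.re_mul_ofReal,
      Complex.re_mul_ofReal, MulChar.mul_apply, Complex.mul_re, hr, zero_mul, sub_zero, ← mul_add, ← mul_add, ← mul_add]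
    apply mul_nonneg hΛ
    have : (n:ℝ) ^ (-σ) + (χ₁ n).re * (n:ℝ) ^ (-σ) + (χ₂ n).re * (n:ℝ) ^ (-σ) + (χ₁ n).re * (χ₂ n).re * (n:ℝ) ^ (-σ)
      = (n:ℝ) ^ (-σ) * ((1 + (χ₁ n).re) * (1 + (χ₂ n).re)) := by ring
    rw [this]
    exact mul_nonneg hp (mul_nonneg (by linarith) (by linarith))
  · rw [MulChar.map_nonunit _ hu, MulChar.map_nonunit _ hu, MulChar.map_nonunit _ hu, MulChar.map_nonunit _ hu]; simp

end CS

namespace CS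

lemma fac1 (f : ℂ → ℂ) (hf : Differentiable ℂ f) (ρ : ℂ) (h0 : f ρ = 0) :
    ∃ h : ℂ → ℂ, Differentiable ℂ h ∧ (∀ s, f s = h s * (s - ρ)) ∧ h ρ = deriv f ρ := by
  refine ⟨dslope f ρ, ?_, ?_, dslope_same _ _⟩
  · rw [← differentiableOn_univ, Complex.differentiableOn_dslope (Filter.univ_mem)]
    exact hf.differentiableOn
  · intro s
    have := sub_smul_dslope f ρ s
    rw [h0, sub_zero, smul_eq_mul] at this
    rw [← this, mul_comm]

lemma fac2 (f : ℂ → ℂ) (hf : Differentiable ℂ f) (ρ₁ ρ₂ : ℂ) (h1 : f ρ₁ = 0) (h2 : f ρ₂ = 0)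
    (h12 : ρ₁ = ρ₂ → deriv f ρ₁ = 0) :
    ∃ h : ℂ → ℂ, Differentiable ℂ h ∧ (∀ s, f s = h s * ((s - ρ₁) * (s - ρ₂))) := by
  obtain ⟨g, hg, hfg, hgd⟩ := fac1 f hf ρ₁ h1
  have hg0 : g ρ₂ = 0 := by
    by_cases h : ρ₁ = ρ₂
    · rw [← h, hgd, h12 h]
    · have := hfg ρ₂
      rw [h2] at this
      exact (mul_eq_zero.1 this.symm).resolve_right (sub_ne_zero.2 (Ne.symm h))
  obtain ⟨k, hk, hgk, -⟩ := fac1 g hg ρ₂ hg0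
  exact ⟨k, hk, fun s => by rw [hfg, hgk]; ring⟩

lemma real_of_sq {Q : ℕ} [NeZero Q] (χ : DirichletCharacter ℂ Q) (h : χ^2 = 1) (a : ZMod Q) : (χ a).im = 0 := by
  by_cases hu : IsUnit a
  · have : (χ a)^2 = 1 := by rw [← MulChar.pow_apply' _ two_ne_zero, h, MulChar.one_apply hu]
    have h3 : (χ a - 1) * (χ a + 1) = 0 := by linear_combination this
    rcases mul_eq_zero.1 h3 with h | h
    · rw [sub_eq_zero.1 h]; simp
    · rw [eq_neg_of_add_eq_zero_left h]; simp
  · rw [MulChar.map_nonunit _ hu]; simp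

lemma LF_conj {Q : ℕ} [NeZero Q] (χ : DirichletCharacter ℂ Q) (h1 : χ ≠ 1) (h : ∀ a, (χ a).im = 0) (s : ℂ) :
    χ.LFunction (starRingEnd ℂ s) = starRingEnd ℂ (χ.LFunction s) := by
  set g : ℂ → ℂ := fun s => starRingEnd ℂ (χ.LFunction (starRingEnd ℂ s)) with hg
  have hd := DirichletCharacter.differentiable_LFunction h1
  have hgd : Differentiable ℂ g := by
    intro z
    have := (hd (starRingEnd ℂ z)).conj_conj
    rw [Complex.conj_conj] at this
    exact this
  have heq : g = χ.LFunction := by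
    refine AnalyticOnNhd.eq_of_eventuallyEq (z₀ := 2) (fun z _ => hgd.analyticAt z) (fun z _ => hd.analyticAt z) ?_
    have hop : {z : ℂ | 1 < z.re} ∈ nhds (2:ℂ) :=
      (isOpen_lt continuous_const continuous_re).mem_nhds (by simp)
    filter_upwards [hop] with z hz
    have hz' : 1 < z.re := hz
    rw [hg]
    simp only
    rw [DirichletCharacter.LFunction_eq_LSeries χ (s := starRingEnd ℂ z) (by simpa using hz'),
      DirichletCharacter.LFunction_eq_LSeries χ hz', LSeries, LSeries, Complex.conj_tsum]
    congr 1
    funext n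
    by_cases hn : n = 0
    · subst hn; simp
    · rw [LSeries.term_of_ne_zero hn, LSeries.term_of_ne_zero hn, map_div₀, Complex.conj_eq_iff_im.2 (h _)]
      congr 1
      rw [Complex.cpow_conj _ _ (by rw [Complex.natCast_arg]; exact Real.pi_pos.ne), Complex.conj_conj, Complex.conj_natCast]
  have := congrFun heq (starRingEnd ℂ s)
  rw [← this, hg]; simp

lemma re_inv (u v : ℝ) (z : ℂ) (hz : z = ⟨u, v⟩) : (1 / z).re = u / (u^2 + v^2) := by
  subst hz
  rw [one_div, Complex.inv_re, Complex.normSq_apply]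
  congr 1; simp only; ring

/-- Hypotheses shared by all applications of the Landau lemma. -/
structure LGood (a : ℝ) (P : ℕ) (E : ℝ) : Prop where
  E1 : 1 ≤ E
  P1 : (1:ℝ) ≤ P
  u0 : ∀ (Q : ℕ) [NeZero Q], Real.log Q ≤ 4 * Real.log E * E → (∀ p : ℕ, p.Prime → p ∣ Q → p ≤ P) →
    ∀ χ : DirichletCharacter ℂ Q, ∀ t : ℝ, |t| ≤ 5 * P →
    ld χ ⟨1 + a / E, t⟩ ≤ 3744 * E + dt χ * (1 / ((⟨1 + a / E, t⟩ : ℂ) - 1)).re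
  u1 : ∀ (Q : ℕ) [NeZero Q], Real.log Q ≤ 4 * Real.log E * E → (∀ p : ℕ, p.Prime → p ∣ Q → p ≤ P) →
    ∀ χ : DirichletCharacter ℂ Q, ∀ t : ℝ, |t| ≤ 5 * P → ∀ ρ, FL χ ρ = 0 → 1 - a / E ≤ ρ.re → |ρ.im - t| ≤ a / E →
    ld χ ⟨1 + a / E, t⟩ ≤ 3744 * E + dt χ * (1 / ((⟨1 + a / E, t⟩ : ℂ) - 1)).re - (1 / (⟨1 + a / E, t⟩ - ρ)).re
  u2 : ∀ (Q : ℕ) [NeZero Q], Real.log Q ≤ 4 * Real.log E * E → (∀ p : ℕ, p.Prime → p ∣ Q → p ≤ P) →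
    ∀ χ : DirichletCharacter ℂ Q, ∀ t : ℝ, |t| ≤ 5 * P →
    ∀ ρ, FL χ ρ = 0 → 1 - a / E ≤ ρ.re → |ρ.im - t| ≤ a / E →
    ∀ ρ', FL χ ρ' = 0 → 1 - a / E ≤ ρ'.re → |ρ'.im - t| ≤ a / E → (ρ = ρ' → deriv (FL χ) ρ = 0) →
    ld χ ⟨1 + a / E, t⟩ ≤ 3744 * E + dt χ * (1 / ((⟨1 + a / E, t⟩ : ℂ) - 1)).re - (1 / (⟨1 + a / E, t⟩ - ρ)).re
      - (1 / (⟨1 + a / E, t⟩ - ρ')).re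

lemma good_exists (a : ℝ) (ha : 0 < a) (ha1 : a ≤ 1) : ∃ l0 : ℝ, 700 ≤ l0 ∧ ∀ (P : ℕ),
    l0 ≤ Real.log (Real.log P) → LGood a P (Real.log P) := by
  obtain ⟨l0, hl0, hU⟩ := landau_unif a ha ha1
  refine ⟨l0, hl0, ?_⟩
  intro P hl
  obtain ⟨hE, -, hlE, hlP⟩ := size_rel P _ rfl (by linarith)
  have hU' := hU P _ rfl hl
  set l := Real.log (Real.log P) with hld
  set E := Real.log P with hEd
  have hE1 : 1 ≤ E := by linarith
  have hball : ∀ t : ℝ, ∀ ρ : ℂ, ρ.re < 1 → 1 - a / E ≤ ρ.re → |ρ.im - t| ≤ a / E →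
      ρ ∈ Metric.closedBall (⟨1 + a / E, t⟩ : ℂ) (l / E / 3) := by
    intro t ρ h1 h2 h3
    rw [Metric.mem_closedBall, dist_eq_norm]
    have h4 := Complex.norm_le_abs_re_add_abs_im (ρ - (⟨1 + a / E, t⟩ : ℂ))
    rw [Complex.sub_re, Complex.sub_im] at h4
    simp only at h4
    have h5 : |ρ.re - (1 + a / E)| ≤ 2 * (a / E) := by rw [abs_le]; constructor <;> linarith [show 0 < a / E by positivity]
    have h6 : 3 * (a / E) ≤ l / E / 3 := by
      rw [div_div, mul_div_assoc', div_le_div_iff₀ (by positivity) (by positivity)]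
      nlinarith
    linarith
  refine ⟨hE1, by linarith, ?_, ?_, ?_⟩
  · intro Q _ hlQ hsm χ t ht
    have := hU' Q hlQ hsm χ ⟨1 + a/E, t⟩ rfl ht [] (by simp) (FL χ) (FL_diff χ) (by simp)
    simpa using this
  · intro Q _ hlQ hsm χ t ht ρ h0 h1 h2
    obtain ⟨h, hd, hf, -⟩ := fac1 _ (FL_diff χ) ρ h0
    have := hU' Q hlQ hsm χ ⟨1 + a/E, t⟩ rfl ht [ρ]
      (by intro r hr; rw [List.mem_singleton] at hr; subst hr; exact hball t r (FL_zero_re χ r h0) h1 h2) h hd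
      (by intro s; rw [hf s]; simp)
    simpa only [List.map_cons, List.map_nil, List.sum_cons, List.sum_nil, add_zero] using this
  · intro Q _ hlQ hsm χ t ht ρ h0 h1 h2 ρ' h0' h1' h2' hdd
    obtain ⟨h, hd, hf⟩ := fac2 _ (FL_diff χ) ρ ρ' h0 h0' hdd
    have := hU' Q hlQ hsm χ ⟨1 + a/E, t⟩ rfl ht [ρ, ρ']
      (by
        intro r hr
        rw [List.mem_cons, List.mem_singleton] at hr
        rcases hr with rfl | rfl
        · exact hball t _ (FL_zero_re χ _ h0) h1 h2
        · exact hball t _ (FL_zero_re χ _ h0') h1' h2') h hd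
      (by intro s; rw [hf s]; simp)
    simp only [List.map_cons, List.map_nil, List.sum_cons, List.sum_nil, add_zero] at this
    linarith

end CS

namespace CS

lemma dt_one {Q : ℕ} : dt (1 : DirichletCharacter ℂ Q) = 1 := by simp [dt]
lemma dt_ne {Q : ℕ} (χ : DirichletCharacter ℂ Q) (h : χ ≠ 1) : dt χ = 0 := by simp [dt, h]

lemma re_pole (x t : ℝ) : (1 / ((⟨1 + x, t⟩ : ℂ) - 1)).re = x / (x^2 + t^2) := by
  apply re_inv
  apply Complex.ext <;> simp

lemma re_zero (x t : ℝ) (ρ : ℂ) : (1 / ((⟨1 + x, t⟩ : ℂ) - ρ)).re = (1 + x - ρ.re) / ((1 + x - ρ.re)^2 + (t - ρ.im)^2) := by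
  apply re_inv
  apply Complex.ext <;> simp

lemma near_ge (x d g : ℝ) (hx : 0 < x) (h1 : x ≤ d) (h2 : d ≤ 1.1 * x) (hg : |g| ≤ x / 2) :
    0.75 * (1 / x) ≤ d / (d^2 + g^2) := by
  have hg2 : g^2 ≤ x^2 / 4 := by
    have := sq_abs g
    nlinarith [abs_nonneg g]
  have hd : 0 < d := by linarith
  rw [mul_one_div, div_le_div_iff₀ hx (by positivity)]
  nlinarith [mul_nonneg (show 0 ≤ d - x by linarith) (show 0 ≤ 1.1 * x - d by linarith)]

lemma E_bd (a E : ℝ) (ha : 0 < a) (ha6 : a * 10^6 ≤ 1) (hE : 1 ≤ E) : 3744 * E ≤ 0.004 * (1 / (a / E)) := by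
  rw [one_div_div, mul_div_assoc', le_div_iff₀ ha]
  nlinarith

lemma gen341 (a : ℝ) (ha : 0 < a) (ha6 : a * 10^6 ≤ 1) (P : ℕ) (E : ℝ) (hG : LGood a P E)
    (Q : ℕ) [NeZero Q] (hQ : Real.log Q ≤ 4 * Real.log E * E) (hsm : ∀ p : ℕ, p.Prime → p ∣ Q → p ≤ P)
    (χ : DirichletCharacter ℂ Q) (ρ : ℂ) (h0 : FL χ ρ = 0) (h1 : 1 - a / 10 / E < ρ.re) (h2 : |ρ.im| ≤ 2 * P) :
    0.6 * (1 / (a / E)) ≤ 4 * (dt χ * ((a/E) / ((a/E)^2 + ρ.im^2))) + dt (χ^2) * ((a/E) / ((a/E)^2 + (2 * ρ.im)^2)) := by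
  have hE1 := hG.E1
  have hx : 0 < a / E := by positivity
  have hbd := E_bd a E ha ha6 hE1
  have e10 : a / 10 / E = (a / E) / 10 := by ring
  rw [e10] at h1
  have hre := FL_zero_re χ ρ h0
  have hP := hG.P1
  have p := pos341 χ (1 + a / E) ρ.im (by linarith)
  have q1 := hG.u0 Q hQ hsm 1 0 (by rw [abs_zero]; positivity)
  have q2 := hG.u1 Q hQ hsm χ ρ.im (h2.trans (by linarith)) ρ h0 (by linarith) (by simp; positivity)
  have q3 := hG.u0 Q hQ hsm (χ^2) (2 * ρ.im) (by rw [abs_mul, abs_two]; linarith)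
  rw [re_pole] at q1 q2 q3
  rw [re_zero] at q2
  rw [dt_one] at q1
  set x := a / E with hxd
  have e1 : x / (x^2 + 0^2) = 1 / x := by field_simp; ring
  rw [e1, one_mul] at q1
  have e2 : (0.909:ℝ) * (1/x) ≤ (1 + x - ρ.re) / ((1 + x - ρ.re)^2 + (ρ.im - ρ.im)^2) := by
    have hd : 0 < 1 + x - ρ.re := by linarith
    have : (1 + x - ρ.re) / ((1 + x - ρ.re)^2 + (ρ.im - ρ.im)^2) = 1 / (1 + x - ρ.re) := by
      rw [sub_self]; field_simp; ring
    rw [this, mul_one_div, div_le_div_iff₀ hx hd]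
    linarith
  linarith

lemma Z1 (a : ℝ) (ha : 0 < a) (ha6 : a * 10^6 ≤ 1) (P : ℕ) (E : ℝ) (hG : LGood a P E)
    (Q : ℕ) [NeZero Q] (hQ : Real.log Q ≤ 4 * Real.log E * E) (hsm : ∀ p : ℕ, p.Prime → p ∣ Q → p ≤ P)
    (χ : DirichletCharacter ℂ Q) (ρ : ℂ) (h0 : FL χ ρ = 0) (h1 : 1 - a / 10 / E < ρ.re) (h2 : |ρ.im| ≤ 2 * P) :
    χ^2 = 1 := by
  by_contra hc
  have h := gen341 a ha ha6 P E hG Q hQ hsm χ ρ h0 h1 h2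
  have hχ : χ ≠ 1 := fun h => hc (by rw [h, one_pow])
  rw [dt_ne _ hc, dt_ne _ hχ] at h
  have hE1 := hG.E1
  have : 0 < 1 / (a / E) := by positivity
  linarith

lemma Z2a (a : ℝ) (ha : 0 < a) (ha6 : a * 10^6 ≤ 1) (P : ℕ) (E : ℝ) (hG : LGood a P E)
    (Q : ℕ) [NeZero Q] (hQ : Real.log Q ≤ 4 * Real.log E * E) (hsm : ∀ p : ℕ, p.Prime → p ∣ Q → p ≤ P)
    (χ : DirichletCharacter ℂ Q) (hχ : χ ≠ 1) (ρ : ℂ) (h0 : FL χ ρ = 0) (h1 : 1 - a / 10 / E < ρ.re)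
    (h2 : |ρ.im| ≤ 2 * P) : |ρ.im| ≤ (a / E) / 2 := by
  have h := gen341 a ha ha6 P E hG Q hQ hsm χ ρ h0 h1 h2
  rw [Z1 a ha ha6 P E hG Q hQ hsm χ ρ h0 h1 h2, dt_ne _ hχ, dt_one] at h
  have hE1 := hG.E1
  have hx : 0 < a / E := by positivity
  set x := a / E with hxd
  by_contra hc
  push Not at hc
  have h3 : x^2 / 4 ≤ ρ.im^2 := by
    rw [← sq_abs ρ.im]; nlinarith
  have h4 : x / (x^2 + (2 * ρ.im)^2) ≤ 0.5 * (1/x) := by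
    rw [mul_one_div, div_le_div_iff₀ (by positivity) hx]
    nlinarith
  have : 0 < 1 / x := by positivity
  linarith

lemma Z0 (a : ℝ) (ha : 0 < a) (ha6 : a * 10^6 ≤ 1) (P : ℕ) (E : ℝ) (hG : LGood a P E)
    (Q : ℕ) [NeZero Q] (hQ : Real.log Q ≤ 4 * Real.log E * E) (hsm : ∀ p : ℕ, p.Prime → p ∣ Q → p ≤ P)
    (ρ : ℂ) (h0 : FL (1 : DirichletCharacter ℂ Q) ρ = 0) (h1 : 1 - a / 10 / E < ρ.re)
    (h2 : |ρ.im| ≤ 2 * P) : |ρ.im| ≤ 10 * (a / E) := by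
  have h := gen341 a ha ha6 P E hG Q hQ hsm 1 ρ h0 h1 h2
  rw [one_pow, dt_one] at h
  have hE1 := hG.E1
  have hx : 0 < a / E := by positivity
  set x := a / E with hxd
  by_contra hc
  push Not at hc
  have h3 : 100 * x^2 ≤ ρ.im^2 := by
    rw [← sq_abs ρ.im]; nlinarith
  have h4 : x / (x^2 + (2 * ρ.im)^2) ≤ 0.01 * (1/x) := by
    rw [mul_one_div, div_le_div_iff₀ (by positivity) hx]
    nlinarith
  have h5 : x / (x^2 + ρ.im^2) ≤ 0.01 * (1/x) := by
    rw [mul_one_div, div_le_div_iff₀ (by positivity) hx]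
    nlinarith
  have : 0 < 1 / x := by positivity
  linarith

lemma Z2b (a : ℝ) (ha : 0 < a) (ha6 : a * 10^6 ≤ 1) (P : ℕ) (E : ℝ) (hG : LGood a P E)
    (Q : ℕ) [NeZero Q] (hQ : Real.log Q ≤ 4 * Real.log E * E) (hsm : ∀ p : ℕ, p.Prime → p ∣ Q → p ≤ P)
    (χ : DirichletCharacter ℂ Q) (hχ : χ ≠ 1) (ρ : ℂ) (h0 : FL χ ρ = 0) (h1 : 1 - a / 10 / E < ρ.re)
    (h2 : |ρ.im| ≤ 2 * P) (ρ' : ℂ) (h0' : FL χ ρ' = 0) (h1' : 1 - a / 10 / E < ρ'.re)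
    (h2' : |ρ'.im| ≤ 2 * P) : ρ = ρ' ∧ deriv (FL χ) ρ ≠ 0 := by
  by_contra hc
  have hdd : ρ = ρ' → deriv (FL χ) ρ = 0 := by
    intro h; by_contra h'; exact hc ⟨h, h'⟩
  have g1 := Z2a a ha ha6 P E hG Q hQ hsm χ hχ ρ h0 h1 h2
  have g2 := Z2a a ha ha6 P E hG Q hQ hsm χ hχ ρ' h0' h1' h2'
  have hE1 := hG.E1
  have hx : 0 < a / E := by positivity
  have hbd := E_bd a E ha ha6 hE1
  have e10 : a / 10 / E = (a / E) / 10 := by ring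
  rw [e10] at h1 h1'
  have r1 := FL_zero_re χ ρ h0
  have r2 := FL_zero_re χ ρ' h0'
  have hP := hG.P1
  have p := pos2 χ (1 + a / E) (by linarith)
  have q1 := hG.u0 Q hQ hsm 1 0 (by rw [abs_zero]; positivity)
  have q2 := hG.u2 Q hQ hsm χ 0 (by rw [abs_zero]; positivity) ρ h0 (by linarith) (by rw [sub_zero]; linarith)
    ρ' h0' (by linarith) (by rw [sub_zero]; linarith) hdd
  rw [re_pole] at q1 q2
  rw [re_zero, re_zero] at q2
  rw [dt_one] at q1
  rw [dt_ne _ hχ] at q2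
  set x := a / E with hxd
  have e1 : x / (x^2 + 0^2) = 1 / x := by field_simp; ring
  rw [e1, one_mul] at q1
  have n1 := near_ge x (1 + x - ρ.re) (0 - ρ.im) hx (by linarith) (by linarith) (by rw [zero_sub, abs_neg]; exact g1)
  have n2 := near_ge x (1 + x - ρ'.re) (0 - ρ'.im) hx (by linarith) (by linarith) (by rw [zero_sub, abs_neg]; exact g2)
  have : 0 < 1 / x := by positivity
  linarith

lemma Z3 (a : ℝ) (ha : 0 < a) (ha6 : a * 10^6 ≤ 1) (P : ℕ) (E : ℝ) (hG : LGood a P E)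
    (Q : ℕ) [NeZero Q] (hQ : Real.log Q ≤ 4 * Real.log E * E) (hsm : ∀ p : ℕ, p.Prime → p ∣ Q → p ≤ P)
    (χ : DirichletCharacter ℂ Q) (hχ : χ ≠ 1) (ρ : ℂ) (h0 : FL χ ρ = 0) (h1 : 1 - a / 10 / E < ρ.re)
    (h2 : |ρ.im| ≤ 2 * P) (χ' : DirichletCharacter ℂ Q) (hχ' : χ' ≠ 1) (ρ' : ℂ) (h0' : FL χ' ρ' = 0)
    (h1' : 1 - a / 10 / E < ρ'.re) (h2' : |ρ'.im| ≤ 2 * P) : χ = χ' := by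
  by_contra hc
  have s1 := Z1 a ha ha6 P E hG Q hQ hsm χ ρ h0 h1 h2
  have hprod : χ * χ' ≠ 1 := by
    intro h
    apply hc
    have h3 : χ * (χ * χ') = χ := by rw [h, mul_one]
    rw [← mul_assoc, ← sq, s1, one_mul] at h3
    exact h3.symm
  have g1 := Z2a a ha ha6 P E hG Q hQ hsm χ hχ ρ h0 h1 h2
  have g2 := Z2a a ha ha6 P E hG Q hQ hsm χ' hχ' ρ' h0' h1' h2'
  have hE1 := hG.E1
  have hx : 0 < a / E := by positivity
  have hbd := E_bd a E ha ha6 hE1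
  have e10 : a / 10 / E = (a / E) / 10 := by ring
  rw [e10] at h1 h1'
  have r1 := FL_zero_re χ ρ h0
  have r2 := FL_zero_re χ' ρ' h0'
  have hP := hG.P1
  have hP5 : |(0:ℝ)| ≤ 5 * P := by rw [abs_zero]; positivity
  have p := pos4 χ χ' (1 + a / E) (by linarith) (real_of_sq χ s1)
  have q1 := hG.u0 Q hQ hsm 1 0 hP5
  have q2 := hG.u1 Q hQ hsm χ 0 hP5 ρ h0 (by linarith) (by rw [sub_zero]; linarith)
  have q3 := hG.u1 Q hQ hsm χ' 0 hP5 ρ' h0' (by linarith) (by rw [sub_zero]; linarith)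
  have q4 := hG.u0 Q hQ hsm (χ * χ') 0 hP5
  rw [re_pole] at q1 q2 q3 q4
  rw [re_zero] at q2 q3
  rw [dt_one] at q1
  rw [dt_ne _ hχ] at q2
  rw [dt_ne _ hχ'] at q3
  rw [dt_ne _ hprod] at q4
  set x := a / E with hxd
  have e1 : x / (x^2 + 0^2) = 1 / x := by field_simp; ring
  rw [e1, one_mul] at q1
  have n1 := near_ge x (1 + x - ρ.re) (0 - ρ.im) hx (by linarith) (by linarith) (by rw [zero_sub, abs_neg]; exact g1)
  have n2 := near_ge x (1 + x - ρ'.re) (0 - ρ'.im) hx (by linarith) (by linarith) (by rw [zero_sub, abs_neg]; exact g2)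
  have : 0 < 1 / x := by positivity
  linarith

end CS

namespace CS

lemma sq_unit_one {q : ℕ} [NeZero q] (χ : DirichletCharacter ℂ q) (h : χ^2 = 1) (v : ZMod q)
    (hv : χ (v^2) ≠ 0) : χ (v^2) = 1 := by
  have hu : IsUnit v := by
    by_contra hc
    apply hv
    rw [map_pow, MulChar.map_nonunit _ hc]; simp
  rw [map_pow, ← MulChar.pow_apply' _ two_ne_zero, h, MulChar.one_apply hu]

lemma real_odd {q : ℕ} [NeZero q] (χ : DirichletCharacter ℂ q) (hp : χ.IsPrimitive) (h : χ^2 = 1)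
    (p : ℕ) (hpp : p.Prime) (hp2 : p ≠ 2) : ¬ p^2 ∣ q := by
  rintro ⟨m, hm⟩
  have hq0 := NeZero.ne q
  have hm0 : m ≠ 0 := by rintro rfl; simp at hm; exact hq0 hm
  obtain ⟨n, hn, hn1, hn0⟩ := Pr_of_primitive χ hp (p * m) ⟨p, by rw [hm]; ring⟩ (by
    rw [hm, sq, mul_assoc]
    exact lt_mul_of_one_lt_left (Nat.mul_pos hpp.pos (Nat.pos_of_ne_zero hm0)) hpp.one_lt)
  obtain ⟨t, ht⟩ := hn
  obtain ⟨k, hk⟩ := hpp.odd_of_ne_two hp2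
  have hnp : (q:ℤ) ∣ n^p - 1 := by
    have h1 : ((p:ℤ) * m) ∣ n - 1 := ⟨t, by rw [ht]; push_cast; ring⟩
    have h2 : (p:ℤ) ∣ ∑ i ∈ Finset.range p, n^i := by
      have h3 : ∀ i ∈ Finset.range p, (n:ℤ)^i ≡ 1 [ZMOD p] := by
        intro i _
        have : n ≡ 1 [ZMOD p] := (Int.modEq_iff_dvd.2 (by
          have := (dvd_mul_right (p:ℤ) m).trans h1
          rw [← neg_sub, dvd_neg] at this; exact this))
        simpa using this.pow i
      have h4 := Int.ModEq.sum h3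
      rw [Finset.sum_const, Finset.card_range, nsmul_eq_mul, mul_one] at h4
      have h5 : (p:ℤ) ≡ 0 [ZMOD p] := by simp [Int.ModEq]
      exact Int.modEq_zero_iff_dvd.1 (h4.trans h5)
    have h6 := mul_dvd_mul h2 h1
    rw [geom_sum_mul] at h6
    have : (q:ℤ) = p * (p * m) := by rw [hm]; push_cast; ring
    rw [this]; exact h6
  have e : ((n:ℤ) : ZMod q) ^ p = 1 := by
    have := (ZMod.intCast_zmod_eq_zero_iff_dvd _ _).2 hnp
    push_cast at this
    exact sub_eq_zero.1 this
  have e2 : ((n:ℤ) : ZMod q) = (((n:ℤ) : ZMod q)^(k+1))^2 := by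
    calc ((n:ℤ) : ZMod q) = ((n:ℤ) : ZMod q)^p * (n:ℤ) := by rw [e, one_mul]
      _ = _ := by rw [hk]; ring
  unfold cz at hn1 hn0
  rw [e2] at hn1 hn0
  exact hn1 (sq_unit_one χ h _ hn0)

lemma real_two {q : ℕ} [NeZero q] (χ : DirichletCharacter ℂ q) (hp : χ.IsPrimitive) (h : χ^2 = 1) :
    ¬ 16 ∣ q := by
  rintro ⟨m, hm⟩
  have hq0 := NeZero.ne q
  have hm0 : 0 < m := by
    rcases Nat.eq_zero_or_pos m with rfl | h
    · simp at hm; exact absurd hm hq0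
    · exact h
  obtain ⟨n, hn, hn1, hn0⟩ := Pr_of_primitive χ hp (8 * m) ⟨2, by rw [hm]; ring⟩ (by omega)
  obtain ⟨t, ht⟩ := hn
  have e2 : ((n:ℤ) : ZMod q) = ((1 + 4 * m * t : ℤ) : ZMod q)^2 := by
    rw [← Int.cast_pow, ← sub_eq_zero, ← Int.cast_sub, ZMod.intCast_zmod_eq_zero_iff_dvd]
    refine ⟨-(m * t^2), ?_⟩
    have : n = 1 + 8 * m * t := by push_cast at ht; linarith
    rw [this, hm]; push_cast; ring
  unfold cz at hn1 hn0
  rw [e2] at hn1 hn0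
  exact hn1 (sq_unit_one χ h _ hn0)

lemma pplus {q : ℕ} [NeZero q] (χ : DirichletCharacter ℂ q) (hp : χ.IsPrimitive) (h : χ^2 = 1) :
    (1/3) * Real.log q ≤ ((q.primeFactors.sup id : ℕ) : ℝ) := by
  have hq0 := NeZero.ne q
  set M := q.primeFactors.sup id with hM
  have hdvd : q ∣ 8 * ∏ p ∈ q.primeFactors, p := by
    have hpr0 : ∏ p ∈ q.primeFactors, p ≠ 0 :=
      Finset.prod_ne_zero_iff.2 (fun p hp => (Nat.prime_of_mem_primeFactors hp).ne_zero)
    rw [← Nat.factorization_prime_le_iff_dvd hq0 (mul_ne_zero (by norm_num) hpr0)]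
    intro p hpp
    by_cases hpq : p ∣ q
    · have hmem : p ∈ q.primeFactors := Nat.mem_primeFactors.2 ⟨hpp, hpq, hq0⟩
      have h1 : p ∣ ∏ p ∈ q.primeFactors, p := Finset.dvd_prod_of_mem _ hmem
      by_cases hp2 : p = 2
      · subst hp2
        have h2 : q.factorization 2 < 4 := by
          by_contra hc
          push Not at hc
          exact real_two χ hp h ((pow_dvd_pow 2 hc).trans (Nat.ordProj_dvd q 2))
        have h3 : 2^3 ∣ 8 * ∏ p ∈ q.primeFactors, p := ⟨_, by norm_num; rfl⟩
        have h4 := (hpp.pow_dvd_iff_le_factorization (mul_ne_zero (by norm_num) hpr0)).1 h3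
        omega
      · have h2 : q.factorization p < 2 := by
          by_contra hc
          push Not at hc
          exact real_odd χ hp h p hpp hp2 ((pow_dvd_pow p hc).trans (Nat.ordProj_dvd q p))
        have h3 : p^1 ∣ 8 * ∏ p ∈ q.primeFactors, p := by
          rw [pow_one]; exact h1.mul_left _
        have h4 := (hpp.pow_dvd_iff_le_factorization (mul_ne_zero (by norm_num) hpr0)).1 h3
        omega
    · rw [Nat.factorization_eq_zero_of_not_dvd hpq]; exact Nat.zero_le _
  by_cases hq1 : q = 1
  · subst hq1; simp
  have hprim : ∏ p ∈ q.primeFactors, p ≤ 4^M := by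
    refine le_trans ?_ (primorial_le_four_pow M)
    unfold primorial
    apply Finset.prod_le_prod_of_subset_of_one_le'
    · intro p hp
      have : p ≤ M := Finset.le_sup (f := id) hp
      exact Finset.mem_filter.2 ⟨Finset.mem_range.2 (by omega), Nat.prime_of_mem_primeFactors hp⟩
    · intro p hp _
      exact (Finset.mem_filter.1 hp).2.one_lt.le
  have hM2 : 2 ≤ M := by
    obtain ⟨p, hp⟩ := Nat.nonempty_primeFactors.2 (by omega : 1 < q)
    exact (Nat.prime_of_mem_primeFactors hp).two_le.trans (Finset.le_sup (f := id) hp)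
  have hle : q ≤ 8 * 4^M := (Nat.le_of_dvd (by
    have : 0 < ∏ p ∈ q.primeFactors, p := Finset.prod_pos (fun p hp => (Nat.prime_of_mem_primeFactors hp).pos)
    omega) hdvd).trans (by omega)
  have hle2 : (q:ℝ) ≤ 2^(3 + 2 * M) := by
    have : (8 * 4^M : ℕ) = 2^(3 + 2*M) := by rw [pow_add, pow_mul]; norm_num
    rw [this] at hle; exact_mod_cast hle
  have h5 := Real.log_le_log (by exact_mod_cast Nat.pos_of_ne_zero hq0) hle2
  rw [Real.log_pow] at h5
  have h6 := Real.log_two_lt_d9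
  have h7 : (2:ℝ) ≤ M := by exact_mod_cast hM2
  push_cast at h5
  have h8 : (3 + 2 * (M:ℝ)) * Real.log 2 ≤ (3 + 2 * (M:ℝ)) * 0.7 := by
    apply mul_le_mul_of_nonneg_left <;> linarith
  linarith

end CS

namespace CS

lemma geo_lower (y : ℝ) (n : ℕ) :
    (n+1:ℝ) * y^n ≤ ∑ i ∈ Finset.range (n+1), (y^2)^i := by
  have h1 := Finset.sum_range_reflect (fun i => (y^2)^i) (n+1)
  have h2 : ∑ i ∈ Finset.range (n+1), (2 * y^n) ≤
      ∑ i ∈ Finset.range (n+1), ((y^2)^i + (y^2)^(n+1-1-i)) := by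
    apply Finset.sum_le_sum
    intro i hi
    have hi' : i + (n - i) = n := by have := Finset.mem_range.1 hi; omega
    have e : y^n = y^i * y^(n-i) := by rw [← pow_add, hi']
    rw [e, Nat.add_sub_cancel, ← pow_mul, ← pow_mul, mul_comm 2 i, mul_comm 2 (n-i), pow_mul, pow_mul]
    nlinarith [sq_nonneg (y^i - y^(n-i))]
  rw [Finset.sum_add_distrib, h1, Finset.sum_const, Finset.card_range, nsmul_eq_mul] at h2
  push_cast at h2
  linarith

/-- the Lambert weights -/
noncomputable def lb (x : ℝ) (n : ℕ) : ℝ := 1/((n+1)*(1-x)) - x^(n+1)/(1-x^(n+1))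

lemma lb_anti (x : ℝ) (h0 : 0 < x) (h1 : x < 1) (n : ℕ) : lb x (n+1) ≤ lb x n := by
  set S := ∑ i ∈ Finset.range (n+1), x^i with hS
  set S' := ∑ i ∈ Finset.range (n+1+1), x^i with hS'
  have e1 : 1 - x^(n+1) = (1-x)*S := by rw [hS, mul_neg_geom_sum]
  have e2 : 1 - x^(n+1+1) = (1-x)*S' := by rw [hS', mul_neg_geom_sum]
  have e3 : S' = S + x^(n+1) := by rw [hS', hS, Finset.sum_range_succ]
  have e4 : S' = x * S + 1 := by rw [hS', hS, geom_sum_succ]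
  have hy := Real.sqrt_pos.2 h0
  have hyx := Real.sq_sqrt h0.le
  set y := Real.sqrt x
  have hy1 : y ≤ 1 := by nlinarith
  have g1 := geo_lower y n
  have g2 := geo_lower y (n+1)
  rw [hyx] at g1 g2
  have hSp : 0 < S := lt_of_lt_of_le (by positivity) g1
  have hSp' : 0 < S' := lt_of_lt_of_le (by positivity) g2
  have key : ((n:ℝ)+1)*(n+2)*x^(n+1) ≤ S * S' := by
    have := mul_le_mul g1 g2 (by positivity) hSp.le
    refine le_trans ?_ this
    push_cast
    have e : x^(n+1) = y * (y^n * y^(n+1)) := by rw [← hyx, ← pow_mul]; ring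
    rw [e]
    have : y * (y^n * y^(n+1)) ≤ y^n * y^(n+1) := mul_le_of_le_one_left (by positivity) hy1
    have h3 : (0:ℝ) ≤ (n+1)*(n+2) := by positivity
    nlinarith [mul_le_mul_of_nonneg_left this h3]
  have hx : 0 < 1 - x := by linarith
  have : lb x n - lb x (n+1) = (1/(1-x)) * (1/((n+1)*(n+2)) - x^(n+1)/(S*S')) := by
    unfold lb
    rw [e1, e2]
    have hn1 : (n:ℝ)+1 ≠ 0 := by positivity
    have hn2 : (n:ℝ)+1+1 ≠ 0 := by positivity
    have hn3 : (n:ℝ)+2 ≠ 0 := by positivity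
    have t1 : x^(n+1)/((1-x)*S) - x^(n+1+1)/((1-x)*S') = (1/(1-x)) * (x^(n+1)/(S*S')) := by
      have : x^(n+1) * S' - x^(n+1+1)*S = x^(n+1) := by rw [e4]; ring
      rw [div_sub_div _ _ (by positivity) (by positivity), one_div, inv_mul_eq_div, div_div,
        div_eq_div_iff (by positivity) (by positivity)]
      linear_combination (1-x)*(S*S'*(1-x)) * this
    have t2 : 1/(((n:ℝ)+1)*(1-x)) - 1/(((n+1:ℕ):ℝ)+1)/(1-x) = (1/(1-x))*(1/((n+1)*(n+2))) := by
      push_cast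
      field_simp; ring
    rw [mul_sub (1/(1-x)), ← t1, ← t2, div_div]; ring
  have hf : x^(n+1)/(S*S') ≤ 1/((n+1)*(n+2)) := by
    rw [div_le_div_iff₀ (by positivity) (by positivity)]; linarith
  have : 0 ≤ lb x n - lb x (n+1) := by
    rw [this]; apply mul_nonneg (by positivity); linarith
  linarith

lemma lb_zero (x : ℝ) (h1 : x < 1) : lb x 0 = 1 := by
  have : 1 - x ≠ 0 := by linarith
  unfold lb; simp only [Nat.cast_zero, zero_add, one_mul, pow_one]; rw [← sub_div, div_self this]

lemma lb_nonneg (x : ℝ) (h0 : 0 < x) (h1 : x < 1) (n : ℕ) : 0 ≤ lb x n := by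
  unfold lb
  have g : (n+1:ℝ) * x^(n+1) ≤ ∑ i ∈ Finset.range (n+1), x^i := by
    have : ∑ i ∈ Finset.range (n+1), x^(n+1) ≤ ∑ i ∈ Finset.range (n+1), x^i := by
      apply Finset.sum_le_sum
      intro i hi
      exact pow_le_pow_of_le_one h0.le h1.le (Finset.mem_range.1 hi).le
    simpa using this
  have e1 : 1 - x^(n+1) = (1-x)*∑ i ∈ Finset.range (n+1), x^i := by rw [mul_neg_geom_sum]
  have hx : 0 < 1 - x := by linarith
  have hS : 0 < ∑ i ∈ Finset.range (n+1), x^i := lt_of_lt_of_le (by positivity) g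
  rw [sub_nonneg, e1, div_le_div_iff₀ (by positivity) (by positivity)]
  nlinarith [mul_le_mul_of_nonneg_left g hx.le]

lemma lb_sum {q : ℕ} (hq : 1 < q) (χ : DirichletCharacter ℂ q) (hχ : Pr χ) (x : ℝ) (h0 : 0 < x)
    (h1 : x < 1) (N : ℕ) : ‖∑ n ∈ Finset.range N, cz χ (1+n) * (lb x n : ℂ)‖ ≤ q := by
  have h := abel (fun n => cz χ (1+n)) (fun n => (lb x n : ℂ)) N
  have hb := complete_av hq χ hχ 1
  rw [eq_sub_iff_add_eq] at h
  rw [← h]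
  have tel : ∑ n ∈ Finset.range N, (q:ℝ) * (lb x n - lb x (n+1)) = q * (1 - lb x N) := by
    rw [← Finset.mul_sum, Finset.sum_range_sub', lb_zero x h1]
  calc _ ≤ ∑ n ∈ Finset.range N, (q:ℝ) * (lb x n - lb x (n+1)) + q * lb x N := by
        refine (norm_add_le _ _).trans (add_le_add ((norm_sum_le _ _).trans (Finset.sum_le_sum ?_)) ?_)
        · intro n _
          rw [norm_mul, ← ofReal_sub, norm_real, Real.norm_of_nonneg (by linarith [lb_anti x h0 h1 n])]
          exact mul_le_mul_of_nonneg_right (hb _) (by linarith [lb_anti x h0 h1 n])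
        · rw [norm_mul, norm_real, Real.norm_of_nonneg (lb_nonneg x h0 h1 N)]
          exact mul_le_mul_of_nonneg_right (hb _) (lb_nonneg x h0 h1 N)
    _ = q := by rw [tel]; ring

lemma lambert (c : ℕ → ℝ) (hc : ∀ n, |c n| ≤ 1) (x : ℝ) (h0 : 0 < x) (h1 : x < 1) 
    (hr : ∀ n : ℕ, 0 ≤ ∑ d ∈ n.divisors, c d) (s : Finset ℕ+) :
    ∃ G : ℝ, HasSum (fun d : ℕ => c (d+1) * (x^(d+1)/(1-x^(d+1)))) G ∧
      ∑ n ∈ s, (∑ d ∈ (n:ℕ).divisors, c d) * x^(n:ℕ) ≤ G := by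
  have hs : Summable fun p : ℕ+ × ℕ+ => c p.1 * x^(p.1*p.2:ℕ) := by
    have := summable_prod_mul_pow 0 (r := x) (by rw [Real.norm_of_nonneg h0.le]; exact h1)
    refine Summable.of_norm_bounded this ?_
    intro p
    rw [norm_mul, pow_zero, Real.norm_of_nonneg (by positivity : 0 ≤ x^(p.1*p.2:ℕ))]
    exact mul_le_mul_of_nonneg_right (hc _) (by positivity)
  have hs2 := sigmaAntidiagonalEquivProd.summable_iff.2 hs
  refine ⟨∑' p : ℕ+ × ℕ+, c p.1 * x^(p.1*p.2:ℕ), ?_, ?_⟩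
  · have h := hs.hasSum.prod_fiberwise (g := fun d : ℕ+ => c d * (x^(d:ℕ)/(1-x^(d:ℕ)))) (by
      intro d
      have hd : x^(d:ℕ) < 1 := pow_lt_one₀ h0.le h1 d.pos.ne'
      have hg := ((hasSum_geometric_of_lt_one (by positivity) hd).mul_left (x^(d:ℕ))).mul_left (c d)
      rw [← div_eq_mul_inv] at hg
      rw [← Equiv.pnatEquivNat.symm.hasSum_iff]
      have e : (fun k : ℕ+ => c d * x^(d*k:ℕ)) ∘ Equiv.pnatEquivNat.symm =
          fun i : ℕ => c d * (x^(d:ℕ) * (x^(d:ℕ))^i) := by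
        funext i
        simp only [Function.comp, Equiv.pnatEquivNat_symm_apply, Nat.succPNat_coe, Nat.succ_eq_add_one]
        rw [pow_mul, pow_succ']
      rw [e]; exact hg)
    have h2 := Equiv.pnatEquivNat.symm.hasSum_iff.2 h
    exact h2
  · have h3 : ∑' p : ℕ+ × ℕ+, c p.1 * x^(p.1*p.2:ℕ) = _ :=
      (sigmaAntidiagonalEquivProd.tsum_eq _).symm.trans (hs2.tsum_sigma)
    have h4 : ∀ n : ℕ+, ∑' z : (n:ℕ).divisorsAntidiagonal,
        ((fun p : ℕ+ × ℕ+ => c p.1 * x^(p.1*p.2:ℕ)) ∘ sigmaAntidiagonalEquivProd) ⟨n, z⟩ =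
        (∑ d ∈ (n:ℕ).divisors, c d) * x^(n:ℕ) := by
      intro n
      have e : ∀ z : (n:ℕ).divisorsAntidiagonal, ((fun p : ℕ+ × ℕ+ => c p.1 * x^(p.1*p.2:ℕ)) ∘
          sigmaAntidiagonalEquivProd) ⟨n, z⟩ = c z.1.1 * x^(n:ℕ) := by
        intro z
        have := (Nat.mem_divisorsAntidiagonal.1 z.2).1
        change c z.1.1 * x^(z.1.1 * z.1.2) = _
        rw [this]
      rw [tsum_congr e, tsum_fintype, Finset.univ_eq_attach,
        Finset.sum_attach _ (fun z : ℕ × ℕ => c z.1 * x^(n:ℕ)), ← Finset.sum_mul,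
        Nat.sum_divisorsAntidiagonal (fun d _ => c d)]
    rw [h3, tsum_congr h4]
    have hsn := hs2.sigma
    rw [summable_congr h4] at hsn
    exact hsn.sum_le_tsum s (fun n _ => mul_nonneg (hr _) (by positivity))
end CS

namespace CS

lemma zm_apply {q : ℕ} (χ : DirichletCharacter ℂ q) (n : ℕ) :
    χ.zetaMul n = ∑ d ∈ n.divisors, χ d := by
  rw [DirichletCharacter.zetaMul, ArithmeticFunction.coe_zeta_mul_apply]
  apply Finset.sum_congr rfl
  intro d hd
  have : d ≠ 0 := (Nat.pos_of_mem_divisors hd).ne'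
  simp [toArithmeticFunction, this]

lemma r_nonneg {q : ℕ} (χ : DirichletCharacter ℂ q) (h : χ^2 = 1) (n : ℕ) :
    0 ≤ ∑ d ∈ n.divisors, (χ d).re := by
  have := DirichletCharacter.zetaMul_nonneg h n
  rw [zm_apply] at this
  have := (Complex.le_def.1 this).1
  simpa using this

lemma zm_sq {q : ℕ} (χ : DirichletCharacter ℂ q) (h : χ^2 = 1) (n : ℕ) (hn : n ≠ 0) :
    ∃ t : ℝ, 1 ≤ t ∧ χ.zetaMul (n^2) = t := by
  induction n using Nat.recOnPosPrimePosCoprime with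
  | zero => exact absurd rfl hn
  | one => exact ⟨1, le_rfl, by simp [χ.isMultiplicative_zetaMul.1]⟩
  | prime_pow p n hp hn0 =>
    rw [zm_apply, ← pow_mul, Nat.sum_divisors_prime_pow hp]
    simp only [Nat.cast_pow, map_pow]
    rcases MulChar.isQuadratic_iff_sq_eq_one.mpr h p with h | h | h
    · refine ⟨1, le_rfl, ?_⟩
      rw [h, Finset.sum_range_succ']; simp
    · refine ⟨n*2+1, by have : (0:ℝ) ≤ n := by positivity
                        linarith, ?_⟩
      rw [h]; simp
    · refine ⟨1, le_rfl, ?_⟩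
      rw [h, neg_one_geom_sum, if_neg (by rw [Nat.not_even_iff_odd]; exact ⟨n, by ring⟩)]; simp
  | coprime a b ha hb hab iha ihb =>
    obtain ⟨t, ht, e⟩ := iha (by omega)
    obtain ⟨u, hu, e'⟩ := ihb (by omega)
    refine ⟨t*u, by nlinarith, ?_⟩
    rw [mul_pow, χ.isMultiplicative_zetaMul.2 (hab.pow 2 2), e, e']; simp

lemma r_sq {q : ℕ} (χ : DirichletCharacter ℂ q) (h : χ^2 = 1) (n : ℕ) (hn : n ≠ 0) :
    1 ≤ ∑ d ∈ (n^2).divisors, (χ d).re := by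
  obtain ⟨t, ht, e⟩ := zm_sq χ h n hn
  rw [zm_apply] at e
  have := congrArg Complex.re e
  rw [Complex.re_sum, ofReal_re] at this
  rw [this]; exact ht

lemma one_ne_of_pr {q : ℕ} (hq : 1 < q) (χ : DirichletCharacter ℂ q) (hp : χ.IsPrimitive) :
    χ ≠ 1 := by
  rintro rfl
  have : NeZero q := ⟨by omega⟩
  rw [DirichletCharacter.isPrimitive_def, DirichletCharacter.conductor_one] at hp
  omega

lemma L1_series {q : ℕ} [NeZero q] (χ : DirichletCharacter ℂ q) (hχ : χ ≠ 1)
    (hS : ∀ N : ℕ, ‖∑ i ∈ Finset.range N, cz χ (1 + i)‖ ≤ q) :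
    Filter.Tendsto (fun N : ℕ => ∑ n ∈ Finset.range N, cz χ (1+n) * pw 1 n) Filter.atTop
      (nhds (χ.LFunction 1)) := by
  rw [tendsto_iff_norm_sub_tendsto_zero]
  have h : Filter.Tendsto (fun N : ℕ => (q * (1 + ‖(1:ℂ)‖ * C0)) * (N + 1 : ℝ) ^ (-(1/4:ℝ)))
      Filter.atTop (nhds 0) := by
    have h1 := (tendsto_rpow_neg_atTop (by norm_num : (0:ℝ) < 1/4)).comp
      (Filter.tendsto_atTop_add_const_right _ (1:ℝ) tendsto_natCast_atTop_atTop)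
    simpa using h1.const_mul (q * (1 + ‖(1:ℂ)‖ * C0))
  refine squeeze_zero (fun _ => norm_nonneg _) (fun N => ?_) h
  rw [norm_sub_rev]
  exact L_approx χ hχ q (by positivity) hS 1 (by norm_num) N

lemma L1_low {q : ℕ} [NeZero q] (hq : 1 < q) (χ : DirichletCharacter ℂ q) (hp : χ.IsPrimitive)
    (h : χ^2 = 1) : 1/(32*q) ≤ (χ.LFunction 1).re := by
  have hPr := Pr_of_primitive χ hp
  have hne := one_ne_of_pr hq χ hp
  have hq0 : (0:ℝ) < q := by positivity
  have hq1 : (1:ℝ) ≤ q := by exact_mod_cast hq.le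
  obtain ⟨x, hx⟩ : ∃ x : ℝ, x = 1 - 1/(32*q^2) := ⟨_, rfl⟩
  have hx0 : 0 < x := by
    have : 1/(32*(q:ℝ)^2) < 1 := by
      rw [div_lt_one (by positivity)]; nlinarith
    rw [hx]; linarith
  have hx1 : x < 1 := by rw [hx]; linarith [show 0 < 1/(32*(q:ℝ)^2) by positivity]
  obtain ⟨G, hG, hlow⟩ := lambert (fun n => (χ n).re) (fun n => (abs_re_le_norm _).trans
    (DirichletCharacter.norm_le_one χ _)) x hx0 hx1 (r_nonneg χ h)
    ((Finset.range (4*q)).map ⟨fun m => (m.succPNat)^2, fun a b hab => by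
      have : ((a.succPNat)^2 : ℕ+) = (b.succPNat)^2 := hab
      have := congrArg PNat.val this
      simp only [PNat.pow_coe, Nat.succPNat_coe] at this
      have := Nat.pow_left_injective two_ne_zero this
      omega⟩)
  rw [Finset.sum_map] at hlow
  have hl2 : (2*q:ℝ) ≤ G := by
    refine le_trans ?_ hlow
    have : ∀ m ∈ Finset.range (4*q), (1/2:ℝ) ≤ (∑ d ∈ ((m+1)^2).divisors, (χ ((d:ℕ):ZMod q)).re) * x^((m+1)^2) := by
      intro m hm
      have h1 := r_sq χ h (m+1) (by omega)
      have h2 : (1/2:ℝ) ≤ x^((m+1)^2) := by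
        have hb := one_add_mul_le_pow (a := -(1/(32*(q:ℝ)^2))) (by
          have : 1/(32*(q:ℝ)^2) ≤ 1 := by rw [div_le_one (by positivity)]; nlinarith
          linarith) ((m+1)^2)
        rw [← sub_eq_add_neg, ← hx] at hb
        have hm' : (m+1:ℝ) ≤ 4*q := by exact_mod_cast Finset.mem_range.1 hm
        have : (((m+1)^2:ℕ):ℝ) * (1/(32*(q:ℝ)^2)) ≤ 1/2 := by
          push_cast
          rw [mul_one_div, div_le_iff₀ (by positivity)]
          nlinarith
        linarith
      nlinarith
    have h3 := Finset.sum_le_sum this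
    rw [Finset.sum_const, Finset.card_range, nsmul_eq_mul] at h3
    push_cast at h3
    refine le_trans (by linarith) h3
  have hup : G ≤ (1/(1-x)) * (χ.LFunction 1).re + q := by
    have t1 := hG.tendsto_sum_nat
    have t2 := (Complex.continuous_re.tendsto _).comp (L1_series χ hne (complete_av hq χ hPr 1))
    have t3 := (t2.const_mul (1/(1-x))).add_const (q:ℝ)
    refine le_of_tendsto_of_tendsto' t1 t3 ?_
    intro N
    have hb := (neg_le_of_abs_le ((abs_re_le_norm _).trans (lb_sum hq χ hPr x hx0 hx1 N)))
    simp only [Function.comp]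
    rw [Complex.re_sum] at hb ⊢
    rw [Finset.mul_sum]
    have : ∑ n ∈ Finset.range N, (cz χ (1+n) * (lb x n : ℂ)).re =
      ∑ n ∈ Finset.range N, 1/(1-x) * (cz χ (1+n) * pw 1 n).re -
      ∑ n ∈ Finset.range N, (χ ((n+1:ℕ):ZMod q)).re * (x^(n+1)/(1-x^(n+1))) := by
      rw [← Finset.sum_sub_distrib]
      apply Finset.sum_congr rfl
      intro n _
      have e1 : cz χ (1+n) = χ ((n+1:ℕ):ZMod q) := by
        unfold cz; congr 1; push_cast; ring
      have e2 : pw 1 n = ((1/(n+1:ℝ) : ℝ) : ℂ) := by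
        unfold pw; rw [Complex.cpow_neg_one]; push_cast; rw [one_div]
      rw [e1, e2, re_mul_ofReal, re_mul_ofReal, lb, mul_comm ((n:ℝ)+1), ← div_div, div_eq_mul_one_div (1/(1-x))]
      ring
    push_cast at this hb ⊢
    linarith
  have e : 1/(1-x) = 32*q^2 := by rw [hx]; field_simp; ring
  rw [e] at hup
  rw [div_le_iff₀ (by positivity)]
  nlinarith

lemma beta_low : ∃ c : ℝ, 0 < c ∧ ∀ (q : ℕ) [NeZero q], 1 < q → ∀ χ : DirichletCharacter ℂ q,
    χ.IsPrimitive → χ^2 = 1 → ∀ β : ℝ, 3/4 ≤ β → β < 1 → χ.LFunction β = 0 → c/q^2 ≤ 1 - β := by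
  have hC := C0_nonneg
  refine ⟨1/(128*(1+3/2*C0)), by positivity, ?_⟩
  intro q _ hq χ hp h β hb hb1 h0
  have hPr := Pr_of_primitive χ hp
  have hne := one_ne_of_pr hq χ hp
  have hq0 : (0:ℝ) < q := by positivity
  have hd := DirichletCharacter.differentiable_LFunction hne
  have hbd : ∀ z : ℂ, ‖z - 1‖ ≤ 1/2 → ‖χ.LFunction z‖ ≤ q * (1 + 3/2 * C0) := by
    intro z hz
    have hre : 1/2 ≤ z.re := by
      have := (abs_re_le_norm (z-1)).trans hz
      rw [sub_re, one_re, abs_le] at this; linarith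
    have hn : ‖z‖ ≤ 3/2 := by
      have := norm_add_le (z-1) 1
      rw [sub_add_cancel, norm_one] at this; linarith
    have := L_approx χ hne q hq0.le (complete_av hq χ hPr 1) z hre 0
    rw [Finset.sum_range_zero, sub_zero, Nat.cast_zero, zero_add, Real.one_rpow, mul_one] at this
    refine this.trans (mul_le_mul_of_nonneg_left ?_ hq0.le)
    nlinarith
  have hder : ∀ z ∈ Metric.closedBall (1:ℂ) (1/4), ‖deriv χ.LFunction z‖ ≤ q*(1+3/2*C0)/(1/4) := by
    intro z hz
    apply Complex.norm_deriv_le_of_forall_mem_sphere_norm_le (by norm_num) hd.diffContOnCl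
    intro w hw
    apply hbd
    rw [mem_closedBall_iff_norm] at hz
    rw [mem_sphere_iff_norm] at hw
    have := norm_add_le (w-z) (z-1)
    rw [sub_add_sub_cancel] at this
    linarith
  have hβ : ‖((β:ℝ):ℂ) - 1‖ = 1 - β := by
    rw [← ofReal_one, ← ofReal_sub, norm_real, Real.norm_eq_abs, abs_of_neg (by linarith)]; ring
  have hm := (convex_closedBall (1:ℂ) (1/4)).norm_image_sub_le_of_norm_deriv_le
    (fun z _ => hd z) hder (x := (β:ℂ)) (y := 1) (by rw [mem_closedBall_iff_norm, hβ]; linarith)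
    (Metric.mem_closedBall_self (by norm_num))
  rw [h0, sub_zero, norm_sub_rev, hβ] at hm
  have h1 := (L1_low hq χ hp h).trans ((re_le_norm _).trans hm)
  rw [div_le_iff₀ (by positivity)] at h1
  rw [div_div, div_le_iff₀ (by positivity)]
  nlinarith
end CS

namespace CS

lemma small1 {q : ℕ} [NeZero q] (χ : DirichletCharacter ℂ q) (B : ℝ) :
    ∃ ε : ℝ, 0 < ε ∧ ∀ s : ℂ, 1 - ε < s.re → |s.im| ≤ B → FL χ s ≠ 0 := by
  have hK : IsCompact ((fun t : ℝ => (1:ℂ) + t * I) '' Set.Icc (-B) B) :=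
    isCompact_Icc.image (by fun_prop)
  have hU : IsOpen {s : ℂ | FL χ s ≠ 0} :=
    isOpen_ne_fun (FL_diff χ).continuous continuous_const
  obtain ⟨δ, hδ, hsub⟩ := hK.exists_thickening_subset_open hU (by
    rintro _ ⟨t, _, rfl⟩ h
    have := FL_zero_re χ _ h
    simp at this)
  refine ⟨δ, hδ, fun s hs hi h0 => ?_⟩
  have h1 := FL_zero_re χ s h0
  refine hsub (Metric.mem_thickening_iff.2 ⟨_, ⟨s.im, abs_le.1 hi, rfl⟩, ?_⟩) h0
  have e : s - ((1:ℂ) + s.im * I) = ((s.re - 1 : ℝ) : ℂ) := by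
    apply Complex.ext <;> simp
  rw [dist_eq_norm, e, norm_real, Real.norm_eq_abs, abs_of_neg (by linarith)]
  linarith

lemma small (N : ℕ) (B : ℝ) : ∃ ε : ℝ, 0 < ε ∧ ∀ (q : ℕ) [NeZero q], q ≤ N →
    ∀ (χ : DirichletCharacter ℂ q) (s : ℂ), 1 - ε < s.re → |s.im| ≤ B → FL χ s ≠ 0 := by
  induction N with
  | zero => exact ⟨1, one_pos, fun q hq h => absurd (Nat.le_zero.1 h) hq.1⟩
  | succ N ih =>
    obtain ⟨ε, hε, h⟩ := ih
    choose f hf hf2 using fun χ : DirichletCharacter ℂ (N+1) => small1 χ B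
    obtain ⟨χ0, h0⟩ := Finite.exists_min f
    refine ⟨min ε (f χ0), lt_min hε (hf _), ?_⟩
    intro q _ hq χ s hs hi
    rcases Nat.lt_or_ge q (N+1) with h1 | h1
    · exact h q (by omega) χ s (by linarith [min_le_left ε (f χ0)]) hi
    · obtain rfl : q = N+1 := by omega
      refine hf2 χ s ?_ hi
      linarith [min_le_right ε (f χ0), h0 χ]

lemma params (l : ℝ) (hl : 24 ≤ l) : ∃ (N : ℕ) (B : ℝ), ∀ T P : ℝ, 3 ≤ T →
    T ^ (1 / Real.log (Real.log T)) ≤ P →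
    1 ≤ Real.log P ∧ 0 < Real.log (Real.log T) ∧
    Real.exp (Real.log P / Real.sqrt (Real.log T)) ≤ P ∧
    ((P ≤ B ∧ T ≤ N) ∨ (l ≤ Real.log (Real.log ⌊P⌋₊) ∧
      2 * Real.log T ≤ 4 * Real.log (Real.log ⌊P⌋₊) * Real.log ⌊P⌋₊ ∧
      Real.log ⌊P⌋₊ ≤ Real.log P ∧ P ≤ 2 * ⌊P⌋₊ ∧
      Real.log (Real.log T) ≤ 3/2 * Real.log (Real.log ⌊P⌋₊))) := by
  refine ⟨⌈Real.exp (Real.exp (2 * Real.log (Real.exp (Real.exp l) + 1)))⌉₊,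
    Real.exp (Real.exp l) + 1, ?_⟩
  intro T P hT hP
  have hT0 : 0 < T := by linarith
  have hlT : 1 < Real.log T := by
    rw [Real.lt_log_iff_exp_lt hT0]; linarith [Real.exp_one_lt_d9]
  obtain ⟨y, hy⟩ : ∃ y, y = Real.log (Real.log T) := ⟨_, rfl⟩
  have hy0 : 0 < y := by rw [hy]; exact Real.log_pos hlT
  have ey : Real.log T = Real.exp y := by rw [hy, Real.exp_log (by linarith)]
  rw [← hy] at hP ⊢
  have hPp : 0 < P := lt_of_lt_of_le (Real.rpow_pos_of_pos hT0 _) hP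
  have hlP : Real.exp y ≤ y * Real.log P := by
    have := Real.log_le_log (Real.rpow_pos_of_pos hT0 _) hP
    rw [Real.log_rpow hT0, ey, one_div, inv_mul_le_iff₀ hy0] at this
    exact this
  have hlP1 : 1 ≤ Real.log P := by
    have := Real.add_one_le_exp y
    by_contra hc
    push Not at hc
    nlinarith
  have hPeq : Real.exp (Real.log P) = P := Real.exp_log hPp
  have hP2 : 2 ≤ P := by
    have := Real.add_one_le_exp (Real.log P); linarith
  have hH : Real.exp (Real.log P / Real.sqrt (Real.log T)) ≤ P := by
    conv_rhs => rw [← hPeq]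
    apply Real.exp_le_exp.2
    apply div_le_self (by linarith)
    rw [Real.one_le_sqrt]; exact hlT.le
  refine ⟨hlP1, hy0, hH, ?_⟩
  have hf1 : (⌊P⌋₊:ℝ) ≤ P := Nat.floor_le hPp.le
  have hf2 : P < ⌊P⌋₊ + 1 := Nat.lt_floor_add_one P
  have hf3 : (2:ℝ) ≤ ⌊P⌋₊ := by exact_mod_cast Nat.le_floor (by exact_mod_cast hP2)
  generalize (⌊P⌋₊:ℝ) = R at *
  have hR1 : 0 < Real.log R := Real.log_pos (by linarith)
  rcases lt_or_ge (Real.log (Real.log R)) l with hc | hc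
  · left
    rw [Real.log_lt_iff_lt_exp hR1, Real.log_lt_iff_lt_exp (by linarith)] at hc
    have hPB : P ≤ Real.exp (Real.exp l) + 1 := by linarith
    refine ⟨hPB, le_trans ?_ (Nat.le_ceil _)⟩
    have h1 := Real.log_le_log hPp hPB
    generalize Real.log (Real.exp (Real.exp l) + 1) = b at *
    have h2 := Real.quadratic_le_exp_of_nonneg hy0.le
    have : y ≤ 2*b := by
      by_contra hc
      push Not at hc
      nlinarith
    rw [← Real.log_le_iff_le_exp hT0, ey]
    exact Real.exp_le_exp.2 this
  · right
    have hlR := Real.exp_log hR1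
    set m := Real.log (Real.log R) with hm
    have hPR : Real.log P ≤ Real.log R + 1 := by
      have : P ≤ R * Real.exp 1 := by nlinarith [Real.exp_one_gt_d9]
      have := Real.log_le_log hPp this
      rwa [Real.log_mul (by linarith) (by positivity), Real.log_exp] at this
    have hE : 25 ≤ Real.log R := by rw [← hlR]; linarith [Real.add_one_le_exp m]
    have hym : y ≤ 3/2 * m := by
      by_contra hcc
      push Not at hcc
      have h1 : Real.exp y ≤ 2 * y * Real.exp (2*y/3) := by
        have : Real.exp m ≤ Real.exp (2*y/3) := Real.exp_le_exp.2 (by linarith)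
        rw [hlR] at this
        nlinarith
      have h2 : Real.exp y = Real.exp (y/3) * Real.exp (2*y/3) := by
        rw [← Real.exp_add]; congr 1; ring
      rw [h2] at h1
      have h3 := le_of_mul_le_mul_right h1 (Real.exp_pos _)
      have h4 := Real.pow_div_factorial_le_exp (y/3) (by linarith) 3
      have h5 : (y/3)^3 / ((Nat.factorial 3 : ℕ):ℝ) = y * (y^2/162) := by
        norm_num [Nat.factorial]; ring
      rw [h5] at h4
      have : y^2/162 ≤ 2 := by
        refine le_of_mul_le_mul_left ?_ hy0
        linarith
      nlinarith
    refine ⟨hc, ?_, Real.log_le_log (by linarith) hf1, by linarith, hym⟩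
    rw [ey]
    nlinarith [mul_le_mul hym hPR (by linarith) (by linarith : 0 ≤ 3/2*m)]
end CS


namespace CS

lemma le_mpf {q p : ℕ} [NeZero q] (hp : p.Prime) (h : p ∣ q) : p ≤ maxPrimeFac q :=
  Finset.le_sup (f := id) (Nat.mem_primeFactors.2 ⟨hp, h, NeZero.ne q⟩)

lemma FL_of_prim {q : ℕ} [NeZero q] (χ : DirichletCharacter ℂ q) (hp : χ.IsPrimitive) (s : ℂ)
    (h : χ.LFunction s = 0) : FL χ s = 0 := by
  by_cases hχ : χ = 1
  · subst hχ
    have hq : q = 1 := by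
      rw [DirichletCharacter.isPrimitive_def, DirichletCharacter.conductor_one] at hp
      exact hp.symm
    subst hq
    have hs : s ≠ 1 := by
      rintro rfl
      rw [DirichletCharacter.LFunction_modOne_eq] at h
      exact riemannZeta_one_ne_zero h
    rw [FL_one s hs, h, mul_zero]
  · rw [FL_ne χ hχ, h]

lemma FL_level {q Q : ℕ} [NeZero q] [NeZero Q] (hd : q ∣ Q) (χ : DirichletCharacter ℂ q) (hχ : χ ≠ 1)
    (s : ℂ) (h : χ.LFunction s = 0) : FL (DirichletCharacter.changeLevel hd χ) s = 0 := by
  have hne : DirichletCharacter.changeLevel hd χ ≠ 1 := by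
    rwa [Ne, DirichletCharacter.changeLevel_eq_one_iff]
  rw [FL_ne _ hne, DirichletCharacter.LFunction_changeLevel hd χ (Or.inl hχ), h, zero_mul]

lemma same_prim {q₁ q₂ Q : ℕ} [NeZero q₁] [NeZero q₂] [NeZero Q] (h1 : q₁ ∣ Q) (h2 : q₂ ∣ Q)
    (χ₁ : DirichletCharacter ℂ q₁) (χ₂ : DirichletCharacter ℂ q₂) (p1 : χ₁.IsPrimitive) (p2 : χ₂.IsPrimitive)
    (h : DirichletCharacter.changeLevel h1 χ₁ = DirichletCharacter.changeLevel h2 χ₂) :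
    (⟨q₁, χ₁⟩ : Σ q : ℕ, DirichletCharacter ℂ q) = ⟨q₂, χ₂⟩ := by
  have e := congrArg DirichletCharacter.conductor h
  rw [DirichletCharacter.conductor_changeLevel, DirichletCharacter.conductor_changeLevel,
    (DirichletCharacter.isPrimitive_def _).1 p1, (DirichletCharacter.isPrimitive_def _).1 p2] at e
  subst e
  have := DirichletCharacter.changeLevel_injective h1 h
  rw [this]

end CS

theorem stmt_6 :
    ∃ c : ℝ, 0 < c ∧ ∃ c₁ : ℝ, 0 < c₁ ∧ ∃ c₂ : ℝ, 0 < c₂ ∧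
    ∀ T P : ℝ, 3 ≤ T → T ^ (1 / Real.log (Real.log T)) ≤ P →
      -- Among all primitive characters `χ mod q` with `q ≤ T` and `P⁺(q) ≤ P`,
      -- at most one has an `L`-function with a zero in the region `R`.
      (∀ (q₁ : ℕ) [NeZero q₁] (q₂ : ℕ) [NeZero q₂]
          (χ₁ : DirichletCharacter ℂ q₁) (χ₂ : DirichletCharacter ℂ q₂),
        ((q₁ : ℝ) ≤ T ∧ (maxPrimeFac q₁ : ℝ) ≤ P ∧ χ₁.IsPrimitive ∧
          ∃ s : ℂ, (1 - c / Real.log P < s.re ∧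
              |s.im| ≤ Real.exp (Real.log P / Real.sqrt (Real.log T))) ∧
            χ₁.LFunction s = 0) →
        ((q₂ : ℝ) ≤ T ∧ (maxPrimeFac q₂ : ℝ) ≤ P ∧ χ₂.IsPrimitive ∧
          ∃ s : ℂ, (1 - c / Real.log P < s.re ∧
              |s.im| ≤ Real.exp (Real.log P / Real.sqrt (Real.log T))) ∧
            χ₂.LFunction s = 0) →
        (⟨q₁, χ₁⟩ : Σ q : ℕ, DirichletCharacter ℂ q) = ⟨q₂, χ₂⟩) ∧
      -- Moreover, any such exceptional character is real, its `L`-function has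
      -- exactly one zero in the region, this zero is real and simple, and the
      -- modulus satisfies `P⁺(q) ≥ c₁ log q` and `log q ≥ c₂ log log T`.
      (∀ (q : ℕ) [NeZero q] (χ : DirichletCharacter ℂ q),
        ((q : ℝ) ≤ T ∧ (maxPrimeFac q : ℝ) ≤ P ∧ χ.IsPrimitive ∧
          ∃ s : ℂ, (1 - c / Real.log P < s.re ∧
              |s.im| ≤ Real.exp (Real.log P / Real.sqrt (Real.log T))) ∧
            χ.LFunction s = 0) →
        (∀ a : ZMod q, (χ a).im = 0) ∧
        (∃! s : ℂ, (1 - c / Real.log P < s.re ∧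
            |s.im| ≤ Real.exp (Real.log P / Real.sqrt (Real.log T))) ∧
          χ.LFunction s = 0) ∧
        (∀ s : ℂ, (1 - c / Real.log P < s.re ∧
            |s.im| ≤ Real.exp (Real.log P / Real.sqrt (Real.log T))) →
          χ.LFunction s = 0 → s.im = 0 ∧ deriv χ.LFunction s ≠ 0) ∧
        c₁ * Real.log q ≤ (maxPrimeFac q : ℝ) ∧
        c₂ * Real.log (Real.log T) ≤ Real.log q) := by
  obtain ⟨a, ha, ha6⟩ : ∃ a : ℝ, 0 < a ∧ a * 10^6 ≤ 1 := ⟨1/10^6, by norm_num, by norm_num⟩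
  obtain ⟨l0, hl0, hgood⟩ := CS.good_exists a ha (by linarith)
  obtain ⟨c3, hc3, hbeta⟩ := CS.beta_low
  obtain ⟨N, B, hpar⟩ := CS.params (max l0 (-2 * Real.log c3)) (le_max_of_le_left (by linarith))
  obtain ⟨ε, hε, hsmall⟩ := CS.small N B
  obtain ⟨ε', hε', hone⟩ := CS.small 1 1
  obtain ⟨c, hcd⟩ : ∃ c, c = min (min ε ε') (a/10) := ⟨_, rfl⟩
  have hc0 : 0 < c := by rw [hcd]; positivity
  have hcε : c ≤ ε := by rw [hcd]; exact (min_le_left _ _).trans (min_le_left _ _)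
  have hcε' : c ≤ ε' := by rw [hcd]; exact (min_le_left _ _).trans (min_le_right _ _)
  have hca : c ≤ a/10 := by rw [hcd]; exact min_le_right _ _
  refine ⟨c, hc0, 1/3, by norm_num, 1/6, by norm_num, ?_⟩
  intro T P hT hP
  obtain ⟨hlP, hy0, hH, hcase⟩ := hpar T P hT hP
  have hcP : c / Real.log P ≤ c := div_le_self hc0.le hlP
  rcases hcase with ⟨hPB, hTN⟩ | ⟨hl, hQT, hPP, hP2, hy⟩
  · -- bounded range: no zeros at all
    have none : ∀ (q : ℕ) [NeZero q] (χ : DirichletCharacter ℂ q), (q:ℝ) ≤ T → χ.IsPrimitive →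
        ∀ s : ℂ, (1 - c / Real.log P < s.re ∧
          |s.im| ≤ Real.exp (Real.log P / Real.sqrt (Real.log T))) → χ.LFunction s ≠ 0 := by
      intro q _ χ hq hp s hs h0
      exact hsmall q (by exact_mod_cast hq.trans hTN) χ s (by linarith [hs.1])
        (hs.2.trans (hH.trans hPB)) (CS.FL_of_prim χ hp s h0)
    refine ⟨?_, ?_⟩
    · rintro q₁ _ q₂ _ χ₁ χ₂ ⟨hq, -, hp, s, hs, h0⟩ -
      exact absurd h0 (none q₁ χ₁ hq hp s hs)
    · rintro q _ χ ⟨hq, -, hp, s, hs, h0⟩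
      exact absurd h0 (none q χ hq hp s hs)
  set R := ⌊P⌋₊ with hR
  set E := Real.log R with hE
  have hG := hgood R ((le_max_left _ _).trans hl)
  have hl3 := (le_max_right _ _).trans hl
  have hE1 : 1 ≤ E := by
    by_contra hc
    push Not at hc
    have h700 : 700 ≤ Real.log E := hl0.trans ((le_max_left _ _).trans hl)
    rcases le_or_gt E 0 with h | h
    · have hn : 0 ≤ E := Real.log_natCast_nonneg _
      have : E = 0 := le_antisymm h hn
      rw [this, Real.log_zero] at h700; linarith
    · linarith [Real.log_nonpos h.le hc.le]
  have hreg : ∀ s : ℂ, (1 - c / Real.log P < s.re ∧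
          |s.im| ≤ Real.exp (Real.log P / Real.sqrt (Real.log T))) →
          1 - a/10/E < s.re ∧ |s.im| ≤ 2 * R := by
    intro s hs
    refine ⟨?_, hs.2.trans (hH.trans hP2)⟩
    have : c / Real.log P ≤ a/10/E := div_le_div₀ (by positivity) hca (by linarith) hPP
    linarith [hs.1]
  have hsm : ∀ (q : ℕ) [NeZero q], (maxPrimeFac q : ℝ) ≤ P → ∀ p : ℕ, p.Prime → p ∣ q → p ≤ R := by
    intro q _ hq p hp hd
    exact Nat.le_floor (le_trans (by exact_mod_cast CS.le_mpf hp hd) hq)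
  have hT1 : 0 ≤ Real.log T := Real.log_nonneg (by linarith)
  have hlog : ∀ (q : ℕ) [NeZero q], (q:ℝ) ≤ T → Real.log q ≤ Real.log T := by
    intro q hq0 hq
    exact Real.log_le_log (by exact_mod_cast Nat.pos_of_ne_zero hq0.1) hq
  have hne1 : ∀ (q : ℕ) [NeZero q] (χ : DirichletCharacter ℂ q), (q:ℝ) ≤ T → (maxPrimeFac q : ℝ) ≤ P →
        χ.IsPrimitive →
        ∀ s : ℂ, (1 - c / Real.log P < s.re ∧
          |s.im| ≤ Real.exp (Real.log P / Real.sqrt (Real.log T))) → χ.LFunction s = 0 → 1 < q := by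
    intro q hq0 χ hq hm hp s hs h0
    by_contra hc
    have : q = 1 := by have := hq0.1; omega
    subst this
    have hF := CS.FL_of_prim χ hp s h0
    have e1 : χ = 1 := DirichletCharacter.level_one χ
    have hi := CS.Z0 a ha ha6 R E hG 1 (by linarith [hlog 1 hq]) (hsm 1 hm) s (by rw [← e1]; exact hF)
      (hreg s hs).1 (hreg s hs).2
    refine hone 1 le_rfl χ s (by linarith [hs.1]) (hi.trans ?_) hF
    have : a / E ≤ a := div_le_self ha.le hE1
    linarith
  refine ⟨?_, ?_⟩
  · rintro q₁ i1 q₂ i2 χ₁ χ₂ ⟨hq, hm, hp, s, hs, h0⟩ ⟨hq', hm', hp', s', hs', h0'⟩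
    have c1 := CS.one_ne_of_pr (hne1 q₁ χ₁ hq hm hp s hs h0) χ₁ hp
    have c2 := CS.one_ne_of_pr (hne1 q₂ χ₂ hq' hm' hp' s' hs' h0') χ₂ hp'
    have : NeZero (q₁ * q₂) := ⟨mul_ne_zero i1.1 i2.1⟩
    apply CS.same_prim (Dvd.intro _ rfl) (Dvd.intro_left q₁ rfl) χ₁ χ₂ hp hp'
    refine CS.Z3 a ha ha6 R E hG (q₁*q₂) ?_ ?_ _ ?_ s (CS.FL_level _ χ₁ c1 s h0) (hreg s hs).1 (hreg s hs).2
      _ ?_ s' (CS.FL_level _ χ₂ c2 s' h0') (hreg s' hs').1 (hreg s' hs').2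
    · push_cast
      rw [Real.log_mul (by exact_mod_cast i1.1) (by exact_mod_cast i2.1)]
      linarith [hlog q₁ hq, hlog q₂ hq']
    · intro p hpp hd
      rcases hpp.dvd_mul.1 hd with h | h
      · exact hsm q₁ hm p hpp h
      · exact hsm q₂ hm' p hpp h
    · rwa [Ne, DirichletCharacter.changeLevel_eq_one_iff]
    · rwa [Ne, DirichletCharacter.changeLevel_eq_one_iff]
  · rintro q i1 χ ⟨hq, hm, hp, s, hs, h0⟩
    have hq1 := hne1 q χ hq hm hp s hs h0
    have hne := CS.one_ne_of_pr hq1 χ hp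
    have hFL := CS.FL_ne χ hne
    have hQ : Real.log q ≤ 4 * Real.log E * E := by linarith [hlog q hq]
    have hsq := CS.Z1 a ha ha6 R E hG q hQ (hsm q hm) χ s (by rw [hFL]; exact h0) (hreg s hs).1 (hreg s hs).2
    have hre := CS.real_of_sq χ hsq
    have huniq : ∀ t t' : ℂ, (1 - c / Real.log P < t.re ∧
          |t.im| ≤ Real.exp (Real.log P / Real.sqrt (Real.log T))) → χ.LFunction t = 0 →
          (1 - c / Real.log P < t'.re ∧
          |t'.im| ≤ Real.exp (Real.log P / Real.sqrt (Real.log T))) → χ.LFunction t' = 0 →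
          t = t' ∧ deriv χ.LFunction t ≠ 0 := by
      intro t t' ht ht0 ht' ht0'
      rw [← hFL] at ht0 ht0' ⊢
      exact CS.Z2b a ha ha6 R E hG q hQ (hsm q hm) χ hne t ht0 (hreg t ht).1 (hreg t ht).2
        t' ht0' (hreg t' ht').1 (hreg t' ht').2
    have hreal : ∀ t : ℂ, (1 - c / Real.log P < t.re ∧
          |t.im| ≤ Real.exp (Real.log P / Real.sqrt (Real.log T))) → χ.LFunction t = 0 →
          t.im = 0 ∧ deriv χ.LFunction t ≠ 0 := by
      intro t ht ht0
      have h := huniq t (starRingEnd ℂ t) ht ht0 (by rw [conj_re, conj_im, abs_neg]; exact ht)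
        (by rw [CS.LF_conj χ hne hre, ht0, map_zero])
      exact ⟨conj_eq_iff_im.1 h.1.symm, h.2⟩
    refine ⟨hre, ⟨s, ⟨hs, h0⟩, fun t ht => (huniq t s ht.1 ht.2 hs h0).1⟩, hreal, CS.pplus χ hp hsq, ?_⟩
    have hs0 := (hreal s hs h0).1
    have es : s = (s.re : ℂ) := by apply Complex.ext <;> simp [hs0]
    have hlt := CS.FL_zero_re χ s (by rw [hFL]; exact h0)
    have hb := hbeta q hq1 χ hp hsq s.re (by linarith [hs.1]) hlt (by rw [← es]; exact h0)
    have hq0 : (0:ℝ) < q := by positivity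
    have hEP : c / Real.log P ≤ 1 / E := div_le_div₀ (by norm_num) (by linarith) (by linarith) hPP
    have hfin : c3 / q^2 ≤ 1/E := by linarith [hs.1]
    rw [div_le_div_iff₀ (by positivity) (by linarith), one_mul] at hfin
    have := Real.log_le_log (by positivity) hfin
    rw [Real.log_mul hc3.ne' (by linarith), Real.log_pow] at this
    push_cast at this
    linarith
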